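/- Let D be a closed convex subset of X that isometrically embeds into M_κ², and let T be a simple geodesic triangle in Y with vertices p, q, r ∈ D. Then T ∪ Int T ⊆ D ∩ E; moreover T ∪ Int T is compact, simply connected, and rectifiably connected as a subspace of X, and T ∪ Int T is convex in Y (every Y-geodesic between points of T ∪ Int T lies in T ∪ Int T). -/

import Mathlib

open Set Metric Filter

noncomputable section

namespace Cat2Cx

/-! ### Comparison angles -/

/-- Inverse hyperbolic cosine. -/
def arcosh (x : ℝ) : ℝ := Real.log (x + Real.sqrt (x ^ 2 - 1))

/-- The Euclidean comparison angle at the vertex of a (comparison) triangle whose adjacent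
sides have lengths `a`, `b` and whose opposite side has length `c`, via the law of cosines. -/
def euclCompAngle (a b c : ℝ) : ℝ :=
  Real.arccos ((a ^ 2 + b ^ 2 - c ^ 2) / (2 * a * b))

/-- The comparison angle in the model plane `M_κ²` of constant curvature `κ ≤ 0`, via the
(Euclidean or hyperbolic) law of cosines. -/
def compAngle (κ a b c : ℝ) : ℝ :=
  if κ = 0 then euclCompAngle a b c
  else
    Real.arccos
      ((Real.cosh (Real.sqrt (-κ) * a) * Real.cosh (Real.sqrt (-κ) * b) -
          Real.cosh (Real.sqrt (-κ) * c)) /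
        (Real.sinh (Real.sqrt (-κ) * a) * Real.sinh (Real.sqrt (-κ) * b)))

variable {Z : Type*}

/-! ### Geodesics with respect to a distance function -/

/-- `f` restricted to `[a,b]` is a unit-speed geodesic for the distance function `d`
(an isometric embedding of the compact interval `[a,b]`). -/
def IsGeodesicWrt (d : Z → Z → ℝ) (f : ℝ → Z) (a b : ℝ) : Prop :=
  a ≤ b ∧ ∀ s ∈ Icc a b, ∀ t ∈ Icc a b, d (f s) (f t) = |s - t|

/-- `f` is a unit-speed geodesic from `x` to `y` (for the distance function `d`),
staying inside `S`. -/
def IsGeodesicFromTo (d : Z → Z → ℝ) (S : Set Z) (f : ℝ → Z) (x y : Z) : Prop :=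
  f 0 = x ∧ f (d x y) = y ∧ IsGeodesicWrt d f 0 (d x y) ∧ MapsTo f (Icc 0 (d x y)) S

/-- `S`, with the distance function `d`, is a geodesic space. -/
def GeodesicSpaceWrt (d : Z → Z → ℝ) (S : Set Z) : Prop :=
  ∀ x ∈ S, ∀ y ∈ S, ∃ f, IsGeodesicFromTo d S f x y

/-- The geodesic segment `[x,y]`: the union of (the images of) all geodesics from `x` to `y`
inside `S`.  In a uniquely geodesic space this is the image of the unique geodesic. -/
def geodSeg (d : Z → Z → ℝ) (S : Set Z) (x y : Z) : Set Z :=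
  ⋃ f ∈ {f : ℝ → Z | IsGeodesicFromTo d S f x y}, f '' Icc 0 (d x y)

/-- `C ⊆ S` is geodesically convex with respect to `d`: every geodesic (in `S`) between two
points of `C` lies in `C`. -/
def ConvexWrtIn (d : Z → Z → ℝ) (S C : Set Z) : Prop :=
  ∀ x ∈ C, ∀ y ∈ C, geodSeg d S x y ⊆ C

/-- `C` is geodesically convex with respect to `d`. -/
abbrev ConvexWrt (d : Z → Z → ℝ) (C : Set Z) : Prop := ConvexWrtIn d univ C

/-- The geodesically convex hull of `A` with respect to `d`. -/
def convexHullWrt (d : Z → Z → ℝ) (A : Set Z) : Set Z :=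
  ⋂₀ {C | ConvexWrt d C ∧ A ⊆ C}

/-- The Alexandrov (upper) angle at `p` between two paths `σ`, `τ` issuing from `p`
(each parametrized so that `σ 0 = τ 0 = p`): the limit as `ε → 0⁺` (i.e. the infimum over
`ε > 0`) of the supremum over `0 < s, t < ε` of the Euclidean comparison angles. -/
def upperAngleWrt (d : Z → Z → ℝ) (p : Z) (σ τ : ℝ → Z) : ℝ :=
  sInf {a | ∃ ε > 0, a = sSup {b | ∃ s t : ℝ, 0 < s ∧ s < ε ∧ 0 < t ∧ t < ε ∧
      b = euclCompAngle (d p (σ s)) (d p (τ t)) (d (σ s) (τ t))}}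

/-- The CAT(κ) condition (for `κ ≤ 0`), in the angle-comparison form
(Bridson–Haefliger II.1.7(4)): `S` is geodesic and for every triple of distinct points the
Alexandrov angle between geodesics is at most the comparison angle in `M_κ²`. -/
def IsCATWrt (κ : ℝ) (d : Z → Z → ℝ) (S : Set Z) : Prop :=
  GeodesicSpaceWrt d S ∧
    ∀ p ∈ S, ∀ q ∈ S, ∀ r ∈ S, p ≠ q → p ≠ r → q ≠ r →
      ∀ σ τ : ℝ → Z, IsGeodesicFromTo d S σ p q → IsGeodesicFromTo d S τ p r →
        upperAngleWrt d p σ τ ≤ compAngle κ (d p q) (d p r) (d q r)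

/-- Completeness of `S` with respect to the distance function `d`:
every Cauchy sequence converges. -/
def CompleteWrt (d : Z → Z → ℝ) (S : Set Z) : Prop :=
  ∀ u : ℕ → Z, (∀ n, u n ∈ S) →
    (∀ ε > 0, ∃ N, ∀ m ≥ N, ∀ n ≥ N, d (u m) (u n) < ε) →
    ∃ x ∈ S, ∀ ε > 0, ∃ N, ∀ n ≥ N, d (u n) x < ε

variable {X : Type*} [MetricSpace X]

/-- `X` is a CAT(κ) metric space. -/
def IsCATSpace (κ : ℝ) (X : Type*) [MetricSpace X] : Prop :=
  IsCATWrt κ (fun x y : X => dist x y) univ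

/-- The distance function of the metric space `X`. -/
abbrev xDist (X : Type*) [MetricSpace X] : X → X → ℝ := fun x y => dist x y

/-! ### The model plane `M_κ²` and polyhedral 2-complexes -/

/-- The distance function of the model plane `M_κ²` of constant curvature `κ ≤ 0`, in global
coordinates `ℝ²`: the Euclidean distance for `κ = 0`, and for `κ < 0` the distance of the
hyperboloid model rescaled by `1/√(-κ)` (so that the curvature is `κ`). -/
def mDist (κ : ℝ) (u v : ℝ × ℝ) : ℝ :=
  if κ = 0 then Real.sqrt ((u.1 - v.1) ^ 2 + (u.2 - v.2) ^ 2)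
  else
    (1 / Real.sqrt (-κ)) *
      arcosh (Real.sqrt (1 + u.1 ^ 2 + u.2 ^ 2) * Real.sqrt (1 + v.1 ^ 2 + v.2 ^ 2) -
        u.1 * v.1 - u.2 * v.2)

/-- A convex polygonal 2-cell in `M_κ²`: the geodesically convex hull of a finite set of
points, with nonempty interior. -/
def IsPolygonalCell (κ : ℝ) (P : Set (ℝ × ℝ)) : Prop :=
  ∃ F : Finset (ℝ × ℝ), P = convexHullWrt (mDist κ) (F : Set (ℝ × ℝ)) ∧ (interior P).Nonempty

/-- The subset `S` of `X` embeds isometrically into the model plane `M_κ²`. -/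
def IsomEmbedsInModelPlane (κ : ℝ) (S : Set X) : Prop :=
  ∃ f : X → ℝ × ℝ, ∀ x ∈ S, ∀ y ∈ S, mDist κ (f x) (f y) = dist x y

/-- A locally finite `M_κ`-polyhedral 2-complex structure on the metric space `X`:
`X` is partitioned into open 2-cells (faces), open 1-cells (edges) and vertices; the closure of
each face is isometric to a compact convex polygon of the model plane `M_κ²` (so each face has
constant curvature `κ`), each edge is a geodesic arc, and the complex is locally finite. -/
structure PolyComplex2 (κ : ℝ) (X : Type*) [MetricSpace X] where
  faces : Set (Set X)
  edges : Set (Set X)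
  vertices : Set X
  faces_open : ∀ F ∈ faces, IsOpen F
  cover : ⋃₀ faces ∪ ⋃₀ edges ∪ vertices = univ
  cells_disjoint : ∀ c ∈ faces ∪ edges, ∀ c' ∈ faces ∪ edges, c ≠ c' → c ∩ c' = ∅
  cells_vertex_disjoint : ∀ c ∈ faces ∪ edges, c ∩ vertices = ∅
  face_chart : ∀ F ∈ faces, ∃ (f : X → ℝ × ℝ) (P : Set (ℝ × ℝ)),
    IsPolygonalCell κ P ∧ InjOn f (closure F) ∧ f '' closure F = P ∧ f '' F = interior P ∧
    ∀ x ∈ closure F, ∀ y ∈ closure F, mDist κ (f x) (f y) = dist x y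
  edge_geodesic : ∀ e ∈ edges, ∃ (f : ℝ → X) (L : ℝ), 0 < L ∧
    IsGeodesicWrt (fun x y : X => dist x y) f 0 L ∧ f '' Ioo 0 L = e
  edge_closure : ∀ e ∈ edges, closure e \ e ⊆ vertices
  face_closure : ∀ F ∈ faces, closure F \ F ⊆ ⋃₀ edges ∪ vertices
  locally_finite : ∀ x : X, ∃ ε > 0,
    {c | (c ∈ faces ∨ c ∈ edges) ∧ (c ∩ ball x ε).Nonempty}.Finite ∧
    (vertices ∩ ball x ε).Finite

/-! ### Simple closed curves, their interiors, and first homology -/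

/-- A simple closed curve in `X` (identified with its image). -/
structure SCC (X : Type*) [TopologicalSpace X] where
  toFun : ℝ → X
  contOn : ContinuousOn toFun (Icc 0 1)
  loop : toFun 0 = toFun 1
  inj : InjOn toFun (Ico 0 1)

/-- The image of a simple closed curve. -/
def SCC.img {X : Type*} [TopologicalSpace X] (γ : SCC X) : Set X := γ.toFun '' Icc 0 1

/-- The first singular homology class of a loop, via the Hurewicz isomorphism: the class of
the loop in the abelianization of the fundamental group (of its path component); the loop is
nullhomologous iff this class is trivial. -/
def loopClassH1 {B : Type*} [TopologicalSpace B] {x : B} (p : Path x x) :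
    Abelianization (FundamentalGroup B x) :=
  Abelianization.of (FundamentalGroup.fromPath (X := TopCat.of B) ⟦p⟧)

/-- The basepoint of a simple closed curve, regarded in a subspace `B` containing it. -/
def SCC.basePoint {X : Type*} [TopologicalSpace X] (γ : SCC X) (B : Set X)
    (h : γ.img ⊆ B) : B :=
  ⟨γ.toFun 0, h ⟨0, ⟨le_rfl, zero_le_one⟩, rfl⟩⟩

/-- The loop of a simple closed curve, as a `Path` in a subspace `B` containing it. -/
def SCC.pathIn {X : Type*} [TopologicalSpace X] (γ : SCC X) (B : Set X) (h : γ.img ⊆ B) :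
    Path (γ.basePoint B h) (γ.basePoint B h) where
  toFun t := ⟨γ.toFun t, h ⟨(t : ℝ), t.2, rfl⟩⟩
  continuous_toFun := by
    apply Continuous.subtype_mk
    exact γ.contOn.comp_continuous continuous_subtype_val fun t => t.2
  source' := by
    apply Subtype.ext
    rfl
  target' := by
    apply Subtype.ext
    exact γ.loop.symm

/-- The simple closed curve `γ` is nullhomologous in the subspace `B` of `X`:
its class in `H₁(B)` vanishes. -/
def SCC.NullhomologousIn {X : Type*} [TopologicalSpace X] (γ : SCC X) (B : Set X) : Prop :=
  ∀ h : γ.img ⊆ B, loopClassH1 (γ.pathIn B h) = 1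

/-- The interior of a simple closed curve `γ`:
`Int γ = {x ∈ X \ γ | [γ] ≠ 0 ∈ H₁(X \ {x})}`. -/
def SCC.interiorSet {X : Type*} [TopologicalSpace X] (γ : SCC X) : Set X :=
  {x | x ∉ γ.img ∧ ¬ γ.NullhomologousIn {x}ᶜ}

/-- The first singular homology of `B` vanishes: every loop in `B` is nullhomologous
(via the Hurewicz isomorphism on each path component). -/
def H1Trivial (B : Type*) [TopologicalSpace B] : Prop :=
  ∀ (x : B) (p : Path x x), loopClassH1 p = 1

/-! ### Rectifiable connectedness and the induced path metric -/

/-- `g` is a path from `x` to `y` (parametrized by `[0,1]`) inside `E`. -/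
def IsPathIn {X : Type*} [TopologicalSpace X] (E : Set X) (g : ℝ → X) (x y : X) : Prop :=
  ContinuousOn g (Icc 0 1) ∧ g 0 = x ∧ g 1 = y ∧ MapsTo g (Icc 0 1) E

/-- `E` is rectifiably connected: any two of its points are joined by a rectifiable
(finite length) path in `E`. -/
def RectConnected {X : Type*} [MetricSpace X] (E : Set X) : Prop :=
  ∀ x ∈ E, ∀ y ∈ E, ∃ g : ℝ → X, IsPathIn E g x y ∧ eVariationOn g (Icc 0 1) ≠ ⊤

/-- The induced path metric on `E`: the infimum of the lengths of rectifiable paths in `E`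
joining the two points. -/
def pathDistIn {X : Type*} [MetricSpace X] (E : Set X) (x y : X) : ℝ :=
  (⨅ g : {g : ℝ → X // IsPathIn E g x y}, eVariationOn g.1 (Icc 0 1)).toReal


universe u
/-! ### Conical neighborhoods -/


/-- The distance function of the `κ`-cone (κ ≤ 0) over a space with distance function `dL`:
a point is a pair (radius, link point), all points of radius `0` being identified (the cone
point); the distance is given by the law of cosines in curvature `κ`, with angle
`min π (dL ℓ ℓ')`. -/
def coneDist (κ : ℝ) {L : Type*} (dL : L → L → ℝ) (a b : ℝ × L) : ℝ :=
  if κ = 0 then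
    Real.sqrt (a.1 ^ 2 + b.1 ^ 2 - 2 * a.1 * b.1 * Real.cos (min Real.pi (dL a.2 b.2)))
  else
    (1 / Real.sqrt (-κ)) *
      arcosh (Real.cosh (Real.sqrt (-κ) * a.1) * Real.cosh (Real.sqrt (-κ) * b.1) -
        Real.sinh (Real.sqrt (-κ) * a.1) * Real.sinh (Real.sqrt (-κ) * b.1) *
          Real.cos (min Real.pi (dL a.2 b.2)))

/-- `V` is a conical neighborhood of `p` in `X`: an open neighborhood of `p` isometric to a
convex open subset of the `κ`-cone over a metric space (the link of `p`), the isometry taking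
`p` to the cone point. -/
def IsConicalNbhd (κ : ℝ) (p : X) (V : Set X) : Prop :=
  IsOpen V ∧ p ∈ V ∧
    ∃ (L : Type u) (dL : L → L → ℝ) (f : X → ℝ × L),
      (∀ a, dL a a = 0) ∧ (∀ a b, 0 ≤ dL a b) ∧ (∀ a b, dL a b = dL b a) ∧
      (∀ a b c, dL a c ≤ dL a b + dL b c) ∧
      (∀ x ∈ V, 0 ≤ (f x).1) ∧ (f p).1 = 0 ∧
      (∀ x ∈ V, ∀ y ∈ V, dist x y = coneDist κ dL (f x) (f y)) ∧
      (∀ x ∈ V, (f x).1 = 0 → x = p) ∧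
      ConvexWrtIn (coneDist κ dL) {w : ℝ × L | 0 ≤ w.1} (f '' V) ∧
      (∀ z ∈ f '' V, ∃ ε > 0, ∀ w : ℝ × L, 0 ≤ w.1 → coneDist κ dL z w < ε → w ∈ f '' V)

/-! ### Geodesics, triangles, and limit segments in `Y = (E, induced path metric)` -/

/-- The set `α` is (the image of) a geodesic arc of `Y = (E, pathDistIn E)`. -/
def IsYGeodesicArc (E : Set X) (α : Set X) : Prop :=
  ∃ (f : ℝ → X) (a b : ℝ), IsGeodesicWrt (pathDistIn E) f a b ∧
    MapsTo f (Icc a b) E ∧ f '' Icc a b = α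

/-- `T` is a geodesic triangle of `Y = (E, pathDistIn E)` with vertices `p`, `q`, `r`:
the union of the three `Y`-geodesics joining the vertices. -/
def IsYTriangle (E : Set X) (T : Set X) (p q r : X) : Prop :=
  p ∈ E ∧ q ∈ E ∧ r ∈ E ∧
    T = geodSeg (pathDistIn E) E p q ∪ geodSeg (pathDistIn E) E q r ∪
        geodSeg (pathDistIn E) E r p

/-- The set `γim` (a curve in `E`) is locally geodesic in `Y` at `p`: some subarc of `γim`
containing `p` in its relative interior is a geodesic of `Y`. -/
def LocallyYGeodesicAt (E γim : Set X) (p : X) : Prop :=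
  ∃ (f : ℝ → X) (a b t : ℝ), t ∈ Ioo a b ∧ f t = p ∧
    IsGeodesicWrt (pathDistIn E) f a b ∧ MapsTo f (Icc a b) E ∧ f '' Icc a b ⊆ γim

/-- `f : [0,1] → E` is the constant-speed parametrization of the `Y`-geodesic
from `x` to `y`. -/
def IsConstSpeedYGeodesic (E : Set X) (f : ℝ → X) (x y : X) : Prop :=
  f 0 = x ∧ f 1 = y ∧ MapsTo f (Icc 0 1) E ∧
    ∀ s ∈ Icc (0:ℝ) 1, ∀ t ∈ Icc (0:ℝ) 1,
      pathDistIn E (f s) (f t) = pathDistIn E x y * |s - t|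

/-- `R` is the limit segment of length `ε` at `p` of the `Y`-geodesic side from `p` to `q`:
`R` is an `X`-geodesic of length `ε` issuing from `p`, and the `X`-geodesics of length `ε`
from `p` through `σ t` (σ the `Y`-geodesic from `p` to `q`) converge uniformly to `R`
as `t → 0⁺`. -/
def IsLimitSegment (E : Set X) (p q : X) (ε : ℝ) (R : ℝ → X) : Prop :=
  0 < ε ∧ R 0 = p ∧ IsGeodesicWrt (fun x y : X => dist x y) R 0 ε ∧
    ∀ σ : ℝ → X, IsGeodesicFromTo (pathDistIn E) E σ p q →
      ∀ δ > 0, ∃ t₀ > 0, ∀ t, 0 < t → t ≤ t₀ → t ≤ pathDistIn E p q →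
        ∀ g : ℝ → X, IsGeodesicWrt (fun x y : X => dist x y) g 0 ε → g 0 = p →
          g (dist p (σ t)) = σ t → ∀ s ∈ Icc 0 ε, dist (g s) (R s) ≤ δ


end Cat2Cx

end

noncomputable section

open Topology unitInterval

namespace Cat2Cx

/-! ### Logarithms and degrees of loops in the punctured plane -/

theorem exists_log_homotopy {A : Type*} [TopologicalSpace A] (H : C(I × A, ℂ))
    (hH : ∀ x, H x ≠ 0) (f : C(A, ℂ)) (h0 : ∀ a, H (0, a) = Complex.exp (f a)) :
    ∃ U : C(I × A, ℂ), (∀ x, Complex.exp (U x) = H x) ∧ ∀ a, U (0, a) = f a := by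
  let H' : C(I × A, {z : ℂ // z ≠ 0}) := ⟨fun x => ⟨H x, hH x⟩, by fun_prop⟩
  have h0' : ∀ a, H' (0, a) = ⟨_, (f a).exp_ne_zero⟩ := fun a => Subtype.ext (h0 a)
  refine ⟨Complex.isCoveringMap_exp.liftHomotopy H' f h0', fun x => ?_, fun a => ?_⟩
  · exact congrArg Subtype.val (congrFun (Complex.isCoveringMap_exp.liftHomotopy_lifts H' f h0') x)
  · exact Complex.isCoveringMap_exp.liftHomotopy_zero H' f h0' a

/-- A nonvanishing function which is homotopic to a constant along `H` has a logarithm. -/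
theorem exists_log_of_homotopy {A : Type*} [TopologicalSpace A] (H : C(I × A, ℂ))
    (hH : ∀ x, H x ≠ 0) (w : ℂ) (h0 : ∀ a, H (0, a) = w) :
    ∃ u : A → ℂ, Continuous u ∧ ∀ a, Complex.exp (u a) = H (1, a) := by
  by_cases hA : Nonempty A
  · obtain ⟨a⟩ := hA
    have hw : w ≠ 0 := by rw [← h0 a]; exact hH _
    obtain ⟨U, hU, -⟩ := exists_log_homotopy H hH ⟨fun _ => Complex.log w, continuous_const⟩
      (fun a => by rw [h0 a]; exact (Complex.exp_log hw).symm)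
    exact ⟨fun a => U (1, a), by fun_prop, fun a => hU _⟩
  · exact ⟨fun _ => 0, continuous_const, fun a => (hA ⟨a⟩).elim⟩

theorem exists_log_real {c : ℝ → ℂ} (hc : Continuous c) (h0 : ∀ t, c t ≠ 0) :
    ∃ u : ℝ → ℂ, Continuous u ∧ ∀ t, Complex.exp (u t) = c t := by
  obtain ⟨u, hu, h⟩ := exists_log_of_homotopy (A := ℝ)
    ⟨fun x => c (x.1 * x.2), by fun_prop⟩ (fun x => h0 _) (c 0) (fun a => by simp)
  exact ⟨u, hu, fun t => by rw [h]; simp⟩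

theorem int_const_of_continuous {A : Type*} [TopologicalSpace A] [PreconnectedSpace A]
    {v : A → ℂ} (hv : Continuous v)
    (h : ∀ a, Complex.exp (v a) = 1) (a b : A) : v a = v b := by
  have hk : ∀ a, ∃ n : ℤ, v a = n * (2 * Real.pi * Complex.I) := fun a =>
    Complex.exp_eq_one_iff.1 (h a)
  choose k hk using hk
  have h2 : (2 * Real.pi * Complex.I : ℂ) ≠ 0 := Complex.two_pi_I_ne_zero
  have hkc : Continuous fun a => (k a : ℝ) := by
    have : (fun a => (k a : ℝ)) = fun a => (v a / (2 * Real.pi * Complex.I)).re := by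
      funext a; rw [hk a, mul_div_cancel_right₀ _ h2]; simp
    rw [this]; fun_prop
  have hkc' : Continuous k := by
    rw [Int.isClosedEmbedding_coe_real.continuous_iff]; exact hkc
  have : k a = k b := PreconnectedSpace.constant ‹_› hkc'
  rw [hk a, hk b, this]

/-- The loop `c : ℝ → ℂ` (of period one, avoiding `0`) has degree `n` about `0`. -/
def HasDeg (c : ℝ → ℂ) (n : ℤ) : Prop :=
  ∃ u : ℝ → ℂ, Continuous u ∧ (∀ t, Complex.exp (u t) = c t) ∧
    ∀ t, u (t + 1) = u t + 2 * Real.pi * Complex.I * n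

theorem exists_hasDeg {c : ℝ → ℂ} (hc : Continuous c) (h0 : ∀ t, c t ≠ 0)
    (hp : ∀ t, c (t + 1) = c t) : ∃ n, HasDeg c n := by
  obtain ⟨u, hu, h⟩ := exists_log_real hc h0
  have h1 : ∀ t, Complex.exp (u (t + 1) - u t) = 1 := fun t => by
    rw [Complex.exp_sub, h, h, hp, div_self (h0 t)]
  obtain ⟨n, hn⟩ := Complex.exp_eq_one_iff.1 (h1 0)
  refine ⟨n, u, hu, h, fun t => ?_⟩
  have := int_const_of_continuous (v := fun t => u (t + 1) - u t) (by fun_prop) h1 t 0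
  rw [hn] at this
  linear_combination this

theorem HasDeg.unique {c : ℝ → ℂ} {m n : ℤ} (h1 : HasDeg c m) (h2 : HasDeg c n) : m = n := by
  obtain ⟨u, hu, he, hp⟩ := h1
  obtain ⟨v, hv, he', hp'⟩ := h2
  have := int_const_of_continuous (v := fun t => u t - v t) (by fun_prop)
    (fun t => by rw [Complex.exp_sub, he, he', div_self]; rw [← he]; exact Complex.exp_ne_zero _) 1 0
  have e1 := hp 0
  have e2 := hp' 0
  rw [zero_add] at e1 e2
  have h2 : (2 * Real.pi * Complex.I : ℂ) ≠ 0 := Complex.two_pi_I_ne_zero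
  rw [e1, e2] at this
  have : (2 * Real.pi * Complex.I : ℂ) * m = 2 * Real.pi * Complex.I * n := by
    linear_combination this
  exact_mod_cast mul_left_cancel₀ h2 this

theorem HasDeg.mul {c d : ℝ → ℂ} {m n : ℤ} (h1 : HasDeg c m) (h2 : HasDeg d n) :
    HasDeg (fun t => c t * d t) (m + n) := by
  obtain ⟨u, hu, he, hp⟩ := h1
  obtain ⟨v, hv, he', hp'⟩ := h2
  refine ⟨fun t => u t + v t, by fun_prop, fun t => by rw [Complex.exp_add, he, he'], fun t => ?_⟩
  simp only [hp, hp']; push_cast; ring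

theorem HasDeg.inv {c : ℝ → ℂ} {m : ℤ} (h1 : HasDeg c m) : HasDeg (fun t => (c t)⁻¹) (-m) := by
  obtain ⟨u, hu, he, hp⟩ := h1
  refine ⟨fun t => - u t, by fun_prop, fun t => by rw [Complex.exp_neg, he], fun t => ?_⟩
  simp only [hp]; push_cast; ring

theorem HasDeg.div {c d : ℝ → ℂ} {m n : ℤ} (h1 : HasDeg c m) (h2 : HasDeg d n) :
    HasDeg (fun t => c t / d t) (m - n) := by
  simpa only [div_eq_mul_inv, sub_eq_add_neg] using h1.mul h2.inv

theorem HasDeg.zpow {c : ℝ → ℂ} {m : ℤ} (h1 : HasDeg c m) (k : ℤ) :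
    HasDeg (fun t => c t ^ k) (k * m) := by
  obtain ⟨u, hu, he, hp⟩ := h1
  refine ⟨fun t => k * u t, by fun_prop, fun t => by rw [Complex.exp_int_mul, he], fun t => ?_⟩
  simp only [hp]; push_cast; ring

theorem HasDeg.congr {c d : ℝ → ℂ} {m : ℤ} (h1 : HasDeg c m) (h : ∀ t, c t = d t) :
    HasDeg d m := by
  rwa [show c = d from funext h] at h1

theorem hasDeg_exp {u : ℝ → ℂ} (hu : Continuous u) (hp : ∀ t, u (t + 1) = u t) :
    HasDeg (fun t => Complex.exp (u t)) 0 :=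
  ⟨u, hu, fun _ => rfl, fun t => by simp [hp]⟩

theorem hasDeg_const {w : ℂ} (hw : w ≠ 0) : HasDeg (fun _ => w) 0 :=
  (hasDeg_exp (u := fun _ => Complex.log w) continuous_const fun _ => rfl).congr
    fun _ => Complex.exp_log hw

theorem HasDeg.homotopy (H : ℝ → ℝ → ℂ) (hc : ContinuousOn (fun x : ℝ × ℝ => H x.1 x.2)
    (Icc 0 1 ×ˢ univ)) (h0 : ∀ s ∈ Icc (0 : ℝ) 1, ∀ t, H s t ≠ 0)
    (hp : ∀ s ∈ Icc (0 : ℝ) 1, ∀ t, H s (t + 1) = H s t) {n : ℤ} (h : HasDeg (H 0) n) :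
    HasDeg (H 1) n := by
  obtain ⟨u, hu, he, hper⟩ := h
  have hcont : Continuous fun x : I × ℝ => H x.1 x.2 :=
    hc.comp_continuous (f := fun x : I × ℝ => ((x.1 : ℝ), x.2)) (by fun_prop)
      (fun x => ⟨x.1.2, mem_univ _⟩)
  obtain ⟨U, hU, hU0⟩ := exists_log_homotopy (A := ℝ) ⟨_, hcont⟩
    (fun x => h0 _ x.1.2 _) ⟨u, hu⟩ (fun a => by simp [he])
  simp only [ContinuousMap.coe_mk] at hU hU0
  refine ⟨fun t => U (1, t), by fun_prop, fun t => by simp [hU], fun t => ?_⟩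
  have := int_const_of_continuous (A := I) (v := fun s => U (s, t + 1) - U (s, t)) (by fun_prop)
    (fun s => by
      rw [Complex.exp_sub, hU, hU]; simp only [hp s s.2 t]; exact div_self (h0 _ s.2 _)) 1 0
  simp only [hU0, hper] at this
  linear_combination this

theorem HasDeg.homotopy_eq (H : ℝ → ℝ → ℂ) (hc : ContinuousOn (fun x : ℝ × ℝ => H x.1 x.2)
    (Icc 0 1 ×ˢ univ)) (h0 : ∀ s ∈ Icc (0 : ℝ) 1, ∀ t, H s t ≠ 0)
    (hp : ∀ s ∈ Icc (0 : ℝ) 1, ∀ t, H s (t + 1) = H s t) {m n : ℤ} (h : HasDeg (H 0) m)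
    (h' : HasDeg (H 1) n) : m = n :=
  (h.homotopy H hc h0 hp).unique h'

end Cat2Cx
end

noncomputable section

open Topology

namespace Cat2Cx

/-! ### From the angle condition to the CAT(0) inequality -/

theorem convexOn_cosh_sqrt : ConvexOn ℝ (Ici (0 : ℝ)) fun y => Real.cosh (Real.sqrt y) := by
  refine ⟨convex_Ici 0, fun x hx y hy a b ha hb hab => ?_⟩
  have key : ∀ y : ℝ, 0 ≤ y → HasSum (fun n : ℕ => y ^ n / ((2 * n).factorial : ℝ))
      (Real.cosh (Real.sqrt y)) := fun y hy => by
    have := Real.hasSum_cosh (Real.sqrt y)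
    simpa only [pow_mul, Real.sq_sqrt hy] using this
  simp only [smul_eq_mul]
  have hxy : 0 ≤ a * x + b * y := add_nonneg (mul_nonneg ha hx) (mul_nonneg hb hy)
  refine hasSum_le (fun n => ?_) (key _ hxy) (((key x hx).mul_left a).add ((key y hy).mul_left b))
  have := (convexOn_pow n).2 hx hy ha hb hab
  simp only [smul_eq_mul] at this
  have hf : (0 : ℝ) < ((2 * n).factorial : ℝ) := by positivity
  rw [← mul_div_assoc, ← mul_div_assoc, ← add_div]
  exact div_le_div_of_nonneg_right this hf.le

theorem cosine_law_comparison {a b c : ℝ} (ha : 0 < a) (hb : 0 < b) (hc : 0 ≤ c)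
    (h1 : |a - b| ≤ c) (h2 : c ≤ a + b) :
    (a ^ 2 + b ^ 2 - c ^ 2) / (2 * a * b) ≤
      (Real.cosh a * Real.cosh b - Real.cosh c) / (Real.sinh a * Real.sinh b) := by
  have hsa := Real.sinh_pos_iff.2 ha
  have hsb := Real.sinh_pos_iff.2 hb
  set x := (a ^ 2 + b ^ 2 - c ^ 2) / (2 * a * b) with hx
  have hxe : 2 * a * b * x = a ^ 2 + b ^ 2 - c ^ 2 := by rw [hx]; field_simp
  rw [le_div_iff₀ (mul_pos hsa hsb)]
  have hsq : (a - b) ^ 2 ≤ c ^ 2 := by rw [← sq_abs (a - b)]; gcongr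
  have hsq2 : c ^ 2 ≤ (a + b) ^ 2 := by gcongr
  have hab : 0 < a * b := mul_pos ha hb
  have hx1 : x ≤ 1 := by
    rw [hx, div_le_one (by positivity)]; nlinarith
  have hx2 : -1 ≤ x := by
    rw [hx, le_div_iff₀ (by positivity)]; nlinarith
  have := convexOn_cosh_sqrt.2 (mem_Ici.2 (sq_nonneg (a - b))) (mem_Ici.2 (sq_nonneg (a + b)))
    (show 0 ≤ (1 + x) / 2 by linarith) (show 0 ≤ (1 - x) / 2 by linarith) (by ring)
  simp only [smul_eq_mul] at this
  rw [show (1 + x) / 2 * (a - b) ^ 2 + (1 - x) / 2 * (a + b) ^ 2 = c ^ 2 by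
    linear_combination (-1) * hxe, Real.sqrt_sq hc, Real.sqrt_sq_eq_abs, Real.sqrt_sq_eq_abs,
    Real.cosh_abs, Real.cosh_abs, Real.cosh_sub, Real.cosh_add] at this
  linarith

theorem compAngle_le_euclCompAngle {κ : ℝ} (hκ : κ ≤ 0) {a b c : ℝ} (ha : 0 < a) (hb : 0 < b)
    (hc : 0 ≤ c) (h1 : |a - b| ≤ c) (h2 : c ≤ a + b) :
    compAngle κ a b c ≤ euclCompAngle a b c := by
  unfold compAngle
  split_ifs with h
  · exact le_rfl
  · have hk : 0 < Real.sqrt (-κ) := Real.sqrt_pos.2 (by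
      rcases hκ.lt_or_eq with h' | h'
      · linarith
      · exact absurd h' h)
    set k := Real.sqrt (-κ)
    refine Real.arccos_le_arccos ?_
    have := cosine_law_comparison (a := k * a) (b := k * b) (c := k * c) (by positivity)
      (by positivity) (by positivity)
      (by rw [← mul_sub, abs_mul, abs_of_pos hk]; gcongr) (by rw [← mul_add]; gcongr)
    refine le_trans (le_of_eq ?_) this
    field_simp

/-- CAT(0) spaces, through Stewart's inequality. -/
class CatZero (X : Type*) [MetricSpace X] : Prop where
  exists_geodesic : ∀ x y : X, ∃ f : ℝ → X, IsGeodesicFromTo (xDist X) univ f x y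
  stewart : ∀ p q r m : X, dist q m + dist m r = dist q r →
    dist q r * dist p m ^ 2 ≤ dist m r * dist p q ^ 2 + dist q m * dist p r ^ 2 -
      dist q m * dist m r * dist q r

theorem cos_add_cos_pos {a b : ℝ} (ha : 0 ≤ a) (hb : 0 ≤ b) (hab : a + b < Real.pi) :
    0 < Real.cos a + Real.cos b := by
  have : Real.cos (Real.pi - b) < Real.cos a :=
    Real.cos_lt_cos_of_nonneg_of_le_pi ha (by linarith) (by linarith)
  rw [Real.cos_pi_sub] at this
  linarith

theorem exists_bound_of_upperAngle_lt {X : Type*} [MetricSpace X] {m : X} {σ τ : ℝ → X} {a : ℝ}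
    (h : upperAngleWrt (xDist X) m σ τ < a) :
    ∃ ε > 0, ∀ s t, 0 < s → s < ε → 0 < t → t < ε →
      euclCompAngle (dist m (σ s)) (dist m (τ t)) (dist (σ s) (τ t)) < a := by
  have hne : {a | ∃ ε > 0, a = sSup {b | ∃ s t : ℝ, 0 < s ∧ s < ε ∧ 0 < t ∧ t < ε ∧
      b = euclCompAngle (xDist X m (σ s)) (xDist X m (τ t)) (xDist X (σ s) (τ t))}}.Nonempty :=
    ⟨_, 1, one_pos, rfl⟩
  obtain ⟨b, ⟨ε, hε, rfl⟩, hb⟩ := exists_lt_of_csInf_lt hne h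
  refine ⟨ε, hε, fun s t hs hs' ht ht' => lt_of_le_of_lt ?_ hb⟩
  refine le_csSup ⟨Real.pi, ?_⟩ ⟨s, t, hs, hs', ht, ht', rfl⟩
  rintro _ ⟨s, t, -, -, -, -, rfl⟩
  exact Real.arccos_le_pi _

theorem upperAngle_nonneg {X : Type*} [MetricSpace X] (m : X) (σ τ : ℝ → X) :
    0 ≤ upperAngleWrt (xDist X) m σ τ := by
  refine Real.sInf_nonneg ?_
  rintro _ ⟨ε, -, rfl⟩
  refine Real.sSup_nonneg ?_
  rintro _ ⟨s, t, -, -, -, -, rfl⟩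
  exact Real.arccos_nonneg _

theorem dist_sq_le_of_euclCompAngle_lt {a b c A : ℝ} (ha : 0 < a) (hb : 0 < b) 
    (hA' : A ≤ Real.pi) (h1 : |a - b| ≤ c) (h2 : c ≤ a + b) (h : euclCompAngle a b c < A) :
    c ^ 2 ≤ a ^ 2 + b ^ 2 - 2 * a * b * Real.cos A := by
  have hab : 0 < a * b := mul_pos ha hb
  have hc : 0 ≤ c := (abs_nonneg _).trans h1
  have hsq : (a - b) ^ 2 ≤ c ^ 2 := by rw [← sq_abs (a - b)]; gcongr
  have hsq2 : c ^ 2 ≤ (a + b) ^ 2 := by gcongr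
  have : Real.cos A ≤ Real.cos (euclCompAngle a b c) :=
    Real.cos_le_cos_of_nonneg_of_le_pi (Real.arccos_nonneg _) hA' h.le
  rw [euclCompAngle, Real.cos_arccos, le_div_iff₀ (by positivity)] at this
  · linarith
  · rw [le_div_iff₀ (by positivity)]; nlinarith
  · rw [div_le_one (by positivity)]; nlinarith

theorem sqrt_bound {t s c d : ℝ}
    (h : d ^ 2 ≤ s ^ 2 + t ^ 2 - 2 * s * t * c) : 2 * t * d ≤ 2 * t ^ 2 + s ^ 2 - 2 * s * t * c := by
  nlinarith [sq_nonneg (d - t)]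

/-- The angles on both sides of a point of a geodesic add up to at least `π`. -/
theorem pi_le_upperAngle_add {X : Type*} [MetricSpace X] {m p q r : X} {σ τ₁ τ₂ : ℝ → X}
    (hσ : IsGeodesicFromTo (xDist X) univ σ m p) (h1 : IsGeodesicFromTo (xDist X) univ τ₁ m q)
    (h2 : IsGeodesicFromTo (xDist X) univ τ₂ m r) (hp : m ≠ p) (hq : m ≠ q) (hr : m ≠ r)
    (hb : dist q m + dist m r = dist q r) :
    Real.pi ≤ upperAngleWrt (xDist X) m σ τ₁ + upperAngleWrt (xDist X) m σ τ₂ := by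
  by_contra! hlt
  set δ := (Real.pi - (upperAngleWrt (xDist X) m σ τ₁ + upperAngleWrt (xDist X) m σ τ₂)) / 3
  have hδ : 0 < δ := by simp only [δ]; linarith
  have n1 := upperAngle_nonneg m σ τ₁
  have n2 := upperAngle_nonneg m σ τ₂
  set A₁ := upperAngleWrt (xDist X) m σ τ₁ + δ with hA₁
  set A₂ := upperAngleWrt (xDist X) m σ τ₂ + δ with hA₂
  have hA : A₁ + A₂ < Real.pi := by simp only [A₁, A₂, δ]; linarith
  obtain ⟨ε₁, hε₁, H1⟩ := exists_bound_of_upperAngle_lt (m := m) (σ := σ) (τ := τ₁) (a := A₁) (by linarith)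
  obtain ⟨ε₂, hε₂, H2⟩ := exists_bound_of_upperAngle_lt (m := m) (σ := σ) (τ := τ₂) (a := A₂) (by linarith)
  have hc := cos_add_cos_pos (a := A₁) (b := A₂) (by linarith) (by linarith) hA
  set c := Real.cos A₁ + Real.cos A₂
  have hpp := dist_pos.2 hp
  have hqq := dist_pos.2 hq
  have hrr := dist_pos.2 hr
  obtain ⟨t, ht0, ht⟩ : ∃ t, 0 < t ∧ t < min (min ε₁ ε₂) (min (dist m q) (dist m r)) :=
    exists_between (by positivity)
  obtain ⟨s, hs0, hs⟩ : ∃ s, 0 < s ∧ s < min (min ε₁ ε₂) (min (dist m p) (t * c)) :=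
    exists_between (by positivity)
  simp only [lt_min_iff] at ht hs
  have dσ : dist m (σ s) = s := by
    have := hσ.2.2.1.2 0 ⟨le_rfl, hpp.le⟩ s ⟨hs0.le, hs.2.1.le⟩
    rw [hσ.1] at this; simpa [abs_of_pos hs0] using this
  have dτ₁ : dist m (τ₁ t) = t := by
    have := h1.2.2.1.2 0 ⟨le_rfl, hqq.le⟩ t ⟨ht0.le, ht.2.1.le⟩
    rw [h1.1] at this; simpa [abs_of_pos ht0] using this
  have dτ₂ : dist m (τ₂ t) = t := by
    have := h2.2.2.1.2 0 ⟨le_rfl, hrr.le⟩ t ⟨ht0.le, ht.2.2.le⟩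
    rw [h2.1] at this; simpa [abs_of_pos ht0] using this
  have eτ₁ : dist (τ₁ t) q = dist m q - t := by
    have := h1.2.2.1.2 t ⟨ht0.le, ht.2.1.le⟩ (dist m q) ⟨hqq.le, le_rfl⟩
    have e := h1.2.1
    rw [e] at this; change dist _ _ = _ at this; rw [this, abs_sub_comm, abs_of_nonneg]; linarith [ht.2.1]
  have eτ₂ : dist (τ₂ t) r = dist m r - t := by
    have := h2.2.2.1.2 t ⟨ht0.le, ht.2.2.le⟩ (dist m r) ⟨hrr.le, le_rfl⟩
    have e := h2.2.1
    rw [e] at this; change dist _ _ = _ at this; rw [this, abs_sub_comm, abs_of_nonneg]; linarith [ht.2.2]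
  have hfar : 2 * t ≤ dist (σ s) (τ₁ t) + dist (σ s) (τ₂ t) := by
    have t1 := dist_triangle q (τ₁ t) r
    have t2 := dist_triangle (τ₁ t) (τ₂ t) r
    have t3 := dist_triangle (τ₁ t) (σ s) (τ₂ t)
    rw [dist_comm (τ₁ t) (σ s)] at t3
    rw [dist_comm q (τ₁ t)] at t1
    rw [dist_comm q m] at hb
    linarith
  have b1 := dist_sq_le_of_euclCompAngle_lt (a := s) (b := t) (c := dist (σ s) (τ₁ t)) hs0 ht0
    (A := A₁) (by linarith)
    (by have := abs_dist_sub_le (σ s) (τ₁ t) m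
        rwa [dist_comm _ m, dist_comm _ m, dσ, dτ₁] at this)
    (by have := dist_triangle_left (σ s) (τ₁ t) m; rwa [dσ, dτ₁] at this)
    (by have := H1 s t hs0 hs.1.1 ht0 ht.1.1; rwa [dσ, dτ₁] at this)
  have b2 := dist_sq_le_of_euclCompAngle_lt (a := s) (b := t) (c := dist (σ s) (τ₂ t)) hs0 ht0
    (A := A₂) (by linarith)
    (by have := abs_dist_sub_le (σ s) (τ₂ t) m
        rwa [dist_comm _ m, dist_comm _ m, dσ, dτ₂] at this)
    (by have := dist_triangle_left (σ s) (τ₂ t) m; rwa [dσ, dτ₂] at this)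
    (by have := H2 s t hs0 hs.1.2 ht0 ht.1.2; rwa [dσ, dτ₂] at this)
  have b1' := sqrt_bound b1
  have b2' := sqrt_bound b2
  have : 2 * t * (2 * t) ≤ 2 * t * (dist (σ s) (τ₁ t) + dist (σ s) (τ₂ t)) := by gcongr
  have h3 : s * (t * c) ≤ s * s := by simp only [c]; nlinarith
  have := le_of_mul_le_mul_left h3 hs0
  linarith [hs.2.2]

theorem catZero_of_isCATSpace {κ : ℝ} (hκ : κ ≤ 0) {X : Type*} [MetricSpace X]
    (hX : IsCATSpace κ X) : CatZero X where
  exists_geodesic x y := hX.1 x (mem_univ _) y (mem_univ _)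
  stewart p q r m hb := by
    by_cases hmq : m = q
    · subst hmq; simp
    by_cases hmr : m = r
    · subst hmr; simp
    by_cases hmp : m = p
    · subst hmp; simp only [dist_self, dist_comm m q, ← hb]; exact le_of_eq (by ring)
    by_cases hpq : p = q
    · subst hpq; simp only [dist_self, ← hb]; exact le_of_eq (by ring)
    by_cases hpr : p = r
    · subst hpr; simp only [dist_self, dist_comm p m, dist_comm p q, ← hb]; exact le_of_eq (by ring)
    obtain ⟨σ, hσ⟩ := hX.1 m (mem_univ _) p (mem_univ _)
    obtain ⟨τ₁, h1⟩ := hX.1 m (mem_univ _) q (mem_univ _)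
    obtain ⟨τ₂, h2⟩ := hX.1 m (mem_univ _) r (mem_univ _)
    have hpi := pi_le_upperAngle_add hσ h1 h2 hmp hmq hmr hb
    have a1 := hX.2 m (mem_univ _) p (mem_univ _) q (mem_univ _) hmp hmq hpq σ τ₁ hσ h1
    have a2 := hX.2 m (mem_univ _) p (mem_univ _) r (mem_univ _) hmp hmr hpr σ τ₂ hσ h2
    simp only at a1 a2
    have P := dist_pos.2 hmp
    have Q := dist_pos.2 hmq
    have R := dist_pos.2 hmr
    have tri : ∀ x : X, |dist m p - dist m x| ≤ dist p x := fun x => by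
      have := abs_dist_sub_le p x m; rwa [dist_comm p m, dist_comm x m] at this
    have c1 := compAngle_le_euclCompAngle hκ P Q dist_nonneg (tri q) (dist_triangle_left p q m)
    have c2 := compAngle_le_euclCompAngle hκ P R dist_nonneg (tri r) (dist_triangle_left p r m)
    have hsum : Real.pi ≤ euclCompAngle (dist m p) (dist m q) (dist p q) +
        euclCompAngle (dist m p) (dist m r) (dist p r) := by
      change Real.pi ≤ upperAngleWrt (fun x y => dist x y) m σ τ₁ +
        upperAngleWrt (fun x y => dist x y) m σ τ₂ at hpi
      linarith
    have hcos : Real.cos (euclCompAngle (dist m p) (dist m q) (dist p q)) ≤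
        - Real.cos (euclCompAngle (dist m p) (dist m r) (dist p r)) := by
      rw [← Real.cos_pi_sub]
      exact Real.cos_le_cos_of_nonneg_of_le_pi
        (sub_nonneg.2 (Real.arccos_le_pi _))
        (Real.arccos_le_pi _) (by linarith)
    have hval : ∀ x : X, 0 < dist m x → Real.cos (euclCompAngle (dist m p) (dist m x) (dist p x)) =
        (dist m p ^ 2 + dist m x ^ 2 - dist p x ^ 2) / (2 * dist m p * dist m x) := fun x hx => by
      have hsq : (dist m p - dist m x) ^ 2 ≤ dist p x ^ 2 := by
        rw [← sq_abs (dist m p - dist m x)]; exact pow_le_pow_left₀ (abs_nonneg _) (tri x) 2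
      have hsq2 : dist p x ^ 2 ≤ (dist m p + dist m x) ^ 2 :=
        pow_le_pow_left₀ dist_nonneg (dist_triangle_left p x m) 2
      have : 0 < dist m p * dist m x := mul_pos P hx
      rw [euclCompAngle, Real.cos_arccos]
      · rw [le_div_iff₀ (by positivity)]; nlinarith
      · rw [div_le_one (by positivity)]; nlinarith
    rw [hval q Q, hval r R, ← neg_div, div_le_div_iff₀ (by positivity) (by positivity)] at hcos
    rw [← hb, dist_comm q m, dist_comm p m]
    have h2 : 2 * dist m p * ((dist m p ^ 2 + dist m q ^ 2 - dist p q ^ 2) * dist m r) ≤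
        2 * dist m p * (-(dist m p ^ 2 + dist m r ^ 2 - dist p r ^ 2) * dist m q) := by linarith
    have := le_of_mul_le_mul_left h2 (by positivity)
    linarith

end Cat2Cx
end

noncomputable section

open Topology

namespace Cat2Cx

/-! ### Geodesics and convexity in CAT(0) spaces -/

section CatZeroToolkit

variable {X : Type*} [MetricSpace X] [CatZero X]

/-- The point dividing the geodesic from `x` to `y` in proportion `t` (clamped to `[0,1]`). -/
def geo (x y : X) (t : ℝ) : X :=
  Classical.choose (CatZero.exists_geodesic x y) (max 0 (min 1 t) * dist x y)

theorem clamp_mem (t : ℝ) : max 0 (min 1 t) ∈ Icc (0 : ℝ) 1 :=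
  ⟨le_max_left _ _, max_le zero_le_one (min_le_left _ _)⟩

theorem clamp_eq {t : ℝ} (ht : t ∈ Icc (0 : ℝ) 1) : max 0 (min 1 t) = t := by
  rw [min_eq_right ht.2, max_eq_right ht.1]

theorem geo_clamp (x y : X) (t : ℝ) : geo x y (max 0 (min 1 t)) = geo x y t := by
  unfold geo; rw [clamp_eq (clamp_mem t)]

@[simp] theorem geo_zero (x y : X) : geo x y 0 = x := by
  have := (Classical.choose_spec (CatZero.exists_geodesic x y)).1
  unfold geo; simpa using this

@[simp] theorem geo_one (x y : X) : geo x y 1 = y := by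
  have := (Classical.choose_spec (CatZero.exists_geodesic x y)).2.1
  unfold geo; simpa using this

theorem dist_geo_geo (x y : X) {s t : ℝ} (hs : s ∈ Icc (0 : ℝ) 1) (ht : t ∈ Icc (0 : ℝ) 1) :
    dist (geo x y s) (geo x y t) = |s - t| * dist x y := by
  have h := (Classical.choose_spec (CatZero.exists_geodesic x y)).2.2.1.2
  have hm : ∀ t ∈ Icc (0 : ℝ) 1, t * dist x y ∈ Icc 0 (dist x y) := fun t ht =>
    ⟨mul_nonneg ht.1 dist_nonneg, mul_le_of_le_one_left dist_nonneg ht.2⟩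
  unfold geo
  rw [clamp_eq hs, clamp_eq ht]
  refine (h _ (hm s hs) _ (hm t ht)).trans ?_
  rw [← sub_mul, abs_mul, abs_of_nonneg (dist_nonneg : 0 ≤ dist x y)]

theorem dist_left_geo (x y : X) {t : ℝ} (ht : t ∈ Icc (0 : ℝ) 1) :
    dist x (geo x y t) = t * dist x y := by
  have := dist_geo_geo x y (s := 0) ⟨le_rfl, zero_le_one⟩ ht
  rwa [geo_zero, zero_sub, abs_neg, abs_of_nonneg ht.1] at this

theorem dist_geo_right (x y : X) {t : ℝ} (ht : t ∈ Icc (0 : ℝ) 1) :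
    dist (geo x y t) y = (1 - t) * dist x y := by
  have := dist_geo_geo x y ht (t := 1) ⟨zero_le_one, le_rfl⟩
  rwa [geo_one, abs_sub_comm, abs_of_nonneg (by linarith [ht.2])] at this

@[simp] theorem geo_self (x : X) (t : ℝ) : geo x x t = x := by
  rw [← geo_clamp, ← dist_eq_zero, dist_comm, dist_left_geo x x (clamp_mem t)]; simp

theorem dist_sq_geo_le (p x y : X) {t : ℝ} (ht : t ∈ Icc (0 : ℝ) 1) :
    dist p (geo x y t) ^ 2 ≤
      (1 - t) * dist p x ^ 2 + t * dist p y ^ 2 - t * (1 - t) * dist x y ^ 2 := by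
  rcases eq_or_ne x y with rfl | hxy
  · simp only [geo_self, dist_self]; linarith
  have h := CatZero.stewart p x y (geo x y t)
    (by rw [dist_left_geo x y ht, dist_geo_right x y ht]; ring)
  rw [dist_left_geo x y ht, dist_geo_right x y ht] at h
  have hp := dist_pos.2 hxy
  refine le_of_mul_le_mul_left (h.trans (le_of_eq ?_)) hp
  ring

theorem eq_geo {x y m : X} {t : ℝ} (ht : t ∈ Icc (0 : ℝ) 1) (h1 : dist x m = t * dist x y)
    (h2 : dist m y = (1 - t) * dist x y) : m = geo x y t := by
  have h := dist_sq_geo_le m x y ht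
  rw [dist_comm m x, h1, h2] at h
  have : dist m (geo x y t) ^ 2 ≤ 0 := h.trans (le_of_eq (by ring))
  exact dist_eq_zero.1 (pow_eq_zero_iff (two_ne_zero) |>.1 (le_antisymm this (sq_nonneg _)))

theorem one_sub_mem {t : ℝ} (ht : t ∈ Icc (0 : ℝ) 1) : 1 - t ∈ Icc (0 : ℝ) 1 :=
  ⟨by linarith [ht.2], by linarith [ht.1]⟩

theorem geo_symm (x y : X) {t : ℝ} (ht : t ∈ Icc (0 : ℝ) 1) : geo y x (1 - t) = geo x y t := by
  refine eq_geo ht ?_ ?_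
  · rw [dist_comm, dist_geo_right y x (one_sub_mem ht), dist_comm x y]; ring
  · rw [dist_comm, dist_left_geo y x (one_sub_mem ht), dist_comm x y]

theorem dist_geo_geo_le_same (x y z : X) {t : ℝ} (ht : t ∈ Icc (0 : ℝ) 1) :
    dist (geo x y t) (geo x z t) ≤ t * dist y z := by
  have h1 := dist_sq_geo_le (geo x y t) x z ht
  have h2 := dist_sq_geo_le z x y ht
  rw [dist_comm (geo x y t) x, dist_left_geo x y ht, dist_comm (geo x y t) z] at h1
  rw [dist_comm z x, dist_comm z y] at h2
  refine abs_le_of_sq_le_sq' ?_ (mul_nonneg ht.1 dist_nonneg) |>.2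
  have h3 := mul_le_mul_of_nonneg_left h2 ht.1
  refine h1.trans ?_
  nlinarith

theorem dist_geo_geo_le (x y x' y' : X) {t : ℝ} (ht : t ∈ Icc (0 : ℝ) 1) :
    dist (geo x y t) (geo x' y' t) ≤ (1 - t) * dist x x' + t * dist y y' := by
  have h1 := dist_geo_geo_le_same x y y' ht
  have h2 := dist_geo_geo_le_same y' x x' (one_sub_mem ht)
  rw [geo_symm x y' ht, geo_symm x' y' ht] at h2
  linarith [dist_triangle (geo x y t) (geo x y' t) (geo x' y' t)]

theorem dist_geo_geo_le_add (x y x' y' : X) (t t' : ℝ) :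
    dist (geo x y t) (geo x' y' t') ≤ |t - t'| * dist x y + dist x x' + dist y y' := by
  rw [← geo_clamp x y t, ← geo_clamp x' y' t']
  have h1 := dist_geo_geo x y (clamp_mem t) (clamp_mem t')
  have h2 := dist_geo_geo_le x y x' y' (clamp_mem t')
  have h3 : |max 0 (min 1 t) - max 0 (min 1 t')| ≤ |t - t'| := by
    refine (abs_max_sub_max_le_max _ _ _ _).trans (max_le (by simp) ?_)
    exact (abs_min_sub_min_le_max _ _ _ _).trans (max_le (by simp) le_rfl)
  have h4 := mul_le_mul_of_nonneg_right h3 (dist_nonneg : 0 ≤ dist x y)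
  have hm := clamp_mem t'
  have h5 : (1 - max 0 (min 1 t')) * dist x x' ≤ dist x x' :=
    mul_le_of_le_one_left dist_nonneg (by linarith [hm.1])
  have h6 : max 0 (min 1 t') * dist y y' ≤ dist y y' :=
    mul_le_of_le_one_left dist_nonneg hm.2
  linarith [dist_triangle (geo x y (max 0 (min 1 t))) (geo x y (max 0 (min 1 t')))
    (geo x' y' (max 0 (min 1 t')))]

theorem continuous_geo : Continuous fun a : X × X × ℝ => geo a.1 a.2.1 a.2.2 := by
  rw [continuous_iff_continuousAt]
  rintro ⟨x, y, t⟩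
  rw [ContinuousAt, tendsto_iff_dist_tendsto_zero]
  have hc : Tendsto (fun a : X × X × ℝ => |t - a.2.2| * dist x y + dist x a.1 + dist y a.2.1)
      (𝓝 (x, y, t)) (𝓝 (|t - t| * dist x y + dist x x + dist y y)) :=
    Continuous.tendsto (by fun_prop) (x, y, t)
  simp only [sub_self, abs_zero, zero_mul, dist_self, add_zero] at hc
  refine squeeze_zero (fun _ => dist_nonneg) (fun a => ?_) hc
  rw [dist_comm]; exact dist_geo_geo_le_add _ _ _ _ _ _

theorem continuous_geo_comp {A : Type*} [TopologicalSpace A] {f g : A → X} {t : A → ℝ}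
    (hf : Continuous f) (hg : Continuous g) (ht : Continuous t) :
    Continuous fun a => geo (f a) (g a) (t a) :=
  continuous_geo.comp (hf.prodMk (hg.prodMk ht))

/-- `y` lies on the geodesic from `x` to `z`. -/
def Btw (x y z : X) : Prop := dist x y + dist y z = dist x z

theorem Btw.symm {x y z : X} (h : Btw x y z) : Btw z y x := by
  unfold Btw at *; rw [dist_comm z y, dist_comm y x, dist_comm z x]; linarith

theorem btw_geo (x y : X) {t : ℝ} (ht : t ∈ Icc (0 : ℝ) 1) : Btw x (geo x y t) y := by
  unfold Btw; rw [dist_left_geo x y ht, dist_geo_right x y ht]; ring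

theorem Btw.exists_geo {x y z : X} (h : Btw x y z) : ∃ t ∈ Icc (0 : ℝ) 1, y = geo x z t := by
  unfold Btw at h
  have h1 : 0 ≤ dist x y := dist_nonneg
  have h2 : 0 ≤ dist y z := dist_nonneg
  rcases eq_or_ne x z with rfl | hxz
  · refine ⟨0, ⟨le_rfl, zero_le_one⟩, ?_⟩
    rw [dist_self] at h; rw [geo_zero]; exact (dist_eq_zero.1 (by linarith)).symm
  · have hp := dist_pos.2 hxz
    refine ⟨dist x y / dist x z, ⟨by positivity, by rw [div_le_one hp]; linarith⟩, ?_⟩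
    refine eq_geo ⟨by positivity, by rw [div_le_one hp]; linarith⟩ ?_ ?_ <;> field_simp
    linarith

/-- Local geodesics are geodesics. -/
theorem Btw.extend {x a b w : X} (h1 : Btw x a b) (hab : a ≠ b) (h2 : Btw a b w) : Btw x b w := by
  have h := CatZero.stewart w x b a h1
  unfold Btw at *
  have hβ := dist_pos.2 hab
  have hα : 0 ≤ dist x a := dist_nonneg
  have hγ : 0 ≤ dist b w := dist_nonneg
  refine le_antisymm ?_ (dist_triangle _ _ _)
  rw [dist_comm w a, ← h1, ← h2, dist_comm w b, dist_comm w x] at h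
  rw [← h1]
  refine abs_le_of_sq_le_sq' (le_of_mul_le_mul_left ?_ hβ) dist_nonneg |>.2
  linarith

theorem Btw.trans_left {x a b w : X} (h1 : Btw x b w) (h2 : Btw x a b) : Btw a b w ∧ Btw x a w := by
  unfold Btw at *
  have := dist_triangle a b w
  have := dist_triangle x a w
  constructor <;> linarith

/-- Geodesic convexity. -/
def GConvex (S : Set X) : Prop := ∀ x ∈ S, ∀ y ∈ S, ∀ t ∈ Icc (0 : ℝ) 1, geo x y t ∈ S

theorem gconvex_of_convexWrt {S : Set X} (h : ConvexWrt (xDist X) S) : GConvex S := by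
  intro x hx y hy t ht
  refine h x hx y hy (mem_iUnion₂.2 ⟨_, Classical.choose_spec (CatZero.exists_geodesic x y), ?_⟩)
  exact ⟨max 0 (min 1 t) * dist x y, by
    rw [clamp_eq ht]
    exact ⟨mul_nonneg ht.1 dist_nonneg, mul_le_of_le_one_left dist_nonneg ht.2⟩, rfl⟩

theorem GConvex.btw {S : Set X} (h : GConvex S) {x y z : X} (hx : x ∈ S) (hz : z ∈ S)
    (hb : Btw x y z) : y ∈ S := by
  obtain ⟨t, ht, rfl⟩ := hb.exists_geo
  exact h x hx z hz t ht

theorem GConvex.inter {S T : Set X} (h : GConvex S) (h' : GConvex T) : GConvex (S ∩ T) :=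
  fun x hx y hy t ht => ⟨h x hx.1 y hy.1 t ht, h' x hx.2 y hy.2 t ht⟩

theorem dist_geo_le_max (p x y : X) {t : ℝ} (ht : t ∈ Icc (0 : ℝ) 1) :
    dist p (geo x y t) ≤ (1 - t) * dist p x + t * dist p y := by
  have := dist_geo_geo_le p p x y ht
  rwa [geo_self] at this

theorem gconvex_ball (p : X) (r : ℝ) : GConvex (ball p r) := by
  intro x hx y hy t ht
  rw [mem_ball'] at *
  refine (dist_geo_le_max p x y ht).trans_lt ?_
  rcases ht.1.eq_or_lt with rfl | h0
  · simpa using hx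
  · nlinarith [ht.1, ht.2]

/-! ### Projections -/

/-- The nearest-point projection onto `C`. -/
def proj (C : Set X) (y : X) : X :=
  open Classical in if h : ∃ c ∈ C, infDist y C = dist y c then h.choose else y

theorem proj_spec {C : Set X} (hC : IsCompact C) (hne : C.Nonempty) (y : X) :
    proj C y ∈ C ∧ infDist y C = dist y (proj C y) := by
  have h := hC.exists_infDist_eq_dist hne y
  unfold proj
  rw [dif_pos h]
  exact h.choose_spec

theorem dist_proj_le {C : Set X} (hC : IsCompact C) {c : X} (hc : c ∈ C) (y : X) :
    dist y (proj C y) ≤ dist y c := by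
  rw [← (proj_spec hC ⟨c, hc⟩ y).2]; exact infDist_le_dist_of_mem hc

theorem proj_sq_le {C : Set X} (hC : IsCompact C) (hconv : GConvex C) {c : X} (hc : c ∈ C) (y : X) :
    dist y (proj C y) ^ 2 + dist (proj C y) c ^ 2 ≤ dist y c ^ 2 := by
  set p := proj C y
  have hp := (proj_spec hC ⟨c, hc⟩ y).1
  have key : ∀ t ∈ Ioc (0 : ℝ) 1, dist y p ^ 2 + (1 - t) * dist p c ^ 2 ≤ dist y c ^ 2 := by
    intro t ht
    have htt : t ∈ Icc (0 : ℝ) 1 := ⟨ht.1.le, ht.2⟩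
    have h1 := dist_sq_geo_le y p c htt
    have h2 := dist_proj_le hC (hconv p hp c hc t htt) y
    have h3 : dist y p ^ 2 ≤ dist y (geo p c t) ^ 2 := pow_le_pow_left₀ dist_nonneg h2 2
    refine le_of_mul_le_mul_left ?_ ht.1
    nlinarith
  have hl : Tendsto (fun t : ℝ => dist y p ^ 2 + (1 - t) * dist p c ^ 2) (𝓝[>] 0)
      (𝓝 (dist y p ^ 2 + (1 - 0) * dist p c ^ 2)) :=
    (Continuous.tendsto (by fun_prop) 0).mono_left nhdsWithin_le_nhds
  simp only [sub_zero, one_mul] at hl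
  refine le_of_tendsto hl ?_
  filter_upwards [Ioc_mem_nhdsGT (show (0 : ℝ) < 1 by norm_num)] with t ht using key t ht

theorem continuous_proj {C : Set X} (hC : IsCompact C) (hne : C.Nonempty) (hconv : GConvex C) :
    Continuous (proj C) := by
  rw [continuous_iff_continuousAt]
  intro y
  have key : ∀ y', dist (proj C y') (proj C y) ^ 2 ≤
      (2 * dist y y' + dist y (proj C y)) ^ 2 - dist y (proj C y) ^ 2 := by
    intro y'
    have hp := (proj_spec hC hne y).1
    have hp' := (proj_spec hC hne y').1
    have h1 := proj_sq_le hC hconv hp' y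
    have h2 := dist_proj_le hC hp y'
    have h3 := dist_triangle y y' (proj C y')
    have h4 := dist_triangle y' y (proj C y)
    rw [dist_comm y' y] at h4
    have h5 : dist y (proj C y') ^ 2 ≤ (2 * dist y y' + dist y (proj C y)) ^ 2 :=
      pow_le_pow_left₀ dist_nonneg (by linarith) 2
    rw [dist_comm (proj C y')]
    linarith
  rw [ContinuousAt, tendsto_iff_dist_tendsto_zero]
  have h2 : Tendsto (fun y' => Real.sqrt ((2 * dist y y' + dist y (proj C y)) ^ 2 -
      dist y (proj C y) ^ 2)) (𝓝 y) (𝓝 (Real.sqrt ((2 * dist y y + dist y (proj C y)) ^ 2 -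
      dist y (proj C y) ^ 2))) :=
    Continuous.tendsto (by fun_prop) y
  simp only [dist_self, mul_zero, zero_add, sub_self, Real.sqrt_zero] at h2
  exact squeeze_zero (fun _ => dist_nonneg) (fun y' => Real.le_sqrt_of_sq_le (key y')) h2

theorem proj_of_mem {C : Set X} (hC : IsCompact C) {y : X} (hy : y ∈ C) : proj C y = y := by
  have := (proj_spec hC ⟨y, hy⟩ y).2
  rw [infDist_zero_of_mem hy] at this
  exact (dist_eq_zero.1 this.symm).symm

/-- Only a point itself projects to a point interior to `C`. -/
theorem eq_of_proj_mem_interior {C : Set X} (hC : IsCompact C) {y : X}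
    (hy : proj C y ∈ interior C) : y = proj C y := by
  set p := proj C y with hp
  have hne : C.Nonempty := ⟨p, interior_subset hy⟩
  have hc : Continuous fun t : ℝ => geo p y t :=
    continuous_geo_comp continuous_const continuous_const continuous_id
  have : ∀ᶠ t in 𝓝[>] (0 : ℝ), geo p y t ∈ interior C :=
    ((hc.tendsto 0).mono_left nhdsWithin_le_nhds).eventually
      (by rw [geo_zero]; exact isOpen_interior.mem_nhds hy)
  obtain ⟨t, ht, ht'⟩ := (this.and (Ioc_mem_nhdsGT (show (0 : ℝ) < 1 by norm_num))).exists
  have h := dist_proj_le hC (interior_subset ht) y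
  have h2 := dist_geo_right p y (t := t) ⟨ht'.1.le, ht'.2⟩
  rw [← hp, dist_comm y, dist_comm y, h2] at h
  have : t * dist p y ≤ 0 := by linarith
  have h0 : dist p y ≤ 0 := by
    by_contra! hpos; exact absurd this (not_le.2 (mul_pos ht'.1 hpos))
  exact (dist_le_zero.1 h0).symm

theorem infDist_geo_le {C : Set X} (hC : IsCompact C) (hne : C.Nonempty) (hconv : GConvex C)
    (x y : X) {t : ℝ} (ht : t ∈ Icc (0 : ℝ) 1) :
    infDist (geo x y t) C ≤ (1 - t) * infDist x C + t * infDist y C := by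
  obtain ⟨h1, h1'⟩ := proj_spec hC hne x
  obtain ⟨h2, h2'⟩ := proj_spec hC hne y
  rw [h1', h2']
  exact (infDist_le_dist_of_mem (hconv _ h1 _ h2 t ht)).trans (dist_geo_geo_le _ _ _ _ ht)

/-- The distance to `C`, perturbed to be strongly convex. -/
def hgt (C : Set X) (η : ℝ) (o y : X) : ℝ := infDist y C + η * dist o y ^ 2

theorem hgt_geo_le {C : Set X} (hC : IsCompact C) (hne : C.Nonempty) (hconv : GConvex C) {η : ℝ}
    (hη : 0 ≤ η) (o x y : X) {t : ℝ} (ht : t ∈ Icc (0 : ℝ) 1) :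
    hgt C η o (geo x y t) ≤
      (1 - t) * hgt C η o x + t * hgt C η o y - η * (t * (1 - t) * dist x y ^ 2) := by
  have h1 := infDist_geo_le hC hne hconv x y ht
  have h2 := mul_le_mul_of_nonneg_left (dist_sq_geo_le o x y ht) hη
  unfold hgt
  linarith

theorem continuous_hgt (C : Set X) (η : ℝ) (o : X) : Continuous (hgt C η o) := by
  unfold hgt
  exact (continuous_infDist_pt C).add (by fun_prop)

end CatZeroToolkit

end Cat2Cx
end

noncomputable section

open Topology

namespace Cat2Cx

/-! ### The projective (Klein) chart of the model plane -/

/-- The time coordinate of the hyperboloid model. -/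
def rho (u : ℝ × ℝ) : ℝ := Real.sqrt (1 + u.1 ^ 2 + u.2 ^ 2)

theorem rho_sq (u : ℝ × ℝ) : rho u ^ 2 = 1 + u.1 ^ 2 + u.2 ^ 2 := Real.sq_sqrt (by positivity)

theorem one_le_rho (u : ℝ × ℝ) : 1 ≤ rho u := Real.one_le_sqrt.2 (by nlinarith [sq_nonneg u.1, sq_nonneg u.2])

theorem rho_pos (u : ℝ × ℝ) : 0 < rho u := one_pos.trans_le (one_le_rho u)

/-- The (negative) Lorentz product. -/
def lor (u v : ℝ × ℝ) : ℝ := rho u * rho v - u.1 * v.1 - u.2 * v.2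

theorem lor_comm (u v : ℝ × ℝ) : lor u v = lor v u := by unfold lor; ring

theorem one_le_lor (u v : ℝ × ℝ) : 1 ≤ lor u v := by
  have h : (1 + u.1 * v.1 + u.2 * v.2) ^ 2 ≤ (rho u * rho v) ^ 2 := by
    rw [mul_pow, rho_sq, rho_sq]
    nlinarith [sq_nonneg (u.1 - v.1), sq_nonneg (u.2 - v.2), sq_nonneg (u.1 * v.2 - u.2 * v.1)]
  have := (abs_le_of_sq_le_sq' h (mul_pos (rho_pos u) (rho_pos v)).le).2
  unfold lor; linarith

/-- The distance of the hyperboloid model. -/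
def hDist (u v : ℝ × ℝ) : ℝ := Real.arcosh (lor u v)

theorem hDist_nonneg (u v : ℝ × ℝ) : 0 ≤ hDist u v := Real.arcosh_nonneg (one_le_lor u v)

theorem cosh_hDist (u v : ℝ × ℝ) : Real.cosh (hDist u v) = lor u v := Real.cosh_arcosh (one_le_lor u v)

theorem sinh_hDist_sq (u v : ℝ × ℝ) : Real.sinh (hDist u v) ^ 2 = lor u v ^ 2 - 1 := by
  rw [← cosh_hDist, Real.cosh_sq]; ring

/-- The Klein chart. -/
def kleinH (u : ℝ × ℝ) : ℂ := ⟨u.1 / rho u, u.2 / rho u⟩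

theorem kleinH_normSq (u : ℝ × ℝ) : rho u ^ 2 * (1 - ((u.1 / rho u) ^ 2 + (u.2 / rho u) ^ 2)) = 1 := by
  have := rho_pos u
  field_simp
  rw [rho_sq]; ring

theorem lor_sq_sub_one (u v : ℝ × ℝ) : lor u v ^ 2 - 1 = rho u ^ 2 * rho v ^ 2 *
    ((u.1 / rho u - v.1 / rho v) ^ 2 + (u.2 / rho u - v.2 / rho v) ^ 2 -
      (u.1 / rho u * (v.2 / rho v) - u.2 / rho u * (v.1 / rho v)) ^ 2) := by
  have hu := rho_pos u
  have hv := rho_pos v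
  have h1 := kleinH_normSq u
  have h2 := kleinH_normSq v
  have h3 : lor u v = rho u * rho v * (1 - u.1 / rho u * (v.1 / rho v) - u.2 / rho u * (v.2 / rho v)) := by
    unfold lor; field_simp
  rw [h3]
  generalize u.1 / rho u = a1 at *
  generalize u.2 / rho u = a2 at *
  generalize v.1 / rho v = b1 at *
  generalize v.2 / rho v = b2 at *
  linear_combination (rho v ^ 2 * (1 - (b1 ^ 2 + b2 ^ 2))) * h1 + h2

theorem norm_kleinH_sub_sq (u v : ℝ × ℝ) : ‖kleinH u - kleinH v‖ ^ 2 =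
    (u.1 / rho u - v.1 / rho v) ^ 2 + (u.2 / rho u - v.2 / rho v) ^ 2 := by
  rw [Complex.sq_norm, Complex.normSq_apply]; simp [kleinH]; ring

theorem sinh_hDist_le (u v : ℝ × ℝ) :
    Real.sinh (hDist u v) ≤ rho u * rho v * ‖kleinH u - kleinH v‖ := by
  have hu := rho_pos u
  have hv := rho_pos v
  refine abs_le_of_sq_le_sq' ?_ (by positivity) |>.2
  rw [sinh_hDist_sq, lor_sq_sub_one, mul_pow, mul_pow, norm_kleinH_sub_sq]
  gcongr
  nlinarith [sq_nonneg (u.1 / rho u * (v.2 / rho v) - u.2 / rho u * (v.1 / rho v))]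

theorem norm_kleinH_sub_le (u v : ℝ × ℝ) : ‖kleinH u - kleinH v‖ ≤ Real.sinh (hDist u v) := by
  have hv := one_le_rho v
  refine abs_le_of_sq_le_sq' ?_ (Real.sinh_nonneg_iff.2 (hDist_nonneg u v)) |>.2
  rw [sinh_hDist_sq, lor_sq_sub_one, norm_kleinH_sub_sq]
  have h1 := kleinH_normSq u
  generalize u.1 / rho u = a1 at *
  generalize u.2 / rho u = a2 at *
  generalize v.1 / rho v = b1 at *
  generalize v.2 / rho v = b2 at *
  have h3 : (1 - (a1 ^ 2 + a2 ^ 2)) * ((a1 - b1) ^ 2 + (a2 - b2) ^ 2) ≤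
      (a1 - b1) ^ 2 + (a2 - b2) ^ 2 - (a1 * b2 - a2 * b1) ^ 2 := by
    nlinarith [sq_nonneg (a1 * (a1 - b1) + a2 * (a2 - b2))]
  have h4 := mul_le_mul_of_nonneg_left h3 (sq_nonneg (rho u))
  rw [← mul_assoc, h1, one_mul] at h4
  have h5 : (1 : ℝ) ≤ rho v ^ 2 := one_le_pow₀ hv
  have h6 : 0 ≤ (a1 - b1) ^ 2 + (a2 - b2) ^ 2 := by positivity
  have h7 := h6.trans h4
  nlinarith [mul_le_mul_of_nonneg_right h5 h7]

theorem kleinH_injective : Function.Injective kleinH := fun u v h => by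
  have h1 := congrArg Complex.re h
  have h2 := congrArg Complex.im h
  simp only [kleinH] at h1 h2
  have hu := rho_pos u
  have hv := rho_pos v
  have n1 := kleinH_normSq u
  have n2 := kleinH_normSq v
  have hr : rho u = rho v := by
    rw [h1, h2] at n1
    have : rho u ^ 2 = rho v ^ 2 := by
      refine mul_right_cancel₀ (b := 1 - ((v.1 / rho v) ^ 2 + (v.2 / rho v) ^ 2)) ?_ (n1.trans n2.symm)
      intro h0; rw [h0] at n2; simp at n2
    exact (pow_left_inj₀ hu.le hv.le two_ne_zero).1 this
  rw [hr] at h1 h2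
  exact Prod.ext ((div_left_inj' hv.ne').1 h1) ((div_left_inj' hv.ne').1 h2)

theorem hDist_eq_zero {u v : ℝ × ℝ} (h : hDist u v = 0) : u = v := by
  have := norm_kleinH_sub_le u v
  rw [h, Real.sinh_zero] at this
  exact kleinH_injective (sub_eq_zero.1 (norm_le_zero_iff.1 this))

theorem hDist_comm (u v : ℝ × ℝ) : hDist u v = hDist v u := by unfold hDist; rw [lor_comm]

theorem hDist_self (u : ℝ × ℝ) : hDist u u = 0 := by
  have := rho_sq u
  rw [hDist, Real.arcosh_eq_zero_iff (one_le_lor u u), lor]; linear_combination this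

theorem mem_segment_kleinH {u v w : ℝ × ℝ} {α β : ℝ} (hα : 0 ≤ α) (hβ : 0 ≤ β)
    (h0 : rho v = α * rho u + β * rho w) (h1 : v.1 = α * u.1 + β * w.1)
    (h2 : v.2 = α * u.2 + β * w.2) : kleinH v ∈ segment ℝ (kleinH u) (kleinH w) := by
  have hu := rho_pos u
  have hv := rho_pos v
  have hw := rho_pos w
  refine ⟨α * rho u / rho v, β * rho w / rho v, by positivity, by positivity, ?_, ?_⟩
  · rw [← add_div, ← h0, div_self hv.ne']
  · apply Complex.ext
    · simp only [kleinH, h1, Complex.add_re, Complex.real_smul, Complex.re_ofReal_mul]; field_simp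
    · simp only [kleinH, h2, Complex.add_im, Complex.real_smul, Complex.im_ofReal_mul]; field_simp

set_option maxHeartbeats 800000 in
theorem hDist_btw_iff (u v w : ℝ × ℝ) :
    hDist u v + hDist v w = hDist u w ↔ kleinH v ∈ segment ℝ (kleinH u) (kleinH w) := by
  have hu := rho_pos u
  have hv := rho_pos v
  have hw := rho_pos w
  have ru := rho_sq u
  have rv := rho_sq v
  have rw' := rho_sq w
  have nA := hDist_nonneg u v
  have nB := hDist_nonneg v w
  have cA := cosh_hDist u v
  have cB := cosh_hDist v w
  have cC := cosh_hDist u w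
  have sA := sinh_hDist_sq u v
  have sB := sinh_hDist_sq v w
  have pA := Real.sinh_nonneg_iff.2 nA
  have pB := Real.sinh_nonneg_iff.2 nB
  constructor
  · intro h
    have hC : lor u w = lor u v * lor v w + Real.sinh (hDist u v) * Real.sinh (hDist v w) := by
      rw [← cC, ← h, Real.cosh_add, cA, cB]
    rcases (add_nonneg pA pB).eq_or_lt with h0 | h0
    · have h1 : hDist u v = 0 := Real.sinh_eq_zero.1 (by linarith)
      rw [hDist_eq_zero h1]; exact left_mem_segment _ _ _
    set a := Real.sinh (hDist u v)
    set b := Real.sinh (hDist v w)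
    set A := lor u v with hA
    set B := lor v w with hB
    have eA : A = rho u * rho v - u.1 * v.1 - u.2 * v.2 := rfl
    have eB : B = rho v * rho w - v.1 * w.1 - v.2 * w.2 := rfl
    have eC : lor u w = rho u * rho w - u.1 * w.1 - u.2 * w.2 := rfl
    obtain ⟨n0, hn0⟩ : ∃ n, n = b * (rho u - A * rho v) + a * (rho w - B * rho v) := ⟨_, rfl⟩
    obtain ⟨n1, hn1⟩ : ∃ n, n = b * (u.1 - A * v.1) + a * (w.1 - B * v.1) := ⟨_, rfl⟩
    obtain ⟨n2, hn2⟩ : ∃ n, n = b * (u.2 - A * v.2) + a * (w.2 - B * v.2) := ⟨_, rfl⟩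
    have orth : n0 * rho v = n1 * v.1 + n2 * v.2 := by
      rw [hn0, hn1, hn2]
      linear_combination (-b) * eA - a * eB + (-b * A - a * B) * rv
    have nul : n0 ^ 2 = n1 ^ 2 + n2 ^ 2 := by
      have e1 : (rho u - A * rho v) ^ 2 - (u.1 - A * v.1) ^ 2 - (u.2 - A * v.2) ^ 2 = 1 - A ^ 2 := by
        linear_combination ru + A ^ 2 * rv + 2 * A * eA
      have e2 : (rho w - B * rho v) ^ 2 - (w.1 - B * v.1) ^ 2 - (w.2 - B * v.2) ^ 2 = 1 - B ^ 2 := by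
        linear_combination rw' + B ^ 2 * rv + 2 * B * eB
      have e3 : (rho u - A * rho v) * (rho w - B * rho v) - (u.1 - A * v.1) * (w.1 - B * v.1) -
          (u.2 - A * v.2) * (w.2 - B * v.2) = a * b := by
        linear_combination hC - eC + A * B * rv + A * eB + B * eA
      rw [hn0, hn1, hn2]
      linear_combination b ^ 2 * e1 + a ^ 2 * e2 + 2 * a * b * e3 + b ^ 2 * sA + a ^ 2 * sB
    have z : n1 ^ 2 + n2 ^ 2 ≤ 0 := by
      have : (n1 * v.1 + n2 * v.2) ^ 2 = (n1 ^ 2 + n2 ^ 2) * (1 + v.1 ^ 2 + v.2 ^ 2) := by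
        rw [← orth, mul_pow, nul, rv]
      nlinarith [sq_nonneg (n1 * v.2 - n2 * v.1)]
    have q1 := sq_nonneg n1
    have q2 := sq_nonneg n2
    have z1 : n1 = 0 := pow_eq_zero_iff two_ne_zero |>.1 (by linarith)
    have z2 : n2 = 0 := pow_eq_zero_iff two_ne_zero |>.1 (by linarith)
    have z0 : n0 = 0 := pow_eq_zero_iff two_ne_zero |>.1 (by linarith [sq_nonneg n0])
    have pAA : 1 ≤ A := one_le_lor u v
    have pBB : 1 ≤ B := one_le_lor v w
    have hs : 0 < b * A + a * B := by
      linarith [mul_nonneg pB (sub_nonneg.2 pAA), mul_nonneg pA (sub_nonneg.2 pBB)]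
    refine mem_segment_kleinH (α := b / (b * A + a * B)) (β := a / (b * A + a * B)) (by positivity)
      (by positivity) ?_ ?_ ?_ <;> field_simp
    · linear_combination hn0 - z0
    · linear_combination hn1 - z1
    · linear_combination hn2 - z2
  · rintro ⟨s, t, hs, ht, hst, h⟩
    have h1 := congrArg Complex.re h
    have h2 := congrArg Complex.im h
    simp only [kleinH, Complex.add_re, Complex.add_im, Complex.real_smul, Complex.re_ofReal_mul,
      Complex.im_ofReal_mul] at h1 h2
    obtain ⟨α, hα⟩ : ∃ α, α = s * rho v / rho u := ⟨_, rfl⟩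
    obtain ⟨β, hβ⟩ : ∃ β, β = t * rho v / rho w := ⟨_, rfl⟩
    have pα : 0 ≤ α := by rw [hα]; positivity
    have pβ : 0 ≤ β := by rw [hβ]; positivity
    have v0 : rho v = α * rho u + β * rho w := by
      rw [hα, hβ]; field_simp; exact hst.symm
    have v1 : v.1 = α * u.1 + β * w.1 := by
      rw [hα, hβ]; field_simp at h1 ⊢; linarith
    have v2 : v.2 = α * u.2 + β * w.2 := by
      rw [hα, hβ]; field_simp at h2 ⊢; linarith
    set C := lor u w with hC
    have eC : C = rho u * rho w - u.1 * w.1 - u.2 * w.2 := rfl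
    have eA : lor u v = α + β * C := by
      rw [eC]; unfold lor; rw [v0, v1, v2]; linear_combination α * ru
    have eB : lor v w = α * C + β := by
      rw [eC]; unfold lor; rw [v0, v1, v2]; linear_combination β * rw'
    have one : α ^ 2 + β ^ 2 + 2 * α * β * C = 1 := by
      rw [v0, v1, v2] at rv
      rw [eC]
      linear_combination rv - α ^ 2 * ru - β ^ 2 * rw'
    have nC := hDist_nonneg u w
    have sC := sinh_hDist_sq u w
    have pC := Real.sinh_nonneg_iff.2 nC
    have s1 : Real.sinh (hDist u v) = β * Real.sinh (hDist u w) := by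
      refine (pow_left_inj₀ pA (by positivity) two_ne_zero).1 ?_
      rw [mul_pow, sA, sC, eA]; linear_combination one
    have s2 : Real.sinh (hDist v w) = α * Real.sinh (hDist u w) := by
      refine (pow_left_inj₀ pB (by positivity) two_ne_zero).1 ?_
      rw [mul_pow, sB, sC, eB]; linear_combination one
    have key : Real.cosh (hDist u v + hDist v w) = Real.cosh (hDist u w) := by
      rw [Real.cosh_add, cA, cB, cC, s1, s2, eA, eB]
      linear_combination α * β * sC + C * one
    rw [← Real.arcosh_cosh (add_nonneg nA nB), key, Real.arcosh_cosh nC]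

end Cat2Cx
end

noncomputable section

open Topology

namespace Cat2Cx

/-- The projective chart of the model plane: geodesics become straight segments. -/
def klein (κ : ℝ) (u : ℝ × ℝ) : ℂ := if κ = 0 then ⟨u.1, u.2⟩ else kleinH u

theorem mDist_zero (u v : ℝ × ℝ) : mDist 0 u v = dist (klein 0 u) (klein 0 v) := by
  rw [mDist, if_pos rfl, Complex.dist_eq, Complex.norm_def, Complex.normSq_apply]
  congr 1; simp [klein]; ring

theorem mDist_neg {κ : ℝ} (h : κ ≠ 0) (u v : ℝ × ℝ) :
    mDist κ u v = (1 / Real.sqrt (-κ)) * hDist u v := by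
  rw [mDist, if_neg h]; rfl

theorem sqrt_neg_pos {κ : ℝ} (hκ : κ ≤ 0) (h : κ ≠ 0) : 0 < Real.sqrt (-κ) :=
  Real.sqrt_pos.2 (by have := lt_of_le_of_ne hκ h; linarith)

theorem klein_injective (κ : ℝ) : Function.Injective (klein κ) := by
  unfold klein
  split_ifs
  · intro u v h
    exact Prod.ext (congrArg Complex.re h) (congrArg Complex.im h)
  · exact kleinH_injective

theorem mDist_btw_iff {κ : ℝ} (hκ : κ ≤ 0) (u v w : ℝ × ℝ) :
    mDist κ u v + mDist κ v w = mDist κ u w ↔ klein κ v ∈ segment ℝ (klein κ u) (klein κ w) := by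
  by_cases h : κ = 0
  · subst h
    rw [mDist_zero, mDist_zero, mDist_zero, dist_add_dist_eq_iff, mem_segment_iff_wbtw]
  · have hk := sqrt_neg_pos hκ h
    simp only [mDist_neg h, klein, if_neg h]
    rw [← hDist_btw_iff, ← mul_add]
    exact ⟨fun h => mul_left_cancel₀ (by positivity) h, fun h => by rw [h]⟩

theorem sinh_le_two_mul {d : ℝ} (h0 : 0 ≤ d) (h1 : d ≤ 1) : Real.sinh d ≤ 2 * d := by
  have a := Real.abs_exp_sub_one_le (x := d) (by rwa [abs_of_nonneg h0])
  rw [abs_of_nonneg h0] at a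
  have b := Real.add_one_le_exp (-d)
  have := (le_abs_self _).trans a
  rw [Real.sinh_eq]; linarith

theorem norm_kleinH_lt_one (u : ℝ × ℝ) : ‖kleinH u‖ < 1 := by
  have h := kleinH_normSq u
  have hp := rho_pos u
  have h2 : ‖kleinH u‖ ^ 2 = (u.1 / rho u) ^ 2 + (u.2 / rho u) ^ 2 := by
    rw [Complex.sq_norm, Complex.normSq_apply]; simp [kleinH]; ring
  rw [← h2] at h
  by_contra! hc
  have : 1 - ‖kleinH u‖ ^ 2 ≤ 0 := by nlinarith
  nlinarith [mul_nonneg (sq_nonneg (rho u)) (neg_nonneg.2 this)]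

theorem norm_klein_sub_le {κ : ℝ} (hκ : κ ≤ 0) :
    ∃ C : ℝ, 0 < C ∧ ∀ u v, ‖klein κ u - klein κ v‖ ≤ C * mDist κ u v := by
  by_cases h : κ = 0
  · subst h
    exact ⟨1, one_pos, fun u v => by rw [mDist_zero, one_mul, dist_eq_norm]⟩
  · have hk := sqrt_neg_pos hκ h
    refine ⟨2 * Real.sqrt (-κ), by positivity, fun u v => ?_⟩
    rw [mDist_neg h, klein, klein, if_neg h, if_neg h]
    have e : 2 * Real.sqrt (-κ) * (1 / Real.sqrt (-κ) * hDist u v) = 2 * hDist u v := by field_simp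
    rw [e]
    rcases le_or_gt (hDist u v) 1 with h1 | h1
    · exact (norm_kleinH_sub_le u v).trans (sinh_le_two_mul (hDist_nonneg u v) h1)
    · have := norm_sub_le (kleinH u) (kleinH v)
      linarith [norm_kleinH_lt_one u, norm_kleinH_lt_one v]

theorem mDist_nonneg {κ : ℝ} (hκ : κ ≤ 0) (u v : ℝ × ℝ) : 0 ≤ mDist κ u v := by
  obtain ⟨C, hC, h⟩ := norm_klein_sub_le hκ
  exact le_of_mul_le_mul_left (by rw [mul_zero]; exact (norm_nonneg _).trans (h u v)) hC

theorem mDist_self (κ : ℝ) (u : ℝ × ℝ) : mDist κ u u = 0 := by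
  by_cases h : κ = 0
  · subst h; rw [mDist_zero, dist_self]
  · rw [mDist_neg h, hDist_self, mul_zero]

theorem mDist_comm (κ : ℝ) (u v : ℝ × ℝ) : mDist κ u v = mDist κ v u := by
  by_cases h : κ = 0
  · subst h; rw [mDist_zero, mDist_zero, dist_comm]
  · rw [mDist_neg h, mDist_neg h, hDist_comm]

theorem eq_of_mDist_eq_zero {κ : ℝ} (hκ : κ ≤ 0) {u v : ℝ × ℝ} (h : mDist κ u v = 0) : u = v := by
  obtain ⟨C, hC, hh⟩ := norm_klein_sub_le hκ
  have := hh u v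
  rw [h, mul_zero] at this
  exact klein_injective κ (sub_eq_zero.1 (norm_le_zero_iff.1 this))

theorem kleinH_rho (u : ℝ × ℝ) : rho u = (Real.sqrt (1 - ‖kleinH u‖ ^ 2))⁻¹ := by
  have h := kleinH_normSq u
  have hp := rho_pos u
  have h2 : ‖kleinH u‖ ^ 2 = (u.1 / rho u) ^ 2 + (u.2 / rho u) ^ 2 := by
    rw [Complex.sq_norm, Complex.normSq_apply]; simp [kleinH]; ring
  rw [← h2] at h
  have h3 : 1 - ‖kleinH u‖ ^ 2 = ((rho u)⁻¹) ^ 2 := by field_simp; linarith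
  rw [h3, Real.sqrt_sq (by positivity), inv_inv]

/-- The inverse of the projective chart. -/
def unklein (κ : ℝ) (z : ℂ) : ℝ × ℝ :=
  if κ = 0 then (z.re, z.im)
  else ((Real.sqrt (1 - ‖z‖ ^ 2))⁻¹ * z.re, (Real.sqrt (1 - ‖z‖ ^ 2))⁻¹ * z.im)

/-- The image of the projective chart. -/
def kleinDom (κ : ℝ) : Set ℂ := if κ = 0 then univ else ball 0 1

theorem isOpen_kleinDom (κ : ℝ) : IsOpen (kleinDom κ) := by
  unfold kleinDom; split_ifs; exacts [isOpen_univ, isOpen_ball]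

theorem convex_kleinDom (κ : ℝ) : Convex ℝ (kleinDom κ) := by
  unfold kleinDom; split_ifs; exacts [convex_univ, convex_ball _ _]

theorem klein_mem (κ : ℝ) (u : ℝ × ℝ) : klein κ u ∈ kleinDom κ := by
  unfold kleinDom klein
  split_ifs
  · trivial
  · exact mem_ball_zero_iff.2 (norm_kleinH_lt_one u)

theorem unklein_klein (κ : ℝ) (u : ℝ × ℝ) : unklein κ (klein κ u) = u := by
  unfold unklein klein
  split_ifs
  · rfl
  · rw [← kleinH_rho]
    have := rho_pos u
    ext <;> simp only [kleinH] <;> field_simp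

theorem klein_unklein (κ : ℝ) {z : ℂ} (hz : z ∈ kleinDom κ) : klein κ (unklein κ z) = z := by
  by_cases h : κ = 0
  · simp [klein, unklein, h]
  · have hz' : ‖z‖ < 1 := by
      unfold kleinDom at hz; rw [if_neg h] at hz; exact mem_ball_zero_iff.1 hz
    have hpos : 0 < 1 - ‖z‖ ^ 2 := by nlinarith [norm_nonneg z]
    set s := Real.sqrt (1 - ‖z‖ ^ 2) with hs
    have hs0 : 0 < s := Real.sqrt_pos.2 hpos
    have hs2 : s ^ 2 = 1 - ‖z‖ ^ 2 := Real.sq_sqrt hpos.le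
    have hn : ‖z‖ ^ 2 = z.re ^ 2 + z.im ^ 2 := by
      rw [Complex.sq_norm, Complex.normSq_apply]; ring
    have hr : rho (s⁻¹ * z.re, s⁻¹ * z.im) = s⁻¹ := by
      have : 1 + (s⁻¹ * z.re) ^ 2 + (s⁻¹ * z.im) ^ 2 = (s⁻¹) ^ 2 := by
        field_simp; rw [hs2, hn]; ring
      simp only [rho]; rw [this, Real.sqrt_sq (by positivity)]
    simp only [klein, unklein, if_neg h, kleinH]
    rw [← hs, hr]
    apply Complex.ext <;> field_simp

theorem continuous_klein (κ : ℝ) : Continuous (klein κ) := by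
  by_cases h : κ = 0
  · rw [show klein κ = fun u => ((u.1 : ℂ) + u.2 * Complex.I) from funext fun u => by
      apply Complex.ext <;> simp [klein, h]]
    fun_prop
  · rw [show klein κ = fun u => (((u.1 / rho u : ℝ) : ℂ) + ((u.2 / rho u : ℝ) : ℂ) * Complex.I) from
      funext fun u => by apply Complex.ext <;> simp [klein, h, kleinH]]
    have h1 : Continuous rho := by unfold rho; fun_prop
    have h2 : Continuous fun u : ℝ × ℝ => u.1 / rho u :=
      continuous_fst.div h1 fun u => (rho_pos u).ne'
    have h3 : Continuous fun u : ℝ × ℝ => u.2 / rho u :=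
      continuous_snd.div h1 fun u => (rho_pos u).ne'
    fun_prop

theorem continuousOn_unklein (κ : ℝ) : ContinuousOn (unklein κ) (kleinDom κ) := by
  change ContinuousOn (fun z => unklein κ z) _
  by_cases h : κ = 0
  · simp only [unklein, if_pos h]
    exact (Complex.continuous_re.prodMk Complex.continuous_im).continuousOn
  · simp only [unklein, kleinDom, if_neg h]
    have : ContinuousOn (fun z : ℂ => (Real.sqrt (1 - ‖z‖ ^ 2))⁻¹) (ball 0 1) := by
      refine ContinuousOn.inv₀ (Continuous.continuousOn (by fun_prop)) fun z hz => ?_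
      rw [mem_ball_zero_iff] at hz
      exact (Real.sqrt_pos.2 (by nlinarith [norm_nonneg z])).ne'
    exact (this.mul Complex.continuous_re.continuousOn).prodMk
      (this.mul Complex.continuous_im.continuousOn)

theorem image_klein_interior (κ : ℝ) (P : Set (ℝ × ℝ)) :
    klein κ '' interior P = interior (klein κ '' P) := by
  apply Subset.antisymm
  · refine interior_maximal (image_mono interior_subset) ?_
    have : klein κ '' interior P = kleinDom κ ∩ unklein κ ⁻¹' interior P := by
      ext z; constructor
      · rintro ⟨u, hu, rfl⟩; exact ⟨klein_mem κ u, by rwa [mem_preimage, unklein_klein]⟩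
      · rintro ⟨h1, h2⟩; exact ⟨_, h2, klein_unklein κ h1⟩
    rw [this]
    exact (continuousOn_unklein κ).isOpen_inter_preimage (isOpen_kleinDom κ) isOpen_interior
  · intro z hz
    obtain ⟨u, hu, rfl⟩ := interior_subset hz
    refine ⟨u, ?_, rfl⟩
    have := preimage_interior_subset_interior_preimage (continuous_klein κ) (show u ∈ _ from hz)
    rwa [preimage_image_eq _ (klein_injective κ)] at this

theorem exists_mDist_le {κ : ℝ} (hκ : κ ≤ 0) (u : ℝ × ℝ) {ε : ℝ} (hε : 0 < ε) :
    ∃ δ > 0, ∀ v, ‖klein κ v - klein κ u‖ < δ → mDist κ u v < ε := by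
  by_cases h : κ = 0
  · subst h
    exact ⟨ε, hε, fun v hv => by rwa [mDist_zero, dist_comm, dist_eq_norm]⟩
  · have hk := sqrt_neg_pos hκ h
    have hc : ContinuousOn (fun z : ℂ => 1 / Real.sqrt (-κ) *
        (rho u * rho (unklein κ z) * ‖kleinH u - z‖)) (kleinDom κ) := by
      have h1 : Continuous rho := by unfold rho; fun_prop
      refine continuousOn_const.mul ((continuousOn_const.mul
        (h1.comp_continuousOn (continuousOn_unklein κ))).mul ?_)
      exact (continuous_const.sub continuous_id).norm.continuousOn
    have h0 : 1 / Real.sqrt (-κ) * (rho u * rho (unklein κ (klein κ u)) * ‖kleinH u - klein κ u‖) <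
        ε := by
      rw [show klein κ u = kleinH u by simp [klein, h]]; simpa using hε
    have hz := (hc.continuousAt ((isOpen_kleinDom κ).mem_nhds (klein_mem κ u))).eventually
      (gt_mem_nhds h0)
    obtain ⟨δ, hδ, H⟩ := Metric.eventually_nhds_iff.1 hz
    refine ⟨δ, hδ, fun v hv => ?_⟩
    have := H (y := klein κ v) (by rwa [dist_eq_norm])
    rw [unklein_klein] at this
    refine lt_of_le_of_lt ?_ this
    rw [mDist_neg h]
    have e : klein κ v = kleinH v := by simp [klein, h]
    rw [e]
    gcongr
    have h2 := sinh_hDist_le u v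
    exact (Real.self_le_sinh_iff.2 (hDist_nonneg u v)).trans h2

/-! ### Geodesics of the model plane -/

theorem mem_geodSeg_model {κ : ℝ} (hκ : κ ≤ 0) {u v w : ℝ × ℝ}
    (hv : klein κ v ∈ segment ℝ (klein κ u) (klein κ w)) :
    v ∈ geodSeg (mDist κ) univ u w := by
  set z : ℝ → ℂ := fun t => AffineMap.lineMap (klein κ u) (klein κ w) t with hz
  have hzm : ∀ t ∈ Icc (0 : ℝ) 1, z t ∈ kleinDom κ := fun t ht =>
    (convex_kleinDom κ).segment_subset (klein_mem κ u) (klein_mem κ w)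
      (by rw [segment_eq_image_lineMap]; exact ⟨t, ht, rfl⟩)
  set p : ℝ → ℝ × ℝ := fun t => unklein κ (z t) with hp
  have hkp : ∀ t ∈ Icc (0 : ℝ) 1, klein κ (p t) = z t := fun t ht => klein_unklein κ (hzm t ht)
  have p0 : p 0 = u := by simp [hp, hz, unklein_klein]
  have p1 : p 1 = w := by simp [hp, hz, unklein_klein]
  set m : ℝ → ℝ := fun t => mDist κ u (p t) with hm
  have add : ∀ s ∈ Icc (0 : ℝ) 1, ∀ t ∈ Icc (0 : ℝ) 1, s ≤ t → m s + mDist κ (p s) (p t) = m t := by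
    intro s hs t ht hst
    rw [hm]; dsimp only
    rw [mDist_btw_iff hκ, hkp s hs, hkp t ht, mem_segment_iff_wbtw]
    have : Wbtw ℝ (z 0) (z s) (z t) := by
      have h : Wbtw ℝ (0 : ℝ) s t := by
        rw [← mem_segment_iff_wbtw, segment_eq_Icc (hs.1.trans hst)]; exact ⟨hs.1, hst⟩
      exact h.map (AffineMap.lineMap (klein κ u) (klein κ w))
    simpa [hz] using this
  have hdist : ∀ s ∈ Icc (0 : ℝ) 1, ∀ t ∈ Icc (0 : ℝ) 1, mDist κ (p s) (p t) = |m s - m t| := by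
    intro s hs t ht
    have n := mDist_nonneg hκ (p s) (p t)
    rcases le_total s t with h | h
    · have := add s hs t ht h
      rw [abs_sub_comm, abs_of_nonneg] <;> linarith
    · have := add t ht s hs h
      rw [mDist_comm] at this
      rw [abs_of_nonneg] <;> linarith
  have hcont : ContinuousOn m (Icc 0 1) := by
    intro t ht
    rw [Metric.continuousWithinAt_iff]
    intro ε hε
    obtain ⟨δ, hδ, H⟩ := exists_mDist_le hκ (p t) hε
    have hzc : Continuous z := AffineMap.lineMap_continuous
    obtain ⟨δ', hδ', H'⟩ := Metric.continuous_iff.1 hzc t δ hδ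
    refine ⟨δ', hδ', fun s hs hst => ?_⟩
    rw [Real.dist_eq, ← hdist s hs t ht, mDist_comm]
    refine H _ ?_
    rw [hkp s hs, hkp t ht, ← dist_eq_norm]
    exact H' s hst
  have m0 : m 0 = 0 := by rw [hm]; dsimp only; rw [p0, mDist_self]
  have m1 : m 1 = mDist κ u w := by rw [hm]; dsimp only; rw [p1]
  have ivt : ∀ σ ∈ Icc 0 (mDist κ u w), ∃ t ∈ Icc (0 : ℝ) 1, m t = σ := by
    intro σ hσ
    rw [← m0, ← m1] at hσ
    exact intermediate_value_Icc zero_le_one hcont hσ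
  choose! τ hτ hmτ using ivt
  have heq : ∀ t ∈ Icc (0 : ℝ) 1, p (τ (m t)) = p t := fun t ht => by
    have hmem : m t ∈ Icc 0 (mDist κ u w) := by
      refine ⟨mDist_nonneg hκ _ _, ?_⟩
      have := add t ht 1 ⟨zero_le_one, le_rfl⟩ ht.2
      rw [m1] at this
      linarith [mDist_nonneg hκ (p t) (p 1)]
    apply eq_of_mDist_eq_zero hκ
    rw [hdist _ (hτ _ hmem) _ ht, hmτ _ hmem]; simp
  have z01 : (0 : ℝ) ∈ Icc (0 : ℝ) 1 := ⟨le_rfl, zero_le_one⟩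
  have o01 : (1 : ℝ) ∈ Icc (0 : ℝ) 1 := ⟨zero_le_one, le_rfl⟩
  rw [segment_eq_image_lineMap] at hv
  obtain ⟨t, ht, htv⟩ := hv
  have hpv : p t = v := by
    rw [hp]; dsimp only; rw [show z t = klein κ v from htv, unklein_klein]
  refine mem_iUnion₂.2 ⟨fun σ => p (τ σ), ⟨?_, ?_, ⟨mDist_nonneg hκ u w, ?_⟩, fun _ _ => trivial⟩, ?_⟩
  · have := heq 0 z01; rwa [m0, p0] at this
  · have := heq 1 o01; rwa [m1, p1] at this
  · intro s hs t ht
    rw [hdist _ (hτ s hs) _ (hτ t ht), hmτ s hs, hmτ t ht]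
  · refine ⟨m t, ⟨mDist_nonneg hκ _ _, ?_⟩, by dsimp only; rw [heq t ht, hpv]⟩
    have := add t ht 1 o01 ht.2
    rw [m1] at this
    linarith [mDist_nonneg hκ (p t) (p 1)]

theorem convex_image_klein {κ : ℝ} (hκ : κ ≤ 0) {P : Set (ℝ × ℝ)} (hP : ConvexWrt (mDist κ) P) :
    Convex ℝ (klein κ '' P) := by
  rw [convex_iff_segment_subset]
  rintro _ ⟨u, hu, rfl⟩ _ ⟨w, hw, rfl⟩ z hz
  have hzd := (convex_kleinDom κ).segment_subset (klein_mem κ u) (klein_mem κ w) hz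
  refine ⟨unklein κ z, hP u hu w hw (mem_geodSeg_model hκ ?_), klein_unklein κ hzd⟩
  rwa [klein_unklein κ hzd]

theorem convexWrt_preimage_klein {κ : ℝ} (hκ : κ ≤ 0) {Q : Set ℂ} (hQ : Convex ℝ Q) :
    ConvexWrt (mDist κ) (klein κ ⁻¹' Q) := by
  intro u hu w hw v hv
  obtain ⟨f, ⟨f0, f1, ⟨h0, hf⟩, -⟩, s, hs, rfl⟩ := mem_iUnion₂.1 hv
  refine hQ.segment_subset hu hw ((mDist_btw_iff hκ _ _ _).1 ?_)
  have a := hf 0 ⟨le_rfl, h0⟩ s hs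
  have b := hf s hs _ ⟨h0, le_rfl⟩
  rw [f0, zero_sub, abs_neg, abs_of_nonneg hs.1] at a
  rw [f1, abs_sub_comm, abs_of_nonneg (by linarith [hs.2])] at b
  rw [a, b]; ring

theorem image_klein_convexHullWrt {κ : ℝ} (hκ : κ ≤ 0) (A : Set (ℝ × ℝ)) :
    klein κ '' convexHullWrt (mDist κ) A = convexHull ℝ (klein κ '' A) := by
  have hA : A ⊆ convexHullWrt (mDist κ) A := fun a ha C hC => hC.2 ha
  have hconv : ConvexWrt (mDist κ) (convexHullWrt (mDist κ) A) := fun x hx y hy z hz C hC =>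
    hC.1 x (hx C hC) y (hy C hC) hz
  apply Subset.antisymm
  · rintro _ ⟨u, hu, rfl⟩
    exact hu _ ⟨convexWrt_preimage_klein hκ (convex_convexHull ℝ (klein κ '' A)),
      fun a ha => subset_convexHull ℝ _ ⟨a, ha, rfl⟩⟩
  · exact convexHull_min (image_mono hA) (convex_image_klein hκ hconv)

end Cat2Cx
end

noncomputable section

open Topology

namespace Cat2Cx

/-! ### Projective charts of subsets of a CAT(0) space -/

section Charts

variable {X : Type*} [MetricSpace X]

/-- A planar chart `g` of `S`, with inverse `h`, taking geodesics to straight segments. -/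
structure IsChart (S : Set X) (g : X → ℂ) (h : ℂ → X) : Prop where
  leftInv : ∀ x ∈ S, h (g x) = x
  contInv : ContinuousOn h (g '' S)
  lip : ∃ C > 0, ∀ x ∈ S, ∀ y ∈ S, ‖g x - g y‖ ≤ C * dist x y
  btw : ∀ x ∈ S, ∀ y ∈ S, ∀ z ∈ S, Btw x y z ↔ g y ∈ segment ℝ (g x) (g z)

theorem exists_isChart {κ : ℝ} (hκ : κ ≤ 0) {S : Set X} {f : X → ℝ × ℝ} [Nonempty X]
    (hf : ∀ x ∈ S, ∀ y ∈ S, mDist κ (f x) (f y) = dist x y) :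
    ∃ h, IsChart S (fun x => klein κ (f x)) h := by
  have hinj : InjOn (fun x => klein κ (f x)) S := fun x hx y hy hxy => by
    have := hf x hx y hy
    rw [klein_injective κ hxy, mDist_self] at this
    exact dist_eq_zero.1 this.symm
  have hl : ∀ x ∈ S, Function.invFunOn (fun x => klein κ (f x)) S (klein κ (f x)) = x :=
    fun x hx => hinj.leftInvOn_invFunOn hx
  refine ⟨Function.invFunOn (fun x => klein κ (f x)) S, hl, ?_, ?_, ?_⟩
  · rintro _ ⟨x, hx, rfl⟩
    rw [Metric.continuousWithinAt_iff]
    intro ε hε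
    obtain ⟨δ, hδ, H⟩ := exists_mDist_le hκ (f x) hε
    refine ⟨δ, hδ, ?_⟩
    rintro _ ⟨y, hy, rfl⟩ hxy
    rw [hl x hx, hl y hy, ← hf y hy x hx, mDist_comm]
    exact H _ (by rwa [dist_eq_norm] at hxy)
  · obtain ⟨C, hC, H⟩ := norm_klein_sub_le hκ
    exact ⟨C, hC, fun x hx y hy => by rw [← hf x hx y hy]; exact H _ _⟩
  · intro x hx y hy z hz
    rw [← mDist_btw_iff hκ, hf x hx y hy, hf y hy z hz, hf x hx z hz, Btw]

variable {S : Set X} {g : X → ℂ} {h : ℂ → X}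

theorem IsChart.mono (c : IsChart S g h) {T : Set X} (hT : T ⊆ S) : IsChart T g h where
  leftInv x hx := c.leftInv x (hT hx)
  contInv := c.contInv.mono (image_mono hT)
  lip := by
    obtain ⟨C, hC, H⟩ := c.lip
    exact ⟨C, hC, fun x hx y hy => H x (hT hx) y (hT hy)⟩
  btw x hx y hy z hz := c.btw x (hT hx) y (hT hy) z (hT hz)

theorem IsChart.injOn (c : IsChart S g h) : InjOn g S := fun x hx y hy hxy => by
  rw [← c.leftInv x hx, hxy, c.leftInv y hy]

theorem IsChart.continuousOn (c : IsChart S g h) : ContinuousOn g S := by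
  obtain ⟨C, hC, H⟩ := c.lip
  intro x hx
  rw [Metric.continuousWithinAt_iff]
  intro ε hε
  refine ⟨ε / C, by positivity, fun y hy hxy => ?_⟩
  rw [dist_eq_norm]
  refine (H y hy x hx).trans_lt ?_
  rwa [lt_div_iff₀ hC, mul_comm] at hxy

theorem IsChart.inv_mem (c : IsChart S g h) {z : ℂ} (hz : z ∈ g '' S) : h z ∈ S ∧ g (h z) = z := by
  obtain ⟨x, hx, rfl⟩ := hz
  rw [c.leftInv x hx]; exact ⟨hx, rfl⟩

theorem IsChart.image_inv (c : IsChart S g h) {K : Set ℂ} (hK : K ⊆ g '' S) :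
    h '' K = S ∩ g ⁻¹' K := by
  ext x; constructor
  · rintro ⟨z, hz, rfl⟩
    have := c.inv_mem (hK hz)
    exact ⟨this.1, by rw [mem_preimage, this.2]; exact hz⟩
  · rintro ⟨hx, hxK⟩; exact ⟨g x, hxK, c.leftInv x hx⟩

theorem IsChart.isCompact_inter_preimage (c : IsChart S g h) {K : Set ℂ} (hK : K ⊆ g '' S)
    (hc : IsCompact K) : IsCompact (S ∩ g ⁻¹' K) := by
  rw [← c.image_inv hK]; exact hc.image_of_continuousOn (c.contInv.mono hK)

variable [CatZero X]

theorem IsChart.convex_image (c : IsChart S g h) (hS : GConvex S)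
    {T : Set X} (hTS : T ⊆ S) (hT : GConvex T) : Convex ℝ (g '' T) := by
  obtain ⟨C, hC, H⟩ := c.lip
  rw [convex_iff_segment_subset]
  rintro _ ⟨x, hx, rfl⟩ _ ⟨y, hy, rfl⟩ z hz
  have hc : ContinuousOn (fun t => g (geo x y t)) (Icc 0 1) :=
    c.continuousOn.comp (continuous_geo_comp continuous_const continuous_const
      continuous_id).continuousOn fun t ht => hS x (hTS hx) y (hTS hy) t ht
  by_cases hxy : g x = g y
  · rw [hxy, segment_same] at hz; rw [hz]; exact ⟨y, hy, rfl⟩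
  set d := ‖g y - g x‖ with hd
  have hdpos : 0 < d := norm_pos_iff.2 (sub_ne_zero.2 (Ne.symm hxy))
  have hm : ContinuousOn (fun t => ‖g (geo x y t) - g x‖) (Icc 0 1) :=
    (hc.sub continuousOn_const).norm
  obtain ⟨r, hr, rfl⟩ : ∃ r ∈ Icc (0 : ℝ) 1, AffineMap.lineMap (g x) (g y) r = z := by
    rwa [segment_eq_image_lineMap] at hz
  have hval : ∀ r ∈ Icc (0 : ℝ) 1, ‖AffineMap.lineMap (g x) (g y) r - g x‖ = r * d := by
    intro r hr
    rw [← dist_eq_norm, dist_comm, dist_left_lineMap, hd, ← dist_eq_norm, dist_comm (g y),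
      Real.norm_of_nonneg hr.1]
  have hmem : r * d ∈ Icc ‖g (geo x y 0) - g x‖ ‖g (geo x y 1) - g x‖ := by
    rw [geo_zero, geo_one, sub_self, norm_zero]
    exact ⟨by have := hr.1; positivity, mul_le_of_le_one_left hdpos.le hr.2⟩
  obtain ⟨t, ht, htr⟩ := intermediate_value_Icc zero_le_one hm hmem
  refine ⟨geo x y t, hT x hx y hy t ht, ?_⟩
  have hseg := (c.btw x (hTS hx) _ (hS x (hTS hx) y (hTS hy) t ht) y (hTS hy)).1 (btw_geo x y ht)
  rw [segment_eq_image_lineMap] at hseg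
  obtain ⟨r', hr', he⟩ := hseg
  dsimp only at htr
  rw [← he] at htr ⊢
  rw [hval r' hr'] at htr
  rw [mul_right_cancel₀ hdpos.ne' htr]

theorem IsChart.gconvex_inter_preimage (c : IsChart S g h) (hS : GConvex S) {A : Set ℂ}
    (hA : Convex ℝ A) : GConvex (S ∩ g ⁻¹' A) := fun x hx y hy t ht =>
  have hm := hS x hx.1 y hy.1 t ht
  ⟨hm, hA.segment_subset hx.2 hy.2 ((c.btw x hx.1 _ hm y hy.1).1 (btw_geo x y ht))⟩

end Charts

/-! ### Local structure of the complex -/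

section Complex

variable {κ : ℝ} {X : Type*} [MetricSpace X]

/-- A chart of the closure of a face. -/
structure IsFaceChart (F : Set X) (g : X → ℂ) (h : ℂ → X) : Prop extends
    IsChart (closure F) g h where
  isCompact_closure : IsCompact (closure F)
  image_eq : g '' F = interior (g '' closure F)

theorem exists_isFaceChart [CatZero X] (hκ : κ ≤ 0) (PC : PolyComplex2 κ X) {F : Set X}
    (hF : F ∈ PC.faces) : F.Nonempty ∧ GConvex (closure F) ∧ ∃ g h, IsFaceChart F g h := by
  obtain ⟨f, P, ⟨A, hA, hne⟩, hinj, hfP, hfF, hiso⟩ := PC.face_chart F hF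
  have hFne : F.Nonempty := by rw [← hfF] at hne; exact image_nonempty.1 hne
  obtain ⟨x₀, hx₀⟩ := hFne
  have : Nonempty X := ⟨x₀⟩
  obtain ⟨h, hc⟩ := exists_isChart hκ hiso
  have him : (fun x => klein κ (f x)) '' closure F = klein κ '' P := by rw [← hfP, image_image]
  have hK : IsCompact (klein κ '' P) := by
    rw [hA, image_klein_convexHullWrt hκ]
    exact Set.Finite.isCompact_convexHull ℝ (A.finite_toSet.image _)
  have hcomp : IsCompact (closure F) := by
    have := hc.isCompact_inter_preimage him.ge hK
    rwa [inter_eq_left.2] at this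
    intro x hx; rw [mem_preimage, ← him]; exact mem_image_of_mem _ hx
  refine ⟨⟨x₀, hx₀⟩, ?_, _, h, hc, hcomp, ?_⟩
  · intro x hx y hy t ht
    have hxP : f x ∈ P := hfP ▸ mem_image_of_mem f hx
    have hyP : f y ∈ P := hfP ▸ mem_image_of_mem f hy
    obtain ⟨φ, ⟨φ0, φ1, ⟨h0, hφ⟩, hmaps⟩, -⟩ := mem_iUnion₂.1
      (mem_geodSeg_model hκ (u := f x) (v := f x) (w := f y) (left_mem_segment _ _ _))
    have hs : t * mDist κ (f x) (f y) ∈ Icc 0 (mDist κ (f x) (f y)) :=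
      ⟨mul_nonneg ht.1 h0, mul_le_of_le_one_left h0 ht.2⟩
    have hPconv : ConvexWrt (mDist κ) P := by
      rw [hA]; exact fun x hx y hy z hz C hC => hC.1 x (hx C hC) y (hy C hC) hz
    have hv : φ (t * mDist κ (f x) (f y)) ∈ P := hPconv _ hxP _ hyP
      (mem_iUnion₂.2 ⟨φ, ⟨φ0, φ1, ⟨h0, hφ⟩, hmaps⟩, _, hs, rfl⟩)
    rw [← hfP] at hv
    obtain ⟨z, hz, hzv⟩ := hv
    have : z = geo x y t := by
      refine eq_geo ht ?_ ?_
      · rw [← hiso x hx z hz, ← hiso x hx y hy, hzv]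
        have := hφ 0 ⟨le_rfl, h0⟩ _ hs
        rwa [φ0, zero_sub, abs_neg, abs_of_nonneg hs.1] at this
      · rw [← hiso z hz y hy, ← hiso x hx y hy, hzv]
        have := hφ _ hs _ ⟨h0, le_rfl⟩
        rw [φ1, abs_sub_comm, abs_of_nonneg (by linarith [hs.2])] at this
        rw [this]; ring
    rwa [← this]
  · rw [him, ← image_klein_interior, ← hfF, image_image]

theorem IsFaceChart.eq_inter {F : Set X} {g : X → ℂ} {h : ℂ → X} (c : IsFaceChart F g h) :
    F = closure F ∩ g ⁻¹' interior (g '' closure F) := by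
  ext x; constructor
  · intro hx
    exact ⟨subset_closure hx, by rw [mem_preimage, ← c.image_eq]; exact mem_image_of_mem _ hx⟩
  · rintro ⟨hx, hx'⟩
    rw [mem_preimage, ← c.image_eq] at hx'
    obtain ⟨y, hy, hxy⟩ := hx'
    rwa [← c.injOn (subset_closure hy) hx hxy]

theorem IsFaceChart.gconvex [CatZero X] {F : Set X} {g : X → ℂ} {h : ℂ → X}
    (c : IsFaceChart F g h) (hF : GConvex (closure F)) : GConvex F := by
  rw [c.eq_inter]
  exact c.gconvex_inter_preimage hF (c.convex_image hF Subset.rfl hF).interior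

theorem isGeodesicWrt_continuousOn {f : ℝ → X} {a b : ℝ}
    (hf : IsGeodesicWrt (fun x y : X => dist x y) f a b) : ContinuousOn f (Icc a b) := by
  intro s hs
  rw [Metric.continuousWithinAt_iff]
  exact fun ε hε => ⟨ε, hε, fun t ht h => by
    have := hf.2 t ht s hs
    dsimp only at this
    rw [this, ← Real.dist_eq]; exact h⟩

theorem exists_local_structure [CatZero X] (hκ : κ ≤ 0) (PC : PolyComplex2 κ X) (x : X) :
    ∃ ρ > 0, IsCompact (closedBall x ρ) ∧ PC.vertices ∩ closedBall x ρ ⊆ {x} ∧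
      {c | c ∈ PC.faces ∧ x ∈ closure c}.Finite ∧
      (∀ c ∈ PC.faces ∪ PC.edges, (c ∩ closedBall x ρ).Nonempty → x ∈ closure c) := by
  obtain ⟨ε, hε, hfin, hvfin⟩ := PC.locally_finite x
  set 𝓒 := {c | (c ∈ PC.faces ∨ c ∈ PC.edges) ∧ (c ∩ ball x ε).Nonempty} with h𝓒
  have hcl : ∀ c ∈ 𝓒, ∃ K, IsCompact K ∧ c ⊆ K := by
    rintro c ⟨hc | hc, -⟩
    · obtain ⟨-, -, g, h, hch⟩ := exists_isFaceChart hκ PC hc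
      exact ⟨_, hch.isCompact_closure, subset_closure⟩
    · obtain ⟨f, L, hL, hf, rfl⟩ := PC.edge_geodesic c hc
      exact ⟨f '' Icc 0 L, isCompact_Icc.image_of_continuousOn (isGeodesicWrt_continuousOn hf),
        image_mono Ioo_subset_Icc_self⟩
  choose! K hK hcK using hcl
  have hcomp : IsCompact ((⋃ c ∈ 𝓒, K c) ∪ (PC.vertices ∩ ball x ε)) :=
    (hfin.isCompact_biUnion hK).union hvfin.isCompact
  have hsub : ball x ε ⊆ (⋃ c ∈ 𝓒, K c) ∪ (PC.vertices ∩ ball x ε) := by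
    intro y hy
    have : y ∈ ⋃₀ PC.faces ∪ ⋃₀ PC.edges ∪ PC.vertices := PC.cover ▸ mem_univ y
    rcases this with (⟨c, hc, hyc⟩ | ⟨c, hc, hyc⟩) | hv
    · have hm : c ∈ 𝓒 := ⟨Or.inl hc, y, hyc, hy⟩
      exact Or.inl (mem_iUnion₂.2 ⟨c, hm, hcK c hm hyc⟩)
    · have hm : c ∈ 𝓒 := ⟨Or.inr hc, y, hyc, hy⟩
      exact Or.inl (mem_iUnion₂.2 ⟨c, hm, hcK c hm hyc⟩)
    · exact Or.inr ⟨hv, hy⟩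
  have hev1 : ∀ᶠ ρ in 𝓝[>] (0 : ℝ), ∀ v ∈ PC.vertices ∩ ball x ε, v ∈ closedBall x ρ → v = x := by
    refine (hvfin.eventually_all).2 fun v hv => ?_
    by_cases hvx : v = x
    · exact Eventually.of_forall fun _ _ => hvx
    · filter_upwards [Ioo_mem_nhdsGT (dist_pos.2 hvx)] with ρ hρ hv'
      exact absurd (mem_closedBall.1 hv') (not_le.2 hρ.2)
  have hev2 : ∀ᶠ ρ in 𝓝[>] (0 : ℝ), ∀ c ∈ 𝓒, (c ∩ closedBall x ρ).Nonempty → x ∈ closure c := by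
    refine (hfin.eventually_all).2 fun c hc => ?_
    by_cases hxc : x ∈ closure c
    · exact Eventually.of_forall fun _ _ => hxc
    · rw [Metric.mem_closure_iff] at hxc
      push Not at hxc
      obtain ⟨δ, hδ, H⟩ := hxc
      filter_upwards [Ioo_mem_nhdsGT hδ] with ρ hρ hv'
      obtain ⟨y, hy, hy'⟩ := hv'
      exact absurd ((H y hy).trans (mem_closedBall'.1 hy')) (not_le.2 hρ.2)
  obtain ⟨ρ, ⟨h1, h2⟩, hρ⟩ := ((hev1.and hev2).and (Ioo_mem_nhdsGT hε)).exists
  have hball : closedBall x ρ ⊆ ball x ε := closedBall_subset_ball hρ.2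
  refine ⟨ρ, hρ.1, hcomp.of_isClosed_subset isClosed_closedBall (hball.trans hsub), ?_, ?_, ?_⟩
  · exact fun v hv => h1 v ⟨hv.1, hball hv.2⟩ hv.2
  · refine hfin.subset fun c hc => ⟨Or.inl hc.1, ?_⟩
    obtain ⟨y, hy, hyx⟩ := Metric.mem_closure_iff.1 hc.2 ε hε
    exact ⟨y, hy, mem_ball'.2 hyx⟩
  · rintro c hc ⟨y, hyc, hy⟩
    exact h2 c ⟨hc, y, hyc, hball hy⟩ ⟨y, hyc, hy⟩

end Complex

end Cat2Cx
end

noncomputable section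

open Topology unitInterval

namespace Cat2Cx

/-! ### Degrees of nullhomologous loops -/

section Homology

variable {B : Type*} [TopologicalSpace B]

/-- The logarithm of `φ` varies by `d` along the path `p`. -/
def LogVar (φ : B → ℂ) {x y : B} (p : Path x y) (d : ℂ) : Prop :=
  ∃ u : I → ℂ, Continuous u ∧ (∀ t, Complex.exp (u t) = φ (p t)) ∧ u 1 - u 0 = d

theorem exists_logVar {φ : B → ℂ} {S : Set B} (hφ : ContinuousOn φ S) (h0 : ∀ y ∈ S, φ y ≠ 0)
    {x y : B} (p : Path x y) (hp : ∀ t, p t ∈ S) : ∃ d, LogVar φ p d := by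
  have hc : Continuous fun t : I => φ (p t) := hφ.comp_continuous p.continuous hp
  obtain ⟨u, hu, h⟩ := exists_log_of_homotopy (A := I)
    ⟨fun z => φ (p (z.1 * z.2)), hc.comp (f := fun z : I × I => z.1 * z.2) (by fun_prop)⟩
    (fun z => h0 _ (hp _)) (φ (p 0)) (fun a => by simp)
  exact ⟨_, u, hu, fun t => by rw [h]; simp, rfl⟩

theorem LogVar.of_homotopy {φ : B → ℂ} {S : Set B} (hφ : ContinuousOn φ S)
    (h0 : ∀ y ∈ S, φ y ≠ 0) {x y : B} {p q : Path x y} (F : p.Homotopy q)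
    (hF : ∀ z, F z ∈ S) {d : ℂ} (h : LogVar φ p d) : LogVar φ q d := by
  obtain ⟨u, hu, he, hd⟩ := h
  obtain ⟨U, hU, hU0⟩ := exists_log_homotopy (A := I)
    ⟨fun z => φ (F z), hφ.comp_continuous F.continuous hF⟩ (fun z => h0 _ (hF z)) ⟨u, hu⟩
    (fun a => by simp [he])
  refine ⟨fun t => U (1, t), by fun_prop, fun t => by rw [hU]; simp, ?_⟩
  have key : ∀ e : I, (∀ s, F (s, e) = F (0, e)) → U (1, e) = U (0, e) := fun e hFe => by
    have := int_const_of_continuous (v := fun s : I => U (s, e) - U (0, e)) (by fun_prop)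
      (fun s => by
        rw [Complex.exp_sub, hU, hU]
        change φ _ / φ _ = 1
        rw [hFe, div_self (h0 _ (hF _))]) 1 0
    simpa [sub_eq_zero] using this
  change U (1, 1) - U (1, 0) = d
  rw [key 1 (by simp), key 0 (by simp), hU0, hU0]; exact hd

theorem LogVar.symm {φ : B → ℂ} {x y : B} {p : Path x y} {d : ℂ} (h : LogVar φ p d) :
    LogVar φ p.symm (-d) := by
  obtain ⟨u, hu, he, rfl⟩ := h
  exact ⟨fun t => u (σ t), by fun_prop, fun t => by simp [he], by simp⟩

theorem LogVar.trans {φ : B → ℂ} {x y z : B} {p : Path x y} {q : Path y z} {d e : ℂ}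
    (h : LogVar φ p d) (h' : LogVar φ q e) : LogVar φ (p.trans q) (d + e) := by
  obtain ⟨u, hu, he, rfl⟩ := h
  obtain ⟨v, hv, he', rfl⟩ := h'
  let P : Path (u 0) (u 1) := ⟨⟨u, hu⟩, rfl, rfl⟩
  let Q : Path (u 1) (v 1 + (u 1 - v 0)) := ⟨⟨fun t => v t + (u 1 - v 0), by fun_prop⟩, by simp, rfl⟩
  have h1 : Complex.exp (u 1 - v 0) = 1 := by
    rw [Complex.exp_sub, he, he', p.target, q.source, div_self]
    rw [← q.source, ← he']; exact Complex.exp_ne_zero _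
  refine ⟨P.trans Q, (P.trans Q).continuous, fun t => ?_, by simp; ring⟩
  rw [Path.trans_apply, Path.trans_apply]
  split_ifs with ht
  · exact he _
  · change Complex.exp (v _ + (u 1 - v 0)) = _
    rw [Complex.exp_add, h1, mul_one, he']

theorem logVar_refl {φ : B → ℂ} {x : B} (h0 : φ x ≠ 0) : LogVar φ (Path.refl x) 0 :=
  ⟨fun _ => Complex.log (φ x), continuous_const, fun t => by simp [Complex.exp_log h0], by simp⟩

/-- A nullhomologous loop is nullhomologous in a large enough member of an exhaustion. -/
theorem logVar_of_loopClassH1_eq_one {W : ℝ → Set B} (hmono : ∀ r s, r ≤ s → W s ⊆ W r)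
    (hW : ∀ K, IsCompact K → ∃ r > 0, K ⊆ W r) {x : B} (p : Path x x)
    (hp : loopClassH1 p = 1) :
    ∃ r > 0, ∀ φ : B → ℂ, ContinuousOn φ (W r) → (∀ y ∈ W r, φ y ≠ 0) → LogVar φ p 0 := by
  have key : ∀ c ∈ commutator (FundamentalGroup B x), ∀ p : Path x x, c = ⟦p⟧ →
      ∃ r > 0, ∀ φ : B → ℂ, ContinuousOn φ (W r) → (∀ y ∈ W r, φ y ≠ 0) → LogVar φ p 0 := by
    have inv : ∀ p q : Path x x, (⟦p⟧ : Path.Homotopic.Quotient x x) = ⟦q⟧ →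
        ∃ r > 0, (∀ t, p t ∈ W r) ∧ ∀ φ : B → ℂ, ContinuousOn φ (W r) → (∀ y ∈ W r, φ y ≠ 0) →
          ∀ d, LogVar φ q d → LogVar φ p d := by
      intro p q hpq
      obtain ⟨F⟩ : p.Homotopic q := Quotient.exact hpq
      obtain ⟨r, hr, hF⟩ := hW _ (isCompact_range F.continuous)
      exact ⟨r, hr, fun t => by simpa using hF (mem_range_self (0, t)), fun φ hφ h0 d hd =>
        hd.of_homotopy hφ h0 F.symm fun z => hF (by
          rw [Path.Homotopy.symm_apply]; exact mem_range_self _)⟩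
    intro c hc
    rw [commutator_eq_closure] at hc
    induction hc using Subgroup.closure_induction with
    | mem c hc =>
      obtain ⟨a, b, rfl⟩ := hc
      obtain ⟨a, rfl⟩ := Quotient.exists_rep a
      obtain ⟨b, rfl⟩ := Quotient.exists_rep b
      intro p hpc
      obtain ⟨r, hr, -, H⟩ := inv p (b.symm.trans (a.symm.trans (b.trans a))) hpc.symm
      obtain ⟨r', hr', hab⟩ := hW _ ((isCompact_range a.continuous).union
        (isCompact_range b.continuous))
      have hm1 := hmono _ _ (min_le_left r r')
      have hm2 := hmono _ _ (min_le_right r r')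
      refine ⟨min r r', lt_min hr hr', fun φ hφ h0 => ?_⟩
      obtain ⟨d, hd⟩ := exists_logVar hφ h0 a fun t => hm2 (hab (Or.inl ⟨t, rfl⟩))
      obtain ⟨e, he⟩ := exists_logVar hφ h0 b fun t => hm2 (hab (Or.inr ⟨t, rfl⟩))
      refine H φ (hφ.mono hm1) (fun y hy => h0 y (hm1 hy)) 0 ?_
      simpa using he.symm.trans (hd.symm.trans (he.trans hd))
    | one =>
      intro p hpc
      obtain ⟨r, hr, hpr, H⟩ := inv p (Path.refl x) hpc.symm
      exact ⟨r, hr, fun φ hφ h0 => H φ hφ h0 0 (logVar_refl (h0 _ (by simpa using hpr 0)))⟩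
    | mul a b _ _ iha ihb =>
      obtain ⟨a, rfl⟩ := Quotient.exists_rep a
      obtain ⟨b, rfl⟩ := Quotient.exists_rep b
      intro p hpc
      obtain ⟨r, hr, -, H⟩ := inv p (b.trans a) hpc.symm
      obtain ⟨s, hs, Ha⟩ := iha a rfl
      obtain ⟨s', hs', Hb⟩ := ihb b rfl
      have hm1 := hmono _ _ (min_le_left r (min s s'))
      have hm2 := hmono _ _ ((min_le_right r (min s s')).trans (min_le_left s s'))
      have hm3 := hmono _ _ ((min_le_right r (min s s')).trans (min_le_right s s'))
      refine ⟨min r (min s s'), lt_min hr (lt_min hs hs'), fun φ hφ h0 => ?_⟩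
      refine H φ (hφ.mono hm1) (fun y hy => h0 y (hm1 hy)) 0 ?_
      simpa using (Hb φ (hφ.mono hm3) fun y hy => h0 y (hm3 hy)).trans
        (Ha φ (hφ.mono hm2) fun y hy => h0 y (hm2 hy))
    | inv a _ iha =>
      obtain ⟨a, rfl⟩ := Quotient.exists_rep a
      intro p hpc
      obtain ⟨r, hr, -, H⟩ := inv p a.symm hpc.symm
      obtain ⟨s, hs, Ha⟩ := iha a rfl
      have hm1 := hmono _ _ (min_le_left r s)
      have hm2 := hmono _ _ (min_le_right r s)
      refine ⟨min r s, lt_min hr hs, fun φ hφ h0 => ?_⟩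
      refine H φ (hφ.mono hm1) (fun y hy => h0 y (hm1 hy)) 0 ?_
      simpa using (Ha φ (hφ.mono hm2) fun y hy => h0 y (hm2 hy)).symm
  refine key _ ?_ p rfl
  rw [← Abelianization.ker_of]
  exact hp

end Homology

/-- A function varying trivially along one period of a periodic loop has degree zero. -/
theorem hasDeg_zero_of_log {c : ℝ → ℂ} (hc : Continuous c) (h0 : ∀ t, c t ≠ 0)
    (hp : ∀ t, c (t + 1) = c t) {u : I → ℂ} (hu : Continuous u)
    (he : ∀ t : I, Complex.exp (u t) = c t) (hd : u 1 - u 0 = 0) : HasDeg c 0 := by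
  obtain ⟨n, v, hv, hve, hvp⟩ := exists_hasDeg hc h0 hp
  have := int_const_of_continuous (v := fun s : I => u s - v s) (by fun_prop)
    (fun s => by rw [Complex.exp_sub, he, hve, div_self (h0 _)]) 1 0
  have h1 := hvp 0
  simp only [Icc.coe_one, Icc.coe_zero, zero_add] at this h1
  refine ⟨v, hv, hve, fun t => ?_⟩
  have hn : 2 * (Real.pi : ℂ) * Complex.I * n = 0 := by linear_combination hd - this - h1
  rw [hvp, hn]; simp

theorem hasDeg_zero_of_H1Trivial {X : Type*} [MetricSpace X] {E : Set X} (hE : H1Trivial E)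
    {L : ℝ → X} (hL : Continuous L) (hp : ∀ t, L (t + 1) = L t) (hLE : ∀ t, L t ∈ E)
    {φ : X → ℂ} (hφ : ContinuousOn φ E) (h0 : ∀ y ∈ E, φ y ≠ 0) :
    HasDeg (fun t => φ (L t)) 0 := by
  let p : Path (⟨L 0, hLE 0⟩ : E) ⟨L 0, hLE 0⟩ :=
    ⟨⟨fun t => ⟨L t, hLE t⟩, by fun_prop⟩, by simp, by
      have := hp 0; rw [zero_add] at this; simp [this]⟩
  obtain ⟨r, -, H⟩ := logVar_of_loopClassH1_eq_one (W := fun _ => univ) (fun _ _ _ => Subset.rfl)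
    (fun K _ => ⟨1, one_pos, subset_univ _⟩) p (hE _ p)
  obtain ⟨u, hu, he, hd⟩ := H (fun y => φ y) hφ.domRestrict.continuousOn fun y _ => h0 y y.2
  exact hasDeg_zero_of_log (hφ.comp_continuous hL hLE) (fun t => h0 _ (hLE t))
    (fun t => by simp only [hp]) hu he hd

end Cat2Cx
end

noncomputable section

open Topology

namespace Cat2Cx

/-! ### Crossings and extension of logarithms -/

theorem eq_add_fract {α : Type*} {c : ℝ → α} (hp : ∀ t, c (t + 1) = c t) (t₀ t : ℝ) :
    c t = c (t₀ + Int.fract (t - t₀)) := by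
  have h : Function.Periodic c 1 := hp
  rw [show t₀ + Int.fract (t - t₀) = t - ⌊t - t₀⌋ by rw [Int.fract]; ring]
  exact (by simpa using (h.sub_int_mul_eq (x := t) ⌊t - t₀⌋).symm)

theorem hasDeg_one_of_crossing {c : ℝ → ℂ} (hc : Continuous c) (hp : ∀ t, c (t + 1) = c t)
    {t₀ : ℝ} (hs : ∀ t ∈ Ioo t₀ (t₀ + 1), c t ∈ Complex.slitPlane) (hre : (c t₀).re < 0)
    (him : (c t₀).im = 0) (hl : ∀ᶠ t in 𝓝[<] t₀, 0 < (c t).im)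
    (hr : ∀ᶠ t in 𝓝[>] t₀, (c t).im < 0) : HasDeg c 1 := by
  have h0 : ∀ t, c t ≠ 0 := fun t => by
    rw [eq_add_fract hp t₀]
    rcases (Int.fract_nonneg (t - t₀)).eq_or_lt with h | h
    · rw [← h, add_zero]; intro h; simp [h] at hre
    · exact Complex.slitPlane_ne_zero (hs _ ⟨by linarith, by linarith [Int.fract_lt_one (t - t₀)]⟩)
  obtain ⟨n, u, hu, he, hup⟩ := exists_hasDeg hc h0 hp
  have hpre : PreconnectedSpace (Ioo t₀ (t₀ + 1)) :=
    isPreconnected_iff_preconnectedSpace.1 isPreconnected_Ioo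
  have hcon : ∀ s ∈ Ioo t₀ (t₀ + 1), ∀ t ∈ Ioo t₀ (t₀ + 1),
      u s - Complex.log (c s) = u t - Complex.log (c t) := fun s hs' t ht =>
    int_const_of_continuous (A := Ioo t₀ (t₀ + 1))
      (v := fun s => u s - Complex.log (c s))
      ((hu.comp continuous_subtype_val).sub
        ((hc.comp continuous_subtype_val).clog fun s => hs s s.2))
      (fun s => by rw [Complex.exp_sub, he, Complex.exp_log (h0 _), div_self (h0 _)])
      ⟨s, hs'⟩ ⟨t, ht⟩
  set k := u (t₀ + 1 / 2) - Complex.log (c (t₀ + 1 / 2)) with hk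
  have hmid : t₀ + 1 / 2 ∈ Ioo t₀ (t₀ + 1) := ⟨by linarith, by linarith⟩
  have e1 : k = u t₀ - (Real.log ‖c t₀‖ - Real.pi * Complex.I) := by
    refine tendsto_nhds_unique (f := fun t => u t - Complex.log (c t)) (l := 𝓝[>] t₀) ?_ ?_
    · refine tendsto_const_nhds.congr' ?_
      filter_upwards [Ioo_mem_nhdsGT (show t₀ < t₀ + 1 by linarith)] with t ht
      exact hcon _ hmid _ ht
    · refine (hu.tendsto t₀ |>.mono_left nhdsWithin_le_nhds).sub
        ((Complex.tendsto_log_nhdsWithin_im_neg_of_re_neg_of_im_zero hre him).comp ?_)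
      exact tendsto_nhdsWithin_iff.2 ⟨(hc.tendsto t₀).mono_left nhdsWithin_le_nhds, hr⟩
  have hl' : ∀ᶠ t in 𝓝[<] (t₀ + 1), 0 < (c t).im := by
    have : Tendsto (fun t => t - 1) (𝓝[<] (t₀ + 1)) (𝓝[<] t₀) := by
      refine tendsto_nhdsWithin_iff.2 ⟨?_, ?_⟩
      · have : Tendsto (fun t : ℝ => t - 1) (𝓝 (t₀ + 1)) (𝓝 (t₀ + 1 - 1)) :=
          (continuous_id.sub continuous_const).tendsto _
        rw [add_sub_cancel_right] at this
        exact this.mono_left nhdsWithin_le_nhds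
      · filter_upwards [self_mem_nhdsWithin] with t ht
        rw [mem_Iio] at ht ⊢; linarith
    filter_upwards [this.eventually hl] with t ht
    rwa [← hp, sub_add_cancel] at ht
  have hcp : c (t₀ + 1) = c t₀ := hp t₀
  have e2 : k = u (t₀ + 1) - (Real.log ‖c t₀‖ + Real.pi * Complex.I) := by
    refine tendsto_nhds_unique (f := fun t => u t - Complex.log (c t)) (l := 𝓝[<] (t₀ + 1)) ?_ ?_
    · refine tendsto_const_nhds.congr' ?_
      filter_upwards [Ioo_mem_nhdsLT (show t₀ < t₀ + 1 by linarith)] with t ht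
      exact hcon _ hmid _ ht
    · refine (hu.tendsto (t₀ + 1) |>.mono_left nhdsWithin_le_nhds).sub
        ((Complex.tendsto_log_nhdsWithin_im_nonneg_of_re_neg_of_im_zero hre him).comp ?_)
      refine tendsto_nhdsWithin_iff.2 ⟨?_, hl'.mono fun _ h => h.le⟩
      rw [← hcp]
      exact (hc.tendsto (t₀ + 1)).mono_left nhdsWithin_le_nhds
  have h1 := hup t₀
  have hn : 2 * Real.pi * Complex.I * ((n : ℂ) - 1) = 0 := by linear_combination -h1 + e1 - e2
  have hne : 2 * (Real.pi : ℂ) * Complex.I ≠ 0 := Complex.two_pi_I_ne_zero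
  rw [mul_eq_zero, or_iff_right hne, sub_eq_zero] at hn
  have : n = 1 := by exact_mod_cast hn
  exact this ▸ ⟨u, hu, he, hup⟩

theorem exists_hasDeg_of_crossing {c : ℝ → ℂ} (hc : Continuous c) (hp : ∀ t, c (t + 1) = c t)
    {t₀ : ℝ} (hs : ∀ t ∈ Ioo t₀ (t₀ + 1), c t ∈ Complex.slitPlane) (hre : (c t₀).re < 0)
    (him : (c t₀).im = 0)
    (h : ((∀ᶠ t in 𝓝[<] t₀, 0 < (c t).im) ∧ ∀ᶠ t in 𝓝[>] t₀, (c t).im < 0) ∨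
      ((∀ᶠ t in 𝓝[<] t₀, (c t).im < 0) ∧ ∀ᶠ t in 𝓝[>] t₀, 0 < (c t).im)) :
    HasDeg c 1 ∨ HasDeg c (-1) := by
  rcases h with ⟨hl, hr⟩ | ⟨hl, hr⟩
  · exact Or.inl (hasDeg_one_of_crossing hc hp hs hre him hl hr)
  · right
    have hcj : HasDeg (fun t => (starRingEnd ℂ) (c t)) 1 := by
      refine hasDeg_one_of_crossing (t₀ := t₀) (Complex.continuous_conj.comp hc)
        (fun t => by simp [hp]) ?_ (by simpa) (by simpa) (by simpa) (by simpa)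
      intro t ht
      have := hs t ht
      rw [Complex.mem_slitPlane_iff] at this ⊢
      simpa using this
    obtain ⟨u, hu, he, hup⟩ := hcj
    refine ⟨fun t => (starRingEnd ℂ) (u t), Complex.continuous_conj.comp hu, fun t => ?_,
      fun t => ?_⟩
    · rw [Complex.exp_conj, he, Complex.conj_conj]
    · simp [hup, Complex.conj_ofNat]

theorem exists_continuous_extension {A : Type*} [TopologicalSpace A] [NormalSpace A] {s : Set A}
    (hs : IsClosed s) {f : A → ℂ} (hf : ContinuousOn f s) :
    ∃ F : A → ℂ, Continuous F ∧ EqOn F f s := by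
  obtain ⟨F, hF⟩ := ContinuousMap.exists_restrict_eq hs
    (⟨fun x => f x, hf.domRestrict⟩ : C(s, ℂ))
  exact ⟨F, F.continuous, fun x hx => DFunLike.congr_fun hF ⟨x, hx⟩⟩

theorem exists_angle_fun {β : Type*} [TopologicalSpace β] {w : ℝ → β} (hw : Continuous w)
    (hp : ∀ t, w (t + 1) = w t) : ∃ W : ℂ → β, ContinuousOn W {0}ᶜ ∧
      (∀ z, W z = w (Complex.arg z / (2 * Real.pi))) ∧
      ∀ (t r : ℝ), 0 < r → W (r * Complex.exp (2 * Real.pi * Complex.I * t)) = w t := by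
  have hpi : 0 < 2 * Real.pi := by positivity
  have hper : Function.Periodic (fun θ => w (θ / (2 * Real.pi))) (2 * Real.pi) := fun θ => by
    simp only [add_div, div_self hpi.ne', hp]
  have hl : Continuous (hper.lift : Real.Angle → β) :=
    continuous_quot_lift _ (hw.comp (continuous_id.div_const _))
  refine ⟨fun z => w (Complex.arg z / (2 * Real.pi)), fun z hz => ?_, fun z => rfl, ?_⟩
  · exact (hl.continuousAt.comp (Complex.continuousAt_arg_coe_angle hz)).continuousWithinAt
  · intro t r hr
    have h1 : ((Complex.arg (r * Complex.exp (2 * Real.pi * Complex.I * t)) : ℝ) : Real.Angle) =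
        ((2 * Real.pi * t : ℝ) : Real.Angle) := by
      rw [show 2 * Real.pi * Complex.I * t = ((2 * Real.pi * t : ℝ) : ℂ) * Complex.I by
        push_cast; ring, Complex.exp_mul_I]
      have := Complex.arg_mul_cos_add_sin_mul_I_coe_angle hr ((2 * Real.pi * t : ℝ) : Real.Angle)
      rwa [Real.Angle.cos_coe, Real.Angle.sin_coe, Complex.ofReal_cos, Complex.ofReal_sin] at this
    have h2 := congrArg (hper.lift : Real.Angle → β) h1
    have h3 : w (Complex.arg (r * Complex.exp (2 * Real.pi * Complex.I * t)) / (2 * Real.pi)) =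
        w (2 * Real.pi * t / (2 * Real.pi)) := h2
    rwa [mul_div_cancel_left₀ _ hpi.ne'] at h3

theorem exists_eq_exp (z : ℂ) :
    ∃ t : ℝ, z = ‖z‖ * Complex.exp (2 * Real.pi * Complex.I * t) := by
  refine ⟨Complex.arg z / (2 * Real.pi), ?_⟩
  conv_lhs => rw [← Complex.norm_mul_exp_arg_mul_I z]
  congr 2
  have : (Real.pi : ℂ) ≠ 0 := by exact_mod_cast Real.pi_ne_zero
  push_cast; field_simp

theorem exists_log_frontier {Q : Set ℂ} (hQ : IsCompact Q) (hconv : Convex ℝ Q) {x : ℂ}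
    (hx : x ∈ interior Q) {φ : ℂ → ℂ} (hφ : ContinuousOn φ (frontier Q))
    (h0 : ∀ y ∈ frontier Q, φ y ≠ 0) :
    ∃ (d : ℤ) (u : ℂ → ℂ), Continuous u ∧
      ∀ y ∈ frontier Q, φ y = Complex.exp (u y) * (y - x) ^ d := by
  set R : Set ℂ := (fun y => y + x) ⁻¹' Q with hR
  have hRc : Convex ℝ R := hconv.affine_preimage (AffineMap.id ℝ ℂ + AffineMap.const ℝ ℂ x)
  have hR0 : R ∈ 𝓝 0 := by
    have : Tendsto (fun y => y + x) (𝓝 0) (𝓝 (0 + x)) := (continuous_add_const x).tendsto 0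
    rw [zero_add] at this
    exact this (mem_interior_iff_mem_nhds.1 hx)
  have hRb : Bornology.IsVonNBounded ℝ R := by
    rw [NormedSpace.isVonNBounded_iff]
    have : R = (Homeomorph.addRight x) ⁻¹' Q := rfl
    rw [this, ← Homeomorph.image_symm]
    exact (hQ.image (Homeomorph.continuous _)).isBounded
  have hfr : ∀ y, gauge R y = 1 ↔ y + x ∈ frontier Q := fun y => by
    rw [gauge_eq_one_iff_mem_frontier hRc hR0,
      show R = (Homeomorph.addRight x) ⁻¹' Q from rfl, ← Homeomorph.preimage_frontier]
    rfl
  have hgpos : ∀ y, y ≠ 0 → 0 < gauge R y := fun y hy =>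
    (gauge_pos (absorbent_nhds_zero hR0) hRb).2 hy
  set e : ℝ → ℂ := fun t => Complex.exp (2 * Real.pi * Complex.I * t) with he
  have hec : Continuous e := by fun_prop
  have hep : ∀ t, e (t + 1) = e t := fun t => by
    simp only [he]; push_cast
    rw [mul_add, mul_one, Complex.exp_add, Complex.exp_two_pi_mul_I, mul_one]
  have hen : ∀ t, e t ≠ 0 := fun t => Complex.exp_ne_zero _
  set G : ℝ → ℝ := fun t => (gauge R (e t))⁻¹ with hG
  have hGpos : ∀ t, 0 < G t := fun t => inv_pos.2 (hgpos _ (hen t))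
  have hGc : Continuous G := ((continuous_gauge hRc hR0).comp hec).inv₀ fun t => (hgpos _ (hen t)).ne'
  set ρ : ℝ → ℂ := fun t => G t * e t + x with hρ
  have hρc : Continuous ρ := by fun_prop
  have hρf : ∀ t, ρ t ∈ frontier Q := fun t => by
    rw [hρ, ← hfr, ← Complex.real_smul, gauge_smul_of_nonneg (hGpos t).le, smul_eq_mul, hG]
    exact inv_mul_cancel₀ (hgpos _ (hen t)).ne'
  have hρp : ∀ t, ρ (t + 1) = ρ t := fun t => by simp only [hρ, hG, hep]
  obtain ⟨d, v, hv, hve, hvp⟩ := exists_hasDeg (c := fun t => φ (ρ t))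
    (hφ.comp_continuous hρc hρf) (fun t => h0 _ (hρf t)) (fun t => by simp only [hρp])
  obtain ⟨W, hW, -, hWe⟩ := exists_angle_fun
    (w := fun t => v t - d * (2 * Real.pi * Complex.I * t) - d * Real.log (G t))
    (by
      have : Continuous fun t => Real.log (G t) := hGc.log fun t => (hGpos t).ne'
      fun_prop) (fun t => by
      simp only [hvp, hG, hep]; push_cast; ring)
  have hne : ∀ y ∈ frontier Q, y - x ≠ 0 := fun y hy h => by
    rw [sub_eq_zero] at h; subst h
    exact hy.2 hx
  obtain ⟨u, hu, huW⟩ := exists_continuous_extension (s := frontier Q) isClosed_frontier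
    (f := fun y => W (y - x)) (hW.comp (by fun_prop) hne)
  refine ⟨d, u, hu, fun y hy => ?_⟩
  obtain ⟨t, ht⟩ := exists_eq_exp (y - x)
  have hnp : 0 < ‖y - x‖ := norm_pos_iff.2 (hne y hy)
  have hgy : gauge R (y - x) = 1 := (hfr _).2 (by rwa [sub_add_cancel])
  have hGt : G t = ‖y - x‖ := by
    rw [ht, ← Complex.real_smul, gauge_smul_of_nonneg hnp.le, smul_eq_mul] at hgy
    rw [hG]; dsimp only
    exact (eq_inv_of_mul_eq_one_left hgy).symm
  have hyρ : ρ t = y := by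
    rw [hρ]; dsimp only; rw [hGt, ← ht, sub_add_cancel]
  have hWy := hWe t _ hnp
  rw [← ht] at hWy
  rw [huW hy]; dsimp only
  rw [hWy, Complex.exp_sub, Complex.exp_sub, hve]
  dsimp only
  rw [hyρ, Complex.exp_int_mul, Complex.exp_int_mul, ← Complex.ofReal_exp, Real.exp_log (hGpos t),
    div_div, ← mul_zpow, mul_comm (Complex.exp _), hGt, ← ht,
    div_mul_cancel₀ _ (zpow_ne_zero _ (hne y hy))]

end Cat2Cx
end

noncomputable section

open Topology

namespace Cat2Cx

/-! ### Points enclosed by a loop -/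

section Enclosed

theorem continuousOn_glue {A B : Type*} [TopologicalSpace A] [TopologicalSpace B]
    {W C₁ C₂ : Set A} {f f₁ f₂ : A → B}
    (h₁ : IsClosed C₁) (h₂ : IsClosed C₂) (hW : W ⊆ C₁ ∪ C₂)
    (hf₁ : ContinuousOn f₁ (W ∩ C₁)) (hf₂ : ContinuousOn f₂ (W ∩ C₂))
    (e₁ : EqOn f f₁ (W ∩ C₁)) (e₂ : EqOn f f₂ (W ∩ C₂)) : ContinuousOn f W := by
  have key : ∀ {C : Set A} {k : A → B}, IsClosed C → ContinuousOn k (W ∩ C) →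
      EqOn f k (W ∩ C) → ∀ x ∈ W, ContinuousWithinAt f (W ∩ C) x := by
    intro C k hC hk e x hx
    by_cases hxC : x ∈ C
    · exact (hk x ⟨hx, hxC⟩).congr e (e ⟨hx, hxC⟩)
    · have : 𝓝[W ∩ C] x = ⊥ := by
        rw [← notMem_closure_iff_nhdsWithin_eq_bot]
        exact fun h => hxC (hC.closure_subset (closure_mono inter_subset_right h))
      rw [ContinuousWithinAt, this]; exact tendsto_bot
  intro x hx
  have := (key h₁ hf₁ e₁ x hx).union (key h₂ hf₂ e₂ x hx)
  rwa [← inter_union_distrib_left, inter_eq_left.2 hW] at this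

theorem exists_compact_convex_between {K P : Set ℂ} (hK : IsCompact K) (hP : IsOpen P)
    (hPc : Convex ℝ P) (hKP : K ⊆ P) : ∃ H, IsCompact H ∧ Convex ℝ H ∧ K ⊆ H ∧ H ⊆ P := by
  have h : ∀ y ∈ K, ∃ u : Finset ℂ, y ∈ interior (convexHull ℝ (u : Set ℂ)) ∧
      convexHull ℝ (u : Set ℂ) ⊆ P := fun y hy => by
    obtain ⟨u, h1, h2⟩ := (convex_singleton (𝕜 := ℝ) y).exists_subset_interior_convexHull_finset_of_isCompact
      isCompact_singleton (t := P) (by rw [nhdsSet_singleton]; exact hP.mem_nhds (hKP hy))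
    exact ⟨u, h1 rfl, h2⟩
  choose! u hu hu' using h
  obtain ⟨t, htK, ht⟩ := hK.elim_nhds_subcover (fun y => interior (convexHull ℝ (u y : Set ℂ)))
    fun y hy => isOpen_interior.mem_nhds (hu y hy)
  have hfin : (⋃ y ∈ t, (u y : Set ℂ)).Finite := t.finite_toSet.biUnion fun y _ => (u y).finite_toSet
  refine ⟨convexHull ℝ (⋃ y ∈ t, (u y : Set ℂ)), hfin.isCompact_convexHull ℝ, convex_convexHull ℝ _,
    fun z hz => ?_, convexHull_min (iUnion₂_subset fun y hy =>
      (subset_convexHull ℝ _).trans (hu' y (htK y hy))) hPc⟩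
  obtain ⟨y, hy, hzy⟩ := mem_iUnion₂.1 (ht hz)
  exact convexHull_mono (subset_biUnion_of_mem (u := fun y => (u y : Set ℂ)) hy)
    (interior_subset hzy)

variable {X : Type*} [MetricSpace X] [CatZero X]

/-- A convex open set with a chart onto an open subset of the plane. -/
structure IsPatch (O : Set X) (g : X → ℂ) (h : ℂ → X) : Prop extends IsChart O g h where
  isOpen : IsOpen O
  gconvex : GConvex O
  isOpen_image : IsOpen (g '' O)

theorem IsChart.isOpen_image_inter {O U : Set X} {g : X → ℂ} {h : ℂ → X}
    (c : IsChart O g h) (hO : IsOpen (g '' O)) (hU : IsOpen U) : IsOpen (g '' (O ∩ U)) := by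
  have : g '' (O ∩ U) = g '' O ∩ h ⁻¹' U := by
    ext z; constructor
    · rintro ⟨x, hx, rfl⟩
      exact ⟨mem_image_of_mem _ hx.1, by rw [mem_preimage, c.leftInv x hx.1]; exact hx.2⟩
    · rintro ⟨hz, hz'⟩
      exact ⟨h z, ⟨(c.inv_mem hz).1, hz'⟩, (c.inv_mem hz).2⟩
  rw [this]
  exact c.contInv.isOpen_inter_preimage hO hU

theorem IsFaceChart.isPatch {F U : Set X} {g : X → ℂ} {h : ℂ → X} (c : IsFaceChart F g h)
    (hF : IsOpen F) (hFc : GConvex (closure F)) (hU : IsOpen U) (hUc : GConvex U) :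
    IsPatch (F ∩ U) g h where
  toIsChart := c.toIsChart.mono (inter_subset_left.trans subset_closure)
  isOpen := hF.inter hU
  gconvex := (c.gconvex hFc).inter hUc
  isOpen_image := (c.toIsChart.mono subset_closure).isOpen_image_inter
    (by rw [c.image_eq]; exact isOpen_interior) hU

theorem IsPatch.isOpen_inter_preimage {O : Set X} {g : X → ℂ} {h : ℂ → X} (c : IsPatch O g h)
    {V : Set ℂ} (hV : IsOpen V) : IsOpen (O ∩ g ⁻¹' V) :=
  c.continuousOn.isOpen_inter_preimage c.isOpen hV

/-- A function which does not vanish off a compact subset of a patch differs, away from the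
patch, from a function without zeros by a power of a function vanishing at one given point. -/
theorem IsPatch.exists_absorb {O Z W : Set X} {g : X → ℂ} {h : ℂ → X} (c : IsPatch O g h)
    (hZ : IsCompact Z) (hZO : Z ⊆ O) {x : X} (hx : x ∈ O) (hOW : O ⊆ W) {φ : X → ℂ}
    (hφ : ContinuousOn φ (W \ Z)) (h0 : ∀ y ∈ W \ Z, φ y ≠ 0) :
    ∃ (d : ℤ) (A ψ : X → ℂ), Continuous A ∧ (∀ y, y ≠ x → A y ≠ 0) ∧ ContinuousOn ψ W ∧
      (∀ y ∈ W, ψ y ≠ 0) ∧ ∀ y ∈ W \ O, φ y = ψ y * A y ^ d := by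
  have hins : insert x Z ⊆ O := insert_subset hx hZO
  obtain ⟨H, hHc, hHconv, hZH, hHO⟩ := exists_compact_convex_between
    ((hZ.insert x).image_of_continuousOn (c.continuousOn.mono hins)) c.isOpen_image
    (c.convex_image c.gconvex Subset.rfl c.gconvex) (image_mono hins)
  obtain ⟨δ, hδ, hδO⟩ := hHc.exists_cthickening_subset_open c.isOpen_image hHO
  set Q' := cthickening δ H with hQ'
  have hQ'c : IsCompact Q' := hHc.cthickening
  have hQ'conv : Convex ℝ Q' := hHconv.cthickening δ
  have hHQ : H ⊆ interior Q' :=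
    (self_subset_thickening hδ H).trans (thickening_subset_interior_cthickening δ H)
  have hgH : ∀ y ∈ insert x Z, g y ∈ interior Q' := fun y hy =>
    hHQ (hZH (mem_image_of_mem g hy))
  set Q := O ∩ g ⁻¹' Q' with hQ
  set Qi := O ∩ g ⁻¹' interior Q' with hQi
  have hQc : IsCompact Q := c.isCompact_inter_preimage hδO hQ'c
  have hQg : GConvex Q := c.gconvex_inter_preimage c.gconvex hQ'conv
  have hQio : IsOpen Qi := c.isOpen_inter_preimage isOpen_interior
  have hQiQ : Qi ⊆ Q := fun y hy => ⟨hy.1, interior_subset (s := Q') hy.2⟩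
  have hxQi : x ∈ Qi := ⟨hx, hgH x (mem_insert _ _)⟩
  have hZQi : Z ⊆ Qi := fun y hy => ⟨hZO hy, hgH y (mem_insert_of_mem _ hy)⟩
  have hne : Q.Nonempty := ⟨x, hQiQ hxQi⟩
  set A : X → ℂ := fun y => g (proj Q y) - g x with hA
  have hAc : Continuous A := by
    refine Continuous.sub ?_ continuous_const
    exact (c.continuousOn.mono inter_subset_left).comp_continuous (continuous_proj hQc hne hQg)
      fun y => (proj_spec hQc hne y).1
  have hA0 : ∀ y, y ≠ x → A y ≠ 0 := by
    intro y hy h0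
    have hp : proj Q y = x :=
      c.injOn (proj_spec hQc hne y).1.1 hx (sub_eq_zero.1 h0)
    refine hy ((eq_of_proj_mem_interior hQc ?_).trans hp)
    rw [hp]; exact interior_maximal hQiQ hQio hxQi
  have hfr : ∀ z ∈ frontier Q', h z ∈ W \ Z ∧ g (h z) = z ∧ h z ∈ O := by
    intro z hz
    have hz1 : z ∈ Q' := hQ'c.isClosed.frontier_subset hz
    have := c.inv_mem (hδO hz1)
    refine ⟨⟨hOW this.1, fun hZ' => hz.2 ?_⟩, this.2, this.1⟩
    rw [← this.2]; exact hgH _ (mem_insert_of_mem _ hZ')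
  obtain ⟨d, u, hu, hue⟩ := exists_log_frontier hQ'c hQ'conv (hgH x (mem_insert _ _))
    (φ := fun z => φ (h z))
    (hφ.comp (c.contInv.mono ((hQ'c.isClosed.frontier_subset).trans hδO)) fun z hz => (hfr z hz).1)
    (fun z hz => h0 _ (hfr z hz).1)
  classical
  set ψ : X → ℂ := fun y => if y ∈ Q then Complex.exp (u (g y)) else φ y * A y ^ (-d) with hψ
  have hov : ∀ y ∈ Q, y ∉ Qi → Complex.exp (u (g y)) = φ y * A y ^ (-d) := by
    intro y hy hyi
    have hyf : g y ∈ frontier Q' := by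
      rw [hQ'c.isClosed.frontier_eq]; exact ⟨hy.2, fun h => hyi ⟨hy.1, h⟩⟩
    have h1 := hue _ hyf
    rw [c.leftInv y hy.1] at h1
    have hAy : A y = g y - g x := by rw [hA]; dsimp only; rw [proj_of_mem hQc hy]
    have hAy0 : A y ≠ 0 := hA0 y fun h => hyi (h ▸ hxQi)
    rw [h1, ← hAy, mul_assoc, ← zpow_add₀ hAy0, add_neg_cancel, zpow_zero, mul_one]
  have hdiff : W ∩ Qiᶜ ⊆ W \ Z := fun y hy => ⟨hy.1, fun h => hy.2 (hZQi h)⟩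
  have hAQ : ∀ y ∈ W ∩ Qiᶜ, A y ≠ 0 := fun y hy => hA0 y fun h => hy.2 (h ▸ hxQi)
  refine ⟨d, A, ψ, hAc, hA0, ?_, ?_, ?_⟩
  · refine continuousOn_glue (C₁ := Q) (C₂ := Qiᶜ) (f₁ := fun y => Complex.exp (u (g y)))
      (f₂ := fun y => φ y * A y ^ (-d)) hQc.isClosed hQio.isClosed_compl ?_ ?_ ?_ ?_ ?_
    · intro y _
      by_cases hy : y ∈ Qi
      · exact Or.inl (hQiQ hy)
      · exact Or.inr hy
    · exact Complex.continuous_exp.comp_continuousOn (hu.comp_continuousOn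
        (c.continuousOn.mono (inter_subset_right.trans inter_subset_left)))
    · exact (hφ.mono hdiff).mul (hAc.continuousOn.zpow₀ _ fun y hy => Or.inl (hAQ y hy))
    · intro y hy; exact if_pos hy.2
    · intro y hy
      by_cases hyQ : y ∈ Q
      · rw [hψ]; dsimp only; rw [if_pos hyQ, hov y hyQ hy.2]
      · exact if_neg hyQ
  · intro y hy
    by_cases hyQ : y ∈ Q
    · rw [hψ]; dsimp only; rw [if_pos hyQ]; exact Complex.exp_ne_zero _
    · have hyi : y ∈ W ∩ Qiᶜ := ⟨hy, fun h => hyQ (hQiQ h)⟩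
      rw [hψ]; dsimp only; rw [if_neg hyQ]
      exact mul_ne_zero (h0 y (hdiff hyi)) (zpow_ne_zero _ (hAQ y hyi))
  · intro y hy
    have hyQ : y ∉ Q := fun h => hy.2 h.1
    have hyi : y ∈ W ∩ Qiᶜ := ⟨hy.1, fun h => hyQ (hQiQ h)⟩
    rw [hψ]; dsimp only; rw [if_neg hyQ, mul_assoc, ← zpow_add₀ (hAQ y hyi), neg_add_cancel,
      zpow_zero, mul_one]

variable {L : ℝ → X}

theorem hasDeg_zero_of_gconvex {C : Set X} (hC : GConvex C) (hL : Continuous L)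
    (hp : ∀ t, L (t + 1) = L t) (hLC : ∀ t, L t ∈ C) {φ : X → ℂ} (hφ : ContinuousOn φ C)
    (h0 : ∀ y ∈ C, φ y ≠ 0) : HasDeg (fun t => φ (L t)) 0 := by
  have hm : ∀ s ∈ Icc (0 : ℝ) 1, ∀ t, geo (L 0) (L t) s ∈ C := fun s hs t =>
    hC _ (hLC 0) _ (hLC t) s hs
  have := HasDeg.homotopy (fun s t => φ (geo (L 0) (L t) s))
    (hφ.comp (continuous_geo_comp continuous_const (hL.comp continuous_snd)
      continuous_fst).continuousOn fun x hx => hm _ hx.1 _)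
    (fun s hs t => h0 _ (hm s hs t)) (fun s _ t => by rw [hp]) (n := 0)
    (by simpa only [geo_zero] using hasDeg_const (h0 _ (hLC 0)))
  simpa only [geo_one] using this

/-- The point `w` is enclosed by the loop `L`: off any neighbourhood of `w` disjoint from `L`
there is a nonvanishing function of nonzero degree along `L`. -/
def Enc (L : ℝ → X) (w : X) : Prop :=
  w ∉ range L ∧ ∀ U, IsOpen U → w ∈ U → Disjoint U (range L) →
    ∃ φ : X → ℂ, ContinuousOn φ Uᶜ ∧ (∀ y ∈ Uᶜ, φ y ≠ 0) ∧ ∃ n : ℤ, n ≠ 0 ∧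
      HasDeg (fun t => φ (L t)) n

/-- The loop `L` together with the points it encloses. -/
def fill (L : ℝ → X) : Set X := range L ∪ {w | Enc L w}

theorem isCompact_range_of_periodic {A : Type*} [TopologicalSpace A] {L : ℝ → A}
    (hL : Continuous L) (hp : ∀ t, L (t + 1) = L t) : IsCompact (range L) := by
  have : range L = L '' Icc 0 1 := by
    refine Subset.antisymm ?_ (image_subset_range _ _)
    rintro _ ⟨t, rfl⟩
    refine ⟨Int.fract t, ⟨Int.fract_nonneg t, (Int.fract_lt_one t).le⟩, ?_⟩
    have := eq_add_fract hp 0 t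
    rw [this]; simp
  rw [this]; exact isCompact_Icc.image hL

theorem isClosed_fill (L : ℝ → X) : IsClosed (fill L) := by
  rw [← isOpen_compl_iff, isOpen_iff_mem_nhds]
  intro w hw
  have hw1 : w ∉ range L := fun h => hw (Or.inl h)
  have hw2 : ¬ Enc L w := fun h => hw (Or.inr h)
  unfold Enc at hw2
  push Not at hw2
  obtain ⟨U, hU, hwU, hd, H⟩ := hw2 hw1
  refine mem_of_superset (hU.mem_nhds hwU) fun y hy hyf => ?_
  rcases hyf with h | h
  · exact hd.le_bot ⟨hy, h⟩
  · obtain ⟨φ, h1, h2, n, hn, h3⟩ := h.2 U hU hy hd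
    exact H φ h1 h2 n hn h3

theorem fill_subset_of_gconvex {C : Set X} (hC : GConvex C) (hCc : IsClosed C) (hL : Continuous L)
    (hp : ∀ t, L (t + 1) = L t) (hLC : ∀ t, L t ∈ C) : fill L ⊆ C := by
  rintro w (⟨t, rfl⟩ | hw)
  · exact hLC t
  · by_contra hwC
    obtain ⟨φ, h1, h2, n, hn, h3⟩ := hw.2 Cᶜ hCc.isOpen_compl hwC (by
      rw [Set.disjoint_left]; rintro _ h ⟨t, rfl⟩; exact h (hLC t))
    rw [compl_compl] at h1 h2
    exact hn (h3.unique (hasDeg_zero_of_gconvex hC hL hp hLC h1 h2))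

theorem fill_subset_of_H1Trivial {E : Set X} (hE : H1Trivial E) (hEc : IsClosed E)
    (hL : Continuous L) (hp : ∀ t, L (t + 1) = L t) (hLE : ∀ t, L t ∈ E) : fill L ⊆ E := by
  rintro w (⟨t, rfl⟩ | hw)
  · exact hLE t
  · by_contra hwC
    obtain ⟨φ, h1, h2, n, hn, h3⟩ := hw.2 Eᶜ hEc.isOpen_compl hwC (by
      rw [Set.disjoint_left]; rintro _ h ⟨t, rfl⟩; exact h (hLE t))
    rw [compl_compl] at h1 h2
    exact hn (h3.unique (hasDeg_zero_of_H1Trivial hE hL hp hLE h1 h2))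

theorem isCompact_fill (hL : Continuous L) (hp : ∀ t, L (t + 1) = L t) : IsCompact (fill L) := by
  have hK := isCompact_range_of_periodic hL hp
  set K := (fun x : X × ℝ => geo (L 0) x.1 x.2) '' (range L ×ˢ Icc 0 1) with hKdef
  have hKc : IsCompact K := (hK.prod isCompact_Icc).image
    (continuous_geo_comp continuous_const continuous_fst continuous_snd)
  refine hKc.of_isClosed_subset (isClosed_fill L) ?_
  have hgK : ∀ s ∈ Icc (0 : ℝ) 1, ∀ t, geo (L 0) (L t) s ∈ K := fun s hs t =>
    ⟨(L t, s), ⟨mem_range_self t, hs⟩, rfl⟩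
  have hLK : ∀ t, L t ∈ K := fun t => by simpa using hgK 1 ⟨zero_le_one, le_rfl⟩ t
  rintro w (⟨t, rfl⟩ | hw)
  · exact hLK t
  · by_contra hwC
    obtain ⟨φ, h1, h2, n, hn, h3⟩ := hw.2 Kᶜ hKc.isClosed.isOpen_compl hwC (by
      rw [Set.disjoint_left]; rintro _ h ⟨t, rfl⟩; exact h (hLK t))
    rw [compl_compl] at h1 h2
    refine hn (h3.unique ?_)
    have := HasDeg.homotopy (fun s t => φ (geo (L 0) (L t) s))
      (h1.comp (continuous_geo_comp continuous_const (hL.comp continuous_snd)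
        continuous_fst).continuousOn fun x hx => hgK _ hx.1 _)
      (fun s hs t => h2 _ (hgK s hs t)) (fun s _ t => by rw [hp]) (n := 0)
      (by simpa only [geo_zero] using hasDeg_const (h2 _ (hLK 0)))
    simpa only [geo_one] using this

/-- If the degree of `φ` along `L` is nonzero and `φ` is continuous without zeros off compact
subsets of finitely many disjoint patches, then `L` encloses one of any chosen points of the
patches. -/
theorem exists_enc_of_hasDeg (hL : Continuous L) (hp : ∀ t, L (t + 1) = L t) {ι : Type*}
    (s : Finset ι) {O Z : ι → Set X} {g : ι → X → ℂ} {h : ι → ℂ → X} {x : ι → X}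
    (c : ∀ i ∈ s, IsPatch (O i) (g i) (h i)) (hO : ∀ i ∈ s, ∀ j ∈ s, i ≠ j → Disjoint (O i) (O j))
    (hOL : ∀ i ∈ s, Disjoint (O i) (range L)) (hZ : ∀ i ∈ s, IsCompact (Z i))
    (hZO : ∀ i ∈ s, Z i ⊆ O i) (hx : ∀ i ∈ s, x i ∈ O i) {φ : X → ℂ}
    (hφ : ContinuousOn φ (⋃ i ∈ s, Z i)ᶜ) (h0 : ∀ y, (∀ i ∈ s, y ∉ Z i) → φ y ≠ 0) {n : ℤ}
    (hn : n ≠ 0) (hd : HasDeg (fun t => φ (L t)) n) : ∃ i ∈ s, Enc L (x i) := by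
  classical
  induction s using Finset.induction_on generalizing φ n with
  | empty =>
    exfalso
    refine hn (hd.unique (hasDeg_zero_of_gconvex (C := univ) (fun _ _ _ _ _ _ => mem_univ _) hL hp
      (fun _ => mem_univ _) (by simpa using hφ) fun y _ => h0 y (by simp)))
  | insert i s his ih =>
    have hi : i ∈ insert i s := Finset.mem_insert_self i s
    have hs : ∀ j ∈ s, j ∈ insert i s := fun j hj => Finset.mem_insert_of_mem hj
    set W : Set X := (⋃ j ∈ s, Z j)ᶜ with hW
    have hWZ : W \ Z i = (⋃ j ∈ insert i s, Z j)ᶜ := by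
      ext y; simp [hW, and_comm]
    have hOW : O i ⊆ W := by
      intro y hy hyW
      simp only [mem_iUnion] at hyW
      obtain ⟨j, hj, hyj⟩ := hyW
      exact (hO i hi j (hs j hj) (fun e => his (e ▸ hj))).le_bot ⟨hy, hZO j (hs j hj) hyj⟩
    obtain ⟨d, A, ψ, hA, hA0, hψ, hψ0, he⟩ := (c i hi).exists_absorb (hZ i hi) (hZO i hi) (hx i hi)
      hOW (φ := φ) (by rw [hWZ]; exact hφ) (by
        intro y hy
        rw [hWZ] at hy
        exact h0 y (by simpa using hy))
    have hLx : ∀ t, L t ≠ x i := fun t ht =>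
      (hOL i hi).le_bot ⟨hx i hi, ⟨t, ht⟩⟩
    have hLW : ∀ t, L t ∈ W \ O i := by
      intro t
      refine ⟨fun h => ?_, fun h => (hOL i hi).le_bot ⟨h, mem_range_self t⟩⟩
      simp only [mem_iUnion] at h
      obtain ⟨j, hj, hyj⟩ := h
      exact (hOL j (hs j hj)).le_bot ⟨hZO j (hs j hj) hyj, mem_range_self t⟩
    obtain ⟨a, ha⟩ := exists_hasDeg (c := fun t => A (L t)) (hA.comp hL)
      (fun t => hA0 _ (hLx t)) fun t => by rw [hp]
    by_cases ha0 : a = 0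
    · subst ha0
      have h1 : HasDeg (fun t => φ (L t) / A (L t) ^ d) n := by
        simpa using hd.div (ha.zpow d)
      have h2 : HasDeg (fun t => ψ (L t)) n := h1.congr fun t => by
        rw [he _ (hLW t), mul_div_cancel_right₀]
        exact zpow_ne_zero _ (hA0 _ (hLx t))
      obtain ⟨j, hj, hjE⟩ := ih (fun j hj => c j (hs j hj))
        (fun j hj k hk => hO j (hs j hj) k (hs k hk)) (fun j hj => hOL j (hs j hj))
        (fun j hj => hZ j (hs j hj)) (fun j hj => hZO j (hs j hj)) (fun j hj => hx j (hs j hj))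
        hψ (fun y hy => hψ0 y (by simpa [hW] using hy)) hn h2
      exact ⟨j, hs j hj, hjE⟩
    · refine ⟨i, hi, fun ⟨t, ht⟩ => hLx t ht, fun U hU hxU hdis => ⟨A, hA.continuousOn, ?_, a, ha0, ha⟩⟩
      exact fun y hy => hA0 y fun e => hy (e ▸ hxU)

/-- Enclosure is constant along a patch disjoint from the loop. -/
theorem IsPatch.enc_of_enc (hL : Continuous L) (hp : ∀ t, L (t + 1) = L t) {O : Set X} {g : X → ℂ}
    {h : ℂ → X} (c : IsPatch O g h) (hOL : Disjoint O (range L)) {x y : X} (hx : x ∈ O)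
    (hy : y ∈ O) (hE : Enc L x) : Enc L y := by
  obtain ⟨U, hU, hxU, hUO, hUc⟩ : ∃ U : Set X, IsOpen U ∧ x ∈ U ∧ closure U ⊆ O ∧
      IsCompact (closure U) := by
    obtain ⟨ε, hε, hεO⟩ := Metric.nhds_basis_closedBall.mem_iff.1
      (c.isOpen_image.mem_nhds (mem_image_of_mem g hx))
    have hK := c.isCompact_inter_preimage hεO (isCompact_closedBall _ _)
    have hsub : closure (O ∩ g ⁻¹' ball (g x) ε) ⊆ O ∩ g ⁻¹' closedBall (g x) ε :=
      closure_minimal (inter_subset_inter_right _ (preimage_mono ball_subset_closedBall))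
        hK.isClosed
    exact ⟨_, c.isOpen_inter_preimage isOpen_ball, ⟨hx, mem_ball_self hε⟩,
      hsub.trans inter_subset_left, hK.of_isClosed_subset isClosed_closure hsub⟩
  obtain ⟨φ, h1, h2, n, hn, h3⟩ := hE.2 U hU hxU (hOL.mono_left (subset_closure.trans hUO))
  have := exists_enc_of_hasDeg hL hp (s := ({()} : Finset Unit)) (O := fun _ => O)
    (Z := fun _ => closure U) (g := fun _ => g) (h := fun _ => h) (x := fun _ => y)
    (fun _ _ => c) (fun i _ j _ h => (h rfl).elim) (fun _ _ => hOL) (fun _ _ => hUc)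
    (fun _ _ => hUO) (fun _ _ => hy) (φ := φ)
    (h1.mono (compl_subset_compl.2 fun z hz => mem_iUnion₂.2 ⟨(), by simp, subset_closure hz⟩))
    (fun z hz => h2 z fun hzU => hz () (by simp) (subset_closure hzU)) hn h3
  simpa using this

end Enclosed

end Cat2Cx
end

noncomputable section

open Topology

namespace Cat2Cx

/-! ### Extending segments of enclosed points -/

section Extend

variable {κ : ℝ} {X : Type*} [MetricSpace X]

theorem PolyComplex2.disjoint_faces (PC : PolyComplex2 κ X) {F G : Set X} (hF : F ∈ PC.faces)
    (hG : G ∈ PC.faces) (h : F ≠ G) : Disjoint F G :=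
  Set.disjoint_iff_inter_eq_empty.2 (PC.cells_disjoint F (Or.inl hF) G (Or.inl hG) h)

theorem PolyComplex2.exists_patch [CatZero X] (hκ : κ ≤ 0) (PC : PolyComplex2 κ X) {F : Set X}
    (hF : F ∈ PC.faces) (b : X) (ρ : ℝ) : ∃ g h, IsPatch (F ∩ ball b ρ) g h := by
  obtain ⟨-, hc, g, h, c⟩ := exists_isFaceChart hκ PC hF
  exact ⟨g, h, c.isPatch (PC.faces_open F hF) hc isOpen_ball (gconvex_ball b ρ)⟩

theorem exists_log_extension [CatZero X] {A : Set X} (hA : IsClosed A) {a : X} {φ : X → ℂ}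
    {V : Set X} (hφ : ContinuousOn φ V) (h0 : ∀ y ∈ V, φ y ≠ 0)
    (hV : ∀ y ∈ A, ∀ s ∈ Icc (0 : ℝ) 1, geo a y s ∈ V) :
    ∃ u : X → ℂ, Continuous u ∧ ∀ y ∈ A, Complex.exp (u y) = φ y := by
  have hc : Continuous fun x : unitInterval × A => φ (geo a x.2 x.1) :=
    hφ.comp_continuous (continuous_geo_comp continuous_const
      (continuous_subtype_val.comp continuous_snd) (continuous_subtype_val.comp continuous_fst))
      fun x => hV _ x.2.2 _ x.1.2
  obtain ⟨u, hu, he⟩ := exists_log_of_homotopy (A := A) ⟨_, hc⟩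
    (fun x => h0 _ (hV _ x.2.2 _ x.1.2)) (φ a) (fun y => by simp)
  obtain ⟨v, hv⟩ := ContinuousMap.exists_restrict_eq hA (⟨u, hu⟩ : C(A, ℂ))
  refine ⟨v, v.continuous, fun y hy => ?_⟩
  have h1 : v y = u ⟨y, hy⟩ := DFunLike.congr_fun hv ⟨y, hy⟩
  rw [h1, he]; simp

variable [CatZero X] {L : ℝ → X}

theorem exists_face_enc_of_extension (hκ : κ ≤ 0) (PC : PolyComplex2 κ X) (hL : Continuous L)
    (hp : ∀ t, L (t + 1) = L t) {a b : X} {ρ r : ℝ} (hb : Enc L b)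
    (hcpt : IsCompact (closedBall b ρ)) (hdis : Disjoint (closedBall b ρ) (range L))
    (hr : 0 < r) (hrρ : r < ρ) (𝓕 : Finset (Set X)) (h𝓕 : ∀ F ∈ 𝓕, F ∈ PC.faces)
    (hS : ∀ w, dist b w = r → Btw a b w → ∃ F ∈ 𝓕, w ∈ F) :
    ∃ F ∈ 𝓕, ∃ w ∈ F, dist b w = r ∧ Btw a b w ∧ ∀ y ∈ F, dist b y < ρ → Enc L y := by
  classical
  by_contra hcon
  push Not at hcon
  set S : Set X := {w | dist b w = r ∧ Btw a b w} with hSdef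
  set 𝓖 := 𝓕.filter fun F => (S ∩ F).Nonempty with h𝓖
  have hx : ∀ F ∈ 𝓖, ∃ y ∈ F, dist b y < ρ ∧ ¬ Enc L y := by
    intro F hF
    rw [h𝓖, Finset.mem_filter] at hF
    obtain ⟨hF, w, hw, hwF⟩ := hF
    exact hcon F hF w hwF hw.1 hw.2
  have : Nonempty X := ⟨b⟩
  choose! x hxF hxρ hxE using hx
  have hGf : ∀ F ∈ 𝓖, F ∈ PC.faces := fun F hF => h𝓕 F (Finset.mem_filter.1 hF).1
  have hpatch : ∀ F ∈ 𝓖, ∃ g h, IsPatch (F ∩ ball b ρ) g h := fun F hF =>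
    PC.exists_patch hκ (hGf F hF) b ρ
  choose! g h hgh using hpatch
  have hSc : IsCompact S := by
    refine hcpt.of_isClosed_subset ?_ fun w hw => ?_
    · refine IsClosed.inter (isClosed_eq (by fun_prop) continuous_const) ?_
      exact isClosed_eq (f := fun w => dist a b + dist b w) (g := fun w => dist a w)
        (by fun_prop) (by fun_prop)
    · rw [mem_closedBall']; exact hw.1.le.trans hrρ.le
  set V : Set X := ⋃ F ∈ 𝓖, F ∩ ball b ρ with hV
  have hVo : IsOpen V := isOpen_biUnion fun F hF => (hgh F hF).isOpen
  have hSV : S ⊆ V := by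
    intro w hw
    obtain ⟨F, hF, hwF⟩ := hS w hw.1 hw.2
    exact mem_iUnion₂.2 ⟨F, Finset.mem_filter.2 ⟨hF, w, hw, hwF⟩, hwF, by
      rw [mem_ball']; exact hw.1.trans_lt hrρ⟩
  obtain ⟨η, hη, hηV⟩ := hSc.exists_cthickening_subset_open hVo hSV
  have hVb : V ⊆ closedBall b ρ := iUnion₂_subset fun F _ =>
    inter_subset_right.trans ball_subset_closedBall
  have hNc : IsCompact (cthickening η S) :=
    hcpt.of_isClosed_subset isClosed_cthickening (hηV.trans hVb)
  set A : Set X := sphere b r \ thickening η S with hA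
  have hAcl : IsClosed A := isClosed_sphere.sdiff isOpen_thickening
  have hAcp : IsCompact A := hcpt.of_isClosed_subset hAcl
    (sdiff_subset.trans (sphere_subset_closedBall.trans (closedBall_subset_closedBall hrρ.le)))
  set K : Set X := (fun x : X × ℝ => geo a x.1 x.2) '' (A ×ˢ Icc 0 1) with hK
  have hKc : IsCompact K := (hAcp.prod isCompact_Icc).image
    (continuous_geo_comp continuous_const continuous_fst continuous_snd)
  have hbK : b ∉ K := by
    rintro ⟨⟨y, s⟩, ⟨hy, hs⟩, he⟩
    refine hy.2 (self_subset_thickening hη _ ⟨by rw [dist_comm]; exact hy.1, ?_⟩)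
    dsimp only at he hs
    rw [← he]; exact btw_geo a y hs
  obtain ⟨ε, hε, hεK⟩ := Metric.isOpen_iff.1 hKc.isClosed.isOpen_compl b hbK
  set U := ball b (min ε r) with hU
  have hUρ : U ⊆ closedBall b ρ := (ball_subset_ball ((min_le_right _ _).trans hrρ.le)).trans
    ball_subset_closedBall
  obtain ⟨φ, hφ, hφ0, n, hn, hdeg⟩ := hb.2 U isOpen_ball (mem_ball_self (lt_min hε hr))
    (hdis.mono_left hUρ)
  obtain ⟨u, hu, hue⟩ := exists_log_extension hAcl (a := a) hφ hφ0 (fun y hy s hs hyU =>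
    hεK (ball_subset_ball (min_le_left _ _) hyU) ⟨(y, s), ⟨hy, hs⟩, rfl⟩)
  set φ' : X → ℂ := fun y => if r ≤ dist b y then φ y else Complex.exp (u y) with hφ'
  have hZ : (⋃ F ∈ 𝓖, cthickening η S ∩ F) = cthickening η S := by
    refine Subset.antisymm (iUnion₂_subset fun F _ => inter_subset_left) fun y hy => ?_
    obtain ⟨F, hF, hyF⟩ := mem_iUnion₂.1 (hηV hy)
    exact mem_iUnion₂.2 ⟨F, hF, hy, hyF.1⟩
  have hrU : ∀ y, r ≤ dist b y → y ∈ Uᶜ := fun y hy hyU => by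
    rw [hU, mem_ball'] at hyU
    exact absurd (hyU.trans_le (min_le_right _ _)) (not_lt.2 hy)
  have hLr : ∀ t, r ≤ dist b (L t) := fun t => by
    by_contra hlt
    refine hdis.le_bot ⟨?_, mem_range_self t⟩
    rw [mem_closedBall']; linarith
  have hres := exists_enc_of_hasDeg hL hp 𝓖 (O := fun F => F ∩ ball b ρ)
    (Z := fun F => cthickening η S ∩ F) (x := x) hgh
    (fun F hF G hG hne => (PC.disjoint_faces (hGf F hF) (hGf G hG) hne).mono inter_subset_left
      inter_subset_left)
    (fun F _ => hdis.mono_left (inter_subset_right.trans ball_subset_closedBall))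
    (fun F hF => ?_) (fun F hF y hy => ?_)
    (fun F hF => ⟨hxF F hF, by rw [mem_ball']; exact hxρ F hF⟩) (φ := φ') ?_ ?_ hn ?_
  · obtain ⟨F, hF, hE⟩ := hres
    exact hxE F hF hE
  · have : cthickening η S ∩ F = cthickening η S \ ⋃ G ∈ 𝓖.erase F, G ∩ ball b ρ := by
      ext y; constructor
      · rintro ⟨hy, hyF⟩
        refine ⟨hy, fun hyG => ?_⟩
        obtain ⟨G, hG, hyG⟩ := mem_iUnion₂.1 hyG
        rw [Finset.mem_erase] at hG
        exact (PC.disjoint_faces (hGf F hF) (hGf G hG.2) hG.1.symm).le_bot ⟨hyF, hyG.1⟩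
      · rintro ⟨hy, hyn⟩
        obtain ⟨G, hG, hyG⟩ := mem_iUnion₂.1 (hηV hy)
        by_cases hGF : G = F
        · exact ⟨hy, hGF ▸ hyG.1⟩
        · exact (hyn (mem_iUnion₂.2 ⟨G, Finset.mem_erase.2 ⟨hGF, hG⟩, hyG⟩)).elim
    rw [this]
    exact hNc.diff (isOpen_biUnion fun G hG => (hgh G (Finset.mem_of_mem_erase hG)).isOpen)
  · obtain ⟨G, hG, hyG⟩ := mem_iUnion₂.1 (hηV hy.1)
    exact ⟨hy.2, hyG.2⟩
  · rw [hZ]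
    refine continuousOn_glue (C₁ := {y | r ≤ dist b y}) (C₂ := {y | dist b y ≤ r}) (f₁ := φ)
      (f₂ := fun y => Complex.exp (u y))
      (isClosed_le continuous_const (by fun_prop)) (isClosed_le (by fun_prop) continuous_const)
      (fun y _ => le_total r (dist b y)) (hφ.mono fun y hy => hrU y hy.2)
      (Complex.continuous_exp.comp hu).continuousOn (fun y hy => if_pos hy.2) fun y hy => ?_
    rcases (show dist b y ≤ r from hy.2).lt_or_eq with hlt | heq
    · exact if_neg (not_le.2 hlt)
    · rw [hφ']; dsimp only
      rw [if_pos heq.ge, hue]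
      exact ⟨by rw [mem_sphere']; exact heq, fun h => hy.1 (thickening_subset_cthickening _ _ h)⟩
  · intro y _
    rw [hφ']; dsimp only
    split_ifs with hy
    · exact hφ0 y (hrU y hy)
    · exact Complex.exp_ne_zero _
  · exact hdeg.congr fun t => by rw [hφ']; dsimp only; rw [if_pos (hLr t)]

end Extend

end Cat2Cx
end

noncomputable section

open Topology

namespace Cat2Cx

/-! ### Geodesics crossing edges -/

section Edges

open ComplexConjugate

/-- The signed area function, positive to the left of the oriented line from `a` to `b`. -/
def side (a b z : ℂ) : ℝ := ((z - a) * conj (b - a)).im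

theorem side_eq (a b z : ℂ) :
    side a b z = (z.im - a.im) * (b.re - a.re) - (z.re - a.re) * (b.im - a.im) := by
  simp [side]; ring

theorem side_left (a b : ℂ) : side a b a = 0 := by simp [side]

theorem side_right (a b : ℂ) : side a b b = 0 := by rw [side_eq]; ring

theorem side_combo (a b x y : ℂ) {s t : ℝ} (h : s + t = 1) :
    side a b (s • x + t • y) = s * side a b x + t * side a b y := by
  obtain rfl : t = 1 - s := by linarith
  simp [side_eq]; ring

theorem exists_frontier_near {P : Set ℂ} (hP : Convex ℝ P) {a b : ℂ} (ha : a ∈ interior P)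
    (hb : b ∈ frontier P) {δ : ℝ} (hδ : 0 < δ) {σ : ℝ} (hσ : σ ≠ 0) :
    ∃ y ∈ frontier P, dist y b < δ ∧ 0 < σ * side a b y := by
  set R : Set ℂ := (fun y => y + a) ⁻¹' P with hR
  have hRc : Convex ℝ R := hP.affine_preimage (AffineMap.id ℝ ℂ + AffineMap.const ℝ ℂ a)
  have hhom : frontier R = (fun y => y + a) ⁻¹' frontier P :=
    ((Homeomorph.addRight a).preimage_frontier P).symm
  have hR0 : R ∈ 𝓝 (0 : ℂ) := by
    have : Tendsto (fun y : ℂ => y + a) (𝓝 0) (𝓝 (0 + a)) := (continuous_add_const a).tendsto 0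
    rw [zero_add] at this
    exact this (mem_interior_iff_mem_nhds.1 ha)
  have hbR : b - a ∈ frontier R := by rw [hhom]; simpa using hb
  have hg1 : gauge R (b - a) = 1 := (gauge_eq_one_iff_mem_frontier hRc hR0).2 hbR
  have hgc : Continuous (gauge R) := continuous_gauge hRc hR0
  set y : ℝ → ℂ := fun ε => (b - a) + ε • (σ • (Complex.I * (b - a))) with hy
  have hyc : Continuous y := by fun_prop
  have hgy : Tendsto (fun ε => gauge R (y ε)) (𝓝 0) (𝓝 1) := by
    have := (hgc.comp hyc).tendsto 0
    simpa [hy, hg1, Function.comp_def] using this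
  have hlim : Tendsto (fun ε => (gauge R (y ε))⁻¹ • y ε + a) (𝓝 0) (𝓝 b) := by
    have := ((hgy.inv₀ one_ne_zero).smul (hyc.tendsto 0)).add_const a
    simpa [hy] using this
  have hev := (Metric.tendsto_nhds.1 hlim δ hδ).and (hgy.eventually (lt_mem_nhds zero_lt_one))
  obtain ⟨ε, ⟨h1, h2⟩, hε⟩ := ((hev.filter_mono nhdsWithin_le_nhds).and
    (self_mem_nhdsWithin (s := Ioi (0 : ℝ)))).exists
  have hba : b - a ≠ 0 := by
    intro h0
    rw [h0, gauge_zero] at hg1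
    exact zero_ne_one hg1
  refine ⟨_, ?_, h1, ?_⟩
  · have : (gauge R (y ε))⁻¹ • y ε ∈ frontier R := by
      rw [← gauge_eq_one_iff_mem_frontier hRc hR0, gauge_smul_of_nonneg (inv_nonneg.2 h2.le),
        smul_eq_mul, inv_mul_cancel₀ h2.ne']
    rwa [hhom] at this
  · have hn : 0 < Complex.normSq (b - a) := Complex.normSq_pos.2 hba
    have hs : side a b ((gauge R (y ε))⁻¹ • y ε + a) =
        (gauge R (y ε))⁻¹ * (ε * (σ * Complex.normSq (b - a))) := by
      rw [side_eq, Complex.normSq_apply]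
      simp [hy]
      ring
    rw [hs]
    have hσ2 : 0 < σ * σ := mul_self_pos.2 hσ
    have : σ * ((gauge R (y ε))⁻¹ * (ε * (σ * Complex.normSq (b - a)))) =
      (gauge R (y ε))⁻¹ * (ε * ((σ * σ) * Complex.normSq (b - a))) := by ring
    rw [this]
    have hε' : 0 < ε := hε
    positivity

variable {κ : ℝ} {X : Type*} [MetricSpace X] [CatZero X]

theorem IsFaceChart.geo_mem {F : Set X} {g : X → ℂ} {h : ℂ → X} (c : IsFaceChart F g h)
    (hF : GConvex (closure F)) {b w : X} (hb : b ∈ closure F) (hw : w ∈ F) {t : ℝ}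
    (ht : t ∈ Ioc (0 : ℝ) 1) : geo b w t ∈ F := by
  have ht' : t ∈ Icc (0 : ℝ) 1 := ⟨ht.1.le, ht.2⟩
  have hwc := subset_closure hw
  rcases eq_or_ne b w with rfl | hbw
  · rwa [geo_self]
  have hm := hF b hb w hwc t ht'
  rw [c.eq_inter]
  refine ⟨hm, ?_⟩
  have hP := c.convex_image hF Subset.rfl hF
  have hseg := (c.btw b hb _ hm w hwc).1 (btw_geo b w ht')
  have hgw : g w ∈ interior (g '' closure F) := by
    rw [← c.image_eq]; exact mem_image_of_mem _ hw
  have hne : g (geo b w t) ≠ g b := by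
    intro he
    have := c.injOn hm hb he
    have h2 := dist_left_geo b w ht'
    rw [this, dist_self] at h2
    exact (mul_pos ht.1 (dist_pos.2 hbw)).ne h2
  rw [← insert_endpoints_openSegment] at hseg
  rcases hseg with he | he | he
  · exact (hne he).elim
  · rw [mem_preimage, he]; exact hgw
  · exact hP.openSegment_self_interior_subset_interior (mem_image_of_mem _ hb) hgw he

theorem btw_geo_geo (x y : X) {s t : ℝ} (hs : 0 ≤ s) (hst : s ≤ t) (ht : t ≤ 1) :
    Btw x (geo x y s) (geo x y t) := by
  have h1 := dist_left_geo x y (t := s) ⟨hs, hst.trans ht⟩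
  have h2 := dist_left_geo x y (t := t) ⟨hs.trans hst, ht⟩
  have h3 := dist_geo_geo x y (s := s) (t := t) ⟨hs, hst.trans ht⟩ ⟨hs.trans hst, ht⟩
  rw [abs_sub_comm, abs_of_nonneg (by linarith)] at h3
  unfold Btw
  rw [h1, h2, h3]; ring

/-- Small balls centred at a point of an edge meet no vertex and no other edge. -/
theorem exists_edge_nbhd (hκ : κ ≤ 0) (PC : PolyComplex2 κ X) {e : Set X} (he : e ∈ PC.edges)
    {b : X} (hb : b ∈ e) {ρ₀ : ℝ} (hρ₀ : 0 < ρ₀) :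
    ∃ ρ > 0, ρ ≤ ρ₀ ∧ IsCompact (closedBall b ρ) ∧ {c | c ∈ PC.faces ∧ b ∈ closure c}.Finite ∧
      ∀ y ∈ closedBall b ρ, y ∈ e ∨ ∃ F ∈ PC.faces, y ∈ F ∧ b ∈ closure F := by
  obtain ⟨ρ, hρ, h1, h2, h3, h4⟩ := exists_local_structure hκ PC b
  have hsub : closedBall b (min ρ ρ₀) ⊆ closedBall b ρ := closedBall_subset_closedBall (min_le_left _ _)
  have hbv : b ∉ PC.vertices := fun h => by
    have := PC.cells_vertex_disjoint e (Or.inr he)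
    exact (this ▸ (⟨hb, h⟩ : b ∈ e ∩ PC.vertices) : b ∈ (∅ : Set X))
  refine ⟨min ρ ρ₀, lt_min hρ hρ₀, min_le_right _ _, h1.of_isClosed_subset isClosed_closedBall hsub,
    h3, fun y hy => ?_⟩
  have hy' := hsub hy
  have hcov : y ∈ ⋃₀ PC.faces ∪ ⋃₀ PC.edges ∪ PC.vertices := PC.cover ▸ mem_univ y
  rcases hcov with (⟨F, hF, hyF⟩ | ⟨e', he', hye⟩) | hv
  · exact Or.inr ⟨F, hF, hyF, h4 F (Or.inl hF) ⟨y, hyF, hy'⟩⟩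
  · left
    have hbe := h4 e' (Or.inr he') ⟨y, hye, hy'⟩
    by_contra hne
    have hee : e' ≠ e := fun h => hne (h ▸ hye)
    refine hbv (PC.edge_closure e' he' ⟨hbe, fun h => ?_⟩)
    have := PC.cells_disjoint e' (Or.inr he') e (Or.inr he) hee
    exact (this ▸ (⟨h, hb⟩ : b ∈ e' ∩ e) : b ∈ (∅ : Set X))
  · exact (hbv ((h2 ⟨hv, hy'⟩ : y = b) ▸ hv)).elim

theorem PolyComplex2.notMem_edge (PC : PolyComplex2 κ X) {F e : Set X} (hF : F ∈ PC.faces)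
    (he : e ∈ PC.edges) (hne : F ≠ e) {x : X} (hx : x ∈ F) : x ∉ e := fun h => by
  have := PC.cells_disjoint F (Or.inl hF) e (Or.inr he) hne
  exact (this ▸ (⟨hx, h⟩ : x ∈ F ∩ e) : x ∈ (∅ : Set X))

/-- A geodesic arriving from a face at a point of an edge leaves the edge. -/
theorem not_btw_of_mem_face (hκ : κ ≤ 0) (PC : PolyComplex2 κ X) {F e : Set X} (hF : F ∈ PC.faces)
    (he : e ∈ PC.edges) (hne : F ≠ e) {a b w : X} (ha : a ∈ F) (hb : b ∈ e) (hbF : b ∈ closure F)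
    (hw : w ∈ e) (hwb : w ≠ b) : ¬ Btw a b w := by
  intro hbt
  obtain ⟨-, hFc, g, h, c⟩ := exists_isFaceChart hκ PC hF
  obtain ⟨f, l, hl, hf, hfe⟩ := PC.edge_geodesic e he
  obtain ⟨ρ, hρ, -, -, -, hnb⟩ := exists_edge_nbhd hκ PC he hb one_pos
  have hac := subset_closure ha
  have hbF' : b ∉ F := fun h => PC.notMem_edge hF he hne h hb
  have hab : g a ≠ g b := fun h => hbF' (c.injOn hac hbF h ▸ ha)
  have hP := c.convex_image hFc Subset.rfl hFc
  have hPc : IsCompact (g '' closure F) := c.isCompact_closure.image_of_continuousOn c.continuousOn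
  have hga : g a ∈ interior (g '' closure F) := by rw [← c.image_eq]; exact mem_image_of_mem _ ha
  have hgb : g b ∈ frontier (g '' closure F) := by
    rw [hPc.isClosed.frontier_eq]
    refine ⟨mem_image_of_mem _ hbF, fun hi => hbF' ?_⟩
    rw [c.eq_inter]; exact ⟨hbF, hi⟩
  have hcol : ∀ {x y z : X}, x ∈ closure F → y ∈ closure F → z ∈ closure F → Btw x y z →
      ∃ s t : ℝ, 0 ≤ s ∧ 0 ≤ t ∧ s + t = 1 ∧ g y = s • g x + t • g z := by
    intro x y z hx hy hz hb
    obtain ⟨s, t, hs, ht, hst, h⟩ := (c.btw x hx y hy z hz).1 hb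
    exact ⟨s, t, hs, ht, hst, h.symm⟩
  -- points of the edge on either side of the line through `a` and `b`
  have hβ : ∀ σ : ℝ, σ ≠ 0 → ∃ β ∈ e, β ∈ closure F ∧ 0 < σ * side (g a) (g b) (g β) := by
    intro σ hσ
    have hcont := c.contInv (g b) (mem_image_of_mem _ hbF)
    rw [Metric.continuousWithinAt_iff] at hcont
    obtain ⟨δ, hδ, H⟩ := hcont ρ hρ
    obtain ⟨y, hy, hyb, hys⟩ := exists_frontier_near hP hga hgb hδ hσ
    have hyP := hPc.isClosed.frontier_subset hy
    have hym := c.inv_mem hyP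
    have hd := H hyP hyb
    rw [c.leftInv b hbF] at hd
    refine ⟨h y, ?_, hym.1, by rwa [hym.2]⟩
    rcases hnb (h y) hd.le with h1 | ⟨G, hG, hyG, -⟩
    · exact h1
    · exfalso
      have hyF : h y ∉ F := fun hyF => hy.2 (by
        rw [← hym.2, ← c.image_eq]; exact mem_image_of_mem _ hyF)
      have hFG : F ≠ G := fun h => hyF (h ▸ hyG)
      obtain ⟨z, hz1, hz2⟩ := mem_closure_iff.1 hym.1 G (PC.faces_open G hG) hyG
      exact (PC.disjoint_faces hF hG hFG).le_bot ⟨hz2, hz1⟩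
  rw [← hfe] at hb hw
  obtain ⟨tb, htb, hfb⟩ := hb
  obtain ⟨tw, htw, hfw⟩ := hw
  have hfd : ∀ x ∈ Ioo 0 l, ∀ y ∈ Ioo 0 l, dist (f x) (f y) = |x - y| := fun x hx y hy =>
    hf.2 x (Ioo_subset_Icc_self hx) y (Ioo_subset_Icc_self hy)
  have hfbtw : ∀ x ∈ Ioo 0 l, ∀ y ∈ Ioo 0 l, ∀ z ∈ Ioo 0 l, |x - y| + |y - z| = |x - z| →
      Btw (f x) (f y) (f z) := fun x hx y hy z hz h => by
    unfold Btw; rw [hfd x hx y hy, hfd y hy z hz, hfd x hx z hz, h]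
  have hopp : ∀ tβ ∈ Ioo 0 l, f tβ ∈ closure F → side (g a) (g b) (g (f tβ)) ≠ 0 →
      (tβ - tb) * (tw - tb) ≤ 0 := by
    intro tβ htβ hβF hβs
    by_contra! hpos
    have hcase : Btw b (f tβ) w ∨ Btw b w (f tβ) := by
      rw [← hfb, ← hfw]
      rcases mul_pos_iff.1 hpos with ⟨h1, h2⟩ | ⟨h1, h2⟩
      · rcases le_total tβ tw with h3 | h3
        · left; refine hfbtw _ htb _ htβ _ htw ?_
          rw [abs_of_nonpos (by linarith), abs_of_nonpos (by linarith), abs_of_nonpos (by linarith)]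
          ring
        · right; refine hfbtw _ htb _ htw _ htβ ?_
          rw [abs_of_nonpos (by linarith), abs_of_nonpos (by linarith), abs_of_nonpos (by linarith)]
          ring
      · rcases le_total tβ tw with h3 | h3
        · right; refine hfbtw _ htb _ htw _ htβ ?_
          rw [abs_of_nonneg (by linarith), abs_of_nonneg (by linarith), abs_of_nonneg (by linarith)]
          ring
        · left; refine hfbtw _ htb _ htβ _ htw ?_
          rw [abs_of_nonneg (by linarith), abs_of_nonneg (by linarith), abs_of_nonneg (by linarith)]
          ring
    rcases hcase with h1 | h1
    · have h2 : Btw a b (f tβ) := (Btw.trans_left hbt.symm h1.symm).1.symm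
      obtain ⟨s, t, hs, ht, hst, h3⟩ := hcol hac hbF hβF h2
      have h4 := side_combo (g a) (g b) (g a) (g (f tβ)) hst
      rw [← h3, side_right, side_left, mul_zero, zero_add] at h4
      have ht0 : t = 0 := by
        rcases mul_eq_zero.1 h4.symm with h | h
        · exact h
        · exact (hβs h).elim
      rw [ht0, zero_smul, add_zero, show s = 1 by linarith, one_smul] at h3
      exact hab h3.symm
    · have hwF : w ∈ closure F := hFc.btw hbF hβF h1
      obtain ⟨s, t, hs, ht, hst, h3⟩ := hcol hac hbF hwF hbt
      obtain ⟨s', t', hs', ht', hst', h3'⟩ := hcol hbF hwF hβF h1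
      have h4 := side_combo (g a) (g b) (g a) (g w) hst
      have h4' := side_combo (g a) (g b) (g b) (g (f tβ)) hst'
      rw [← h3, side_right, side_left, mul_zero, zero_add] at h4
      rw [← h3', side_right, mul_zero, zero_add] at h4'
      rw [h4'] at h4
      rcases mul_eq_zero.1 h4.symm with h | h
      · rw [h, zero_smul, add_zero, show s = 1 by linarith, one_smul] at h3
        exact hab h3.symm
      · rcases mul_eq_zero.1 h with h | h
        · rw [h, zero_smul, add_zero, show s' = 1 by linarith, one_smul] at h3'
          exact hwb (c.injOn hwF hbF h3')
        · exact hβs h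
  obtain ⟨β₁, hβ₁, hβ₁F, hs₁⟩ := hβ 1 one_ne_zero
  obtain ⟨β₂, hβ₂, hβ₂F, hs₂⟩ := hβ (-1) (by norm_num)
  rw [← hfe] at hβ₁ hβ₂
  obtain ⟨t₁, ht₁, rfl⟩ := hβ₁
  obtain ⟨t₂, ht₂, rfl⟩ := hβ₂
  have ho₁ := hopp t₁ ht₁ hβ₁F (by linarith)
  have ho₂ := hopp t₂ ht₂ hβ₂F (by linarith)
  have htwb : tw ≠ tb := fun h => hwb (by rw [← hfb, ← hfw, h])
  have hcase : Btw b (f t₁) (f t₂) ∨ Btw b (f t₂) (f t₁) := by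
    rw [← hfb]
    rcases htwb.lt_or_gt with h | h
    · have h1 : tb ≤ t₁ := by by_contra! h'; nlinarith
      have h2 : tb ≤ t₂ := by by_contra! h'; nlinarith
      rcases le_total t₁ t₂ with h3 | h3
      · left; refine hfbtw _ htb _ ht₁ _ ht₂ ?_
        rw [abs_of_nonpos (by linarith), abs_of_nonpos (by linarith), abs_of_nonpos (by linarith)]
        ring
      · right; refine hfbtw _ htb _ ht₂ _ ht₁ ?_
        rw [abs_of_nonpos (by linarith), abs_of_nonpos (by linarith), abs_of_nonpos (by linarith)]
        ring
    · have h1 : t₁ ≤ tb := by by_contra! h'; nlinarith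
      have h2 : t₂ ≤ tb := by by_contra! h'; nlinarith
      rcases le_total t₁ t₂ with h3 | h3
      · right; refine hfbtw _ htb _ ht₂ _ ht₁ ?_
        rw [abs_of_nonneg (by linarith), abs_of_nonneg (by linarith), abs_of_nonneg (by linarith)]
        ring
      · left; refine hfbtw _ htb _ ht₁ _ ht₂ ?_
        rw [abs_of_nonneg (by linarith), abs_of_nonneg (by linarith), abs_of_nonneg (by linarith)]
        ring
  rcases hcase with h1 | h1
  · obtain ⟨s, t, hs, ht, hst, h3⟩ := hcol hbF hβ₁F hβ₂F h1
    have h4 := side_combo (g a) (g b) (g b) (g (f t₂)) hst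
    rw [← h3, side_right] at h4
    nlinarith
  · obtain ⟨s, t, hs, ht, hst, h3⟩ := hcol hbF hβ₂F hβ₁F h1
    have h4 := side_combo (g a) (g b) (g b) (g (f t₁)) hst
    rw [← h3, side_right] at h4
    nlinarith

end Edges

end Cat2Cx
end

noncomputable section

open Topology

namespace Cat2Cx

/-! ### Extending geodesics inside the filling -/

section Extension

theorem PolyComplex2.face_or_edge_or_vertex {κ : ℝ} {X : Type*} [MetricSpace X]
    (PC : PolyComplex2 κ X) (x : X) :
    (∃ F ∈ PC.faces, x ∈ F) ∨ (∃ e ∈ PC.edges, x ∈ e) ∨ x ∈ PC.vertices := by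
  have := PC.cover ▸ mem_univ x
  rcases this with (⟨F, hF, h⟩ | ⟨F, hF, h⟩) | h
  · exact Or.inl ⟨F, hF, h⟩
  · exact Or.inr (Or.inl ⟨F, hF, h⟩)
  · exact Or.inr (Or.inr h)

variable {κ : ℝ} {X : Type*} [MetricSpace X] [CatZero X] {L : ℝ → X}

theorem PolyComplex2.face_ne_edge (hκ : κ ≤ 0) (PC : PolyComplex2 κ X) {F e : Set X}
    (hF : F ∈ PC.faces) (he : e ∈ PC.edges) : F ≠ e := by
  intro hFe
  obtain ⟨⟨x, hx⟩, hFc, g, h, c⟩ := exists_isFaceChart hκ PC hF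
  obtain ⟨f, l, hl, hf, hfe⟩ := PC.edge_geodesic e he
  have hop : IsOpen (g '' F) := by rw [c.image_eq]; exact isOpen_interior
  obtain ⟨ε, hε, hball⟩ := Metric.isOpen_iff.1 hop (g x) (mem_image_of_mem _ hx)
  obtain ⟨y, hy, hgy⟩ := hball (show g x + (ε / 2 : ℝ) ∈ ball (g x) ε by
    rw [mem_ball, dist_self_add_left, Complex.norm_real, Real.norm_eq_abs, abs_of_pos (by linarith)]
    linarith)
  obtain ⟨z, hz, hgz⟩ := hball (show g x + (ε / 2 : ℝ) * Complex.I ∈ ball (g x) ε by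
    rw [mem_ball, dist_self_add_left, norm_mul, Complex.norm_real, Real.norm_eq_abs,
      abs_of_pos (by linarith), Complex.norm_I]
    linarith)
  have key : ∀ {a b d : X}, a ∈ F → b ∈ F → d ∈ F → Btw a b d →
      ∃ s t : ℝ, s + t = 1 ∧ g b = s • g a + t • g d := by
    intro a b d ha hb hd hbt
    obtain ⟨s, t, -, -, hst, h⟩ := (c.btw a (subset_closure ha) b (subset_closure hb) d
      (subset_closure hd)).1 hbt
    exact ⟨s, t, hst, h.symm⟩
  have hyre : (g y).re = (g x).re + ε / 2 := by rw [hgy]; simp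
  have hyim : (g y).im = (g x).im := by rw [hgy]; simp
  have hzre : (g z).re = (g x).re := by rw [hgz]; simp
  have hzim : (g z).im = (g x).im + ε / 2 := by rw [hgz]; simp
  have n1 : ¬ Btw x y z := fun hb => by
    obtain ⟨s, t, hst, h⟩ := key hx hy hz hb
    have h1 := congrArg Complex.re h
    have h2 := congrArg Complex.im h
    simp only [Complex.add_re, Complex.add_im, Complex.real_smul, Complex.re_ofReal_mul, Complex.im_ofReal_mul,
      hyre, hyim, hzre, hzim] at h1 h2
    obtain rfl : s = 1 - t := by linarith
    nlinarith
  have n2 : ¬ Btw x z y := fun hb => by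
    obtain ⟨s, t, hst, h⟩ := key hx hz hy hb
    have h1 := congrArg Complex.re h
    have h2 := congrArg Complex.im h
    simp only [Complex.add_re, Complex.add_im, Complex.real_smul, Complex.re_ofReal_mul, Complex.im_ofReal_mul,
      hyre, hyim, hzre, hzim] at h1 h2
    obtain rfl : s = 1 - t := by linarith
    nlinarith
  have n3 : ¬ Btw y x z := fun hb => by
    obtain ⟨s, t, hst, h⟩ := key hy hx hz hb
    have h1 := congrArg Complex.re h
    have h2 := congrArg Complex.im h
    simp only [Complex.add_re, Complex.add_im, Complex.real_smul, Complex.re_ofReal_mul, Complex.im_ofReal_mul,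
      hyre, hyim, hzre, hzim] at h1 h2
    obtain rfl : s = 1 - t := by linarith
    have : t * ε = 0 := by linarith
    rcases mul_eq_zero.1 this with h | h
    · rw [h] at h1; linarith
    · linarith
  rw [hFe, ← hfe] at hx hy hz
  obtain ⟨tx, htx, rfl⟩ := hx
  obtain ⟨ty, hty, rfl⟩ := hy
  obtain ⟨tz, htz, rfl⟩ := hz
  have hfb : ∀ {a b d : ℝ}, a ∈ Ioo 0 l → b ∈ Ioo 0 l → d ∈ Ioo 0 l → a ≤ b → b ≤ d →
      Btw (f a) (f b) (f d) := by
    intro a b d ha hb hd hab hbd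
    have h1 := hf.2 a (Ioo_subset_Icc_self ha) b (Ioo_subset_Icc_self hb)
    have h2 := hf.2 b (Ioo_subset_Icc_self hb) d (Ioo_subset_Icc_self hd)
    have h3 := hf.2 a (Ioo_subset_Icc_self ha) d (Ioo_subset_Icc_self hd)
    rw [abs_of_nonpos (by linarith)] at h1 h2 h3
    change dist _ _ = _ at h1 h2 h3
    unfold Btw; linarith
  rcases le_total tx ty with h1 | h1 <;> rcases le_total ty tz with h2 | h2 <;>
    rcases le_total tx tz with h3 | h3
  · exact n1 (hfb htx hty htz h1 h2)
  · exact n1 (hfb htx hty htz h1 h2)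
  · exact n2 (hfb htx htz hty h3 h2)
  · exact n3 (hfb htz htx hty h3 h1).symm
  · exact n3 (hfb hty htx htz h1 h3)
  · exact n2 (hfb hty htz htx h2 h3).symm
  · exact n1 (hfb htz hty htx h2 h1).symm
  · exact n1 (hfb htz hty htx h2 h1).symm

/-- A geodesic which starts in a face and avoids the vertices never contains two points of an
edge. -/
theorem not_btw_of_start_in_face (hκ : κ ≤ 0) (PC : PolyComplex2 κ X) {F e : Set X}
    (hF : F ∈ PC.faces) (he : e ∈ PC.edges) {x b w : X} (hx : x ∈ F)
    (hv : ∀ y, Btw x y b → y ∉ PC.vertices) (hb : b ∈ e) (hw : w ∈ e) (hwb : w ≠ b) :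
    ¬ Btw x b w := by
  intro hbt
  set A : Set ℝ := {s | s ∈ Icc (0 : ℝ) 1 ∧ geo x b s ∈ e} with hA
  have hcont : Continuous fun s : ℝ => geo x b s :=
    continuous_geo_comp continuous_const continuous_const continuous_id
  have hAeq : A = Icc (0 : ℝ) 1 ∩ (fun s => geo x b s) ⁻¹' closure e := by
    ext s; constructor
    · rintro ⟨h1, h2⟩; exact ⟨h1, subset_closure h2⟩
    · rintro ⟨h1, h2⟩
      refine ⟨h1, ?_⟩
      by_contra h3
      exact hv _ (btw_geo x b h1) (PC.edge_closure e he ⟨h2, h3⟩)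
  have hAc : IsCompact A := by
    rw [hAeq]; exact isCompact_Icc.inter_right (isClosed_closure.preimage hcont)
  have hAne : A.Nonempty := ⟨1, by simp, by rwa [geo_one]⟩
  obtain ⟨s₀, ⟨hs₀, hs₀e⟩, hmin⟩ := hAc.exists_isLeast hAne
  have hs₀pos : 0 < s₀ := by
    rcases hs₀.1.eq_or_lt with h | h
    · exfalso
      rw [← h, geo_zero] at hs₀e
      exact PC.notMem_edge hF he (PC.face_ne_edge hκ hF he) hx hs₀e
    · exact h
  set b₀ := geo x b s₀ with hb₀
  obtain ⟨ρ, hρ, -, -, -, hnb⟩ := exists_edge_nbhd hκ PC he hs₀e one_pos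
  obtain ⟨δ, hδ, H⟩ := Metric.continuous_iff.1 hcont s₀ ρ hρ
  set s := max (s₀ / 2) (s₀ - δ / 2) with hs
  have hs1 : 0 < s := lt_of_lt_of_le (by linarith) (le_max_left _ _)
  have hs2 : s < s₀ := max_lt (by linarith) (by linarith)
  have hsm : s ∈ Icc (0 : ℝ) 1 := ⟨hs1.le, hs2.le.trans hs₀.2⟩
  have hd : dist (geo x b s) b₀ < ρ := H s (by
    rw [Real.dist_eq, abs_of_neg (by linarith)]
    have := le_max_right (s₀ / 2) (s₀ - δ / 2)
    linarith)
  have hb1 : Btw x b₀ b := btw_geo x b hs₀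
  have hb2 : Btw x (geo x b s) b₀ := btw_geo_geo x b hs1.le hs2.le hs₀.2
  have hb3 : Btw (geo x b s) b₀ b := (hb1.trans_left hb2).1
  have hb4 : Btw (geo x b s) b₀ w ∧ w ≠ b₀ := by
    have h1 := (hbt.trans_left hb1).1
    have h2 : Btw x b₀ w := (hbt.trans_left hb1).2
    refine ⟨(h2.trans_left hb2).1, ?_⟩
    rintro rfl
    unfold Btw at h1
    rw [dist_self] at h1
    have := dist_nonneg (x := b₀) (y := b)
    have := dist_nonneg (x := b) (y := b₀)
    exact hwb (dist_eq_zero.1 (by linarith))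
  rcases hnb _ hd.le with h | ⟨G, hG, h1, h2⟩
  · exact absurd (hmin ⟨hsm, h⟩) (not_le.2 hs2)
  · exact not_btw_of_mem_face hκ PC hG he (PC.face_ne_edge hκ hG he) h1 hs₀e h2 hw hb4.2 hb4.1

/-- A geodesic issuing from a face, avoiding the vertices and ending at an enclosed point can be
prolonged inside the set of enclosed points. -/
theorem exists_enc_extension (hκ : κ ≤ 0) (PC : PolyComplex2 κ X) (hL : Continuous L)
    (hp : ∀ t, L (t + 1) = L t) {F : Set X} (hF : F ∈ PC.faces) {x b : X} (hx : x ∈ F)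
    (hv : ∀ y, Btw x y b → y ∉ PC.vertices) (hb : Enc L b) :
    ∃ w, w ≠ b ∧ Btw x b w ∧ ∀ y, Btw b y w → Enc L y := by
  classical
  have hRc : IsClosed (range L) := (isCompact_range_of_periodic hL hp).isClosed
  obtain ⟨ρ₁, hρ₁, hρ₁d⟩ : ∃ ρ > 0, Disjoint (closedBall b ρ) (range L) := by
    obtain ⟨ρ, hρ, h⟩ := Metric.nhds_basis_closedBall.mem_iff.1
      (hRc.isOpen_compl.mem_nhds hb.1)
    exact ⟨ρ, hρ, disjoint_left.2 fun y hy hyL => h hy hyL⟩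
  obtain ⟨ρ, hρ, hρ1, hcpt, 𝓕, h𝓕, hS⟩ : ∃ ρ > 0, ρ ≤ ρ₁ ∧ IsCompact (closedBall b ρ) ∧
      ∃ 𝓕 : Finset (Set X), (∀ F ∈ 𝓕, F ∈ PC.faces ∧ b ∈ closure F) ∧
        ∀ w, dist b w = ρ / 2 → Btw x b w → ∃ F ∈ 𝓕, w ∈ F := by
    rcases PC.face_or_edge_or_vertex b with ⟨G, hG, hbG⟩ | ⟨e, he, hbe⟩ | h
    · obtain ⟨ρ, hρ, hcpt, -⟩ := exists_local_structure hκ PC b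
      obtain ⟨ρ', hρ', h⟩ := Metric.nhds_basis_closedBall.mem_iff.1
        ((PC.faces_open G hG).mem_nhds hbG)
      have hpos : 0 < min (min ρ ρ') ρ₁ := lt_min (lt_min hρ hρ') hρ₁
      refine ⟨min (min ρ ρ') ρ₁, hpos, min_le_right _ _,
        hcpt.of_isClosed_subset isClosed_closedBall (closedBall_subset_closedBall
          ((min_le_left _ _).trans (min_le_left _ _))), {G}, ?_, ?_⟩
      · intro F hF; rw [Finset.mem_singleton] at hF; subst hF; exact ⟨hG, subset_closure hbG⟩
      · intro w hw _
        refine ⟨G, Finset.mem_singleton_self _, h ?_⟩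
        rw [mem_closedBall, dist_comm, hw]
        have := (min_le_left (min ρ ρ') ρ₁).trans (min_le_right _ _)
        linarith
    · obtain ⟨ρ, hρ, hle, hcpt, hfin, hnb⟩ := exists_edge_nbhd hκ PC he hbe hρ₁
      refine ⟨ρ, hρ, hle, hcpt, hfin.toFinset, fun F hF => hfin.mem_toFinset.1 hF, ?_⟩
      intro w hw hbt
      rcases hnb w (by rw [mem_closedBall, dist_comm, hw]; linarith) with h | ⟨G, hG, h1, h2⟩
      · exfalso
        refine not_btw_of_start_in_face hκ PC hF he hx hv hbe h ?_ hbt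
        rintro rfl
        rw [dist_self] at hw; linarith
      · exact ⟨G, hfin.mem_toFinset.2 ⟨hG, h2⟩, h1⟩
    · exact absurd h (hv b (by simp [Btw]))
  obtain ⟨G, hG, w, hw, hdw, hbt, hE⟩ := exists_face_enc_of_extension hκ PC hL hp (a := x) hb hcpt
    (hρ₁d.mono_left (closedBall_subset_closedBall hρ1)) (half_pos hρ) (half_lt_self hρ) 𝓕
    (fun F hF => (h𝓕 F hF).1) hS
  refine ⟨w, ?_, hbt, fun y hy => ?_⟩
  · rintro rfl; rw [dist_self] at hdw; linarith
  · rcases eq_or_ne y b with rfl | hyb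
    · exact hb
    obtain ⟨-, hGc, g, h, c⟩ := exists_isFaceChart hκ PC (h𝓕 G hG).1
    obtain ⟨t, ht, rfl⟩ := hy.exists_geo
    have ht0 : 0 < t := by
      rcases ht.1.eq_or_lt with h | h
      · rw [← h, geo_zero] at hyb; exact (hyb rfl).elim
      · exact h
    refine hE _ (c.geo_mem hGc (h𝓕 G hG).2 hw ⟨ht0, ht.2⟩) ?_
    rw [dist_left_geo b w ht, hdw]
    nlinarith [ht.2]

end Extension

end Cat2Cx
end

noncomputable section

open Topology

namespace Cat2Cx

/-! ### Curves which locally follow another curve -/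

section Follows

variable {A B : Type*}

/-- Near the parameter `t`, the curve `L` runs monotonically along the curve `f` near `s`. -/
def Follows (L : ℝ → A) (t : ℝ) (f : ℝ → A) (s : ℝ) : Prop :=
  (map L (𝓝[<] t) ≤ map f (𝓝[<] s) ∧ map L (𝓝[>] t) ≤ map f (𝓝[>] s)) ∨
    (map L (𝓝[<] t) ≤ map f (𝓝[>] s) ∧ map L (𝓝[>] t) ≤ map f (𝓝[<] s))

theorem Follows.image {L f : ℝ → A} {t s : ℝ} (h : Follows L t f s) (G : A → B) :
    Follows (fun t => G (L t)) t (fun s => G (f s)) s := by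
  have key : ∀ {l l' : Filter ℝ}, map L l ≤ map f l' →
      map (fun t => G (L t)) l ≤ map (fun s => G (f s)) l' := fun {l l'} h => by
    have := map_mono (m := G) h
    rwa [map_map, map_map] at this
  exact h.imp (fun h => ⟨key h.1, key h.2⟩) fun h => ⟨key h.1, key h.2⟩

theorem Follows.sign {c γ : ℝ → A} {t s : ℝ} (h : Follows c t γ s) {G : A → ℝ}
    (hG : ((∀ᶠ x in 𝓝[<] s, 0 < G (γ x)) ∧ ∀ᶠ x in 𝓝[>] s, G (γ x) < 0) ∨
      ((∀ᶠ x in 𝓝[<] s, G (γ x) < 0) ∧ ∀ᶠ x in 𝓝[>] s, 0 < G (γ x))) :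
    ((∀ᶠ x in 𝓝[<] t, 0 < G (c x)) ∧ ∀ᶠ x in 𝓝[>] t, G (c x) < 0) ∨
      ((∀ᶠ x in 𝓝[<] t, G (c x) < 0) ∧ ∀ᶠ x in 𝓝[>] t, 0 < G (c x)) := by
  have pos : ∀ {l l' : Filter ℝ}, map c l ≤ map γ l' → (∀ᶠ x in l', 0 < G (γ x)) →
      ∀ᶠ x in l, 0 < G (c x) := fun h hP =>
    eventually_map.1 ((eventually_map (P := fun y => 0 < G y).2 hP).filter_mono h)
  have neg : ∀ {l l' : Filter ℝ}, map c l ≤ map γ l' → (∀ᶠ x in l', G (γ x) < 0) →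
      ∀ᶠ x in l, G (c x) < 0 := fun h hP =>
    eventually_map.1 ((eventually_map (P := fun y => G y < 0).2 hP).filter_mono h)
  rcases h with ⟨h1, h2⟩ | ⟨h1, h2⟩ <;> rcases hG with ⟨h3, h4⟩ | ⟨h3, h4⟩
  · exact Or.inl ⟨pos h1 h3, neg h2 h4⟩
  · exact Or.inr ⟨neg h1 h3, pos h2 h4⟩
  · exact Or.inr ⟨neg h1 h4, pos h2 h3⟩
  · exact Or.inl ⟨pos h1 h4, neg h2 h3⟩

theorem nhdsLT_le_map {τ : ℝ → ℝ} {a s : ℝ} (hab : a < s) (hc : ContinuousOn τ (Icc a s))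
    (h : ∀ x ∈ Ico a s, τ x < τ s) : 𝓝[<] τ s ≤ map τ (𝓝[<] s) := by
  intro U hU
  obtain ⟨b, hb, hbU⟩ := (mem_nhdsLT_iff_exists_Ioo_subset' hab).1 (mem_map.1 hU)
  have hb' : max a b ∈ Ico a s := ⟨le_max_left _ _, max_lt hab hb⟩
  refine mem_of_superset (Ioo_mem_nhdsLT (h _ hb')) ?_
  refine (intermediate_value_Ioo hb'.2.le (hc.mono (Icc_subset_Icc_left hb'.1))).trans ?_
  rintro _ ⟨x, hx, rfl⟩
  exact hbU ⟨(le_max_right _ _).trans_lt hx.1, hx.2⟩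

theorem nhdsGT_le_map {τ : ℝ → ℝ} {a s : ℝ} (hab : s < a) (hc : ContinuousOn τ (Icc s a))
    (h : ∀ x ∈ Ioc s a, τ s < τ x) : 𝓝[>] τ s ≤ map τ (𝓝[>] s) := by
  intro U hU
  obtain ⟨b, hb, hbU⟩ := (mem_nhdsGT_iff_exists_Ioo_subset' hab).1 (mem_map.1 hU)
  have hb' : min a b ∈ Ioc s a := ⟨lt_min hab hb, min_le_left _ _⟩
  refine mem_of_superset (Ioo_mem_nhdsGT (h _ hb')) ?_
  refine (intermediate_value_Ioo hb'.1.le (hc.mono (Icc_subset_Icc_right hb'.2))).trans ?_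
  rintro _ ⟨x, hx, rfl⟩
  exact hbU ⟨hx.1, hx.2.trans_le (min_le_right _ _)⟩

theorem nhdsLT_le_map_nhdsGT {τ : ℝ → ℝ} {a s : ℝ} (hab : s < a) (hc : ContinuousOn τ (Icc s a))
    (h : ∀ x ∈ Ioc s a, τ x < τ s) : 𝓝[<] τ s ≤ map τ (𝓝[>] s) := by
  intro U hU
  obtain ⟨b, hb, hbU⟩ := (mem_nhdsGT_iff_exists_Ioo_subset' hab).1 (mem_map.1 hU)
  have hb' : min a b ∈ Ioc s a := ⟨lt_min hab hb, min_le_left _ _⟩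
  refine mem_of_superset (Ioo_mem_nhdsLT (h _ hb')) ?_
  refine (intermediate_value_Ioo' hb'.1.le (hc.mono (Icc_subset_Icc_right hb'.2))).trans ?_
  rintro _ ⟨x, hx, rfl⟩
  exact hbU ⟨hx.1, hx.2.trans_le (min_le_right _ _)⟩

theorem nhdsGT_le_map_nhdsLT {τ : ℝ → ℝ} {a s : ℝ} (hab : a < s) (hc : ContinuousOn τ (Icc a s))
    (h : ∀ x ∈ Ico a s, τ s < τ x) : 𝓝[>] τ s ≤ map τ (𝓝[<] s) := by
  intro U hU
  obtain ⟨b, hb, hbU⟩ := (mem_nhdsLT_iff_exists_Ioo_subset' hab).1 (mem_map.1 hU)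
  have hb' : max a b ∈ Ico a s := ⟨le_max_left _ _, max_lt hab hb⟩
  refine mem_of_superset (Ioo_mem_nhdsGT (h _ hb')) ?_
  refine (intermediate_value_Ioo' hb'.2.le (hc.mono (Icc_subset_Icc_left hb'.1))).trans ?_
  rintro _ ⟨x, hx, rfl⟩
  exact hbU ⟨(le_max_right _ _).trans_lt hx.1, hx.2⟩

/-- A curve follows its reparametrizations. -/
theorem follows_of_injOn {L : ℝ → A} {f : ℝ → A} {τ : ℝ → ℝ} {a b s : ℝ} (hs : s ∈ Ioo a b)
    (hτ : ContinuousOn τ (Icc a b)) (hi : InjOn τ (Icc a b)) (h : ∀ x ∈ Icc a b, L (τ x) = f x) :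
    Follows L (τ s) f s := by
  have hab : a ≤ b := (hs.1.trans hs.2).le
  have hs' := Ioo_subset_Icc_self hs
  have hl : ∀ {l : Filter ℝ}, (∀ᶠ x in l, x ∈ Icc a b) → map L (map τ l) = map f l := fun h' => by
    rw [map_map]; exact map_congr (h'.mono h)
  have e1 : ∀ᶠ x in 𝓝[<] s, x ∈ Icc a b := by
    filter_upwards [Ioo_mem_nhdsLT hs.1] with x hx using ⟨hx.1.le, (hx.2.trans hs.2).le⟩
  have e2 : ∀ᶠ x in 𝓝[>] s, x ∈ Icc a b := by
    filter_upwards [Ioo_mem_nhdsGT hs.2] with x hx using ⟨(hs.1.trans hx.1).le, hx.2.le⟩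
  have c1 := hτ.mono (Icc_subset_Icc_right hs.2.le)
  have c2 := hτ.mono (Icc_subset_Icc_left hs.1.le)
  rcases hτ.strictMonoOn_of_injOn_Icc' hab hi with hm | hm
  · left
    rw [← hl e1, ← hl e2]
    exact ⟨map_mono (nhdsLT_le_map hs.1 c1 fun x hx => hm ⟨hx.1, (hx.2.trans hs.2).le⟩ hs' hx.2),
      map_mono (nhdsGT_le_map hs.2 c2 fun x hx => hm hs' ⟨(hs.1.trans hx.1).le, hx.2⟩ hx.1)⟩
  · right
    rw [← hl e1, ← hl e2]
    exact ⟨map_mono (nhdsLT_le_map_nhdsGT hs.2 c2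
        fun x hx => hm hs' ⟨(hs.1.trans hx.1).le, hx.2⟩ hx.1),
      map_mono (nhdsGT_le_map_nhdsLT hs.1 c1
        fun x hx => hm ⟨hx.1, (hx.2.trans hs.2).le⟩ hs' hx.2)⟩

theorem Follows.comp {L f f' : ℝ → A} {t s : ℝ} {u : ℝ → ℝ} (h : Follows L t f s) {a b : ℝ}
    (hs : s ∈ Ioo a b) (hu : ContinuousOn u (Icc a b)) (hi : InjOn u (Icc a b))
    (hf : ∀ x ∈ Icc a b, f x = f' (u x)) : Follows L t f' (u s) := by
  have hab : a ≤ b := (hs.1.trans hs.2).le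
  have hs' := Ioo_subset_Icc_self hs
  have e1 : ∀ᶠ x in 𝓝[<] s, x ∈ Icc a b := by
    filter_upwards [Ioo_mem_nhdsLT hs.1] with x hx using ⟨hx.1.le, (hx.2.trans hs.2).le⟩
  have e2 : ∀ᶠ x in 𝓝[>] s, x ∈ Icc a b := by
    filter_upwards [Ioo_mem_nhdsGT hs.2] with x hx using ⟨(hs.1.trans hx.1).le, hx.2.le⟩
  have hl : ∀ {l : Filter ℝ}, (∀ᶠ x in l, x ∈ Icc a b) → map f l = map f' (map u l) := fun h' => by
    rw [map_map]; exact map_congr (h'.mono hf)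
  have hc := (hu.continuousAt (Icc_mem_nhds hs.1 hs.2)).tendsto
  have t1 : Tendsto u (𝓝[<] s) (𝓝 (u s)) := hc.mono_left nhdsWithin_le_nhds
  have t2 : Tendsto u (𝓝[>] s) (𝓝 (u s)) := hc.mono_left nhdsWithin_le_nhds
  have l1 : ∀ᶠ x in 𝓝[<] s, x < s := eventually_mem_nhdsWithin
  have l2 : ∀ᶠ x in 𝓝[>] s, s < x := eventually_mem_nhdsWithin
  rw [Follows, hl e1, hl e2] at h
  rcases hu.strictMonoOn_of_injOn_Icc' hab hi with hm | hm
  · have m1 : map u (𝓝[<] s) ≤ 𝓝[<] (u s) := tendsto_nhdsWithin_iff.2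
      ⟨t1, (e1.and l1).mono fun x hx => hm hx.1 hs' hx.2⟩
    have m2 : map u (𝓝[>] s) ≤ 𝓝[>] (u s) := tendsto_nhdsWithin_iff.2
      ⟨t2, (e2.and l2).mono fun x hx => hm hs' hx.1 hx.2⟩
    exact h.imp (fun h => ⟨h.1.trans (map_mono m1), h.2.trans (map_mono m2)⟩)
      fun h => ⟨h.1.trans (map_mono m2), h.2.trans (map_mono m1)⟩
  · have m1 : map u (𝓝[<] s) ≤ 𝓝[>] (u s) := tendsto_nhdsWithin_iff.2
      ⟨t1, (e1.and l1).mono fun x hx => hm hx.1 hs' hx.2⟩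
    have m2 : map u (𝓝[>] s) ≤ 𝓝[<] (u s) := tendsto_nhdsWithin_iff.2
      ⟨t2, (e2.and l2).mono fun x hx => hm hs' hx.1 hx.2⟩
    exact (h.imp (fun h => ⟨h.1.trans (map_mono m1), h.2.trans (map_mono m2)⟩)
      fun h => ⟨h.1.trans (map_mono m2), h.2.trans (map_mono m1)⟩).symm

theorem exists_int_add_mem_Ioc (t c : ℝ) : ∃ n : ℤ, t + n ∈ Ioc (c - 1 / 2) (c + 1 / 2) := by
  refine ⟨⌊c + 1 / 2 - t⌋, ?_, ?_⟩
  · have := Int.lt_floor_add_one (c + 1 / 2 - t); linarith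
  · have := Int.floor_le (c + 1 / 2 - t); linarith

theorem periodic_add_int {L : ℝ → A} (hp : ∀ t, L (t + 1) = L t) (t : ℝ) (n : ℤ) :
    L (t + n) = L t := by
  have : Function.Periodic L 1 := hp
  simpa using this.int_mul n t

theorem int_eq_zero_of_abs_lt {x : ℝ} {n : ℤ} (h : x = n) (hx : |x| < 1) : x = 0 := by
  rw [h] at hx ⊢
  have : |n| < 1 := by exact_mod_cast hx
  rw [Int.abs_lt_one_iff.1 this, Int.cast_zero]

/-- A loop which is injective along an injective arc contained in it follows this arc. -/
theorem exists_follows [MetricSpace A] {L : ℝ → A} (hL : Continuous L)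
    (hp : ∀ t, L (t + 1) = L t) {f : ℝ → A} {t₀ s₀ ε : ℝ} (hε : 0 < ε) (hf₀ : f s₀ = L t₀)
    (hfc : ContinuousOn f (Icc (s₀ - ε) (s₀ + ε))) (hfi : InjOn f (Icc (s₀ - ε) (s₀ + ε)))
    (hfr : ∀ s ∈ Icc (s₀ - ε) (s₀ + ε), f s ∈ range L)
    (hinj : ∀ s ∈ Icc (s₀ - ε) (s₀ + ε), ∀ t t', L t = f s → L t' = f s → ∃ n : ℤ, t' - t = n) :
    ∃ ε' > 0, ε' ≤ ε ∧ (∀ s ∈ Ioo (s₀ - ε') (s₀ + ε'), ∃ t, L t = f s ∧ Follows L t f s) ∧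
      ∃ δ > 0, ∀ t, dist (L t) (L t₀) < δ → ∃ s ∈ Ioo (s₀ - ε') (s₀ + ε'), L t = f s := by
  have hs₀ : s₀ ∈ Icc (s₀ - ε) (s₀ + ε) := ⟨by linarith, by linarith⟩
  -- points of the loop with parameter away from `t₀` are away from `L t₀`
  have away : ∀ η > 0, ∃ δ > 0, ∀ t, dist (L t) (L t₀) < δ → ∃ n : ℤ, |t + n - t₀| < η := by
    intro η hη
    set K : Set ℝ := Icc (t₀ - 1 / 2) (t₀ + 1 / 2) ∩ {t | η ≤ |t - t₀|} with hK
    have hKc : IsCompact K := isCompact_Icc.inter_right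
      (isClosed_le continuous_const (by fun_prop))
    have hKn : L t₀ ∉ L '' K := by
      rintro ⟨t, ht, h⟩
      obtain ⟨n, hn⟩ := hinj s₀ hs₀ t₀ t hf₀.symm (h.trans hf₀.symm)
      have h1 : |t - t₀| < 1 := by rw [abs_lt]; constructor <;> linarith [ht.1.1, ht.1.2]
      have h2 := int_eq_zero_of_abs_lt hn h1
      have h3 : η ≤ |t - t₀| := ht.2
      rw [h2, abs_zero] at h3; linarith
    obtain ⟨δ, hδ, h⟩ := Metric.nhds_basis_ball.mem_iff.1
      ((hKc.image hL).isClosed.isOpen_compl.mem_nhds hKn)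
    refine ⟨δ, hδ, fun t ht => ?_⟩
    obtain ⟨n, hn⟩ := exists_int_add_mem_Ioc t t₀
    refine ⟨n, ?_⟩
    by_contra! hcon
    refine h (show L t ∈ ball (L t₀) δ from ht) ⟨t + n, ⟨Ioc_subset_Icc_self hn, hcon⟩, ?_⟩
    exact periodic_add_int hp t n
  obtain ⟨δ₁, hδ₁, H₁⟩ := away (1 / 4) (by norm_num)
  obtain ⟨ε₁, hε₁, H₂⟩ := Metric.continuousWithinAt_iff.1 (hfc s₀ hs₀) δ₁ hδ₁
  set ε' := min ε (ε₁ / 2) with hε'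
  have hε'0 : 0 < ε' := lt_min hε (by linarith)
  have hε'1 : ε' ≤ ε := min_le_left _ _
  have hsub : Icc (s₀ - ε') (s₀ + ε') ⊆ Icc (s₀ - ε) (s₀ + ε) :=
    Icc_subset_Icc (by linarith) (by linarith)
  have hτ : ∀ s ∈ Icc (s₀ - ε') (s₀ + ε'), ∃ t, L t = f s ∧ |t - t₀| < 1 / 4 := by
    intro s hs
    obtain ⟨t, ht⟩ := hfr s (hsub hs)
    obtain ⟨n, hn⟩ := H₁ t (by
      rw [ht, ← hf₀]
      refine H₂ (hsub hs) ?_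
      rw [Real.dist_eq, abs_lt]
      have := min_le_right ε (ε₁ / 2)
      constructor <;> linarith [hs.1, hs.2])
    exact ⟨t + n, (periodic_add_int hp t n).trans ht, hn⟩
  choose! τ hτL hτt using hτ
  have huniq : ∀ s ∈ Icc (s₀ - ε') (s₀ + ε'), ∀ t, L t = f s → |t - t₀| ≤ 1 / 4 → t = τ s := by
    intro s hs t ht ht'
    obtain ⟨n, hn⟩ := hinj s (hsub hs) (τ s) t (hτL s hs) ht
    have h1 := abs_lt.1 (hτt s hs)
    have h2 := abs_le.1 ht'
    have := int_eq_zero_of_abs_lt hn (by rw [abs_lt]; constructor <;> linarith)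
    linarith
  have hs₀' : s₀ ∈ Icc (s₀ - ε') (s₀ + ε') := ⟨by linarith, by linarith⟩
  have hτ₀ : τ s₀ = t₀ := (huniq s₀ hs₀' t₀ hf₀.symm (by simp)).symm
  have hτc : ContinuousOn τ (Icc (s₀ - ε') (s₀ + ε')) := by
    intro s hs
    refine (isCompact_Icc (a := t₀ - 1 / 4) (b := t₀ + 1 / 4)).tendsto_nhds_of_unique_mapClusterPt
      ?_ ?_
    · filter_upwards [self_mem_nhdsWithin] with x hx
      have := abs_lt.1 (hτt x hx)
      constructor <;> linarith
    · intro t ht hcl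
      have h1 : MapClusterPt (L t) (𝓝[Icc (s₀ - ε') (s₀ + ε')] s) (L ∘ τ) :=
        hcl.continuousAt_comp hL.continuousAt
      have h2 : Tendsto (L ∘ τ) (𝓝[Icc (s₀ - ε') (s₀ + ε')] s) (𝓝 (f s)) := by
        refine ((hfc s (hsub hs)).mono hsub).tendsto.congr' ?_
        filter_upwards [self_mem_nhdsWithin] with x hx using (hτL x hx).symm
      have h3 : L t = f s := by
        by_contra hne
        have := h1.neBot
        exact this.ne (disjoint_iff.1 ((disjoint_nhds_nhds.2 hne).mono_right h2))
      refine huniq s hs t h3 (abs_le.2 ⟨by linarith [ht.1], by linarith [ht.2]⟩)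
  have hτi : InjOn τ (Icc (s₀ - ε') (s₀ + ε')) := fun x hx y hy hxy =>
    hfi (hsub hx) (hsub hy) (by rw [← hτL x hx, ← hτL y hy, hxy])
  refine ⟨ε', hε'0, hε'1, fun s hs => ⟨τ s, hτL s (Ioo_subset_Icc_self hs),
    follows_of_injOn hs hτc hτi hτL⟩, ?_⟩
  have hnh : ∀ᶠ t in 𝓝 t₀, t ∈ τ '' Ioo (s₀ - ε') (s₀ + ε') := by
    have hc := hτc.mono Ioo_subset_Icc_self
    have hab : s₀ - ε' < s₀ + ε' := by linarith
    have hl : s₀ - ε' ∈ Icc (s₀ - ε') (s₀ + ε') := ⟨le_rfl, hab.le⟩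
    have hr : s₀ + ε' ∈ Icc (s₀ - ε') (s₀ + ε') := ⟨hab.le, le_rfl⟩
    rcases hτc.strictMonoOn_of_injOn_Icc' hab.le hτi with hm | hm
    · refine mem_of_superset (Ioo_mem_nhds ?_ ?_) (intermediate_value_Ioo hab.le hτc)
      · rw [← hτ₀]; exact hm hl hs₀' (by linarith)
      · rw [← hτ₀]; exact hm hs₀' hr (by linarith)
    · refine mem_of_superset (Ioo_mem_nhds ?_ ?_) (intermediate_value_Ioo' hab.le hτc)
      · rw [← hτ₀]; exact hm hs₀' hr (by linarith)
      · rw [← hτ₀]; exact hm hl hs₀' (by linarith)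
  obtain ⟨η, hη, hηs⟩ := Metric.eventually_nhds_iff.1 hnh
  obtain ⟨δ, hδ, H⟩ := away η hη
  refine ⟨δ, hδ, fun t ht => ?_⟩
  obtain ⟨n, hn⟩ := H t ht
  obtain ⟨s, hs, hst⟩ := hηs (show dist (t + n) t₀ < η from hn)
  exact ⟨s, hs, by rw [← hτL s (Ioo_subset_Icc_self hs), hst, periodic_add_int hp]⟩

end Follows

end Cat2Cx
end

noncomputable section

open Topology

namespace Cat2Cx

/-! ### Winding numbers jump across a curve -/

section Jump

theorem exists_hasDerivAt_ne_zero {γ : ℝ → ℂ} {K : NNReal} {a b : ℝ} (hab : a < b)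
    (h : LipschitzOnWith K γ (Icc a b)) (hne : γ a ≠ γ b) :
    ∃ s ∈ Ioo a b, ∃ v ≠ 0, HasDerivAt γ v s := by
  by_contra! hcon
  have hae : ∀ᵐ x ∂(MeasureTheory.volume : MeasureTheory.Measure ℝ), x ∈ Ioo a b →
      HasDerivAt γ 0 x := by
    filter_upwards [(h.mono Ioo_subset_Icc_self).ae_differentiableWithinAt_of_mem] with x hx hxm
    have hd := ((hx hxm).differentiableAt (Ioo_mem_nhds hxm.1 hxm.2)).hasDerivAt
    by_cases h0 : deriv γ x = 0
    · rwa [h0] at hd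
    · exact absurd hd (hcon x hxm _ h0)
  have key : ∀ P : ℂ →L[ℝ] ℝ, P (γ b) - P (γ a) = 0 := fun P => by
    have hl : LipschitzOnWith (‖P‖₊ * K) (fun x => P (γ x)) (uIcc a b) := by
      rw [uIcc_of_le hab.le]
      exact P.lipschitz.comp_lipschitzOnWith h
    rw [← hl.absolutelyContinuousOnInterval.integral_deriv_eq_sub,
      intervalIntegral.integral_of_le hab.le, MeasureTheory.integral_Ioc_eq_integral_Ioo]
    refine MeasureTheory.setIntegral_eq_zero_of_ae_eq_zero ?_
    filter_upwards [hae] with x hx hxm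
    have := P.hasFDerivAt.comp_hasDerivAt x (hx hxm)
    rw [map_zero] at this
    exact this.deriv
  refine hne (Complex.ext ?_ ?_)
  · have := key Complex.reCLM
    simp only [Complex.reCLM_apply] at this
    linarith
  · have := key Complex.imCLM
    simp only [Complex.imCLM_apply] at this
    linarith

theorem div_sub_add_eq (Y : ℂ) (ε : ℝ) : (Y - ε * Complex.I) / (Y + ε * Complex.I) =
    ((Y.re ^ 2 + Y.im ^ 2 - ε ^ 2 : ℝ) - (2 * Y.re * ε : ℝ) * Complex.I) *
      ((Complex.normSq (Y + ε * Complex.I))⁻¹ : ℝ) := by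
  rw [div_eq_mul_inv, Complex.inv_def, ← mul_assoc]
  congr 1
  apply Complex.ext <;> simp [pow_two] <;> ring

/-- The winding number of a loop changes by one when crossing it transversally. -/
theorem eventually_hasDeg_jump {c γ : ℝ → ℂ} (hc : Continuous c) (hp : ∀ t, c (t + 1) = c t)
    {s t : ℝ} {v : ℂ} (hv : v ≠ 0) (hd : HasDerivAt γ v s) (hct : c t = γ s)
    (hF : Follows c t γ s) (hinj : ∀ t', c t' = c t → ∃ n : ℤ, t' - t = n) :
    ∀ᶠ ε : ℝ in 𝓝[>] (0 : ℝ), ∃ m n : ℤ, (m = n + 1 ∨ m = n - 1) ∧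
      HasDeg (fun x => c x - (c t + ε * Complex.I * v)) m ∧
      HasDeg (fun x => c x - (c t - ε * Complex.I * v)) n ∧
      (∀ x, c x ≠ c t + ε * Complex.I * v) ∧ (∀ x, c x ≠ c t - ε * Complex.I * v) := by
  set Y : ℂ → ℂ := fun y => (y - c t) / v with hY
  have hslope : ∀ᶠ x in 𝓝[≠] s, 0 < (slope γ s x / v).re := by
    have h1 : Tendsto (fun x => (slope γ s x / v).re) (𝓝[≠] s) (𝓝 (v / v).re) :=
      (Complex.continuous_re.tendsto _).comp ((hasDerivAt_iff_tendsto_slope.1 hd).div_const v)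
    rw [div_self hv, Complex.one_re] at h1
    exact h1.eventually (lt_mem_nhds one_pos)
  have hYre : ∀ x, x ≠ s → (Y (γ x)).re = (x - s) * (slope γ s x / v).re := fun x hx => by
    have hx' : ((x - s : ℝ) : ℂ) ≠ 0 := Complex.ofReal_ne_zero.2 (sub_ne_zero.2 hx)
    rw [← Complex.re_ofReal_mul, hY, slope_def_module, Complex.real_smul, hct]
    congr 1
    rw [Complex.ofReal_inv]
    field_simp
  have hsgn := hF.sign (G := fun y => (Y y).re) (Or.inr ⟨by
      filter_upwards [hslope.filter_mono (nhdsWithin_mono s fun x (hx : x < s) => hx.ne),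
        self_mem_nhdsWithin] with x hx hxs
      have hxs : x < s := hxs
      rw [hYre x hxs.ne]
      exact mul_neg_of_neg_of_pos (by linarith) hx, by
      filter_upwards [hslope.filter_mono (nhdsWithin_mono s fun x (hx : s < x) => hx.ne'),
        self_mem_nhdsWithin] with x hx hxs
      have hxs : s < x := hxs
      rw [hYre x hxs.ne']
      exact mul_pos (by linarith) hx⟩)
  obtain ⟨η, hη, hηl, hηr⟩ : ∃ η > 0, (∀ x ∈ Ioo (t - η) t, (Y (c x)).re ≠ 0) ∧
      ∀ x ∈ Ioo t (t + η), (Y (c x)).re ≠ 0 := by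
    have h1 : ∀ᶠ x in 𝓝[<] t, (Y (c x)).re ≠ 0 := by
      rcases hsgn with h | h
      · exact h.1.mono fun x hx => hx.ne'
      · exact h.1.mono fun x hx => hx.ne
    have h2 : ∀ᶠ x in 𝓝[>] t, (Y (c x)).re ≠ 0 := by
      rcases hsgn with h | h
      · exact h.2.mono fun x hx => hx.ne
      · exact h.2.mono fun x hx => hx.ne'
    obtain ⟨a, ha, h1⟩ := mem_nhdsLT_iff_exists_Ioo_subset.1 h1
    obtain ⟨b, hb, h2⟩ := mem_nhdsGT_iff_exists_Ioo_subset.1 h2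
    have ha : a < t := ha
    have hb : t < b := hb
    refine ⟨min (t - a) (b - t), lt_min (by linarith) (by linarith), fun x hx => h1 ⟨?_, hx.2⟩,
      fun x hx => h2 ⟨hx.1, ?_⟩⟩
    · have := min_le_left (t - a) (b - t); linarith [hx.1]
    · have := min_le_right (t - a) (b - t); linarith [hx.2]
  have hYc : Continuous fun x => ‖Y (c x)‖ := by
    simp only [hY]; fun_prop
  obtain ⟨δ, hδ, hδY⟩ : ∃ δ > 0, ∀ x ∈ Icc (t + η) (t + 1 - η), δ ≤ ‖Y (c x)‖ := by
    have hpos : ∀ x ∈ Icc (t + η) (t + 1 - η), 0 < ‖Y (c x)‖ := fun x hx => by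
      rw [norm_pos_iff]
      refine div_ne_zero (sub_ne_zero.2 fun h => ?_) hv
      obtain ⟨n, hn⟩ := hinj x h
      have := int_eq_zero_of_abs_lt hn (by rw [abs_lt]; constructor <;> linarith [hx.1, hx.2])
      linarith [hx.1]
    rcases (Icc (t + η) (t + 1 - η)).eq_empty_or_nonempty with h | h
    · exact ⟨1, one_pos, fun x hx => by simp [h] at hx⟩
    · obtain ⟨x, hx, hmin⟩ := isCompact_Icc.exists_isMinOn h hYc.continuousOn
      exact ⟨_, hpos x hx, fun y hy => hmin hy⟩
  filter_upwards [Ioo_mem_nhdsGT hδ] with ε hε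
  have hgen : ∀ x ∈ Ioo t (t + 1), (Y (c x)).re ≠ 0 ∨ ε < ‖Y (c x)‖ := fun x hx => by
    rcases lt_or_ge x (t + η) with h1 | h1
    · exact Or.inl (hηr x ⟨hx.1, h1⟩)
    rcases le_or_gt x (t + 1 - η) with h2 | h2
    · exact Or.inr (hε.2.trans_le (hδY x ⟨h1, h2⟩))
    · left
      have := hηl (x - 1) ⟨by linarith, by linarith [hx.2]⟩
      rwa [← hp, sub_add_cancel] at this
  have hgen' : ∀ x, c x = c t ∨ (Y (c x)).re ≠ 0 ∨ ε < ‖Y (c x)‖ := fun x => by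
    have h1 := Int.fract_nonneg (x - t)
    have h2 := Int.fract_lt_one (x - t)
    rw [eq_add_fract hp t x]
    rcases h1.eq_or_lt with h | h
    · left; rw [← h, add_zero]
    · right; exact hgen _ ⟨by linarith, by linarith⟩
  have hne : ∀ {σ : ℂ}, ‖σ‖ = 1 → σ.re = 0 → ∀ x, c x ≠ c t + ε * σ * v := fun {σ} h1 h2 x hx => by
    have h3 : Y (c x) = ε * σ := by
      simp only [hY]; rw [hx, add_sub_cancel_left, mul_div_cancel_right₀ _ hv]
    rcases hgen' x with h | h | h
    · rw [h] at hx
      have : (ε : ℂ) * σ * v = 0 := by linear_combination -hx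
      have h4 : σ ≠ 0 := by rintro rfl; simp at h1
      simp [hv, h4, hε.1.ne'] at this
    · rw [h3] at h; simp [h2] at h
    · rw [h3, norm_mul, h1, Complex.norm_real, Real.norm_eq_abs, abs_of_pos hε.1] at h
      linarith
  have hn1 : ∀ x, c x ≠ c t + ε * Complex.I * v := hne (by simp) (by simp)
  have hn2 : ∀ x, c x ≠ c t - ε * Complex.I * v := fun x => by
    have := hne (σ := -Complex.I) (by simp) (by simp) x
    rwa [show c t + ε * -Complex.I * v = c t - ε * Complex.I * v by ring] at this
  obtain ⟨m, hm⟩ := exists_hasDeg (c := fun x => c x - (c t + ε * Complex.I * v)) (by fun_prop)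
    (fun x => sub_ne_zero.2 (hn1 x)) (fun x => by rw [hp])
  obtain ⟨n, hn⟩ := exists_hasDeg (c := fun x => c x - (c t - ε * Complex.I * v)) (by fun_prop)
    (fun x => sub_ne_zero.2 (hn2 x)) (fun x => by rw [hp])
  refine ⟨m, n, ?_, hm, hn, hn1, hn2⟩
  set q : ℝ → ℂ := fun x => (c x - (c t + ε * Complex.I * v)) / (c x - (c t - ε * Complex.I * v))
    with hq
  have hqY : ∀ x, q x = ((Y (c x)).re ^ 2 + (Y (c x)).im ^ 2 - ε ^ 2 : ℝ) *
        ((Complex.normSq (Y (c x) + ε * Complex.I))⁻¹ : ℝ) +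
      (-(2 * (Y (c x)).re * ε * (Complex.normSq (Y (c x) + ε * Complex.I))⁻¹) : ℝ) * Complex.I := by
    intro x
    have h1 : q x = (Y (c x) - ε * Complex.I) / (Y (c x) + ε * Complex.I) := by
      have e1 : c x - (c t + ε * Complex.I * v) = (Y (c x) - ε * Complex.I) * v := by
        simp only [hY]; rw [sub_mul, div_mul_cancel₀ _ hv]; ring
      have e2 : c x - (c t - ε * Complex.I * v) = (Y (c x) + ε * Complex.I) * v := by
        simp only [hY]; rw [add_mul, div_mul_cancel₀ _ hv]; ring
      rw [hq]; dsimp only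
      rw [e1, e2, mul_div_mul_right _ _ hv]
    rw [h1, div_sub_add_eq]; push_cast; ring
  have hqre : ∀ x, (q x).re = ((Y (c x)).re ^ 2 + (Y (c x)).im ^ 2 - ε ^ 2) *
      (Complex.normSq (Y (c x) + ε * Complex.I))⁻¹ := fun x => by
    rw [hqY]; simp only [← Complex.ofReal_mul, Complex.add_re, Complex.ofReal_re, Complex.re_ofReal_mul, Complex.I_re]; ring
  have hqim : ∀ x, (q x).im = -(2 * (Y (c x)).re * ε *
      (Complex.normSq (Y (c x) + ε * Complex.I))⁻¹) := fun x => by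
    rw [hqY]; simp only [← Complex.ofReal_mul, Complex.add_im, Complex.ofReal_im, Complex.im_ofReal_mul, Complex.I_im]; ring
  have hN : ∀ x, 0 < (Complex.normSq (Y (c x) + ε * Complex.I))⁻¹ := fun x => by
    rw [inv_pos, Complex.normSq_pos]
    intro h
    apply hn2 x
    have : c x = Y (c x) * v + c t := by simp only [hY]; rw [div_mul_cancel₀ _ hv]; ring
    rw [this]; linear_combination v * h
  have hYt : Y (c t) = 0 := by simp [hY]
  have hε1 := hε.1
  have hqd := exists_hasDeg_of_crossing (c := q) (t₀ := t)
    (Continuous.div (by fun_prop) (by fun_prop) fun x => sub_ne_zero.2 (hn2 x))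
    (fun x => by simp only [hq, hp])
    (fun x hx => by
      rw [Complex.mem_slitPlane_iff, hqre, hqim]
      rcases hgen x hx with h | h
      · right
        exact neg_ne_zero.2 (mul_ne_zero (mul_ne_zero (mul_ne_zero two_ne_zero h) hε1.ne')
          (hN x).ne')
      · left
        refine mul_pos ?_ (hN x)
        have h3 := Complex.sq_norm (Y (c x))
        rw [Complex.normSq_apply] at h3
        nlinarith)
    (by
      rw [hqre, hYt]
      refine mul_neg_of_neg_of_pos ?_ (by have := hN t; rwa [hYt] at this)
      simp only [Complex.zero_re, Complex.zero_im]; nlinarith)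
    (by rw [hqim, hYt]; simp)
    (by
      have hpos : ∀ x, (Y (c x)).re < 0 → 0 < (q x).im := fun x hx => by
        rw [hqim]
        have h1 := hN x
        have h2 : 0 < -(Y (c x)).re := by linarith
        have := mul_pos (mul_pos h2 hε1) h1
        nlinarith
      have hneg : ∀ x, 0 < (Y (c x)).re → (q x).im < 0 := fun x hx => by
        rw [hqim]
        have h1 := hN x
        have := mul_pos (mul_pos hx hε1) h1
        nlinarith
      rcases hsgn with ⟨h1, h2⟩ | ⟨h1, h2⟩
      · exact Or.inr ⟨h1.mono fun x hx => hneg x hx, h2.mono fun x hx => hpos x hx⟩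
      · exact Or.inl ⟨h1.mono fun x hx => hpos x hx, h2.mono fun x hx => hneg x hx⟩)
  have hdiv : HasDeg q (m - n) := hm.div hn
  rcases hqd with h | h
  · left; have := hdiv.unique h; omega
  · right; have := hdiv.unique h; omega

end Jump

/-! ### The induced path metric -/

section PathMetric

variable {X : Type*} [MetricSpace X]

theorem dist_le_pathDistIn {E : Set X} (hE : RectConnected E) {x y : X} (hx : x ∈ E)
    (hy : y ∈ E) : dist x y ≤ pathDistIn E x y := by
  obtain ⟨g, hg, hgv⟩ := hE x hx y hy
  have hle : edist x y ≤ ⨅ g : {g : ℝ → X // IsPathIn E g x y}, eVariationOn g.1 (Icc 0 1) := by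
    refine le_iInf fun g => ?_
    have := eVariationOn.edist_le g.1 (s := Icc (0 : ℝ) 1) (x := 0) (y := 1) (by simp) (by simp)
    rwa [g.2.2.1, g.2.2.2.1] at this
  have hfin : (⨅ g : {g : ℝ → X // IsPathIn E g x y}, eVariationOn g.1 (Icc 0 1)) ≠ ⊤ :=
    ne_top_of_le_ne_top hgv (iInf_le (fun g : {g : ℝ → X // IsPathIn E g x y} =>
      eVariationOn g.1 (Icc 0 1)) ⟨g, hg⟩)
  rw [dist_edist]
  exact ENNReal.toReal_mono hfin hle

theorem eVariationOn_geo_le [CatZero X] (x y : X) :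
    eVariationOn (fun t => geo x y t) (Icc 0 1) ≤ edist x y := by
  have h : LipschitzOnWith (nndist x y) (fun t => geo x y t) (Icc 0 1) :=
    LipschitzOnWith.of_dist_le_mul fun s hs t ht => by
      rw [dist_geo_geo x y hs ht, Real.dist_eq, coe_nndist, mul_comm]
  have hid : eVariationOn (fun t : ℝ => t) (Icc 0 1) ≤ 1 := by
    have := (monotoneOn_id (s := Icc (0 : ℝ) 1)).eVariationOn_eq (a := 0) (b := 1) (by simp) (by simp)
    rw [inter_self] at this
    refine this.le.trans (le_of_eq ?_)
    rw [id, id, sub_zero, ENNReal.ofReal_one]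
  calc eVariationOn (fun t => geo x y t) (Icc 0 1)
      ≤ nndist x y * eVariationOn (fun t : ℝ => t) (Icc 0 1) :=
        h.comp_eVariationOn_le (g := fun t : ℝ => t) (fun t ht => ht)
    _ ≤ edist x y := by
        rw [edist_nndist]
        exact mul_le_of_le_one_right' hid

theorem isPathIn_geo [CatZero X] {E : Set X} {x y : X} (h : ∀ t ∈ Icc (0 : ℝ) 1, geo x y t ∈ E) :
    IsPathIn E (fun t => geo x y t) x y :=
  ⟨(continuous_geo_comp continuous_const continuous_const continuous_id).continuousOn, geo_zero x y,
    geo_one x y, h⟩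

theorem pathDistIn_le_dist [CatZero X] {E : Set X} {x y : X}
    (h : ∀ t ∈ Icc (0 : ℝ) 1, geo x y t ∈ E) : pathDistIn E x y ≤ dist x y := by
  rw [dist_edist]
  exact ENNReal.toReal_mono (edist_ne_top _ _) ((iInf_le (fun g : {g : ℝ → X // IsPathIn E g x y} =>
    eVariationOn g.1 (Icc 0 1)) ⟨_, isPathIn_geo h⟩).trans (eVariationOn_geo_le x y))

/-- A geodesic of the path metric runs along every chord contained in the subset. -/
theorem exists_eq_of_chord [CatZero X] {E : Set X} (hE : RectConnected E) {f : ℝ → X} {a b : ℝ}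
    (hab : a ≤ b) (hf : ∀ s ∈ Icc a b, ∀ t ∈ Icc a b, pathDistIn E (f s) (f t) = |s - t|)
    (hfE : ∀ s ∈ Icc a b, f s ∈ E) (h : ∀ t ∈ Icc (0 : ℝ) 1, geo (f a) (f b) t ∈ E) {x : X}
    (hx : Btw (f a) x (f b)) : ∃ s ∈ Icc a b, f s = x := by
  have ha : a ∈ Icc a b := ⟨le_rfl, hab⟩
  have hb : b ∈ Icc a b := ⟨hab, le_rfl⟩
  have hd : ∀ s ∈ Icc a b, ∀ t ∈ Icc a b, dist (f s) (f t) ≤ |s - t| := fun s hs t ht =>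
    hf s hs t ht ▸ dist_le_pathDistIn hE (hfE s hs) (hfE t ht)
  have hdab : dist (f a) (f b) = b - a := by
    refine le_antisymm ((hd a ha b hb).trans ?_) ?_
    · rw [abs_sub_comm, abs_of_nonneg (by linarith)]
    · have := pathDistIn_le_dist h
      rwa [hf a ha b hb, abs_sub_comm, abs_of_nonneg (by linarith)] at this
  obtain ⟨t, ht, rfl⟩ := hx.exists_geo
  have hm : a + t * (b - a) ∈ Icc a b := by
    constructor <;> nlinarith [ht.1, ht.2]
  have h1 := hd a ha _ hm
  have h2 := hd _ hm b hb
  rw [abs_sub_comm, abs_of_nonneg (by linarith [hm.1])] at h1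
  rw [abs_sub_comm, abs_of_nonneg (by linarith [hm.2])] at h2
  have h3 := dist_triangle (f a) (f (a + t * (b - a))) (f b)
  exact ⟨_, hm, eq_geo ht (by rw [hdab] at *; linarith) (by rw [hdab] at *; linarith)⟩

end PathMetric

end Cat2Cx
end

noncomputable section

open Topology

namespace Cat2Cx

/-! ### Enclosed points next to a curve -/

section NearCurve

variable {κ : ℝ} {X : Type*} [MetricSpace X] [CatZero X] {L : ℝ → X}

/-- A chart of a patch extends to a continuous function on `X` without creating new preimages of
the points near a given one. -/
theorem IsPatch.exists_extension {O : Set X} {g : X → ℂ} {h : ℂ → X} (c : IsPatch O g h) {z : ℂ}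
    {r : ℝ} (hr : 0 < r) (hz : closedBall z r ⊆ g '' O) :
    ∃ A : X → ℂ, Continuous A ∧ (∀ y ∈ O, g y ∈ closedBall z r → A y = g y) ∧
      ∀ y, A y ∈ ball z r → y ∈ O ∧ A y = g y := by
  set Q := O ∩ g ⁻¹' closedBall z r with hQ
  have hQc : IsCompact Q := c.isCompact_inter_preimage hz (isCompact_closedBall _ _)
  have hQg : GConvex Q := c.gconvex_inter_preimage c.gconvex (convex_closedBall _ _)
  have hQn : Q.Nonempty := by
    obtain ⟨x, hx, hxz⟩ := hz (mem_closedBall_self hr.le)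
    exact ⟨x, hx, by rw [mem_preimage, hxz]; exact mem_closedBall_self hr.le⟩
  have hA : ∀ y ∈ Q, g (proj Q y) = g y := fun y hy => by rw [proj_of_mem hQc hy]
  refine ⟨fun y => g (proj Q y), (c.continuousOn.mono inter_subset_left).comp_continuous
    (continuous_proj hQc hQn hQg) fun y => (proj_spec hQc hQn y).1, fun y hy hy' => hA y ⟨hy, hy'⟩,
    fun y hy => ?_⟩
  have hp := (proj_spec hQc hQn y).1
  have hinside : proj Q y ∈ interior Q := interior_maximal
    (inter_subset_inter_right O (preimage_mono ball_subset_closedBall))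
    (c.isOpen_inter_preimage isOpen_ball) ⟨hp.1, hy⟩
  have := eq_of_proj_mem_interior hQc hinside
  rw [← this] at hp
  exact ⟨hp.1, hA y hp⟩

theorem enc_of_hasDeg {x : X} (hx : x ∉ range L) {φ : X → ℂ} (hφ : Continuous φ)
    (h0 : ∀ y, y ≠ x → φ y ≠ 0) {n : ℤ} (hn : n ≠ 0) (hd : HasDeg (fun t => φ (L t)) n) :
    Enc L x :=
  ⟨hx, fun _ _ hxU _ => ⟨φ, hφ.continuousOn, fun y hy => h0 y fun h => hy (h ▸ hxU), n, hn, hd⟩⟩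

/-- A rectifiable arc of a loop inside a patch encloses points of the patch. -/
theorem IsPatch.exists_enc (hL : Continuous L) (hp : ∀ t, L (t + 1) = L t) {O : Set X} {g : X → ℂ}
    {h : ℂ → X} (c : IsPatch O g h) {f : ℝ → X} {a b : ℝ} (hab : a < b)
    (hf : ∀ s ∈ Icc a b, ∀ t ∈ Icc a b, dist (f s) (f t) ≤ |s - t|) (hne : f a ≠ f b)
    (hfO : ∀ s ∈ Icc a b, f s ∈ O) (hF : ∀ s ∈ Ioo a b, ∃ t, L t = f s ∧ Follows L t f s)
    (hinj : ∀ s ∈ Ioo a b, ∀ t t', L t = f s → L t' = f s → ∃ n : ℤ, t' - t = n) :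
    ∃ x ∈ O, Enc L x := by
  obtain ⟨C, hC, hlip⟩ := c.lip
  have hLip : LipschitzOnWith ⟨C, hC.le⟩ (fun s => g (f s)) (Icc a b) :=
    LipschitzOnWith.of_dist_le_mul fun s hs t ht => by
      rw [dist_eq_norm, Real.dist_eq]
      exact (hlip _ (hfO s hs) _ (hfO t ht)).trans
        (mul_le_mul_of_nonneg_left (hf s hs t ht) hC.le)
  have ha : a ∈ Icc a b := ⟨le_rfl, hab.le⟩
  have hb : b ∈ Icc a b := ⟨hab.le, le_rfl⟩
  obtain ⟨s, hs, v, hv, hd⟩ := exists_hasDerivAt_ne_zero hab hLip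
    (fun h => hne (c.injOn (hfO a ha) (hfO b hb) h))
  have hs' := Ioo_subset_Icc_self hs
  obtain ⟨t, ht, hFt⟩ := hF s hs
  obtain ⟨r, hr, hrO⟩ := Metric.nhds_basis_closedBall.mem_iff.1
    (c.isOpen_image.mem_nhds (mem_image_of_mem g (hfO s hs')))
  obtain ⟨A, hA, hAg, hAO⟩ := c.exists_extension hr hrO
  have hAs : A (f s) = g (f s) := hAg _ (hfO s hs') (mem_closedBall_self hr.le)
  have hγc : ContinuousAt (fun s => g (f s)) s := hd.continuousAt
  have hd' : HasDerivAt (fun s => A (f s)) v s := by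
    refine hd.congr_of_eventuallyEq ?_
    filter_upwards [Ioo_mem_nhds hs.1 hs.2, hγc.eventually (ball_mem_nhds _ hr)] with x hx hx'
    exact hAg _ (hfO x (Ioo_subset_Icc_self hx)) (ball_subset_closedBall hx')
  have hjump := eventually_hasDeg_jump (c := fun t => A (L t)) (hA.comp hL)
    (fun t => by rw [hp]) hv hd' (by rw [ht]) (hFt.image A) (fun t' ht' => by
      have h1 : A (L t') = g (f s) := by rw [ht', ht, hAs]
      obtain ⟨h2, h3⟩ := hAO (L t') (by rw [h1]; exact mem_ball_self hr)
      exact hinj s hs t t' ht (c.injOn h2 (hfO s hs') (by rw [← h3, h1])))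
  have hball : ∀ σ : ℂ, ∀ᶠ ε : ℝ in 𝓝[>] (0 : ℝ), A (L t) + ε * σ ∈ ball (g (f s)) r := fun σ => by
    have : Continuous fun ε : ℝ => A (L t) + ε * σ := by fun_prop
    refine (this.tendsto 0).mono_left nhdsWithin_le_nhds (isOpen_ball.mem_nhds ?_)
    rw [mem_ball, Complex.ofReal_zero, zero_mul, add_zero, ht, hAs, dist_self]; exact hr
  have main : ∀ w ∈ ball (g (f s)) r, (∀ x, A (L x) ≠ w) → ∀ m : ℤ, m ≠ 0 →
      HasDeg (fun x => A (L x) - w) m → ∃ x ∈ O, Enc L x := fun w hw hwL m hm hdeg => by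
    obtain ⟨hx, hgx⟩ := c.inv_mem (hrO (ball_subset_closedBall hw))
    refine ⟨h w, hx, enc_of_hasDeg (φ := fun y => A y - w) ?_ (by fun_prop) (fun y hy h' => ?_) hm
      hdeg⟩
    · rintro ⟨x, hx'⟩
      exact hwL x (by rw [hx', hAg _ hx (by rw [hgx]; exact ball_subset_closedBall hw), hgx])
    · have h1 := sub_eq_zero.1 h'
      obtain ⟨h2, h3⟩ := hAO y (by rw [h1]; exact hw)
      exact hy (c.injOn h2 hx (by rw [hgx, ← h3, h1]))
  obtain ⟨ε, ⟨m, n, hmn, hm, hn, hm0, hn0⟩, hb1, hb2⟩ :=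
    (hjump.and ((hball (Complex.I * v)).and (hball (-(Complex.I * v))))).exists
  have e1 : A (L t) + ε * Complex.I * v = A (L t) + ε * (Complex.I * v) := by ring
  have e2 : A (L t) - ε * Complex.I * v = A (L t) + ε * -(Complex.I * v) := by ring
  rcases eq_or_ne m 0 with h0 | h0
  · exact main _ (e2 ▸ hb2) hn0 n (by omega) hn
  · exact main _ (e1 ▸ hb1) hm0 m h0 hm

/-- An arc of a loop along an edge encloses points of the neighbouring faces. -/
theorem exists_enc_of_edge (hκ : κ ≤ 0) (PC : PolyComplex2 κ X) (hL : Continuous L)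
    (hp : ∀ t, L (t + 1) = L t) {e : Set X} (he : e ∈ PC.edges) {f : ℝ → X} {l : ℝ}
    (hf : ∀ s ∈ Icc 0 l, ∀ t ∈ Icc 0 l, dist (f s) (f t) = |s - t|) (hfe : f '' Ioo 0 l = e)
    {s t : ℝ} (hs : s ∈ Ioo 0 l) (ht : L t = f s) (hF : Follows L t f s)
    (hinj : ∀ t', L t' = f s → ∃ n : ℤ, t' - t = n) {δ : ℝ} (hδ : 0 < δ)
    (hloc : ∀ t', dist (L t') (f s) < δ → L t' ∈ e) :
    ∃ F ∈ PC.faces, ∃ x ∈ F, dist x (f s) < δ ∧ Enc L x := by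
  classical
  have hl : (0 : ℝ) ∈ Icc 0 l := ⟨le_rfl, (hs.1.trans hs.2).le⟩
  have hs' := Ioo_subset_Icc_self hs
  obtain ⟨ρ, hρ, hρ₀, hcpt, hfin, hρe⟩ := exists_edge_nbhd hκ PC he
    (hfe ▸ mem_image_of_mem f hs : f s ∈ e) (ρ₀ := min δ (min (s / 2) ((l - s) / 2)))
    (lt_min hδ (lt_min (half_pos hs.1) (half_pos (by linarith [hs.2]))))
  have hρδ : ρ ≤ δ := hρ₀.trans (min_le_left _ _)
  have hρs : ρ < s := by
    have := hρ₀.trans ((min_le_right _ _).trans (min_le_left _ _)); linarith [hs.1]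
  have hρl : s + ρ < l := by
    have := hρ₀.trans ((min_le_right _ _).trans (min_le_right _ _)); linarith [hs.2]
  set 𝓕 : Finset (Set X) := hfin.toFinset with h𝓕
  have hmem : ∀ F, F ∈ 𝓕 ↔ F ∈ PC.faces ∧ f s ∈ closure F := fun F => by
    rw [h𝓕, Set.Finite.mem_toFinset]; rfl
  set O : Set X → Set X := fun F => F ∩ ball (f s) ρ with hO
  have hOo : ∀ F ∈ 𝓕, IsOpen (O F) := fun F hF => (PC.faces_open F ((hmem F).1 hF).1).inter isOpen_ball
  -- points off the patches
  set J : Set ℝ := Icc (s - ρ) (s + ρ) with hJ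
  have hJl : ∀ x ∈ J, x ∈ Ioo 0 l := fun x hx => ⟨by linarith [hx.1], by linarith [hx.2]⟩
  have hfJ : ∀ x ∈ J, f x ∈ e := fun x hx => hfe ▸ mem_image_of_mem f (hJl x hx)
  have heJ : ∀ y ∈ e, dist y (f s) ≤ ρ → ∃ x ∈ J, f x = y := fun y hy hd => by
    rw [← hfe] at hy
    obtain ⟨x, hx, rfl⟩ := hy
    rw [hf x (Ioo_subset_Icc_self hx) s hs', abs_le] at hd
    exact ⟨x, ⟨by linarith [hd.1], by linarith [hd.2]⟩, rfl⟩
  have heO : ∀ y ∈ e, ∀ F ∈ 𝓕, y ∉ O F := fun y hy F hF hyF => by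
    have := PC.cells_disjoint F (Or.inl ((hmem F).1 hF).1) e (Or.inr he)
      (PC.face_ne_edge hκ ((hmem F).1 hF).1 he)
    exact (this ▸ (⟨hyF.1, hy⟩ : y ∈ F ∩ e) : y ∈ (∅ : Set X))
  have hJc : ContinuousOn f J := by
    refine ContinuousOn.mono (s := Icc 0 l) (isGeodesicWrt_continuousOn ⟨hl.2, hf⟩)
      fun x hx => Ioo_subset_Icc_self (hJl x hx)
  have hJcl : IsClosed (f '' J) := (isCompact_Icc.image_of_continuousOn hJc).isClosed
  set β : X → ℂ := fun y => if dist y (f s) < ρ then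
    -Complex.exp (Real.pi * ((dist y (f 0) - s) / ρ : ℝ) * Complex.I) else 1 with hβ
  have hβJ : ∀ x ∈ J, β (f x) = -Complex.exp (Real.pi * ((x - s) / ρ : ℝ) * Complex.I) := by
    intro x hx
    have hx' := Ioo_subset_Icc_self (hJl x hx)
    have h0 : dist (f x) (f 0) = x := by
      rw [hf x hx' 0 hl, sub_zero, abs_of_nonneg hx'.1]
    simp only [hβ]
    split_ifs with h
    · rw [h0]
    · rw [hf x hx' s hs', not_lt] at h
      have : x - s = ρ ∨ x - s = -ρ := by
        rcases abs_cases (x - s) with h' | h'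
        · left; linarith [hx.2]
        · right; linarith [hx.1]
      rcases this with h | h
      · rw [h, div_self hρ.ne', Complex.ofReal_one, mul_one, Complex.exp_pi_mul_I, neg_neg]
      · rw [h, neg_div, div_self hρ.ne', Complex.ofReal_neg, Complex.ofReal_one, mul_neg_one, neg_mul,
          Complex.exp_neg, Complex.exp_pi_mul_I]; norm_num
  have hβc : ContinuousOn β ((ball (f s) ρ)ᶜ ∪ f '' J) := by
    refine ContinuousOn.union_of_isClosed ?_ ?_ isOpen_ball.isClosed_compl hJcl
    · exact (continuousOn_const (c := (1 : ℂ))).congr fun y hy => if_neg hy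
    · have : ContinuousOn (fun y => -Complex.exp (Real.pi * ((dist y (f 0) - s) / ρ : ℝ) * Complex.I))
        (f '' J) := by fun_prop
      refine this.congr ?_
      rintro _ ⟨x, hx, rfl⟩
      have hx' := Ioo_subset_Icc_self (hJl x hx)
      dsimp only
      rw [hβJ x hx, hf x hx' 0 hl, sub_zero, abs_of_nonneg hx'.1]
  obtain ⟨Φ, hΦ, hΦβ⟩ := exists_continuous_extension (isOpen_ball.isClosed_compl.union hJcl) hβc
  have hβ0 : ∀ y, β y ≠ 0 := fun y => by
    simp only [hβ]; split_ifs
    · exact neg_ne_zero.2 (Complex.exp_ne_zero _)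
    · exact one_ne_zero
  have hcover : ∀ y, y ∈ (ball (f s) ρ)ᶜ ∪ f '' J ∨ ∃ F ∈ 𝓕, y ∈ O F := fun y => by
    by_cases hy : y ∈ ball (f s) ρ
    · rcases hρe y (ball_subset_closedBall hy) with h | ⟨F, hF, hyF, hF'⟩
      · exact Or.inl (Or.inr (heJ y h (mem_ball.1 hy).le))
      · exact Or.inr ⟨F, (hmem F).2 ⟨hF, hF'⟩, hyF, hy⟩
    · exact Or.inl (Or.inl hy)
  have hzero : ∀ y, Φ y = 0 → ∃ F ∈ 𝓕, y ∈ O F := fun y hy => by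
    rcases hcover y with h | h
    · exact absurd (hΦβ h ▸ hy) (hβ0 y)
    · exact h
  set Z : Set X → Set X := fun F => Φ ⁻¹' {0} ∩ O F with hZ
  have hZc : ∀ F ∈ 𝓕, IsCompact (Z F) := fun F hF => by
    refine hcpt.of_isClosed_subset ?_ fun y hy => ball_subset_closedBall hy.2.2
    have : Z F = Φ ⁻¹' {0} ∩ (⋃ G ∈ {G | G ∈ 𝓕 ∧ G ≠ F}, O G)ᶜ := by
      ext y
      simp only [hZ, mem_inter_iff, mem_compl_iff, mem_iUnion, not_exists]
      refine and_congr_right fun hy => ⟨fun h G hG hyG => ?_, fun h => ?_⟩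
      · exact Set.disjoint_left.1 (PC.disjoint_faces ((hmem F).1 hF).1 ((hmem G).1 hG.1).1 hG.2.symm)
          h.1 hyG.1
      · obtain ⟨G, hG, hyG⟩ := hzero y hy
        by_cases hGF : G = F
        · exact hGF ▸ hyG
        · exact absurd hyG (h G ⟨hG, hGF⟩)
    rw [this]
    exact (isClosed_singleton.preimage hΦ).inter
      (isOpen_biUnion fun G hG => hOo G hG.1).isClosed_compl
  have hLJ : ∀ t', L t' ∈ (ball (f s) ρ)ᶜ ∪ f '' J := fun t' => by
    by_cases h : dist (L t') (f s) < ρ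
    · obtain ⟨x, hx, hx'⟩ := heJ _ (hloc t' (h.trans_le hρδ)) h.le
      exact Or.inr ⟨x, hx, hx'⟩
    · exact Or.inl h
  have hsJ : s ∈ J := ⟨by linarith, by linarith⟩
  have hΦJ : ∀ x ∈ J, Φ (f x) = -Complex.exp (Real.pi * ((x - s) / ρ : ℝ) * Complex.I) :=
    fun x hx => by rw [hΦβ (Or.inr (mem_image_of_mem f hx)), hβJ x hx]
  have him : ∀ x ∈ J, (Φ (f x)).im = -Real.sin (Real.pi * ((x - s) / ρ)) := fun x hx => by
    rw [hΦJ x hx, ← Complex.ofReal_mul, Complex.neg_im, Complex.exp_ofReal_mul_I_im]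
  have hsin : ∀ x, s < x → x < s + ρ → 0 < Real.sin (Real.pi * ((x - s) / ρ)) := fun x h1 h2 => by
    have h3 : 0 < (x - s) / ρ := div_pos (by linarith) hρ
    have h4 : (x - s) / ρ < 1 := by rw [div_lt_one hρ]; linarith
    exact Real.sin_pos_of_pos_of_lt_pi (by positivity) (by nlinarith [Real.pi_pos])
  have hsin' : ∀ x, s - ρ < x → x < s → Real.sin (Real.pi * ((x - s) / ρ)) < 0 := fun x h1 h2 => by
    have := hsin (2 * s - x) (by linarith) (by linarith)
    rw [show Real.pi * ((2 * s - x - s) / ρ) = -(Real.pi * ((x - s) / ρ)) by ring, Real.sin_neg] at this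
    linarith
  have hΦs : Φ (f s) = -1 := by rw [hΦJ s hsJ]; simp
  have hdeg := exists_hasDeg_of_crossing (c := fun x => Φ (L x)) (t₀ := t) (hΦ.comp hL)
    (fun x => by rw [hp]) (fun x hx => by
      rcases hLJ x with h | ⟨y, hy, h⟩
      · rw [hΦβ (Or.inl h), show β (L x) = 1 from if_neg h]
        exact Complex.one_mem_slitPlane
      · rw [← h]
        by_cases hys : y = s + ρ ∨ y = s - ρ
        · rw [hΦβ (Or.inr (mem_image_of_mem f hy)), show β (f y) = 1 from if_neg ?_]
          · exact Complex.one_mem_slitPlane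
          · rw [hf y (Ioo_subset_Icc_self (hJl y hy)) s hs', not_lt]
            rcases hys with rfl | rfl
            · rw [add_sub_cancel_left]; exact le_abs_self ρ
            · rw [sub_sub_cancel_left, abs_neg]; exact le_abs_self ρ
        · push Not at hys
          refine Complex.mem_slitPlane_iff.2 (Or.inr ?_)
          rw [him y hy, neg_ne_zero]
          rcases lt_trichotomy y s with h1 | h1 | h1
          · exact (hsin' y (lt_of_le_of_ne hy.1 (Ne.symm hys.2)) h1).ne
          · exfalso
            obtain ⟨n, hn⟩ := hinj x (by rw [← h, h1])
            have := int_eq_zero_of_abs_lt hn (by rw [abs_lt]; constructor <;> linarith [hx.1, hx.2])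
            linarith [hx.1]
          · exact (hsin y h1 (lt_of_le_of_ne hy.2 hys.1)).ne')
    (by rw [ht, hΦs]; simp) (by rw [ht, hΦs]; simp)
    (hF.sign (G := fun y => (Φ y).im) (Or.inl ⟨by
      filter_upwards [Ioo_mem_nhdsLT (show s - ρ < s by linarith)] with x hx
      rw [him x ⟨hx.1.le, by linarith [hx.2]⟩]; linarith [hsin' x hx.1 hx.2], by
      filter_upwards [Ioo_mem_nhdsGT (show s < s + ρ by linarith)] with x hx
      rw [him x ⟨by linarith [hx.1], hx.2.le⟩]; linarith [hsin x hx.1 hx.2]⟩))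
  have hpatch : ∀ F, ∃ g h, F ∈ 𝓕 → IsPatch (O F) g h := fun F => by
    by_cases hF : F ∈ 𝓕
    · obtain ⟨g, h, c⟩ := PC.exists_patch hκ ((hmem F).1 hF).1 (f s) ρ
      exact ⟨g, h, fun _ => c⟩
    · exact ⟨fun _ => 0, fun _ => f s, fun h => absurd h hF⟩
  choose g h c using hpatch
  have hpt : ∀ F, ∃ x, F ∈ 𝓕 → x ∈ O F := fun F => by
    by_cases hF : F ∈ 𝓕
    · obtain ⟨x, hx, hx'⟩ := Metric.mem_closure_iff.1 ((hmem F).1 hF).2 ρ hρ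
      exact ⟨x, fun _ => ⟨hx, by rwa [mem_ball, dist_comm]⟩⟩
    · exact ⟨f s, fun h => absurd h hF⟩
  choose x hx using hpt
  obtain ⟨n, hn, hnd⟩ : ∃ n : ℤ, n ≠ 0 ∧ HasDeg (fun x => Φ (L x)) n := by
    rcases hdeg with h | h
    · exact ⟨1, one_ne_zero, h⟩
    · exact ⟨-1, by norm_num, h⟩
  obtain ⟨F, hF, hE⟩ := exists_enc_of_hasDeg hL hp 𝓕 (O := O) (Z := Z) (g := g) (h := h) (x := x) c
    (fun F hF G hG hFG => (PC.disjoint_faces ((hmem F).1 hF).1 ((hmem G).1 hG).1 hFG).mono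
      inter_subset_left inter_subset_left)
    (fun F hF => Set.disjoint_left.2 fun y hy ⟨t', ht'⟩ => heO y
      (ht' ▸ hloc t' (by rw [ht']; exact (mem_ball.1 hy.2).trans_le hρδ)) F hF hy)
    hZc (fun F _ => inter_subset_right) hx (φ := Φ) hΦ.continuousOn
    (fun y hy h => by
      obtain ⟨F, hF, hyF⟩ := hzero y h
      exact hy F hF ⟨h, hyF⟩) hn hnd
  exact ⟨F, ((hmem F).1 hF).1, x F, (hx F hF).1, (mem_ball.1 (hx F hF).2).trans_le hρδ, hE⟩

/-- Near an arc which a loop traverses once there are points of faces enclosed by the loop. -/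
theorem exists_enc_near (hκ : κ ≤ 0) (PC : PolyComplex2 κ X) (hL : Continuous L)
    (hp : ∀ t, L (t + 1) = L t) {f : ℝ → X} {s₀ ε : ℝ} (hε : 0 < ε)
    (hf : ∀ s ∈ Icc (s₀ - ε) (s₀ + ε), ∀ t ∈ Icc (s₀ - ε) (s₀ + ε), dist (f s) (f t) ≤ |s - t|)
    (hfi : InjOn f (Icc (s₀ - ε) (s₀ + ε))) (hfr : ∀ s ∈ Icc (s₀ - ε) (s₀ + ε), f s ∈ range L)
    (hinj : ∀ s ∈ Icc (s₀ - ε) (s₀ + ε), ∀ t t', L t = f s → L t' = f s → ∃ n : ℤ, t' - t = n)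
    {δ : ℝ} (hδ : 0 < δ) : ∃ F ∈ PC.faces, ∃ x ∈ F, dist x (f s₀) < δ ∧ Enc L x := by
  have hfc : ContinuousOn f (Icc (s₀ - ε) (s₀ + ε)) :=
    (LipschitzOnWith.of_dist_le_mul (K := 1) fun s hs t ht => by
      rw [NNReal.coe_one, one_mul, Real.dist_eq]; exact hf s hs t ht).continuousOn
  obtain ⟨ρ, hρ, -, hv, -, -⟩ := exists_local_structure hκ PC (f s₀)
  set η := min ε (min ρ δ / 2) with hη
  have hη0 : 0 < η := lt_min hε (half_pos (lt_min hρ hδ))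
  have hηε : η ≤ ε := min_le_left _ _
  have hs₀ : s₀ ∈ Icc (s₀ - ε) (s₀ + ε) := ⟨by linarith, by linarith⟩
  have hI : ∀ s ∈ Ioo s₀ (s₀ + η), s ∈ Icc (s₀ - ε) (s₀ + ε) := fun s hs =>
    ⟨by linarith [hs.1], by linarith [hs.2]⟩
  have hds : ∀ s ∈ Ioo s₀ (s₀ + η), dist (f s) (f s₀) < min ρ δ / 2 := fun s hs => by
    refine (hf s (hI s hs) s₀ hs₀).trans_lt ?_
    rw [abs_of_nonneg (by linarith [hs.1])]
    linarith [hs.2, min_le_right ε (min ρ δ / 2)]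
  have hsub : ∀ s₁ ε₁, s₁ - ε₁ ∈ Ioo s₀ (s₀ + η) → s₁ + ε₁ ∈ Ioo s₀ (s₀ + η) →
      Icc (s₁ - ε₁) (s₁ + ε₁) ⊆ Ioo s₀ (s₀ + η) := fun s₁ ε₁ h1 h2 s hs =>
    ⟨by linarith [hs.1, h1.1], by linarith [hs.2, h2.2]⟩
  -- a neighbourhood of a parameter whose image lies in an open set relative to the arc
  have hshrink : ∀ s₁ ∈ Ioo s₀ (s₀ + η), ∀ U, U ∈ 𝓝 (f s₁) → ∃ ε₁ > 0,
      Icc (s₁ - ε₁) (s₁ + ε₁) ⊆ Ioo s₀ (s₀ + η) ∧ ∀ s ∈ Icc (s₁ - ε₁) (s₁ + ε₁), f s ∈ U := by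
    intro s₁ hs₁ U hU
    have hc : ContinuousAt f s₁ := hfc.continuousAt (mem_of_superset (Ioo_mem_nhds hs₁.1 hs₁.2)
      fun s hs => hI s hs)
    obtain ⟨ε₁, hε₁, h⟩ := Metric.nhds_basis_closedBall.mem_iff.1
      (inter_mem (Ioo_mem_nhds hs₁.1 hs₁.2) (hc hU))
    rw [Real.closedBall_eq_Icc] at h
    exact ⟨ε₁, hε₁, fun s hs => (h hs).1, fun s hs => (h hs).2⟩
  have hfol : ∀ s₁ ε₁, 0 < ε₁ → Icc (s₁ - ε₁) (s₁ + ε₁) ⊆ Ioo s₀ (s₀ + η) → ∃ t₁, L t₁ = f s₁ ∧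
      ∃ ε' > 0, ε' ≤ ε₁ ∧ (∀ s ∈ Ioo (s₁ - ε') (s₁ + ε'), ∃ t, L t = f s ∧ Follows L t f s) ∧
      ∃ δ > 0, ∀ t, dist (L t) (L t₁) < δ → ∃ s ∈ Ioo (s₁ - ε') (s₁ + ε'), L t = f s := by
    intro s₁ ε₁ hε₁ hs₁
    have hs₁' : Icc (s₁ - ε₁) (s₁ + ε₁) ⊆ Icc (s₀ - ε) (s₀ + ε) := fun s hs => hI s (hs₁ hs)
    obtain ⟨t₁, ht₁⟩ := hfr s₁ (hs₁' ⟨by linarith, by linarith⟩)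
    exact ⟨t₁, ht₁, exists_follows hL hp hε₁ ht₁.symm (hfc.mono hs₁') (hfi.mono hs₁')
      (fun s hs => hfr s (hs₁' hs)) fun s hs => hinj s (hs₁' hs)⟩
  by_cases hface : ∃ s₁ ∈ Ioo s₀ (s₀ + η), ∃ F ∈ PC.faces, f s₁ ∈ F
  · obtain ⟨s₁, hs₁, F, hF, hfF⟩ := hface
    obtain ⟨ε₁, hε₁, hs1, hs2⟩ := hshrink s₁ hs₁ F ((PC.faces_open F hF).mem_nhds hfF)
    obtain ⟨t₁, ht₁, ε', hε', hε'', hfol, -⟩ := hfol s₁ ε₁ hε₁ hs1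
    obtain ⟨g, h, c⟩ := PC.exists_patch hκ hF (f s₀) δ
    have hs3 : Icc (s₁ - ε' / 2) (s₁ + ε' / 2) ⊆ Icc (s₁ - ε₁) (s₁ + ε₁) :=
      Icc_subset_Icc (by linarith) (by linarith)
    have hs4 : Icc (s₁ - ε' / 2) (s₁ + ε' / 2) ⊆ Icc (s₀ - ε) (s₀ + ε) :=
      fun s hs => hI s (hs1 (hs3 hs))
    obtain ⟨x, hx, hE⟩ := c.exists_enc hL hp (f := f) (a := s₁ - ε' / 2) (b := s₁ + ε' / 2) (by linarith)
      (fun s hs t ht => hf s (hs4 hs) t (hs4 ht))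
      (fun h => by
        have := hfi (hs4 ⟨le_rfl, by linarith⟩) (hs4 ⟨by linarith, le_rfl⟩) h
        linarith)
      (fun s hs => ⟨hs2 s (hs3 hs), (hds s (hs1 (hs3 hs))).trans_le
        (by linarith [min_le_right ρ δ])⟩)
      (fun s hs => hfol s ⟨by linarith [hs.1], by linarith [hs.2]⟩)
      (fun s hs => hinj s (hs4 (Ioo_subset_Icc_self hs)))
    exact ⟨F, hF, x, hx.1, hx.2, hE⟩
  push Not at hface
  have hedge : ∀ s ∈ Ioo s₀ (s₀ + η), ∃ e ∈ PC.edges, f s ∈ e := fun s hs => by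
    rcases PC.face_or_edge_or_vertex (f s) with ⟨F, hF, h⟩ | h | h
    · exact absurd h (hface s hs F hF)
    · exact h
    · have : f s = f s₀ := hv ⟨h, by
        rw [mem_closedBall]; linarith [hds s hs, min_le_left ρ δ, lt_min hρ hδ]⟩
      linarith [hfi (hI s hs) hs₀ this, hs.1]
  have hs₁ : s₀ + η / 2 ∈ Ioo s₀ (s₀ + η) := ⟨by linarith, by linarith⟩
  set s₁ := s₀ + η / 2 with hs₁def
  obtain ⟨e, he, hse⟩ := hedge s₁ hs₁
  obtain ⟨r, hr, -, -, -, hre⟩ := exists_edge_nbhd hκ PC he hse one_pos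
  obtain ⟨ε₁, hε₁, hs1, hs2⟩ := hshrink s₁ hs₁ _ (closedBall_mem_nhds _ hr)
  have hs2e : ∀ s ∈ Icc (s₁ - ε₁) (s₁ + ε₁), f s ∈ e := fun s hs => by
    rcases hre _ (hs2 s hs) with h | ⟨F, hF, h, -⟩
    · exact h
    · exact absurd h (hface s (hs1 hs) F hF)
  obtain ⟨t₁, ht₁, ε', hε', hε'', hfol, δ', hδ', hloc⟩ := hfol s₁ ε₁ hε₁ hs1
  have hs3 : Ioo (s₁ - ε') (s₁ + ε') ⊆ Icc (s₁ - ε₁) (s₁ + ε₁) := fun s hs =>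
    ⟨by linarith [hs.1], by linarith [hs.2]⟩
  obtain ⟨fe, l, hl, ⟨-, hfe⟩, hfe'⟩ := PC.edge_geodesic e he
  dsimp only at hfe
  have hl0 : (0 : ℝ) ∈ Icc 0 l := ⟨le_rfl, hl.le⟩
  have hu : ∀ s ∈ Icc (s₁ - ε₁) (s₁ + ε₁), dist (f s) (fe 0) ∈ Ioo 0 l ∧
      f s = fe (dist (f s) (fe 0)) := fun s hs => by
    have := hs2e s hs
    rw [← hfe'] at this
    obtain ⟨x, hx, hxs⟩ := this
    rw [← hxs, hfe x (Ioo_subset_Icc_self hx) 0 hl0, sub_zero, abs_of_pos hx.1]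
    exact ⟨hx, rfl⟩
  obtain ⟨t, ht, hF⟩ := hfol s₁ ⟨by linarith, by linarith⟩
  have hs₁I : s₁ ∈ Icc (s₁ - ε₁) (s₁ + ε₁) := ⟨by linarith, by linarith⟩
  have hsub' : Icc (s₁ - ε₁) (s₁ + ε₁) ⊆ Icc (s₀ - ε) (s₀ + ε) := fun s hs => hI s (hs1 hs)
  have hF' := hF.comp (f' := fe) (u := fun s => dist (f s) (fe 0)) (a := s₁ - ε₁) (b := s₁ + ε₁)
    ⟨by linarith, by linarith⟩ (continuous_dist.comp_continuousOn ((hfc.mono hsub').prodMk continuousOn_const))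
    (fun s hs s' hs' h => hfi (hsub' hs) (hsub' hs') (by
      dsimp only at h; rw [(hu s hs).2, (hu s' hs').2, h])) fun s hs => (hu s hs).2
  have hus := hu s₁ hs₁I
  obtain ⟨F, hFF, x, hx, hxd, hE⟩ := exists_enc_of_edge hκ PC hL hp he hfe hfe' hus.1
    (by rw [← hus.2, ht]) hF' (fun t' ht' => hinj s₁ (hI s₁ hs₁) t t' ht (by rw [ht', ← hus.2]))
    (δ := min δ' (min ρ δ / 2)) (lt_min hδ' (half_pos (lt_min hρ hδ))) (fun t' ht' => by
      rw [← hus.2, ← ht₁] at ht'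
      obtain ⟨s, hs, h⟩ := hloc t' (ht'.trans_le (min_le_left _ _))
      rw [h]; exact hs2e s (hs3 hs))
  refine ⟨F, hFF, x, hx, ?_, hE⟩
  rw [← hus.2] at hxd
  have h1 := hds s₁ hs₁
  have h2 := dist_triangle x (f s₁) (f s₀)
  have h3 := hxd.trans_le (min_le_right _ _)
  linarith [min_le_right ρ δ]

end NearCurve

end Cat2Cx
end

noncomputable section

open Topology

namespace Cat2Cx

/-! ### Loops which are geodesic off a convex set -/

section Maximum

variable {κ : ℝ} {X : Type*} [MetricSpace X] [CatZero X] {L : ℝ → X}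

theorem Btw.left_or_right {x y b z : X} (hb : Btw x b z) (hy : Btw x y z) :
    Btw x y b ∨ Btw b y z := by
  obtain ⟨s, hs, rfl⟩ := hb.exists_geo
  obtain ⟨t, ht, rfl⟩ := hy.exists_geo
  rcases le_total t s with h | h
  · exact Or.inl (btw_geo_geo x z ht.1 h hs.2)
  · exact Or.inr (hy.trans_left (btw_geo_geo x z hs.1 h ht.2)).1

theorem exists_ne_zero_mem_ker (φ : StrongDual ℝ ℂ) : ∃ u : ℂ, u ≠ 0 ∧ φ u = 0 := by
  by_cases h : φ 1 = 0
  · exact ⟨1, one_ne_zero, h⟩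
  · refine ⟨φ Complex.I • (1 : ℂ) - φ 1 • Complex.I, fun h0 => h ?_, ?_⟩
    · have := congrArg Complex.im h0
      simpa using this
    · rw [map_sub, map_smul, map_smul, smul_eq_mul, smul_eq_mul, mul_comm, sub_self]

/-- A supporting line of a convex open set inside a patch. -/
theorem IsPatch.exists_support {O S : Set X} {g : X → ℂ} {h : ℂ → X} (c : IsPatch O g h)
    (hS : IsOpen S) (hSc : GConvex S) {x : X} (hx : x ∈ O) (hxS : x ∉ S) :
    ∃ o₁ ∈ O, ∃ o₂ ∈ O, o₁ ≠ x ∧ o₂ ≠ x ∧ Btw o₁ x o₂ ∧ o₁ ∉ S ∧ o₂ ∉ S := by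
  have hconv : Convex ℝ (g '' (O ∩ S)) :=
    c.convex_image c.gconvex inter_subset_left (c.gconvex.inter hSc)
  obtain ⟨φ, hφ⟩ := geometric_hahn_banach_open_point hconv (c.isOpen_image_inter c.isOpen_image hS)
    (x := g x) (by
      rintro ⟨y, hy, hyx⟩
      exact hxS (c.injOn hy.1 hx hyx ▸ hy.2))
  obtain ⟨u, hu, hφu⟩ := exists_ne_zero_mem_ker φ
  obtain ⟨r, hr, hrO⟩ := Metric.isOpen_iff.1 c.isOpen_image (g x) (mem_image_of_mem g hx)
  set τ := r / 2 / ‖u‖ with hτ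
  have hun : 0 < ‖u‖ := norm_pos_iff.2 hu
  have hτ0 : 0 < τ := by positivity
  have key : ∀ σ : ℝ, |σ| = τ → ∃ o ∈ O, g o = g x + σ • u ∧ o ≠ x ∧ o ∉ S := fun σ hσ => by
    have hmem : g x + σ • u ∈ g '' O := hrO (by
      rw [mem_ball, dist_eq_norm, add_sub_cancel_left, norm_smul, Real.norm_eq_abs, hσ, hτ,
        div_mul_cancel₀ _ hun.ne']
      linarith)
    obtain ⟨h1, h2⟩ := c.inv_mem hmem
    refine ⟨_, h1, h2, fun h3 => ?_, fun h3 => ?_⟩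
    · rw [h3, left_eq_add, smul_eq_zero] at h2
      rcases h2 with h2 | h2
      · rw [h2, abs_zero] at hσ; exact hτ0.ne hσ
      · exact hu h2
    · have := hφ _ ⟨_, ⟨h1, h3⟩, h2⟩
      rw [map_add, map_smul, hφu, smul_zero, add_zero] at this
      exact lt_irrefl _ this
  obtain ⟨o₁, h1, e1, n1, s1⟩ := key (-τ) (by rw [abs_neg, abs_of_pos hτ0])
  obtain ⟨o₂, h2, e2, n2, s2⟩ := key τ (abs_of_pos hτ0)
  refine ⟨o₁, h1, o₂, h2, n1, n2, (c.btw o₁ h1 x hx o₂ h2).2 ?_, s1, s2⟩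
  rw [e1, e2]
  refine ⟨1 / 2, 1 / 2, by norm_num, by norm_num, by norm_num, ?_⟩
  simp only [Complex.real_smul]; push_cast; ring

/-- Following a geodesic of enclosed points along which the height increases one meets the loop. -/
theorem exists_mem_range_of_ray (hκ : κ ≤ 0) (PC : PolyComplex2 κ X) (hL : Continuous L)
    (hp : ∀ t, L (t + 1) = L t) {C : Set X} (hC : IsCompact C) (hne : C.Nonempty) (hconv : GConvex C)
    {η : ℝ} (hη : 0 < η) {o' : X} {m δ : ℝ} (hδ : 0 < δ) (hm : ∀ w ∈ fill L, hgt C η o' w ≤ m)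
    {F : Set X} (hF : F ∈ PC.faces) {x : X} (hx : x ∈ F) (hmx : m - hgt C η o' x < η * (δ ^ 2 / 8))
    (hv : ∀ y, dist x y < δ / 2 → y ∉ range L → y ∉ PC.vertices)
    {o : X} (hox : o ≠ x) (hod : dist x o ≤ δ / 4) (hoh : hgt C η o' x ≤ hgt C η o' o)
    (hoE : ∀ y, Btw x y o → Enc L y) :
    ∃ y ∈ range L, Btw x o y ∧ dist x y < δ / 2 ∧ ∀ w, Btw x w y → w ∈ fill L := by
  set A : Set X := {w | w ∈ fill L ∧ Btw x o w ∧ ∀ t ∈ Icc (0 : ℝ) 1, geo x w t ∈ fill L} with hA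
  have hfc := isClosed_fill L
  have hAc : IsCompact A := by
    refine (isCompact_fill hL hp).of_isClosed_subset ?_ fun w hw => hw.1
    have h1 : IsClosed {w : X | Btw x o w} := by
      unfold Btw; exact isClosed_eq (by fun_prop) (by fun_prop)
    have h2 : IsClosed {w : X | ∀ t ∈ Icc (0 : ℝ) 1, geo x w t ∈ fill L} := by
      simp only [ofPred_forall]
      refine isClosed_iInter fun t => isClosed_iInter fun _ => hfc.preimage ?_
      exact continuous_geo_comp continuous_const continuous_id continuous_const
    exact hfc.inter (h1.inter h2)
  have hAd : ∀ w ∈ A, dist x w < δ / 2 := fun w ⟨hw, hb, _⟩ => by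
    obtain ⟨t, ht, hot⟩ := hb.exists_geo
    have hdo : dist x o = t * dist x w := by rw [hot]; exact dist_left_geo x w ht
    have ht0 : 0 < t := lt_of_le_of_ne ht.1 fun h => hox (by rw [hot, ← h, geo_zero])
    have h1 := hgt_geo_le hC hne hconv hη.le o' x w ht
    rw [← hot] at h1
    have h2 := hm w hw
    by_contra hcon
    rw [not_lt] at hcon
    have h3 : t * (η * ((1 - t) * dist x w ^ 2)) ≤ t * (m - hgt C η o' x) := by nlinarith
    have h4 := le_of_mul_le_mul_left h3 ht0
    have h5 : (1 - t) * dist x w ^ 2 = dist x w * (dist x w - dist x o) := by rw [hdo]; ring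
    have h6 : δ ^ 2 / 8 ≤ dist x w * (dist x w - dist x o) := by nlinarith
    rw [h5] at h4
    nlinarith
  have ho : o ∈ A := by
    have : ∀ y, Btw x y o → y ∈ fill L := fun y hy => Or.inr (hoE y hy)
    exact ⟨this o (by unfold Btw; simp), by unfold Btw; simp, fun t ht => this _ (btw_geo x o ht)⟩
  obtain ⟨w, hw, hmax⟩ := hAc.exists_isMaxOn ⟨o, ho⟩ (f := fun w => dist x w) (by fun_prop)
  have hwfill : ∀ y, Btw x y w → y ∈ fill L := fun y hy => by
    obtain ⟨t, ht, rfl⟩ := hy.exists_geo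
    exact hw.2.2 t ht
  have hwd : ∀ y, Btw x y w → dist x y < δ / 2 := fun y hy => by
    have := hAd w hw
    unfold Btw at hy
    linarith [dist_nonneg (x := y) (y := w)]
  by_cases hex : ∃ y, Btw x y w ∧ y ∈ range L
  · obtain ⟨y, hy, hyL⟩ := hex
    refine ⟨y, hyL, ?_, hwd y hy, fun v hv => hwfill v (hy.trans_left hv).2⟩
    rcases hy.left_or_right hw.2.1 with h | h
    · exact h
    · rcases hw.2.1.left_or_right hy with h' | h'
      · exact absurd hyL (hoE y h').1
      · unfold Btw at h h' hy ⊢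
        have := hw.2.1
        unfold Btw at this
        linarith [dist_comm o y, dist_nonneg (x := o) (y := y)]
  · push Not at hex
    exfalso
    have hwb : Btw x w w := by unfold Btw; simp
    obtain ⟨w', hw', hb, hE⟩ := exists_enc_extension hκ PC hL hp hF hx
      (fun y hy => hv y (hwd y hy) (hex y hy)) ((hwfill w hwb).resolve_left (hex w hwb))
    have hw'A : w' ∈ A := by
      have : ∀ y, Btw x y w' → y ∈ fill L := fun y hy => by
        rcases hb.left_or_right hy with h | h
        · exact hwfill y h
        · exact Or.inr (hE y h)
      exact ⟨this w' (by unfold Btw; simp), (hb.trans_left hw.2.1).2, fun t ht => this _ (btw_geo x w' ht)⟩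
    have h1 : dist x w' ≤ dist x w := hmax hw'A
    have h2 := dist_pos.2 hw'.symm
    unfold Btw at hb
    linarith

/-- A loop in `E` which is a simple arc of local geodesics of the path metric of `E` wherever it is
outside a compact convex set `C`, is contained in `C`. -/
theorem mem_of_locally_geodesic (hκ : κ ≤ 0) (PC : PolyComplex2 κ X) {E : Set X}
    (hEc : IsClosed E) (hEr : RectConnected E) (hE : H1Trivial E) (hL : Continuous L)
    (hp : ∀ t, L (t + 1) = L t) (hLE : ∀ t, L t ∈ E) {C : Set X} (hC : IsCompact C)
    (hne : C.Nonempty) (hconv : GConvex C)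
    (hinj : ∀ t t', L t ∉ C → L t' = L t → ∃ n : ℤ, t' - t = n)
    (hgeo : ∀ t, L t ∉ C → ∃ (f : ℝ → X) (s₀ ε : ℝ), 0 < ε ∧ f s₀ = L t ∧
      (∀ s ∈ Icc (s₀ - ε) (s₀ + ε), ∀ s' ∈ Icc (s₀ - ε) (s₀ + ε),
        pathDistIn E (f s) (f s') = |s - s'|) ∧ ∀ s ∈ Icc (s₀ - ε) (s₀ + ε), f s ∈ range L)
    (t : ℝ) : L t ∈ C := by
  by_contra ht
  have hRc := isCompact_range_of_periodic hL hp
  obtain ⟨o', ho'⟩ := id hne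
  have hd : 0 < infDist (L t) C := (hC.isClosed.notMem_iff_infDist_pos hne).1 ht
  obtain ⟨R, hR⟩ := (hRc.image (f := fun y => dist o' y ^ 2) (by fun_prop)).bddAbove
  have hR' : ∀ t, dist o' (L t) ^ 2 ≤ R := fun t => hR (mem_image_of_mem _ (mem_range_self t))
  have hR0 : 0 ≤ R := (sq_nonneg _).trans (hR' 0)
  set η := infDist (L t) C / (R + 1) with hηdef
  have hη : 0 < η := by positivity
  have hηR : η * R < infDist (L t) C := by
    have : η * (R + 1) = infDist (L t) C := div_mul_cancel₀ _ (by positivity)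
    linarith
  obtain ⟨_, ⟨t₀, rfl⟩, hmax⟩ := hRc.exists_isMaxOn (range_nonempty L)
    (continuous_hgt C η o').continuousOn
  have hmaxL : ∀ t, hgt C η o' (L t) ≤ hgt C η o' (L t₀) := fun t => hmax (mem_range_self t)
  have hz : L t₀ ∉ C := fun h => by
    have h1 := hmaxL t
    unfold hgt at h1
    rw [infDist_zero_of_mem h] at h1
    have := hR' t₀
    nlinarith [sq_nonneg (dist o' (L t))]
  have hfill : ∀ w ∈ fill L, hgt C η o' w ≤ hgt C η o' (L t₀) :=
    fill_subset_of_gconvex (C := {w | hgt C η o' w ≤ hgt C η o' (L t₀)}) (fun x hx y hy s hs => by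
      have h1 := hgt_geo_le hC hne hconv hη.le o' x y hs
      have h2 : 0 ≤ η * (s * (1 - s) * dist x y ^ 2) :=
        mul_nonneg hη.le (mul_nonneg (mul_nonneg hs.1 (by linarith [hs.2])) (sq_nonneg _))
      have h3 : hgt C η o' x ≤ hgt C η o' (L t₀) := hx
      have h4 : hgt C η o' y ≤ hgt C η o' (L t₀) := hy
      have h5 := mul_le_mul_of_nonneg_left h4 hs.1
      have h6 := mul_le_mul_of_nonneg_left h3 (show 0 ≤ 1 - s by linarith [hs.2])
      change hgt C η o' (geo x y s) ≤ _
      linarith) (isClosed_le (continuous_hgt C η o') continuous_const) hL hp hmaxL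
  have hfillE := fill_subset_of_H1Trivial hE hEc hL hp hLE
  obtain ⟨f, s₀, ε₀, hε₀, hfs₀, hf₀, hfr₀⟩ := hgeo t₀ hz
  have hrE : ∀ {y}, y ∈ range L → y ∈ E := fun {y} ⟨t, ht⟩ => ht ▸ hLE t
  have hlip₀ : ∀ s ∈ Icc (s₀ - ε₀) (s₀ + ε₀), ∀ s' ∈ Icc (s₀ - ε₀) (s₀ + ε₀),
      dist (f s) (f s') ≤ |s - s'| := fun s hs s' hs' =>
    hf₀ s hs s' hs' ▸ dist_le_pathDistIn hEr (hrE (hfr₀ s hs)) (hrE (hfr₀ s' hs'))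
  obtain ⟨ε, hε, hεε, hfC⟩ : ∃ ε > 0, ε ≤ ε₀ ∧ ∀ s ∈ Icc (s₀ - ε) (s₀ + ε), f s ∉ C := by
    obtain ⟨r, hr, hrC⟩ := Metric.isOpen_iff.1 hC.isClosed.isOpen_compl (L t₀) hz
    refine ⟨min ε₀ (r / 2), lt_min hε₀ (half_pos hr), min_le_left _ _, fun s hs => hrC ?_⟩
    have h1 := min_le_left ε₀ (r / 2)
    have h2 := min_le_right ε₀ (r / 2)
    rw [mem_ball, ← hfs₀]
    refine (hlip₀ s ⟨by linarith [hs.1], by linarith [hs.2]⟩ s₀ ⟨by linarith, by linarith⟩).trans_lt ?_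
    rw [abs_lt]; constructor <;> linarith [hs.1, hs.2]
  have hsub : Icc (s₀ - ε) (s₀ + ε) ⊆ Icc (s₀ - ε₀) (s₀ + ε₀) :=
    Icc_subset_Icc (by linarith) (by linarith)
  have hf := fun s hs s' hs' => hf₀ s (hsub hs) s' (hsub hs')
  have hlip := fun s hs s' hs' => hlip₀ s (hsub hs) s' (hsub hs')
  have hfr := fun s hs => hfr₀ s (hsub hs)
  have hfi : InjOn f (Icc (s₀ - ε) (s₀ + ε)) := fun s hs s' hs' h => by
    have h1 := hf s hs s' hs'
    have h2 := hf s' hs' s' hs'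
    rw [h, h2, sub_self, abs_zero] at h1
    exact sub_eq_zero.1 (abs_eq_zero.1 h1.symm)
  have hinj' : ∀ s ∈ Icc (s₀ - ε) (s₀ + ε), ∀ t t', L t = f s → L t' = f s → ∃ n : ℤ, t' - t = n :=
    fun s hs t t' h h' => hinj t t' (h ▸ hfC s hs) (h'.trans h.symm)
  have hfc : ContinuousOn f (Icc (s₀ - ε) (s₀ + ε)) :=
    (LipschitzOnWith.of_dist_le_mul (K := 1) fun s hs t ht => by
      rw [NNReal.coe_one, one_mul, Real.dist_eq]; exact hlip s hs t ht).continuousOn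
  obtain ⟨ε', hε', hεε', -, δ₁, hδ₁, hloc⟩ := exists_follows hL hp hε hfs₀ hfc hfi hfr hinj'
  obtain ⟨ρ, hρ, -, hvert, -, -⟩ := exists_local_structure hκ PC (L t₀)
  set δ := min δ₁ ρ with hδdef
  have hδ : 0 < δ := lt_min hδ₁ hρ
  obtain ⟨δ₂, hδ₂, hcont⟩ := Metric.continuous_iff.1 (continuous_hgt C η o') (L t₀)
    (η * (δ ^ 2 / 8)) (by positivity)
  obtain ⟨F, hF, x, hx, hxd, hxE⟩ := exists_enc_near hκ PC hL hp hε hlip hfi hfr hinj'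
    (δ := min δ₂ (δ / 2)) (lt_min hδ₂ (half_pos hδ))
  rw [hfs₀] at hxd
  have hmx : hgt C η o' (L t₀) - hgt C η o' x < η * (δ ^ 2 / 8) := by
    have := hcont x (hxd.trans_le (min_le_left _ _))
    rw [Real.dist_eq, abs_lt] at this
    linarith [this.1]
  have hxz : dist x (L t₀) < δ / 2 := hxd.trans_le (min_le_right _ _)
  have hnear : ∀ y, dist x y < δ / 2 → dist y (L t₀) < δ := fun y hy => by
    have := dist_triangle_left y (L t₀) x
    linarith
  have hv : ∀ y, dist x y < δ / 2 → y ∉ range L → y ∉ PC.vertices := fun y hy hyL hyv => by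
    have : y = L t₀ := hvert ⟨hyv, ((hnear y hy).trans_le (min_le_right _ _)).le⟩
    exact hyL (this ▸ mem_range_self t₀)
  obtain ⟨r, hr, hrL⟩ := Metric.isOpen_iff.1 hRc.isClosed.isOpen_compl x hxE.1
  obtain ⟨g, h, c⟩ := PC.exists_patch hκ hF x (min r (δ / 4))
  have hxO : x ∈ F ∩ ball x (min r (δ / 4)) := ⟨hx, mem_ball_self (lt_min hr (by linarith))⟩
  have hOL : Disjoint (F ∩ ball x (min r (δ / 4))) (range L) := Set.disjoint_left.2 fun y hy hyL =>
    hrL (ball_subset_ball (min_le_left _ _) hy.2) hyL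
  obtain ⟨o₁, ho₁, o₂, ho₂, hn₁, hn₂, hb, hs₁, hs₂⟩ := c.exists_support
    (S := {w | hgt C η o' w < hgt C η o' x}) (isOpen_lt (continuous_hgt C η o') continuous_const)
    (fun y hy w hw s hs => by
      have h1 := hgt_geo_le hC hne hconv hη.le o' y w hs
      have h2 : 0 ≤ η * (s * (1 - s) * dist y w ^ 2) :=
        mul_nonneg hη.le (mul_nonneg (mul_nonneg hs.1 (by linarith [hs.2])) (sq_nonneg _))
      have h3 : hgt C η o' y < hgt C η o' x := hy
      have h4 : hgt C η o' w < hgt C η o' x := hw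
      change hgt C η o' (geo y w s) < _
      rcases hs.1.eq_or_lt with h0 | h0
      · rw [← h0] at h1 ⊢; rw [geo_zero]; exact h3
      · have h5 := mul_lt_mul_of_pos_left h4 h0
        have h6 := mul_le_mul_of_nonneg_left h3.le (show 0 ≤ 1 - s by linarith [hs.2])
        linarith) hxO (fun h => lt_irrefl _ (show hgt C η o' x < hgt C η o' x from h))
  have ray : ∀ o ∈ F ∩ ball x (min r (δ / 4)), o ≠ x → ¬ hgt C η o' o < hgt C η o' x →
      ∃ y ∈ range L, Btw x o y ∧ dist x y < δ / 2 ∧ ∀ w, Btw x w y → w ∈ fill L :=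
    fun o ho hox hoh => exists_mem_range_of_ray hκ PC hL hp hC hne hconv hη hδ hfill hF hx hmx hv hox
      (by
        have := mem_ball'.1 ho.2
        exact (this.trans_le (min_le_right _ _)).le) (not_lt.1 hoh) (fun y hy => by
        obtain ⟨s, hs, rfl⟩ := hy.exists_geo
        exact c.enc_of_enc hL hp hOL hxO (c.gconvex x hxO o ho s hs) hxE)
  obtain ⟨y₁, hy₁, hb₁, hd₁, hf₁⟩ := ray o₁ ho₁ hn₁ hs₁
  obtain ⟨y₂, hy₂, hb₂, hd₂, hf₂⟩ := ray o₂ ho₂ hn₂ hs₂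
  have hB1 : Btw o₁ x y₂ := ((hb.extend hn₂.symm hb₂).trans_left hb).2
  have hB2 : Btw y₂ x y₁ := ((hB1.symm.extend hn₁.symm hb₁).trans_left hB1.symm).2
  have hchord : ∀ y, Btw y₂ y y₁ → y ∈ E := fun y hy => by
    rcases hB2.left_or_right hy with h | h
    · exact hfillE (hf₂ y h.symm)
    · exact hfillE (hf₁ y h)
  have hpar : ∀ y ∈ range L, dist x y < δ / 2 → ∃ s ∈ Ioo (s₀ - ε') (s₀ + ε'), y = f s := by
    rintro _ ⟨t, rfl⟩ hy
    exact hloc t ((hnear _ hy).trans_le (min_le_left _ _))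
  obtain ⟨a, ha, rfl⟩ := hpar y₁ hy₁ hd₁
  obtain ⟨b, hb', rfl⟩ := hpar y₂ hy₂ hd₂
  have hfin : ∀ a ∈ Ioo (s₀ - ε') (s₀ + ε'), ∀ b ∈ Ioo (s₀ - ε') (s₀ + ε'), a ≤ b →
      Btw (f a) x (f b) → (∀ y, Btw (f a) y (f b) → y ∈ E) → False := fun a ha b hb hab hB hch => by
    have hI : Icc a b ⊆ Icc (s₀ - ε) (s₀ + ε) :=
      Icc_subset_Icc (by linarith [ha.1]) (by linarith [hb.2])
    obtain ⟨s, hs, hsx⟩ := exists_eq_of_chord hEr hab (fun s hs t ht => hf s (hI hs) t (hI ht))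
      (fun s hs => hrE (hfr s (hI hs))) (fun t ht => hch _ (btw_geo _ _ ht)) hB
    exact hxE.1 (hsx ▸ hfr s (hI hs))
  rcases le_total a b with hab | hab
  · exact hfin a ha b hb' hab hB2.symm fun y hy => hchord y hy.symm
  · exact hfin b hb' a ha hab hB2 hchord

end Maximum

end Cat2Cx
end

noncomputable section

open Topology

namespace Cat2Cx

/-! ### Winding numbers -/

section Winding

variable {c : ℝ → ℂ}

open Classical in
/-- The winding number of the loop `c` around `z`, zero if `z` lies on the loop. -/
def wind (c : ℝ → ℂ) (z : ℂ) : ℤ :=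
  if h : ∃ n, HasDeg (fun t => c t - z) n then h.choose else 0

theorem HasDeg.wind_eq {z : ℂ} {n : ℤ} (h : HasDeg (fun t => c t - z) n) : wind c z = n := by
  have : ∃ n, HasDeg (fun t => c t - z) n := ⟨n, h⟩
  rw [wind, dif_pos this]
  exact this.choose_spec.unique h

theorem hasDeg_wind (hc : Continuous c) (hp : ∀ t, c (t + 1) = c t) {z : ℂ} (hz : z ∉ range c) :
    HasDeg (fun t => c t - z) (wind c z) := by
  obtain ⟨n, hn⟩ := exists_hasDeg (c := fun t => c t - z) (by fun_prop)
    (fun t h => hz ⟨t, sub_eq_zero.1 h⟩) (fun t => by simp only [hp])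
  rwa [hn.wind_eq]

theorem notMem_range_of_wind {z : ℂ} (h : wind c z ≠ 0) : z ∉ range c := by
  rintro ⟨t, rfl⟩
  refine h ?_
  rw [wind, dif_neg]
  rintro ⟨n, u, -, hu, -⟩
  exact Complex.exp_ne_zero _ ((hu t).trans (sub_self _))

theorem wind_eq_of_path (hc : Continuous c) (hp : ∀ t, c (t + 1) = c t) {σ : ℝ → ℂ}
    (hσ : ContinuousOn σ (Icc 0 1)) (h : ∀ s ∈ Icc (0 : ℝ) 1, σ s ∉ range c) :
    wind c (σ 0) = wind c (σ 1) :=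
  HasDeg.homotopy_eq (fun s t => c t - σ s)
    ((hc.comp continuous_snd).continuousOn.sub (hσ.comp continuous_fst.continuousOn fun x hx => hx.1))
    (fun s hs t h0 => h s hs ⟨t, sub_eq_zero.1 h0⟩) (fun s _ t => by simp only [hp])
    (hasDeg_wind hc hp (h 0 (by simp))) (hasDeg_wind hc hp (h 1 (by simp)))

theorem wind_eq_of_segment (hc : Continuous c) (hp : ∀ t, c (t + 1) = c t) {x y : ℂ}
    (h : ∀ z ∈ segment ℝ x y, z ∉ range c) : wind c x = wind c y := by
  have := wind_eq_of_path hc hp (σ := fun s => AffineMap.lineMap x y s)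
    (AffineMap.lineMap_continuous (R := ℝ)).continuousOn fun s hs =>
      h _ (by rw [segment_eq_image_lineMap]; exact mem_image_of_mem _ hs)
  simpa using this

theorem eventually_wind_eq (hc : Continuous c) (hp : ∀ t, c (t + 1) = c t) {z : ℂ}
    (hz : z ∉ range c) : ∀ᶠ y in 𝓝 z, y ∉ range c ∧ wind c y = wind c z := by
  obtain ⟨r, hr, h⟩ := Metric.isOpen_iff.1
    (isCompact_range_of_periodic hc hp).isClosed.isOpen_compl z hz
  filter_upwards [ball_mem_nhds z hr] with y hy
  exact ⟨h hy, wind_eq_of_segment hc hp fun x hx =>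
    h ((convex_ball z r).segment_subset hy (mem_ball_self hr) hx)⟩

theorem wind_eq_zero_of_convex (hc : Continuous c) (hp : ∀ t, c (t + 1) = c t) {C : Set ℂ}
    (hC : Convex ℝ C) (hcC : ∀ t, c t ∈ C) {z : ℂ} (hz : z ∉ C) : wind c z = 0 := by
  have hm : ∀ s ∈ Icc (0 : ℝ) 1, ∀ t, AffineMap.lineMap (c 0) (c t) s ∈ C := fun s hs t =>
    hC.segment_subset (hcC 0) (hcC t) (by rw [segment_eq_image_lineMap]; exact mem_image_of_mem _ hs)
  have h0 : HasDeg (fun _ => c 0 - z) 0 :=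
    hasDeg_const (sub_ne_zero.2 fun h => hz (h ▸ hcC 0))
  have := HasDeg.homotopy (fun s t => AffineMap.lineMap (c 0) (c t) s - z)
    (by simp only [AffineMap.lineMap_apply_module]; fun_prop)
    (fun s hs t h => hz (sub_eq_zero.1 h ▸ hm s hs t)) (fun s _ t => by simp only [hp])
    (h0.congr fun t => by simp)
  exact HasDeg.wind_eq (by simpa using this)

theorem mem_interior_of_wind (hc : Continuous c) (hp : ∀ t, c (t + 1) = c t) {C : Set ℂ}
    (hC : Convex ℝ C) (hcC : ∀ t, c t ∈ C) {z : ℂ} (hz : wind c z ≠ 0) : z ∈ interior C := by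
  by_contra h
  have h1 : z ∈ closure Cᶜ := by rwa [closure_compl]
  obtain ⟨y, hyC, hy⟩ := ((mem_closure_iff_frequently.1 h1).and_eventually
    (eventually_wind_eq hc hp (notMem_range_of_wind hz))).exists
  exact hz (hy.2 ▸ wind_eq_zero_of_convex hc hp hC hcC hyC)

/-- The loop together with the points around which it winds. -/
def windFill (c : ℝ → ℂ) : Set ℂ := range c ∪ {z | wind c z ≠ 0}

theorem isClosed_wind (hc : Continuous c) (hp : ∀ t, c (t + 1) = c t) :
    IsClosed {z | wind c z = 0} := by
  rw [← isOpen_compl_iff, isOpen_iff_mem_nhds]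
  intro z hz
  filter_upwards [eventually_wind_eq hc hp (notMem_range_of_wind hz)] with y hy
  exact fun h => hz (hy.2.symm.trans h)

theorem isClosed_windFill (hc : Continuous c) (hp : ∀ t, c (t + 1) = c t) :
    IsClosed (windFill c) := by
  rw [← isOpen_compl_iff, isOpen_iff_mem_nhds]
  intro z hz
  filter_upwards [eventually_wind_eq hc hp fun h => hz (Or.inl h)] with y hy h
  rcases h with h | h
  · exact hy.1 h
  · exact hz (Or.inr fun h' => h (hy.2.trans h'))

theorem windFill_subset (hc : Continuous c) (hp : ∀ t, c (t + 1) = c t) {C : Set ℂ}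
    (hC : Convex ℝ C) (hcC : ∀ t, c t ∈ C) : windFill c ⊆ C := by
  rintro z (⟨t, rfl⟩ | hz)
  · exact hcC t
  · exact interior_subset (mem_interior_of_wind hc hp hC hcC hz)

/-- A periodic function descends to the image of a simple loop. -/
theorem exists_descent {A B : Type*} [TopologicalSpace A] [T2Space A] [TopologicalSpace B]
    {c : ℝ → A} (hc : Continuous c) (hp : ∀ t, c (t + 1) = c t)
    (hinj : ∀ t t', c t' = c t → ∃ n : ℤ, t' - t = n) {v : ℝ → B} (hv : Continuous v)
    (hvp : ∀ t, v (t + 1) = v t) : ∃ f : A → B, ContinuousOn f (range c) ∧ ∀ t, f (c t) = v t := by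
  have hf : ∀ t, v (Function.invFun c (c t)) = v t := fun t => by
    obtain ⟨n, hn⟩ := hinj t _ (Function.invFun_eq (f := c) ⟨t, rfl⟩)
    rw [show Function.invFun c (c t) = t + n by linarith, periodic_add_int hvp]
  refine ⟨fun x => v (Function.invFun c x), ?_, hf⟩
  rw [continuousOn_iff_isClosed]
  intro F hF
  refine ⟨c '' (Icc 0 1 ∩ v ⁻¹' F),
    ((isCompact_Icc.inter_right (hF.preimage hv)).image hc).isClosed, ?_⟩
  ext x; constructor
  · rintro ⟨hx, t, rfl⟩
    have h0 := eq_add_fract hp 0 t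
    have h1 := eq_add_fract hvp 0 t
    rw [zero_add, sub_zero] at h0 h1
    rw [mem_preimage, hf, h1] at hx
    exact ⟨⟨Int.fract t, ⟨⟨Int.fract_nonneg t, (Int.fract_lt_one t).le⟩, hx⟩, h0.symm⟩,
      mem_range_self t⟩
  · rintro ⟨⟨t, ⟨-, ht⟩, rfl⟩, h⟩
    exact ⟨by rw [mem_preimage, hf]; exact ht, h⟩

/-- The plane retracts onto a simple loop together with the points around which it winds. -/
theorem exists_retraction (hc : Continuous c) (hp : ∀ t, c (t + 1) = c t)
    (hinj : ∀ t t', c t' = c t → ∃ n : ℤ, t' - t = n) {w₁ w₂ : ℂ} (h₁ : w₁ ∉ range c)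
    (h₂ : w₂ ∉ range c) (hw : wind c w₁ = wind c w₂ + 1 ∨ wind c w₁ = wind c w₂ - 1) :
    ∃ ρ : ℂ → ℂ, Continuous ρ ∧ (∀ z, ρ z ∈ windFill c) ∧ ∀ z ∈ windFill c, ρ z = z := by
  have hcV : ∀ t, wind c (c t) = 0 := fun t => by
    by_contra h; exact notMem_range_of_wind h (mem_range_self t)
  obtain ⟨Φ, hΦ, hΦ0, e, he, hΦe⟩ : ∃ Φ : ℂ → ℂ, ContinuousOn Φ {z | wind c z = 0} ∧
      (∀ z, wind c z = 0 → Φ z ≠ 0) ∧ ∃ e : ℤ, (e = 1 ∨ e = -1) ∧ HasDeg (fun t => Φ (c t)) e := by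
    have hd₁ := hasDeg_wind hc hp h₁
    have hd₂ := hasDeg_wind hc hp h₂
    by_cases e₁ : wind c w₁ = 0
    · refine ⟨fun z => z - w₂, by fun_prop, fun z hz h => ?_, _, by omega, hd₂⟩
      rw [sub_eq_zero.1 h] at hz
      omega
    by_cases e₂ : wind c w₂ = 0
    · refine ⟨fun z => z - w₁, by fun_prop, fun z hz h => ?_, _, by omega, hd₁⟩
      exact e₁ (sub_eq_zero.1 h ▸ hz)
    · refine ⟨fun z => (z - w₁) / (z - w₂), ContinuousOn.div (by fun_prop) (by fun_prop)
        fun z hz h => e₂ (sub_eq_zero.1 h ▸ hz), fun z hz => div_ne_zero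
          (fun h => e₁ (sub_eq_zero.1 h ▸ hz)) fun h => e₂ (sub_eq_zero.1 h ▸ hz), _, ?_, hd₁.div hd₂⟩
      omega
  have hee : (e : ℝ) * e = 1 := by rcases he with rfl | rfl <;> norm_num
  obtain ⟨u, hu, hue, hup⟩ := hΦe
  obtain ⟨f, hf, hfc⟩ := exists_descent hc hp hinj
    (v := fun t => u t - 2 * Real.pi * Complex.I * (e * t)) (by fun_prop)
    (fun t => by simp only [hup]; push_cast; ring)
  obtain ⟨F, hF, hFf⟩ := exists_continuous_extension
    (isCompact_range_of_periodic hc hp).isClosed hf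
  obtain ⟨W, hW, hWv, hWe⟩ := exists_angle_fun (w := fun t => c (e * t))
    (hc.comp (by fun_prop)) (fun t => by rw [mul_add, mul_one]; exact periodic_add_int hp _ _)
  set r : ℂ → ℂ := fun z => W (Φ z * Complex.exp (-F z)) with hr
  have hrc : ∀ t, r (c t) = c t := fun t => by
    have h1 : Φ (c t) * Complex.exp (-F (c t)) =
        (1 : ℝ) * Complex.exp (2 * Real.pi * Complex.I * ((e * t : ℝ) : ℂ)) := by
      rw [← show _ = Φ (c t) from hue t, hFf (mem_range_self t), hfc, ← Complex.exp_add, Complex.ofReal_one, one_mul]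
      congr 1; push_cast; ring
    change W _ = _
    rw [h1, hWe _ _ one_pos, ← mul_assoc, hee, one_mul]
  classical
  refine ⟨fun z => if wind c z = 0 then r z else z, ?_, fun z => ?_, fun z hz => ?_⟩
  · rw [← continuousOn_univ]
    refine continuousOn_glue (f₁ := r) (f₂ := fun z => z) (isClosed_wind hc hp)
      (isClosed_windFill hc hp) (fun z _ => ?_) ?_ continuousOn_id (fun z hz => if_pos hz.2)
      fun z hz => ?_
    · by_cases h : wind c z = 0
      · exact Or.inl h
      · exact Or.inr (Or.inr h)
    · rw [univ_inter]
      exact hW.comp (hΦ.mul (by fun_prop)) fun z hz =>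
        mul_ne_zero (hΦ0 z hz) (Complex.exp_ne_zero _)
    · rcases hz.2 with ⟨t, rfl⟩ | h
      · exact (if_pos (hcV t)).trans (hrc t)
      · exact if_neg h
  · dsimp only
    split_ifs with h
    · rw [hr]; dsimp only; rw [hWv]; exact Or.inl (mem_range_self _)
    · exact Or.inr h
  · dsimp only
    split_ifs with h
    · rcases hz with ⟨t, rfl⟩ | h'
      · exact hrc t
      · exact absurd h h'
    · rfl

end Winding

theorem contractibleSpace_of_retract {A B : Type*} [TopologicalSpace A] [TopologicalSpace B]
    [ContractibleSpace B] {S : Set A} {g : A → B} {k : B → A} (hg : ContinuousOn g S)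
    (hk : Continuous k) (hkS : ∀ z, k z ∈ S) (h : ∀ x ∈ S, k (g x) = x) : ContractibleSpace S := by
  rw [contractible_iff_id_nullhomotopic]
  have := ((id_nullhomotopic B).comp_right (⟨fun z => ⟨k z, hkS z⟩, by fun_prop⟩ : C(B, S))).comp_left
    (⟨fun x => g x, hg.domRestrict⟩ : C(S, B))
  convert this
  ext x
  exact (h x x.2).symm

end Cat2Cx
end

noncomputable section

open Topology

namespace Cat2Cx

/-! ### Points enclosed by a loop in a planar convex set -/

section Planar

open ComplexConjugate in
theorem mem_interior_of_cross {S : Set ℂ} (hS : Convex ℝ S) {z A B : ℂ} {l m : ℝ} (hl : 0 < l)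
    (hm : 0 < m) (hA : z + A ∈ S) (hA' : z - l * A ∈ S) (hB : z + B ∈ S) (hB' : z - m * B ∈ S)
    (hd : (A * conj B).im ≠ 0) : z ∈ interior S := by
  have key : ∀ {l : ℝ} {A : ℂ}, 0 < l → z + A ∈ S → z - l * A ∈ S →
      ∀ s : ℝ, -l ≤ s → s ≤ 1 → z + s * A ∈ S := by
    intro l A hl h h' s hs hs'
    have := hS h' h (show 0 ≤ (1 - s) / (1 + l) from div_nonneg (by linarith) (by linarith))
      (show 0 ≤ (l + s) / (1 + l) from div_nonneg (by linarith) (by linarith))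
      (by field_simp; ring)
    convert this using 1
    have : (1 + l : ℂ) ≠ 0 := by exact_mod_cast (by linarith : (1 + l : ℝ) ≠ 0)
    simp only [Complex.real_smul]; push_cast; field_simp; ring
  rw [mem_interior_iff_mem_nhds]
  have h1 : ∀ᶠ y in 𝓝 z, ((y - z) * conj B).im / (A * conj B).im * 2 ∈ Ioo (-l) 1 := by
    refine ContinuousAt.eventually_mem (by fun_prop) (Ioo_mem_nhds ?_ ?_) <;> simp [hl]
  have h2 : ∀ᶠ y in 𝓝 z, (A * conj (y - z)).im / (A * conj B).im * 2 ∈ Ioo (-m) 1 := by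
    refine ContinuousAt.eventually_mem (by fun_prop) (Ioo_mem_nhds ?_ ?_) <;> simp [hm]
  filter_upwards [h1, h2] with y h1 h2
  have := hS (key hl hA hA' _ h1.1.le h1.2.le) (key hm hB hB' _ h2.1.le h2.2.le)
    (show (0 : ℝ) ≤ 1 / 2 by norm_num) (show (0 : ℝ) ≤ 1 / 2 by norm_num) (by norm_num)
  generalize hs : ((y - z) * conj B).im / (A * conj B).im * 2 = s at this
  generalize ht : (A * conj (y - z)).im / (A * conj B).im * 2 = t at this
  rw [div_mul_eq_mul_div, div_eq_iff hd] at hs ht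
  convert this using 1
  simp only [Complex.mul_im, Complex.conj_re, Complex.conj_im, Complex.sub_re, Complex.sub_im]
    at hd hs ht
  apply Complex.ext
  · refine mul_left_cancel₀ hd ?_
    simp only [Complex.add_re, Complex.smul_re, Complex.re_ofReal_mul, smul_eq_mul]
    linear_combination A.re / 2 * hs + B.re / 2 * ht
  · refine mul_left_cancel₀ hd ?_
    simp only [Complex.add_im, Complex.smul_im, Complex.im_ofReal_mul, smul_eq_mul]
    linear_combination A.im / 2 * hs + B.im / 2 * ht

end Planar

section Enclosed

variable {κ : ℝ} {X : Type*} [MetricSpace X] [CatZero X] {D : Set X} {G : X → ℂ} {h : ℂ → X}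
  {L : ℝ → X}

theorem IsChart.frequently_mem_face (c : IsChart D G h) (hκ : κ ≤ 0) (PC : PolyComplex2 κ X)
    {w : X} (hw : w ∈ D) (hi : G w ∈ interior (G '' D)) :
    ∃ᶠ y in 𝓝 (G w), ∃ F ∈ PC.faces, h y ∈ F := by
  intro hno
  obtain ⟨ρ, hρ, -, hvert, -⟩ := exists_local_structure hκ PC w
  obtain ⟨ε, hε, hfin, -⟩ := PC.locally_finite w
  have hc : ContinuousAt h (G w) := c.contInv.continuousAt (mem_interior_iff_mem_nhds.1 hi)
  have hb : ball w (min ρ ε) ∈ 𝓝 (h (G w)) := by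
    rw [c.leftInv w hw]; exact ball_mem_nhds w (lt_min hρ hε)
  obtain ⟨r, hr, hr'⟩ := Metric.eventually_nhds_iff_ball.1
    ((hno.and (mem_interior_iff_mem_nhds.1 hi)).and (hc.eventually_mem hb))
  set K := sphere (G w) (r / 2)
  have hsub : ∀ y ∈ K, y ∈ ball (G w) r := fun y hy => by
    rw [mem_ball, mem_sphere.1 hy]; linarith
  have hinf : K.Infinite := by
    refine (isPreconnected_sphere (by rw [Complex.rank_real_complex]; norm_num) _ _).infinite_of_nontrivial
      ⟨G w + (r / 2 : ℝ), ?_, G w - (r / 2 : ℝ), ?_, fun h => ?_⟩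
    · simp [abs_of_pos hr]
    · simp [abs_of_pos hr]
    · have := congrArg Complex.re h
      simp at this; linarith
  have hex : ∃ e ∈ PC.edges, (K ∩ h ⁻¹' e).Infinite := by
    by_contra hcon
    push Not at hcon
    refine hinf (((hfin.subset fun c hc => ?_ :
      {e | e ∈ PC.edges ∧ (e ∩ ball w ε).Nonempty}.Finite).biUnion
        fun e he => hcon e he.1).subset fun y hy => ?_)
    · exact ⟨Or.inr hc.1, hc.2⟩
    · obtain ⟨⟨hf, hyD⟩, hyb⟩ := hr' y (hsub y hy)
      rcases PC.face_or_edge_or_vertex (h y) with hF | ⟨e, he, hye⟩ | hv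
      · exact absurd hF hf
      · exact mem_biUnion (x := e) ⟨he, h y, hye, ball_subset_ball (min_le_right _ _) hyb⟩ ⟨hy, hye⟩
      · have := hvert ⟨hv, ball_subset_closedBall (ball_subset_ball (min_le_left _ _) hyb)⟩
        have h2 : y = G w := by rw [← (c.inv_mem hyD).2, mem_singleton_iff.1 this]
        rw [h2, mem_sphere, dist_self] at hy
        linarith
  obtain ⟨e, he, hinfe⟩ := hex
  obtain ⟨f, l, hl, ⟨-, hf⟩, rfl⟩ := PC.edge_geodesic e he
  obtain ⟨t, hts, htc⟩ := hinfe.exists_subset_card_eq 3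
  have hbtw : ∀ y₁ ∈ t, ∀ y₂ ∈ t, ∀ y₃ ∈ t, y₁ ≠ y₂ → y₁ ≠ y₃ → y₂ ≠ y₃ →
      ¬ Btw (h y₁) (h y₂) (h y₃) := by
    intro y₁ h₁ y₂ h₂ y₃ h₃ n12 n13 n23 hb
    have m : ∀ y ∈ t, y ∈ G '' D ∧ y ∈ K := fun y hy =>
      ⟨(hr' y (hsub y (hts hy).1)).1.2, (hts hy).1⟩
    have hseg := (c.btw _ (c.inv_mem (m _ h₁).1).1 _ (c.inv_mem (m _ h₂).1).1 _
      (c.inv_mem (m _ h₃).1).1).1 hb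
    rw [(c.inv_mem (m _ h₁).1).2, (c.inv_mem (m _ h₂).1).2, (c.inv_mem (m _ h₃).1).2] at hseg
    have := openSegment_subset_ball_of_ne (sphere_subset_closedBall (m _ h₁).2)
      (sphere_subset_closedBall (m _ h₃).2) n13 (mem_openSegment_of_ne_left_right n12 n23.symm hseg)
    exact (mem_ball.1 this).ne (mem_sphere.1 (m _ h₂).2)
  obtain ⟨y₁, y₂, y₃, n12, n13, n23, rfl⟩ := Finset.card_eq_three.1 htc
  obtain ⟨s₁, hs₁, e₁⟩ := (hts (by simp : y₁ ∈ _)).2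
  obtain ⟨s₂, hs₂, e₂⟩ := (hts (by simp : y₂ ∈ _)).2
  obtain ⟨s₃, hs₃, e₃⟩ := (hts (by simp : y₃ ∈ _)).2
  have hbt : ∀ a ∈ Ioo 0 l, ∀ b ∈ Ioo 0 l, ∀ d ∈ Ioo 0 l, a ≤ b → b ≤ d →
      Btw (f a) (f b) (f d) := by
    intro a ha b hb d hd hab hbd
    have H : ∀ a ∈ Ioo 0 l, ∀ b ∈ Ioo 0 l, dist (f a) (f b) = |a - b| :=
      fun a ha b hb => hf a (Ioo_subset_Icc_self ha) b (Ioo_subset_Icc_self hb)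
    unfold Btw
    rw [H a ha b hb, H b hb d hd, H a ha d hd, abs_of_nonpos (by linarith),
      abs_of_nonpos (by linarith), abs_of_nonpos (by linarith)]
    ring
  have h1 : y₁ ∈ ({y₁, y₂, y₃} : Finset ℂ) := by simp
  have h2 : y₂ ∈ ({y₁, y₂, y₃} : Finset ℂ) := by simp
  have h3 : y₃ ∈ ({y₁, y₂, y₃} : Finset ℂ) := by simp
  rcases le_total s₁ s₂ with a | a <;> rcases le_total s₂ s₃ with b | b <;>
    rcases le_total s₁ s₃ with d | d
  · exact hbtw _ h1 _ h2 _ h3 n12 n13 n23 (e₁ ▸ e₂ ▸ e₃ ▸ hbt _ hs₁ _ hs₂ _ hs₃ a b)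
  · exact hbtw _ h1 _ h2 _ h3 n12 n13 n23 (e₁ ▸ e₂ ▸ e₃ ▸ hbt _ hs₁ _ hs₂ _ hs₃ a b)
  · exact hbtw _ h1 _ h3 _ h2 n13 n12 n23.symm (e₁ ▸ e₂ ▸ e₃ ▸ hbt _ hs₁ _ hs₃ _ hs₂ d b)
  · exact hbtw _ h3 _ h1 _ h2 n13.symm n23.symm n12 (e₁ ▸ e₂ ▸ e₃ ▸ hbt _ hs₃ _ hs₁ _ hs₂ d a)
  · exact hbtw _ h2 _ h1 _ h3 n12.symm n23 n13 (e₁ ▸ e₂ ▸ e₃ ▸ hbt _ hs₂ _ hs₁ _ hs₃ a d)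
  · exact hbtw _ h2 _ h3 _ h1 n23 n12.symm n13.symm (e₁ ▸ e₂ ▸ e₃ ▸ hbt _ hs₂ _ hs₃ _ hs₁ b d)
  · exact hbtw _ h3 _ h2 _ h1 n23.symm n13.symm n12.symm (e₁ ▸ e₂ ▸ e₃ ▸ hbt _ hs₃ _ hs₂ _ hs₁ b a)
  · exact hbtw _ h3 _ h2 _ h1 n23.symm n13.symm n12.symm (e₁ ▸ e₂ ▸ e₃ ▸ hbt _ hs₃ _ hs₂ _ hs₁ b a)

open ComplexConjugate in
theorem IsChart.mem_interior_of_patch (c : IsChart D G h) (hD : GConvex D) {O : Set X} {g : X → ℂ}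
    {k : ℂ → X} (p : IsPatch O g k) {w : X} (hw : w ∈ D) (hwO : w ∈ O)
    (hi : G w ∈ interior (G '' D)) : w ∈ interior D := by
  have hc : ContinuousAt h (G w) := c.contInv.continuousAt (mem_interior_iff_mem_nhds.1 hi)
  have hb : O ∈ 𝓝 (h (G w)) := by rw [c.leftInv w hw]; exact p.isOpen.mem_nhds hwO
  have hev : ∀ᶠ y in 𝓝 (G w), y ∈ G '' D := mem_interior_iff_mem_nhds.1 hi
  obtain ⟨r, hr, hr'⟩ := Metric.eventually_nhds_iff_ball.1 (hev.and (hc.eventually_mem hb))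
  set ε := r / 2
  have hε : 0 < ε := by positivity
  have hmem : ∀ v : ℂ, ‖v‖ = 1 → h (G w + ε * v) ∈ D ∧ G (h (G w + ε * v)) = G w + ε * v ∧
      h (G w + ε * v) ∈ O := fun v hv => by
    have := hr' (G w + ε * v) (by simp [hv, ε, abs_of_pos hr, hr])
    exact ⟨(c.inv_mem this.1).1, (c.inv_mem this.1).2, this.2⟩
  set P : ℂ → ℂ := fun v => g (h (G w + ε * v)) - g w
  have hεc : (ε : ℂ) ≠ 0 := by exact_mod_cast hε.ne'
  have hP0 : ∀ v : ℂ, ‖v‖ = 1 → P v ≠ 0 := fun v hv h0 => by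
    have h1 := p.injOn (hmem v hv).2.2 hwO (sub_eq_zero.1 h0)
    have h2 := (hmem v hv).2.1
    rw [h1, left_eq_add, mul_eq_zero] at h2
    rcases h2 with h2 | h2
    · exact hεc h2
    · rw [h2, norm_zero] at hv; exact zero_ne_one hv
  have hopp : ∀ v : ℂ, ‖v‖ = 1 → ∃ l : ℝ, 0 < l ∧ P (-v) = -l * P v := fun v hv => by
    have hv' : ‖-v‖ = 1 := by rwa [norm_neg]
    obtain ⟨a, b, ha, hb, hab, he⟩ := (p.btw _ (hmem v hv).2.2 _ hwO _ (hmem _ hv').2.2).1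
      ((c.btw _ (hmem v hv).1 _ hw _ (hmem _ hv').1).2 (by
        rw [(hmem v hv).2.1, (hmem _ hv').2.1]
        refine ⟨1 / 2, 1 / 2, by norm_num, by norm_num, by norm_num, ?_⟩
        simp only [Complex.real_smul]; push_cast; ring))
    have habc : (a + b : ℂ) = 1 := by exact_mod_cast hab
    have he' : a * P v + b * P (-v) = 0 := by
      simp only [Complex.real_smul] at he
      simp only [P]
      linear_combination he - g w * habc
    have hb0 : b ≠ 0 := fun h => by
      subst h
      have : (a : ℂ) ≠ 0 := by rw [show a = 1 by linarith]; simp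
      simp [this, hP0 v hv] at he'
    have ha0 : a ≠ 0 := fun h => by
      subst h
      simp [hb0, hP0 _ hv'] at he'
    refine ⟨a / b, div_pos (ha.lt_of_ne' ha0) (hb.lt_of_ne' hb0), ?_⟩
    have : (b : ℂ) ≠ 0 := by exact_mod_cast hb0
    push_cast; field_simp
    linear_combination he'
  have hbtwP : ∀ v : ℂ, ∀ v' : ℂ, ‖v‖ = 1 → ‖v'‖ = 1 → ∀ s ∈ Icc (0 : ℝ) 1, P v = s * P v' →
      v = v' := by
    intro v v' hv hv' s hs he
    obtain ⟨a, b, ha, hb, hab, h1⟩ := (c.btw _ hw _ (hmem v hv).1 _ (hmem v' hv').1).1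
      ((p.btw _ hwO _ (hmem v hv).2.2 _ (hmem v' hv').2.2).2 (by
        refine ⟨1 - s, s, by linarith [hs.2], hs.1, by ring, ?_⟩
        simp only [Complex.real_smul, P] at he ⊢
        push_cast
        linear_combination -he))
    rw [(hmem v hv).2.1, (hmem v' hv').2.1] at h1
    have habc : (a + b : ℂ) = 1 := by exact_mod_cast hab
    have h2 : v = b * v' := by
      simp only [Complex.real_smul] at h1
      have : (ε : ℂ) * (v - b * v') = 0 := by linear_combination -h1 + G w * habc
      rcases mul_eq_zero.1 this with h | h
      · exact absurd h hεc
      · exact sub_eq_zero.1 h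
    have h3 := congrArg norm h2
    rw [norm_mul, hv, hv', mul_one, Complex.norm_real, Real.norm_eq_abs, abs_of_nonneg hb] at h3
    rw [h2, ← h3]; simp
  have hray : ∀ v : ℂ, ∀ v' : ℂ, ‖v‖ = 1 → ‖v'‖ = 1 → ∀ s : ℝ, 0 < s → P v = s * P v' →
      v = v' := by
    intro v v' hv hv' s hs he
    rcases le_total s 1 with h1 | h1
    · exact hbtwP v v' hv hv' s ⟨hs.le, h1⟩ he
    · refine (hbtwP v' v hv' hv s⁻¹ ⟨by positivity, inv_le_one_of_one_le₀ h1⟩ ?_).symm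
      have : (s : ℂ) ≠ 0 := by exact_mod_cast hs.ne'
      rw [he]; push_cast; field_simp
  have hdet : (P 1 * conj (P Complex.I)).im ≠ 0 := by
    intro h0
    have h1 := hP0 Complex.I (by simp)
    set s := (P 1 * conj (P Complex.I)).re / Complex.normSq (P Complex.I)
    have hs : P 1 = s * P Complex.I := by
      have h2 : P 1 * conj (P Complex.I) = ((P 1 * conj (P Complex.I)).re : ℂ) := by
        apply Complex.ext <;> simp [h0]
      have h3 : (Complex.normSq (P Complex.I) : ℂ) ≠ 0 := by
        exact_mod_cast (Complex.normSq_pos.2 h1).ne'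
      simp only [s]
      push_cast
      field_simp
      rw [← h2, ← Complex.mul_conj]; ring
    have hsne : s ≠ 0 := fun h => hP0 1 (by simp) (by rw [hs, h]; simp)
    obtain ⟨l, hl, hP⟩ := hopp Complex.I (by simp)
    rcases hsne.lt_or_gt with h2 | h2
    · have := hray 1 (-Complex.I) (by simp) (by simp) (-s / l) (div_pos (by linarith) hl) (by
        have : (l : ℂ) ≠ 0 := by exact_mod_cast hl.ne'
        rw [hP, hs]; push_cast; field_simp)
      simpa using congrArg Complex.re this
    · simpa using congrArg Complex.re (hray 1 Complex.I (by simp) (by simp) s h2 hs)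
  have hS : Convex ℝ (g '' (D ∩ O)) :=
    p.convex_image p.gconvex inter_subset_right (hD.inter p.gconvex)
  have hin : ∀ v : ℂ, ‖v‖ = 1 → g w + P v ∈ g '' (D ∩ O) := fun v hv =>
    ⟨_, ⟨(hmem v hv).1, (hmem v hv).2.2⟩, by simp [P]⟩
  obtain ⟨l, hl, hPl⟩ := hopp 1 (by simp)
  obtain ⟨m, hm, hPm⟩ := hopp Complex.I (by simp)
  have hinside := mem_interior_of_cross hS hl hm (hin 1 (by simp))
    (by convert hin (-1) (by simp) using 1; rw [hPl]; ring) (hin Complex.I (by simp))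
    (by convert hin (-Complex.I) (by simp) using 1; rw [hPm]; ring) hdet
  refine interior_maximal (fun y hy => ?_) (p.isOpen_inter_preimage isOpen_interior) ⟨hwO, hinside⟩
  obtain ⟨x, hx, he⟩ := interior_subset hy.2
  rw [← p.injOn hx.2 hy.1 he]; exact hx.1

theorem IsChart.mem_fill_of_wind (c : IsChart D G h) (hκ : κ ≤ 0) (PC : PolyComplex2 κ X)
    (hDc : IsCompact D) (hD : GConvex D) (hL : Continuous L) (hp : ∀ t, L (t + 1) = L t)
    (hLD : ∀ t, L t ∈ D) {w : X} (hw : w ∈ D) (hwind : wind (fun t => G (L t)) (G w) ≠ 0) :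
    w ∈ fill L := by
  have hc : Continuous fun t => G (L t) := c.continuousOn.comp_continuous hL hLD
  have hcp : ∀ t, G (L (t + 1)) = G (L t) := fun t => by rw [hp]
  have hconv : Convex ℝ (G '' D) := c.convex_image hD le_rfl hD
  have hi : G w ∈ interior (G '' D) :=
    mem_interior_of_wind hc hcp hconv (fun t => mem_image_of_mem _ (hLD t)) hwind
  have hcont : ContinuousAt h (G w) := c.contInv.continuousAt (mem_interior_iff_mem_nhds.1 hi)
  by_contra hno
  have hnh : (fill L)ᶜ ∈ 𝓝 (h (G w)) := by
    rw [c.leftInv w hw]; exact (isClosed_fill L).isOpen_compl.mem_nhds hno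
  obtain ⟨y, ⟨F, hF, hyF⟩, ⟨⟨hyr, hyw⟩, hyi⟩, hyn⟩ :=
    ((c.frequently_mem_face hκ PC hw hi).and_eventually
      (((eventually_wind_eq hc hcp (notMem_range_of_wind hwind)).and
        (isOpen_interior.mem_nhds hi)).and (hcont.eventually_mem hnh))).exists
  have hyD := c.inv_mem (interior_subset hyi)
  obtain ⟨g, k, p⟩ := PC.exists_patch hκ hF (h y) 1
  have hinside := c.mem_interior_of_patch hD p hyD.1 ⟨hyF, mem_ball_self one_pos⟩ (by rwa [hyD.2])
  have hne : D.Nonempty := ⟨w, hw⟩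
  refine hyn (Or.inr (enc_of_hasDeg (L := L) (x := h y) ?_ (φ := fun x => G (proj D x) - y) ?_ ?_
    (hyw ▸ hwind : wind (fun t => G (L t)) y ≠ 0) ?_))
  · rintro ⟨t, ht⟩
    exact hyr ⟨t, by simp only [ht, hyD.2]⟩
  · exact (c.continuousOn.comp_continuous (continuous_proj hDc hne hD)
      fun x => (proj_spec hDc hne x).1).sub continuous_const
  · intro x hx h0
    have h1 : proj D x = h y :=
      c.injOn (proj_spec hDc hne x).1 hyD.1 (by rw [hyD.2]; exact sub_eq_zero.1 h0)
    have := eq_of_proj_mem_interior hDc (y := x) (by rwa [h1])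
    exact hx (this.trans h1)
  · exact (hasDeg_wind hc hcp hyr).congr fun t => by rw [proj_of_mem hDc (hLD t)]

end Enclosed

end Cat2Cx

end

noncomputable section

open Topology

namespace Cat2Cx

/-! ### Loops composed of two paths -/

section Loops

variable {A : Type*}

/-- The periodic loop running first along `P` and then along `Q`. -/
def loop (P Q : ℝ → A) (t : ℝ) : A :=
  if Int.fract t ≤ 1 / 2 then P (max 0 (min 1 (2 * Int.fract t)))
  else Q (max 0 (min 1 (2 * Int.fract t - 1)))

variable {P Q : ℝ → A}

theorem loop_periodic (P Q : ℝ → A) (t : ℝ) : loop P Q (t + 1) = loop P Q t := by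
  simp only [loop, Int.fract_add_one]

theorem loop_left (P Q : ℝ → A) {s : ℝ} (hs : s ∈ Icc (0 : ℝ) 1) : loop P Q (s / 2) = P s := by
  have h : Int.fract (s / 2) = s / 2 :=
    Int.fract_eq_self.2 ⟨by linarith [hs.1], by linarith [hs.2]⟩
  rw [loop, h, if_pos (by linarith [hs.2]), mul_div_cancel₀ _ two_ne_zero, clamp_eq hs]

theorem loop_right (h1 : P 1 = Q 0) (h2 : Q 1 = P 0) {s : ℝ} (hs : s ∈ Icc (0 : ℝ) 1) :
    loop P Q ((1 + s) / 2) = Q s := by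
  rcases eq_or_lt_of_le hs.1 with rfl | h0
  · simpa [h1] using loop_left P Q (s := 1) (by simp)
  rcases eq_or_lt_of_le hs.2 with rfl | h3
  · have := loop_left P Q (s := 0) (by simp)
    rw [show ((1 : ℝ) + 1) / 2 = 0 / 2 + 1 by norm_num, loop_periodic, this, h2]
  · have h : Int.fract ((1 + s) / 2) = (1 + s) / 2 :=
      Int.fract_eq_self.2 ⟨by linarith, by linarith⟩
    rw [loop, h, if_neg (by linarith), mul_div_cancel₀ _ two_ne_zero, add_sub_cancel_left,
      clamp_eq hs]

theorem loop_cases (t : ℝ) : ∃ n : ℤ, ∃ s ∈ Icc (0 : ℝ) 1,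
    t = s / 2 + n ∨ t = (1 + s) / 2 + n := by
  have h0 := Int.fract_nonneg t
  have h1 := Int.fract_lt_one t
  have h := Int.fract_add_floor t
  rcases le_total (Int.fract t) (1 / 2) with h2 | h2
  · exact ⟨⌊t⌋, 2 * Int.fract t, ⟨by linarith, by linarith⟩, Or.inl (by linarith)⟩
  · exact ⟨⌊t⌋, 2 * Int.fract t - 1, ⟨by linarith, by linarith⟩, Or.inr (by linarith)⟩

theorem loop_apply_cases (h1 : P 1 = Q 0) (h2 : Q 1 = P 0) (t : ℝ) :
    ∃ n : ℤ, ∃ s ∈ Icc (0 : ℝ) 1, (t = s / 2 + n ∧ loop P Q t = P s) ∨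
      (t = (1 + s) / 2 + n ∧ loop P Q t = Q s) := by
  obtain ⟨n, s, hs, h | h⟩ := loop_cases t
  · exact ⟨n, s, hs, Or.inl ⟨h, by rw [h, periodic_add_int (loop_periodic P Q), loop_left P Q hs]⟩⟩
  · exact ⟨n, s, hs, Or.inr ⟨h, by rw [h, periodic_add_int (loop_periodic P Q),
      loop_right h1 h2 hs]⟩⟩

theorem range_loop (h1 : P 1 = Q 0) (h2 : Q 1 = P 0) :
    range (loop P Q) = P '' Icc 0 1 ∪ Q '' Icc 0 1 := by
  ext x
  constructor
  · rintro ⟨t, rfl⟩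
    obtain ⟨n, s, hs, ⟨-, h⟩ | ⟨-, h⟩⟩ := loop_apply_cases h1 h2 t
    · exact Or.inl ⟨s, hs, h.symm⟩
    · exact Or.inr ⟨s, hs, h.symm⟩
  · rintro (⟨s, hs, rfl⟩ | ⟨s, hs, rfl⟩)
    · exact ⟨_, loop_left P Q hs⟩
    · exact ⟨_, loop_right h1 h2 hs⟩

theorem loop_inj (h1 : P 1 = Q 0) (h2 : Q 1 = P 0) {C : Set A}
    (hP : ∀ s ∈ Icc (0 : ℝ) 1, ∀ s' ∈ Icc (0 : ℝ) 1, P s ∉ C → P s' = P s → s' = s)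
    (hQ : ∀ s ∈ Icc (0 : ℝ) 1, ∀ s' ∈ Icc (0 : ℝ) 1, Q s ∉ C → Q s' = Q s → s' = s)
    (hPQ : ∀ s ∈ Icc (0 : ℝ) 1, ∀ s' ∈ Icc (0 : ℝ) 1, P s = Q s' → P s ∈ C) (t t' : ℝ)
    (ht : loop P Q t ∉ C) (he : loop P Q t' = loop P Q t) : ∃ n : ℤ, t' - t = n := by
  obtain ⟨n, s, hs, ⟨e, h⟩ | ⟨e, h⟩⟩ := loop_apply_cases h1 h2 t <;>
    obtain ⟨n', s', hs', ⟨e', h'⟩ | ⟨e', h'⟩⟩ := loop_apply_cases h1 h2 t' <;> rw [h, h'] at he <;>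
      rw [h] at ht
  · have := hP s hs s' hs' ht he
    exact ⟨n' - n, by rw [e, e', this]; push_cast; ring⟩
  · exact absurd (hPQ s hs s' hs' he.symm) ht
  · exact absurd (he ▸ hPQ s' hs' s hs he) ht
  · have := hQ s hs s' hs' ht he
    exact ⟨n' - n, by rw [e, e', this]; push_cast; ring⟩

theorem loop_comp {B : Type*} (G : A → B) (P Q : ℝ → A) (t : ℝ) :
    G (loop P Q t) = loop (fun s => G (P s)) (fun s => G (Q s)) t := by
  simp only [loop]; split_ifs <;> rfl

variable [TopologicalSpace A]

theorem continuous_loop (hP : ContinuousOn P (Icc 0 1)) (hQ : ContinuousOn Q (Icc 0 1))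
    (h1 : P 1 = Q 0) (h2 : Q 1 = P 0) : Continuous (loop P Q) := by
  have hc : ∀ {R : ℝ → A}, ContinuousOn R (Icc 0 1) → ∀ {u : ℝ → ℝ}, Continuous u →
      Continuous fun s => R (max 0 (min 1 (u s))) := fun hR u hu =>
    hR.comp_continuous (by fun_prop) fun s => clamp_mem _
  have h : Continuous fun s : ℝ => if s ≤ 1 / 2 then P (max 0 (min 1 (2 * s)))
      else Q (max 0 (min 1 (2 * s - 1))) :=
    Continuous.if_le (hc hP (by fun_prop)) (hc hQ (by fun_prop)) continuous_id continuous_const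
      fun s hs => by rw [show s = 1 / 2 from hs]; simpa using h1
  refine h.continuousOn.comp_fract'' ?_
  simp only [mul_zero, mul_one]
  rw [if_pos (by norm_num), if_neg (by norm_num)]
  norm_num [h2]

end Loops

section LoopWind

theorem lift_unique {u v : ℝ → ℂ} (hu : ContinuousOn u (Icc 0 1)) (hv : ContinuousOn v (Icc 0 1))
    (h : ∀ s ∈ Icc (0 : ℝ) 1, Complex.exp (u s) = Complex.exp (v s)) : u 1 - u 0 = v 1 - v 0 := by
  have := int_const_of_continuous (A := Icc (0 : ℝ) 1) (v := fun s => u s - v s)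
    (hu.domRestrict.sub hv.domRestrict) (fun s => by
      rw [Complex.exp_sub, h s s.2, div_self (Complex.exp_ne_zero _)]) ⟨1, by simp⟩ ⟨0, by simp⟩
  simp only at this
  linear_combination this

theorem wind_loop {P Q : ℝ → ℂ} {z : ℂ} (hP : ContinuousOn P (Icc 0 1))
    (hQ : ContinuousOn Q (Icc 0 1)) (h1 : P 1 = Q 0) (h2 : Q 1 = P 0)
    (hz : z ∉ range (loop P Q)) {u v : ℝ → ℂ} (hu : ContinuousOn u (Icc 0 1))
    (hv : ContinuousOn v (Icc 0 1)) (hue : ∀ s ∈ Icc (0 : ℝ) 1, Complex.exp (u s) = P s - z)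
    (hve : ∀ s ∈ Icc (0 : ℝ) 1, Complex.exp (v s) = Q s - z) :
    2 * Real.pi * Complex.I * wind (loop P Q) z = (u 1 - u 0) + (v 1 - v 0) := by
  obtain ⟨w, hw, hwe, hwp⟩ := hasDeg_wind (continuous_loop hP hQ h1 h2) (loop_periodic P Q) hz
  have hwe' : ∀ t, Complex.exp (w t) = loop P Q t - z := hwe
  have e1 := lift_unique hu (v := fun s => w (s / 2)) (by fun_prop) fun s hs => by
    rw [hue s hs, hwe', loop_left P Q hs]
  have e2 := lift_unique hv (v := fun s => w ((1 + s) / 2)) (by fun_prop) fun s hs => by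
    rw [hve s hs, hwe', loop_right h1 h2 hs]
  have e3 := hwp 0
  rw [e1, e2]
  norm_num at e3 ⊢
  rw [e3]; ring

theorem wind_add {c g : ℝ → ℂ} (hc : Continuous c) (hp : ∀ t, c (t + 1) = c t) {α β : ℝ}
    (hg : ContinuousOn g (Icc 0 1)) (h0 : g 0 = c β) (h1 : g 1 = c α) {z : ℂ} (hz : z ∉ range c)
    (hzg : ∀ s ∈ Icc (0 : ℝ) 1, g s ≠ z) :
    wind c z = wind (loop (fun s => c (α + (β - α) * s)) g) z +
      wind (loop (fun s => c (β + (α + 1 - β) * s)) fun s => g (1 - s)) z := by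
  obtain ⟨u, hu, hue, hup⟩ := hasDeg_wind hc hp hz
  obtain ⟨v, hv, hve⟩ := exists_log_real (c := fun s => g (max 0 (min 1 s)) - z)
    ((hg.comp_continuous (by fun_prop) clamp_mem).sub continuous_const)
    fun s => sub_ne_zero.2 (hzg _ (clamp_mem s))
  have hve' : ∀ s ∈ Icc (0 : ℝ) 1, Complex.exp (v s) = g s - z := fun s hs => by
    rw [hve, clamp_eq hs]
  have hg' : ContinuousOn (fun s => g (1 - s)) (Icc 0 1) :=
    hg.comp (by fun_prop) fun s hs => one_sub_mem hs
  have a1 : c (α + (β - α) * 1) = g 0 := by rw [h0]; ring_nf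
  have a2 : g 1 = c (α + (β - α) * 0) := by rw [h1]; ring_nf
  have a3 : c (β + (α + 1 - β) * 1) = g (1 - 0) := by
    rw [sub_zero, h1, ← hp α]; ring_nf
  have a4 : g (1 - 1) = c (β + (α + 1 - β) * 0) := by rw [sub_self, h0]; ring_nf
  have e1 := wind_loop (P := fun s => c (α + (β - α) * s)) (Q := g) (z := z)
    (Continuous.continuousOn (by fun_prop)) hg a1 a2
    (by
      rw [range_loop a1 a2]
      rintro (⟨s, hs, h⟩ | ⟨s, hs, h⟩)
      · exact hz ⟨_, h⟩
      · exact hzg s hs h)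
    (u := fun s => u (α + (β - α) * s)) (v := v) (by fun_prop) (by fun_prop) (fun s _ => hue _) hve'
  have e2 := wind_loop (P := fun s => c (β + (α + 1 - β) * s)) (Q := fun s => g (1 - s)) (z := z)
    (Continuous.continuousOn (by fun_prop)) hg' a3 a4
    (by
      rw [range_loop (P := fun s => c (β + (α + 1 - β) * s)) (Q := fun s => g (1 - s)) a3 a4]
      rintro (⟨s, hs, h⟩ | ⟨s, hs, h⟩)
      · exact hz ⟨_, h⟩
      · exact hzg _ (one_sub_mem hs) h)
    (u := fun s => u (β + (α + 1 - β) * s)) (v := fun s => v (1 - s)) (by fun_prop) (by fun_prop)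
    (fun s _ => hue _) (fun s hs => hve' _ (one_sub_mem hs))
  have e3 := hup α
  have hne : (2 * Real.pi * Complex.I : ℂ) ≠ 0 := Complex.two_pi_I_ne_zero
  have : (wind c z : ℂ) = wind (loop (fun s => c (α + (β - α) * s)) g) z +
      wind (loop (fun s => c (β + (α + 1 - β) * s)) fun s => g (1 - s)) z := by
    refine mul_left_cancel₀ hne ?_
    rw [mul_add, e1, e2]
    ring_nf at e3 ⊢
    linear_combination -e3
  exact_mod_cast this

end LoopWind

end Cat2Cx

end

noncomputable section

open Topology

namespace Cat2Cx

/-! ### Piecewise geodesic loops -/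

section YLoops

variable {κ : ℝ} {X : Type*} [MetricSpace X]

/-- Near `x`, the set `S` contains a geodesic of `(E, pathDistIn E)` through `x`. -/
def GeoAt (E S : Set X) (x : X) : Prop :=
  ∃ (f : ℝ → X) (s₀ ε : ℝ), 0 < ε ∧ f s₀ = x ∧
    (∀ s ∈ Icc (s₀ - ε) (s₀ + ε), ∀ s' ∈ Icc (s₀ - ε) (s₀ + ε),
      pathDistIn E (f s) (f s') = |s - s'|) ∧ ∀ s ∈ Icc (s₀ - ε) (s₀ + ε), f s ∈ S

/-- `L` is a loop in `E` which is simple and locally geodesic in `(E, pathDistIn E)` away from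
the finite set `V`. -/
structure YLoop (E : Set X) (L : ℝ → X) (V : Set X) : Prop where
  isClosed : IsClosed E
  rect : RectConnected E
  h1 : H1Trivial E
  cont : Continuous L
  per : ∀ t, L (t + 1) = L t
  mem : ∀ t, L t ∈ E
  finite : V.Finite
  inj : ∀ t t', L t ∉ V → L t' = L t → ∃ n : ℤ, t' - t = n
  geo : ∀ t, L t ∉ V → GeoAt E (range L) (L t)

variable {E : Set X} {L : ℝ → X} {V : Set X}

theorem dist_le_of_pathDistIn (hE : RectConnected E) {f : ℝ → X} {a b l : ℝ}
    (hfE : ∀ s ∈ Icc a b, f s ∈ E)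
    (hf : ∀ s ∈ Icc a b, ∀ t ∈ Icc a b, pathDistIn E (f s) (f t) = l * |s - t|) :
    ∀ s ∈ Icc a b, ∀ t ∈ Icc a b, dist (f s) (f t) ≤ l * |s - t| := fun s hs t ht =>
  hf s hs t ht ▸ dist_le_pathDistIn hE (hfE s hs) (hfE t ht)

theorem continuousOn_of_dist_le {f : ℝ → X} {a b l : ℝ}
    (hf : ∀ s ∈ Icc a b, ∀ t ∈ Icc a b, dist (f s) (f t) ≤ l * |s - t|) :
    ContinuousOn f (Icc a b) := by
  have : LipschitzOnWith ⟨|l|, abs_nonneg l⟩ f (Icc a b) :=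
    LipschitzOnWith.of_dist_le_mul fun s hs t ht => by
      rw [Real.dist_eq]
      exact (hf s hs t ht).trans (mul_le_mul_of_nonneg_right (le_abs_self l) (abs_nonneg _))
  exact this.continuousOn

theorem pathDistIn_self {x : X} (hx : x ∈ E) :
    pathDistIn E x x = 0 := by
  have : (⨅ g : {g : ℝ → X // IsPathIn E g x x}, eVariationOn g.1 (Icc 0 1)) = 0 := by
    refine le_antisymm ?_ bot_le
    refine (iInf_le _ ⟨fun _ => x, continuousOn_const, rfl, rfl, fun _ _ => hx⟩).trans ?_
    exact (eVariationOn.constant_on (by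
      rintro _ ⟨_, _, rfl⟩ _ ⟨_, _, rfl⟩; rfl)).le
  rw [pathDistIn, this]; rfl

theorem injOn_of_pathDistIn {f : ℝ → X} {a b l : ℝ} (hl : 0 < l)
    (hfE : ∀ s ∈ Icc a b, f s ∈ E)
    (hf : ∀ s ∈ Icc a b, ∀ t ∈ Icc a b, pathDistIn E (f s) (f t) = l * |s - t|) :
    InjOn f (Icc a b) := fun s hs t ht h => by
  have := hf s hs t ht
  rw [h, pathDistIn_self (hfE t ht)] at this
  rcases mul_eq_zero.1 this.symm with h0 | h0
  · exact absurd h0 hl.ne'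
  · exact sub_eq_zero.1 (abs_eq_zero.1 h0)

variable {D : Set X} {G : X → ℂ} {h : ℂ → X}

theorem IsChart.continuous_comp (c : IsChart D G h) (hL : Continuous L) (hLD : ∀ t, L t ∈ D) :
    Continuous fun t => G (L t) := c.continuousOn.comp_continuous hL hLD

variable [CatZero X]

/-- A piecewise geodesic loop lies in the hull of its vertices. -/
theorem YLoop.mem_hull (l : YLoop E L V) (hκ : κ ≤ 0) (PC : PolyComplex2 κ X)
    (c : IsChart D G h) (hD : GConvex D) (hV : V.Nonempty) (hVD : V ⊆ D) (t : ℝ) :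
    L t ∈ D ∩ G ⁻¹' convexHull ℝ (G '' V) := by
  have hVC : V ⊆ D ∩ G ⁻¹' convexHull ℝ (G '' V) := fun v hv =>
    ⟨hVD hv, subset_convexHull ℝ _ (mem_image_of_mem G hv)⟩
  exact mem_of_locally_geodesic hκ PC l.isClosed l.rect l.h1 l.cont l.per l.mem
    (c.isCompact_inter_preimage (convexHull_min (image_mono hVD) (c.convex_image hD le_rfl hD))
      ((l.finite.image G).isCompact_convexHull ℝ)) (hV.mono hVC)
    (c.gconvex_inter_preimage hD (convex_convexHull ℝ _))
    (fun t t' ht => l.inj t t' fun hv => ht (hVC hv)) (fun t ht => l.geo t fun hv => ht (hVC hv)) t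

/-- The points around which a piecewise geodesic loop winds belong to `E`. -/
theorem YLoop.windFill_subset (l : YLoop E L V) (hκ : κ ≤ 0) (PC : PolyComplex2 κ X)
    (c : IsChart D G h) (hDc : IsCompact D) (hD : GConvex D) (hLD : ∀ t, L t ∈ D) :
    D ∩ G ⁻¹' windFill (fun t => G (L t)) ⊆ fill L ∩ E := by
  have : D ∩ G ⁻¹' windFill (fun t => G (L t)) ⊆ fill L := by
    rintro x ⟨hx, ⟨t, ht⟩ | hw⟩
    · exact Or.inl ⟨t, c.injOn (hLD t) hx ht⟩
    · exact c.mem_fill_of_wind hκ PC hDc hD l.cont l.per hLD hx hw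
  exact fun x hx => ⟨this hx, fill_subset_of_H1Trivial l.h1 l.isClosed l.cont l.per l.mem (this hx)⟩

/-- The winding number jumps across a piecewise geodesic loop. -/
theorem YLoop.exists_jump (l : YLoop E L V) (c : IsChart D G h) (hLD : ∀ t, L t ∈ D) {t₀ : ℝ}
    (ht₀ : L t₀ ∉ V) {U : Set ℂ} (hU : U ∈ 𝓝 (G (L t₀))) :
    ∃ w₁ ∈ U, ∃ w₂ ∈ U, w₁ ∉ range (fun t => G (L t)) ∧ w₂ ∉ range (fun t => G (L t)) ∧
      (wind (fun t => G (L t)) w₁ = wind (fun t => G (L t)) w₂ + 1 ∨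
        wind (fun t => G (L t)) w₁ = wind (fun t => G (L t)) w₂ - 1) := by
  obtain ⟨f, s₀, ε₀, hε₀, hf₀, hf, hfL⟩ := l.geo t₀ ht₀
  have hfE : ∀ s ∈ Icc (s₀ - ε₀) (s₀ + ε₀), f s ∈ E := fun s hs => by
    obtain ⟨t, ht⟩ := hfL s hs
    rw [← ht]; exact l.mem t
  have hfD : ∀ s ∈ Icc (s₀ - ε₀) (s₀ + ε₀), f s ∈ D := fun s hs => by
    obtain ⟨t, ht⟩ := hfL s hs
    rw [← ht]; exact hLD t
  have hf' : ∀ s ∈ Icc (s₀ - ε₀) (s₀ + ε₀), ∀ s' ∈ Icc (s₀ - ε₀) (s₀ + ε₀),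
      pathDistIn E (f s) (f s') = 1 * |s - s'| := fun s hs s' hs' => by
    rw [hf s hs s' hs', one_mul]
  have hd := dist_le_of_pathDistIn l.rect hfE hf'
  have hfc := continuousOn_of_dist_le hd
  have hfi := injOn_of_pathDistIn one_pos hfE hf'
  have hs₀ : Icc (s₀ - ε₀) (s₀ + ε₀) ∈ 𝓝 s₀ := Icc_mem_nhds (by linarith) (by linarith)
  have hfa : ContinuousAt f s₀ := hfc.continuousAt hs₀
  have hGa : ContinuousAt (fun s => G (f s)) s₀ := (c.continuousOn.comp hfc hfD).continuousAt hs₀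
  have hnear : ∀ᶠ s in 𝓝 s₀, f s ∉ V ∧ G (f s) ∈ interior U := by
    refine (hfa.eventually (l.finite.isClosed.isOpen_compl.mem_nhds ?_)).and
      (hGa.eventually (isOpen_interior.mem_nhds ?_))
    · rwa [hf₀]
    · simp only [hf₀]; exact mem_interior_iff_mem_nhds.2 hU
  obtain ⟨ε₁, hε₁, hball⟩ := Metric.nhds_basis_closedBall.mem_iff.1 hnear
  set ε := min ε₀ ε₁ with hε
  have hεp : 0 < ε := lt_min hε₀ hε₁
  have hsub : Icc (s₀ - ε) (s₀ + ε) ⊆ Icc (s₀ - ε₀) (s₀ + ε₀) :=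
    Icc_subset_Icc (by linarith [min_le_left ε₀ ε₁]) (by linarith [min_le_left ε₀ ε₁])
  have hn : ∀ s ∈ Icc (s₀ - ε) (s₀ + ε), f s ∉ V ∧ G (f s) ∈ interior U := fun s hs =>
    hball (by
      rw [Real.closedBall_eq_Icc]
      exact ⟨by linarith [hs.1, min_le_right ε₀ ε₁], by linarith [hs.2, min_le_right ε₀ ε₁]⟩)
  have hinj : ∀ s ∈ Icc (s₀ - ε) (s₀ + ε), ∀ t t', L t = f s → L t' = f s →
      ∃ n : ℤ, t' - t = n := fun s hs t t' ht ht' =>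
    l.inj t t' (ht ▸ (hn s hs).1) (ht'.trans ht.symm)
  obtain ⟨ε', hε', hle, hF, -⟩ := exists_follows l.cont l.per hεp hf₀ (hfc.mono hsub)
    (hfi.mono hsub) (fun s hs => hfL s (hsub hs)) hinj
  obtain ⟨C, hC, hlip⟩ := c.lip
  have hsub' : Icc (s₀ - ε' / 2) (s₀ + ε' / 2) ⊆ Icc (s₀ - ε) (s₀ + ε) :=
    Icc_subset_Icc (by linarith) (by linarith)
  have hLip : LipschitzOnWith ⟨C, hC.le⟩ (fun s => G (f s)) (Icc (s₀ - ε' / 2) (s₀ + ε' / 2)) :=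
    LipschitzOnWith.of_dist_le_mul fun s hs t ht => by
      have hs := hsub (hsub' hs)
      have ht := hsub (hsub' ht)
      rw [dist_eq_norm, Real.dist_eq]
      have := hd s hs t ht
      rw [one_mul] at this
      exact (hlip _ (hfD s hs) _ (hfD t ht)).trans (mul_le_mul_of_nonneg_left this hC.le)
  have ha : s₀ - ε' / 2 ∈ Icc (s₀ - ε₀) (s₀ + ε₀) := hsub (hsub' ⟨by linarith, by linarith⟩)
  have hb : s₀ + ε' / 2 ∈ Icc (s₀ - ε₀) (s₀ + ε₀) := hsub (hsub' ⟨by linarith, by linarith⟩)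
  obtain ⟨s, hs, v, hv, hdv⟩ := exists_hasDerivAt_ne_zero (by linarith) hLip fun h => by
    have := hfi ha hb (c.injOn (hfD _ ha) (hfD _ hb) h)
    linarith
  have hsε := hsub' (Ioo_subset_Icc_self hs)
  obtain ⟨t, ht, hFt⟩ := hF s ⟨by linarith [hs.1], by linarith [hs.2]⟩
  have hjump := eventually_hasDeg_jump (c := fun t => G (L t)) (c.continuous_comp l.cont hLD)
    (fun t => by rw [l.per]) hv hdv (by rw [ht]) (hFt.image G) fun t' ht' =>
      hinj s hsε t t' ht ((c.injOn (hLD t') (hLD t) ht').trans ht)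
  have hball : ∀ σ : ℂ, ∀ᶠ ε : ℝ in 𝓝[>] (0 : ℝ), G (L t) + ε * σ ∈ U := fun σ => by
    have : Continuous fun ε : ℝ => G (L t) + ε * σ := by fun_prop
    refine (this.tendsto 0).mono_left nhdsWithin_le_nhds (mem_interior_iff_mem_nhds.1 ?_)
    rw [Complex.ofReal_zero, zero_mul, add_zero, ht]; exact (hn s hsε).2
  obtain ⟨ε, ⟨m, n, hmn, hm, hn, hm0, hn0⟩, hb1, hb2⟩ :=
    (hjump.and ((hball (Complex.I * v)).and (hball (-(Complex.I * v))))).exists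
  have e1 : G (L t) + ε * Complex.I * v = G (L t) + ε * (Complex.I * v) := by ring
  have e2 : G (L t) - ε * Complex.I * v = G (L t) + ε * -(Complex.I * v) := by ring
  refine ⟨_, e1 ▸ hb1, _, e2 ▸ hb2, fun ⟨x, hx⟩ => hm0 x hx, fun ⟨x, hx⟩ => hn0 x hx, ?_⟩
  rw [hm.wind_eq, hn.wind_eq]
  exact hmn

end YLoops

end Cat2Cx
end

noncomputable section

open Topology

namespace Cat2Cx

/-! ### The interior of a simple closed curve -/

section Interior

variable {X : Type*} [MetricSpace X]

theorem SCC.nullhomologousIn_of_simplyConnected (γ : SCC X) {S B : Set X}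
    [SimplyConnectedSpace S] (hS : γ.img ⊆ S) (hSB : S ⊆ B) : γ.NullhomologousIn B := by
  intro hB
  have h1 := (SimplyConnectedSpace.paths_homotopic (γ.pathIn S hS) (Path.refl _)).map
    (⟨inclusion hSB, continuous_inclusion hSB⟩ : C(S, B))
  have h2 : (⟦γ.pathIn B hB⟧ : Path.Homotopic.Quotient _ _) = ⟦Path.refl _⟧ := Quotient.sound h1
  rw [loopClassH1, show FundamentalGroup.fromPath (X := TopCat.of B) ⟦γ.pathIn B hB⟧ = 1 from h2,
    map_one]

theorem SCC.mem_interiorSet_of_enc (γ : SCC X) {L : ℝ → X} (hL : Continuous L)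
    (hp : ∀ t, L (t + 1) = L t) (hLγ : ∀ t ∈ Icc (0 : ℝ) 1, L t = γ.toFun t) {x : X}
    (hx : Enc L x) : x ∈ γ.interiorSet := by
  have hrange : γ.img ⊆ range L := by
    rintro _ ⟨t, ht, rfl⟩; exact ⟨t, hLγ t ht⟩
  refine ⟨fun h => hx.1 (hrange h), fun hnull => ?_⟩
  have hB : γ.img ⊆ {x}ᶜ := fun y hy h => hx.1 (mem_singleton_iff.1 h ▸ hrange hy)
  obtain ⟨r, hr, H⟩ := logVar_of_loopClassH1_eq_one (B := ({x}ᶜ : Set X))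
    (W := fun r => {y | r ≤ dist y.1 x}) (fun r s hrs y hy => hrs.trans hy)
    (fun K hK => by
      obtain ⟨r, hr, h⟩ := Metric.isOpen_iff.1
        (hK.image continuous_subtype_val).isClosed.isOpen_compl x (by
          rintro ⟨y, -, hy⟩; exact y.2 hy)
      exact ⟨r, hr, fun y hy => show r ≤ dist y.1 x from
        not_lt.1 fun hlt => h (mem_ball.2 hlt) ⟨y, hy, rfl⟩⟩) _ (hnull hB)
  obtain ⟨r₀, hr₀, h₀⟩ := Metric.isOpen_iff.1
    (isCompact_range_of_periodic hL hp).isClosed.isOpen_compl x hx.1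
  obtain ⟨φ, hφ, hφ0, n, hn, hdeg⟩ := hx.2 (ball x (min r r₀)) isOpen_ball
    (mem_ball_self (lt_min hr hr₀)) (Set.disjoint_left.2 fun y hy =>
      h₀ (ball_subset_ball (min_le_right _ _) hy))
  have hLU : ∀ t, L t ∈ (ball x (min r r₀))ᶜ := fun t h' =>
    h₀ (ball_subset_ball (min_le_right _ _) h') (mem_range_self t)
  have hWU : ∀ y : ({x}ᶜ : Set X), r ≤ dist y.1 x → y.1 ∈ (ball x (min r r₀))ᶜ := fun y hy h' =>
    absurd (mem_ball.1 h') (not_lt.2 ((min_le_left _ _).trans hy))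
  obtain ⟨u, hu, he, hd⟩ := H (fun y => φ y)
    (hφ.comp continuous_subtype_val.continuousOn fun y hy => hWU y hy) fun y hy => hφ0 _ (hWU y hy)
  refine hn (hdeg.unique (hasDeg_zero_of_log (hφ.comp_continuous hL hLU) (fun t => hφ0 _ (hLU t))
    (fun t => by simp only [hp]) hu (fun t => (he t).trans ?_) hd))
  rw [hLγ t t.2]; rfl

end Interior

section FilledLoop

variable {κ : ℝ} {X : Type*} [MetricSpace X] [CatZero X] {E : Set X} {L : ℝ → X} {V : Set X}
  {D : Set X} {G : X → ℂ} {h : ℂ → X}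

theorem YLoop.exists_notMem (l : YLoop E L V) (hinj : ∀ t t', L t' = L t → ∃ n : ℤ, t' - t = n) :
    ∃ t, L t ∉ V := by
  by_contra! hV
  refine (Set.infinite_of_injOn_mapsTo (f := L) (s := Ioo (0 : ℝ) 1) (fun s hs t ht he => ?_)
    (fun t _ => hV t) (Ioo_infinite one_pos)) l.finite
  obtain ⟨n, hn⟩ := hinj t s he
  have := int_eq_zero_of_abs_lt hn
    (abs_lt.2 ⟨by linarith [hs.1, ht.2], by linarith [hs.2, ht.1]⟩)
  linarith

/-- A simple loop together with the points around which it winds is contractible. -/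
theorem YLoop.contractibleSpace (l : YLoop E L V)
    (hinj : ∀ t t', L t' = L t → ∃ n : ℤ, t' - t = n) (c : IsChart D G h) (hD : GConvex D)
    (hLD : ∀ t, L t ∈ D) : ContractibleSpace ↥(D ∩ G ⁻¹' windFill fun t => G (L t)) := by
  obtain ⟨t, ht⟩ := l.exists_notMem hinj
  obtain ⟨w₁, -, w₂, -, h₁, h₂, hw⟩ := l.exists_jump c hLD ht univ_mem
  have hc := c.continuous_comp l.cont hLD
  have hcp : ∀ t, G (L (t + 1)) = G (L t) := fun t => by rw [l.per]
  obtain ⟨ρ, hρ, hρK, hρi⟩ := exists_retraction hc hcp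
    (fun t t' he => hinj t t' (c.injOn (hLD t') (hLD t) he)) h₁ h₂ hw
  have hK : windFill (fun t => G (L t)) ⊆ G '' D := Cat2Cx.windFill_subset hc hcp
    (c.convex_image hD le_rfl hD) fun t => mem_image_of_mem G (hLD t)
  refine contractibleSpace_of_retract (B := ℂ) (g := G) (k := fun z => h (ρ z))
    (c.continuousOn.mono inter_subset_left)
    (c.contInv.comp_continuous hρ fun z => hK (hρK z)) (fun z => ?_) fun x hx => ?_
  · have := c.inv_mem (hK (hρK z))
    exact ⟨this.1, by rw [mem_preimage, this.2]; exact hρK z⟩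
  · rw [hρi _ hx.2, c.leftInv x hx.1]

theorem IsChart.isCompact_windFill (c : IsChart D G h) (hD : IsCompact D) (hL : Continuous L)
    (hp : ∀ t, L (t + 1) = L t) (hLD : ∀ t, L t ∈ D) :
    IsCompact (D ∩ G ⁻¹' windFill fun t => G (L t)) :=
  hD.of_isClosed_subset (c.continuousOn.preimage_isClosed_of_isClosed hD.isClosed
    (isClosed_windFill (c.continuous_comp hL hLD) fun t => by rw [hp])) inter_subset_left

/-- The filled loop consists of the curve and its interior. -/
theorem YLoop.img_union_interiorSet (l : YLoop E L V)
    (hinj : ∀ t t', L t' = L t → ∃ n : ℤ, t' - t = n) (hκ : κ ≤ 0) (PC : PolyComplex2 κ X)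
    (c : IsChart D G h) (hDc : IsCompact D) (hD : GConvex D) (hLD : ∀ t, L t ∈ D) (γ : SCC X)
    (hγ : range L = γ.img) (hLγ : ∀ t ∈ Icc (0 : ℝ) 1, L t = γ.toFun t) :
    γ.img ∪ γ.interiorSet = D ∩ G ⁻¹' windFill fun t => G (L t) := by
  have := l.contractibleSpace hinj c hD hLD
  have hTK : γ.img ⊆ D ∩ G ⁻¹' windFill fun t => G (L t) := by
    rw [← hγ]; rintro _ ⟨t, rfl⟩; exact ⟨hLD t, Or.inl ⟨t, rfl⟩⟩
  refine Subset.antisymm (union_subset hTK fun x hx => ?_) fun x hx => ?_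
  · by_contra hxK
    exact hx.2 (γ.nullhomologousIn_of_simplyConnected hTK (subset_compl_singleton_iff.2 hxK))
  · rcases (l.windFill_subset hκ PC c hDc hD hLD hx).1 with h1 | h1
    · exact Or.inl (hγ ▸ h1)
    · exact Or.inr (γ.mem_interiorSet_of_enc l.cont l.per hLγ h1)

end FilledLoop

end Cat2Cx
end

noncomputable section

open Topology

namespace Cat2Cx

/-! ### Rectifiable connectedness of the filled loop -/

theorem exists_first_hit {A : Type*} [TopologicalSpace A] {σ : ℝ → A} {a b : ℝ} (hab : a ≤ b)
    (hσ : ContinuousOn σ (Icc a b)) {R : Set A} (hR : IsClosed R) (hb : σ b ∈ R) :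
    ∃ s ∈ Icc a b, σ s ∈ R ∧ ∀ s' ∈ Ico a s, σ s' ∉ R := by
  have hK : IsCompact (Icc a b ∩ σ ⁻¹' R) :=
    isCompact_Icc.of_isClosed_subset (hσ.preimage_isClosed_of_isClosed isClosed_Icc hR)
      inter_subset_left
  obtain ⟨s, hs, hmin⟩ := hK.exists_isLeast ⟨b, ⟨hab, le_rfl⟩, hb⟩
  exact ⟨s, hs.1, hs.2, fun s' hs' h =>
    (hmin ⟨⟨hs'.1, hs'.2.le.trans hs.1.2⟩, h⟩).not_gt hs'.2⟩

section RectJoined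

variable {X : Type*} [MetricSpace X] {K : Set X} {x y z : X}

/-- `x` and `y` are joined by a rectifiable path in `K`. -/
def RectJoined (K : Set X) (x y : X) : Prop :=
  ∃ g : ℝ → X, IsPathIn K g x y ∧ eVariationOn g (Icc 0 1) ≠ ⊤

theorem RectJoined.symm (h : RectJoined K x y) : RectJoined K y x := by
  obtain ⟨g, ⟨h1, h2, h3, h4⟩, h5⟩ := h
  have hm : MapsTo (fun s : ℝ => 1 - s) (Icc 0 1) (Icc 0 1) := fun s hs => one_sub_mem hs
  refine ⟨g ∘ fun s => 1 - s, ⟨h1.comp (by fun_prop) hm, by simp [h3], by simp [h2],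
    h4.comp hm⟩, ne_top_of_le_ne_top h5 (eVariationOn.comp_le_of_antitoneOn g _ ?_ hm)⟩
  exact fun s _ t _ hst => sub_le_sub_left hst 1

theorem RectJoined.trans (h : RectJoined K x y) (h' : RectJoined K y z) : RectJoined K x z := by
  obtain ⟨g, ⟨h1, h2, h3, h4⟩, h5⟩ := h
  obtain ⟨k, ⟨k1, k2, k3, k4⟩, k5⟩ := h'
  set f : ℝ → X := fun t => if t ≤ 1 / 2 then g (2 * t) else k (2 * t - 1) with hf
  have e1 : EqOn f (g ∘ fun t => 2 * t) (Icc 0 (1 / 2)) := fun t ht => if_pos ht.2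
  have e2 : EqOn f (k ∘ fun t => 2 * t - 1) (Icc (1 / 2) 1) := fun t ht => by
    rcases eq_or_lt_of_le ht.1 with h | h
    · rw [hf]; simp [← h, h3, k2]
    · exact if_neg (not_le.2 h)
  have m1 : MapsTo (fun t : ℝ => 2 * t) (Icc 0 (1 / 2)) (Icc 0 1) := fun t ht =>
    ⟨by linarith [ht.1], by linarith [ht.2]⟩
  have m2 : MapsTo (fun t : ℝ => 2 * t - 1) (Icc (1 / 2) 1) (Icc 0 1) := fun t ht =>
    ⟨by linarith [ht.1], by linarith [ht.2]⟩
  have hI : Icc (0 : ℝ) (1 / 2) ∪ Icc (1 / 2) 1 = Icc 0 1 :=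
    Icc_union_Icc_eq_Icc (by norm_num) (by norm_num)
  refine ⟨f, ⟨?_, ?_, ?_, ?_⟩, ?_⟩
  · rw [← hI]
    exact ((h1.comp (by fun_prop) m1).congr e1).union_of_isClosed
      ((k1.comp (by fun_prop) m2).congr e2) isClosed_Icc isClosed_Icc
  · rw [e1 (by norm_num)]; simpa using h2
  · rw [e2 (by norm_num)]; norm_num [k3]
  · rw [← hI]
    exact (h4.comp m1 |>.congr e1.symm).union_union (k4.comp m2 |>.congr e2.symm) |>.mono_right
      (union_self K).subset
  · have := eVariationOn.Icc_add_Icc f (s := univ) (a := 0) (b := 1 / 2) (c := 1) (by norm_num)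
      (by norm_num) (mem_univ _)
    simp only [univ_inter] at this
    rw [← this, eVariationOn.eq_of_eqOn e1, eVariationOn.eq_of_eqOn e2]
    refine ENNReal.add_ne_top.2 ⟨ne_top_of_le_ne_top h5
      (eVariationOn.comp_le_of_monotoneOn g _ (fun s _ t _ hst => ?_) m1), ne_top_of_le_ne_top k5
      (eVariationOn.comp_le_of_monotoneOn k _ (fun s _ t _ hst => ?_) m2)⟩
    · simpa using hst
    · simpa using hst

theorem rectJoined_of_dist_le {f : ℝ → X} {a b l : ℝ} (hab : a ≤ b)
    (hf : ∀ s ∈ Icc a b, ∀ t ∈ Icc a b, dist (f s) (f t) ≤ l * |s - t|)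
    (hK : ∀ s ∈ Icc a b, f s ∈ K) : RectJoined K (f a) (f b) := by
  have hm : MapsTo (fun s : ℝ => a + (b - a) * s) (Icc 0 1) (Icc a b) := fun s hs =>
    ⟨by nlinarith [hs.1], by nlinarith [hs.2]⟩
  have hLip : LipschitzOnWith ⟨|l|, abs_nonneg l⟩ f (Icc a b) :=
    LipschitzOnWith.of_dist_le_mul fun s hs t ht => by
      rw [Real.dist_eq]
      exact (hf s hs t ht).trans (mul_le_mul_of_nonneg_right (le_abs_self l) (abs_nonneg _))
  refine ⟨f ∘ fun s => a + (b - a) * s, ⟨(continuousOn_of_dist_le hf).comp (by fun_prop) hm,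
    by simp, by simp, fun s hs => hK _ (hm hs)⟩, ne_top_of_le_ne_top ?_
      (eVariationOn.comp_le_of_monotoneOn f _ (fun s _ t _ hst => ?_) hm)⟩
  · have := hLip.locallyBoundedVariationOn a b ⟨le_rfl, hab⟩ ⟨hab, le_rfl⟩
    rwa [inter_self] at this
  · have := mul_le_mul_of_nonneg_left hst (sub_nonneg.2 hab)
    exact add_le_add_right this a

theorem rectJoined_of_mem_geodSeg {E : Set X} (hE : RectConnected E) {u v : X}
    (hK : geodSeg (pathDistIn E) E u v ⊆ K) (hx : x ∈ geodSeg (pathDistIn E) E u v) :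
    RectJoined K x u ∧ RectJoined K x v := by
  simp only [geodSeg, mem_iUnion, mem_image] at hx
  obtain ⟨f, hf, s, hs, rfl⟩ := hx
  have hfK : ∀ s ∈ Icc 0 (pathDistIn E u v), f s ∈ K := fun s hs => hK (by
    simp only [geodSeg, mem_iUnion]; exact ⟨f, hf, s, hs, rfl⟩)
  obtain ⟨h0, h1, h2, h3⟩ := hf
  have hd := dist_le_of_pathDistIn hE h3 (l := 1) fun s hs t ht => by rw [h2.2 s hs t ht, one_mul]
  have hl : Icc 0 s ⊆ Icc 0 (pathDistIn E u v) := Icc_subset_Icc le_rfl hs.2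
  have hr : Icc s (pathDistIn E u v) ⊆ Icc 0 (pathDistIn E u v) := Icc_subset_Icc hs.1 le_rfl
  constructor
  · have := rectJoined_of_dist_le hs.1 (fun a ha b hb => hd a (hl ha) b (hl hb))
      fun a ha => hfK a (hl ha)
    rw [h0] at this; exact this.symm
  · have := rectJoined_of_dist_le hs.2 (fun a ha b hb => hd a (hr ha) b (hr hb))
      fun a ha => hfK a (hr ha)
    rwa [h1] at this

theorem rectJoined_of_isYTriangle {E T : Set X} (hE : RectConnected E) {p q r : X}
    (hT : IsYTriangle E T p q r) (hTK : T ⊆ K) (hx : x ∈ T) (hy : y ∈ T) : RectJoined K x y := by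
  obtain ⟨-, -, -, rfl⟩ := hT
  have h1 := fun {x} => rectJoined_of_mem_geodSeg (x := x) hE
    ((subset_union_left.trans subset_union_left).trans hTK)
  have h2 := fun {x} => rectJoined_of_mem_geodSeg (x := x) hE
    ((subset_union_right.trans subset_union_left).trans hTK)
  have h3 := fun {x} => rectJoined_of_mem_geodSeg (x := x) hE (subset_union_right.trans hTK)
  rcases hx with (hx | hx) | hx <;> rcases hy with (hy | hy) | hy
  · exact (h1 hx).1.trans (h1 hy).1.symm
  · exact (h1 hx).2.trans (h2 hy).1.symm
  · exact (h1 hx).1.trans (h3 hy).2.symm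
  · exact (h2 hx).1.trans (h1 hy).2.symm
  · exact (h2 hx).1.trans (h2 hy).1.symm
  · exact (h2 hx).2.trans (h3 hy).1.symm
  · exact (h3 hx).2.trans (h1 hy).1.symm
  · exact (h3 hx).1.trans (h2 hy).2.symm
  · exact (h3 hx).1.trans (h3 hy).1.symm

end RectJoined

section FilledLoop

variable {X : Type*} [MetricSpace X] [CatZero X] {L : ℝ → X} {D : Set X} {G : X → ℂ} {h : ℂ → X}

/-- Every point of the filled loop is joined to the loop. -/
theorem IsChart.rectJoined_range (c : IsChart D G h) (hD : GConvex D) (hL : Continuous L)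
    (hp : ∀ t, L (t + 1) = L t) (hLD : ∀ t, L t ∈ D) {x : X}
    (hx : x ∈ D ∩ G ⁻¹' windFill fun t => G (L t)) :
    ∃ t, RectJoined (D ∩ G ⁻¹' windFill fun t => G (L t)) x (L t) := by
  have hgc : Continuous fun s => geo x (L 0) s :=
    continuous_geo_comp continuous_const continuous_const continuous_id
  have hgD : ∀ s ∈ Icc (0 : ℝ) 1, geo x (L 0) s ∈ D := fun s hs => hD x hx.1 _ (hLD 0) s hs
  obtain ⟨s, hs, ⟨t, ht⟩, hmin⟩ := exists_first_hit (σ := fun s => geo x (L 0) s) zero_le_one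
    hgc.continuousOn (isCompact_range_of_periodic hL hp).isClosed ⟨0, (geo_one x (L 0)).symm⟩
  have hcR : ∀ s' ∈ Ico 0 s, G (geo x (L 0) s') ∉ range fun t => G (L t) := by
    rintro s' hs' ⟨t, ht⟩
    exact hmin s' hs' ⟨t, c.injOn (hLD t) (hgD s' ⟨hs'.1, hs'.2.le.trans hs.2⟩) ht⟩
  have hK : ∀ s' ∈ Icc 0 s, geo x (L 0) s' ∈ D ∩ G ⁻¹' windFill fun t => G (L t) := by
    intro s' hs'
    refine ⟨hgD s' ⟨hs'.1, hs'.2.trans hs.2⟩, ?_⟩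
    rcases eq_or_lt_of_le hs'.2 with rfl | hlt
    · exact Or.inl ⟨t, congrArg G ht⟩
    · have hm : ∀ a ∈ Icc (0 : ℝ) 1, a * s' ∈ Ico 0 s := fun a ha =>
        ⟨mul_nonneg ha.1 hs'.1, by nlinarith [ha.1, ha.2, hs'.1]⟩
      have := wind_eq_of_path (c.continuous_comp hL hLD) (fun t => by rw [hp])
        (σ := fun a => G (geo x (L 0) (a * s')))
        (c.continuousOn.comp (by fun_prop) fun a ha =>
          hgD _ ⟨(hm a ha).1, (hm a ha).2.le.trans hs.2⟩) fun a ha => hcR _ (hm a ha)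
      simp only [zero_mul, one_mul, geo_zero] at this
      refine Or.inr ?_
      rcases hx.2 with h0 | h0
      · exact absurd (by rw [geo_zero]; exact h0) (hcR 0 ⟨le_rfl, hs'.1.trans_lt hlt⟩)
      · show wind _ _ ≠ 0
        rw [← this]; exact h0
  have := rectJoined_of_dist_le hs.1 (l := dist x (L 0)) (fun a ha b hb => by
    rw [dist_geo_geo x (L 0) ⟨ha.1, ha.2.trans hs.2⟩ ⟨hb.1, hb.2.trans hs.2⟩, mul_comm]) hK
  rw [geo_zero] at this
  exact ⟨t, by rw [ht]; exact this⟩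

end FilledLoop

end Cat2Cx
end

noncomputable section

open Topology

namespace Cat2Cx

/-! ### Cutting a loop along a geodesic -/

section Cutting

variable {κ : ℝ} {X : Type*} [MetricSpace X] {E : Set X} {L : ℝ → X} {V : Set X}

theorem GeoAt.of_subset_union {S S' Z : Set X} {x : X} (hg : GeoAt E S x) (hE : RectConnected E)
    (hSE : S ⊆ E) (hZ : IsClosed Z) (hx : x ∉ Z) (hS : S ⊆ S' ∪ Z) : GeoAt E S' x := by
  obtain ⟨f, s₀, ε₀, hε₀, rfl, hf, hfS⟩ := hg
  have hfc := continuousOn_of_dist_le (dist_le_of_pathDistIn hE (fun s hs => hSE (hfS s hs))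
    (l := 1) fun s hs s' hs' => by rw [hf s hs s' hs', one_mul])
  have hfa : ContinuousAt f s₀ := hfc.continuousAt (Icc_mem_nhds (by linarith) (by linarith))
  obtain ⟨ε₁, hε₁, hball⟩ := Metric.nhds_basis_closedBall.mem_iff.1
    (hfa.eventually (hZ.isOpen_compl.mem_nhds hx))
  have hsub : Icc (s₀ - min ε₀ ε₁) (s₀ + min ε₀ ε₁) ⊆ Icc (s₀ - ε₀) (s₀ + ε₀) :=
    Icc_subset_Icc (by linarith [min_le_left ε₀ ε₁]) (by linarith [min_le_left ε₀ ε₁])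
  refine ⟨f, s₀, min ε₀ ε₁, lt_min hε₀ hε₁, rfl, fun s hs s' hs' => hf s (hsub hs) s' (hsub hs'),
    fun s hs => (hS (hfS s (hsub hs))).resolve_right (hball ?_)⟩
  rw [Real.closedBall_eq_Icc]
  exact ⟨by linarith [hs.1, min_le_right ε₀ ε₁], by linarith [hs.2, min_le_right ε₀ ε₁]⟩

theorem geoAt_of_pathDistIn {f : ℝ → X} {a b l : ℝ} (hl : 0 < l)
    (hf : ∀ s ∈ Icc a b, ∀ t ∈ Icc a b, pathDistIn E (f s) (f t) = l * |s - t|) {s : ℝ}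
    (hs : s ∈ Ioo a b) {S : Set X} (hS : ∀ s ∈ Icc a b, f s ∈ S) : GeoAt E S (f s) := by
  have hm : ∀ u ∈ Icc (l * s - l * min (s - a) (b - s)) (l * s + l * min (s - a) (b - s)),
      u / l ∈ Icc a b := fun u hu => by
    rw [mem_Icc, le_div_iff₀ hl, div_le_iff₀ hl]
    have h1 := mul_le_mul_of_nonneg_left (min_le_left (s - a) (b - s)) hl.le
    have h2 := mul_le_mul_of_nonneg_left (min_le_right (s - a) (b - s)) hl.le
    constructor
    · linarith [hu.1]
    · linarith [hu.2]
  refine ⟨fun u => f (u / l), l * s, l * min (s - a) (b - s), mul_pos hl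
    (lt_min (by linarith [hs.1]) (by linarith [hs.2])), congrArg f (mul_div_cancel_left₀ _ hl.ne'),
    fun u hu v hv => ?_, fun u hu => hS _ (hm u hu)⟩
  rw [hf _ (hm u hu) _ (hm v hv), ← sub_div, abs_div, abs_of_pos hl, mul_div_cancel₀ _ hl.ne']

theorem exists_mem_Ioc_of_range {A : Type*} {L : ℝ → A} (hp : ∀ t, L (t + 1) = L t) {x : A}
    (hx : x ∈ range L) (α : ℝ) : ∃ t ∈ Ioc α (α + 1), L t = x := by
  obtain ⟨t, rfl⟩ := hx
  obtain ⟨n, hn⟩ := exists_int_add_mem_Ioc t (α + 1 / 2)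
  exact ⟨t + n, ⟨by linarith [hn.1], by linarith [hn.2]⟩, periodic_add_int hp t n⟩

/-- A geodesic chord cuts a piecewise geodesic loop into two piecewise geodesic loops. -/
theorem YLoop.cut (l : YLoop E L V) (hinj : ∀ t t', L t' = L t → ∃ n : ℤ, t' - t = n) {α β : ℝ}
    (hαβ : α < β) (hβα : β < α + 1) {Γ : ℝ → X} {ℓ : ℝ} (hℓ : 0 < ℓ)
    (hΓ : ∀ s ∈ Icc (0 : ℝ) 1, ∀ t ∈ Icc (0 : ℝ) 1, pathDistIn E (Γ s) (Γ t) = ℓ * |s - t|)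
    (hΓE : ∀ s ∈ Icc (0 : ℝ) 1, Γ s ∈ E) (h0 : Γ 0 = L β) (h1 : Γ 1 = L α)
    (hΓL : ∀ s ∈ Ioo (0 : ℝ) 1, Γ s ∉ range L) :
    YLoop E (loop (fun s => L (α + (β - α) * s)) Γ) ({L α, L β} ∪ V ∩ L '' Ioo α β) := by
  have j1 : L (α + (β - α) * 1) = Γ 0 := by rw [h0]; ring_nf
  have j2 : Γ 1 = L (α + (β - α) * 0) := by rw [h1]; ring_nf
  have hba : 0 < β - α := sub_pos.2 hαβ
  have hLc := l.cont
  refine ⟨l.isClosed, l.rect, l.h1, continuous_loop (Continuous.continuousOn (by fun_prop))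
    (continuousOn_of_dist_le (dist_le_of_pathDistIn l.rect hΓE hΓ)) j1 j2, loop_periodic _ _,
    fun t => ?_, (toFinite _).union (l.finite.inter_of_left _), ?_, fun t ht => ?_⟩
  · obtain ⟨n, s, hs, ⟨-, h⟩ | ⟨-, h⟩⟩ := loop_apply_cases (P := fun s => L (α + (β - α) * s)) j1 j2 t
    · rw [h]; exact l.mem _
    · rw [h]; exact hΓE s hs
  · refine loop_inj j1 j2 (fun s hs s' hs' _ he => ?_) (fun s hs s' hs' _ he =>
      injOn_of_pathDistIn hℓ hΓE hΓ hs' hs he) fun s hs s' hs' he => ?_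
    · obtain ⟨n, hn⟩ := hinj _ _ he
      have := int_eq_zero_of_abs_lt hn (abs_lt.2 ⟨by nlinarith [hs.1, hs.2, hs'.1, hs'.2],
        by nlinarith [hs.1, hs.2, hs'.1, hs'.2]⟩)
      have h2 : (β - α) * (s' - s) = 0 := by linarith
      rcases mul_eq_zero.1 h2 with h3 | h3 <;> linarith
    · rcases eq_or_lt_of_le hs'.1 with h2 | h2
      · rw [he, ← h2, h0]; simp
      rcases eq_or_lt_of_le hs'.2 with h3 | h3
      · rw [he, h3, h1]; simp
      exact absurd ⟨_, he⟩ (hΓL s' ⟨h2, h3⟩)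
  · obtain ⟨n, s, hs, ⟨-, h⟩ | ⟨-, h⟩⟩ :=
      loop_apply_cases (P := fun s => L (α + (β - α) * s)) j1 j2 t
    · rw [h] at ht ⊢
      have hs0 : 0 < s := lt_of_le_of_ne hs.1 fun h => ht (by rw [← h]; simp)
      have hs1 : s < 1 := lt_of_le_of_ne hs.2 fun h => ht (by rw [h]; simp)
      have hu : α + (β - α) * s ∈ Ioo α β := ⟨by nlinarith, by nlinarith⟩
      refine (l.geo _ fun hv => ht (Or.inr ⟨hv, mem_image_of_mem L hu⟩)).of_subset_union l.rect
        (by rintro _ ⟨t, rfl⟩; exact l.mem t)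
        (isCompact_Icc.image l.cont : IsCompact (L '' Icc β (α + 1))).isClosed ?_ ?_
      · rintro ⟨v, hv, he⟩
        obtain ⟨n, hn⟩ := hinj _ _ he
        have := int_eq_zero_of_abs_lt hn (abs_lt.2 ⟨by linarith [hv.1, hu.2],
          by linarith [hv.2, hu.1]⟩)
        linarith [hv.1, hu.2]
      · intro x hx
        obtain ⟨v, hv, rfl⟩ := exists_mem_Ioc_of_range l.per hx α
        rcases le_total v β with hvβ | hvβ
        · refine Or.inl ⟨_, (loop_left (s := (v - α) / (β - α)) _ Γ ⟨?_, ?_⟩).trans ?_⟩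
          · exact div_nonneg (by linarith [hv.1]) hba.le
          · rw [div_le_one hba]; linarith
          · simp only [mul_div_cancel₀ _ hba.ne']; ring_nf
        · exact Or.inr ⟨v, ⟨hvβ, hv.2⟩, rfl⟩
    · rw [h] at ht ⊢
      refine geoAt_of_pathDistIn hℓ hΓ ⟨lt_of_le_of_ne hs.1 fun h => ht ?_,
        lt_of_le_of_ne hs.2 fun h => ht ?_⟩ fun s hs => ⟨_, loop_right j1 j2 hs⟩
      · rw [← h, h0]; simp
      · rw [h, h1]; simp

end Cutting

end Cat2Cx
end

noncomputable section

open Topology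

namespace Cat2Cx

/-! ### Geodesics between points of a filled geodesic triangle -/

theorem interior_convexHull_pair (a b : ℂ) : interior (convexHull ℝ ({a, b} : Set ℂ)) = ∅ := by
  by_contra h
  have h1 := (interior_convexHull_nonempty_iff_affineSpan_eq_top (s := ({a, b} : Set ℂ))).1
    (nonempty_iff_ne_empty.2 h)
  have h2 := collinear_iff_finrank_le_one.1 (collinear_pair ℝ a b)
  rw [← direction_affineSpan, h1, AffineSubspace.direction_top, finrank_top,
    Complex.finrank_real_complex] at h2
  norm_num at h2

theorem mem_extremePoints_of_triple {a b c v : ℂ}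
    (h : (interior (convexHull ℝ ({a, b, c} : Set ℂ))).Nonempty) (hv : v ∈ ({a, b, c} : Set ℂ)) :
    v ∈ extremePoints ℝ (convexHull ℝ ({a, b, c} : Set ℂ)) := by
  by_contra hx
  have hpair : ∀ x y : ℂ, ({a, b, c} : Set ℂ) \ {v} ⊆ {x, y} → False := fun x y hs => by
    have h1 := closure_convexHull_extremePoints
      ((toFinite ({a, b, c} : Set ℂ)).isCompact_convexHull ℝ) (convex_convexHull ℝ _)
    have h2 : convexHull ℝ ({a, b, c} : Set ℂ) ⊆ convexHull ℝ {x, y} :=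
      h1.symm.subset.trans (closure_minimal (convexHull_mono fun z hz =>
        hs ⟨extremePoints_convexHull_subset hz, fun e => hx (e ▸ hz)⟩)
        ((toFinite _).isCompact_convexHull ℝ).isClosed)
    have := h.mono (interior_mono h2)
    rw [interior_convexHull_pair] at this
    exact not_nonempty_empty this
  rcases hv with rfl | rfl | rfl
  · exact hpair b c fun z hz => hz.1.resolve_left hz.2
  · exact hpair a c fun z hz => hz.1.imp_right fun h => h.resolve_left hz.2
  · exact hpair a b fun z hz => hz.1.imp_right fun h => h.resolve_right hz.2

section Chords

variable {κ : ℝ} {X : Type*} [MetricSpace X] {E : Set X} {L : ℝ → X} {V : Set X}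

/-- `Γ` is a constant speed geodesic of `E` from `L β` to `L α` meeting the loop `L` only at its
endpoints. -/
structure Chord (E : Set X) (L : ℝ → X) (α β ℓ : ℝ) (Γ : ℝ → X) : Prop where
  lt : α < β
  lt_add_one : β < α + 1
  pos : 0 < ℓ
  geo : ∀ s ∈ Icc (0 : ℝ) 1, ∀ t ∈ Icc (0 : ℝ) 1, pathDistIn E (Γ s) (Γ t) = ℓ * |s - t|
  mem : ∀ s ∈ Icc (0 : ℝ) 1, Γ s ∈ E
  zero : Γ 0 = L β
  one : Γ 1 = L α
  notMem : ∀ s ∈ Ioo (0 : ℝ) 1, Γ s ∉ range L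

/-- The loop running along `L` from `L α` to `L β` and back along the chord. -/
def cutLoop {X : Type*} (L : ℝ → X) (α β : ℝ) (Γ : ℝ → X) : ℝ → X := loop (fun s => L (α + (β - α) * s)) Γ

variable {α β ℓ : ℝ} {Γ : ℝ → X}

theorem Chord.flip (h : Chord E L α β ℓ Γ) (hp : ∀ t, L (t + 1) = L t) :
    Chord E L β (α + 1) ℓ fun s => Γ (1 - s) where
  lt := h.lt_add_one
  lt_add_one := by linarith [h.lt]
  pos := h.pos
  geo s hs t ht := by
    rw [h.geo _ (one_sub_mem hs) _ (one_sub_mem ht), abs_sub_comm s t]; ring_nf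
  mem s hs := h.mem _ (one_sub_mem hs)
  zero := by rw [sub_zero, h.one, hp]
  one := by rw [sub_self, h.zero]
  notMem s hs := h.notMem _ ⟨by linarith [hs.2], by linarith [hs.1]⟩

theorem Chord.yLoop (h : Chord E L α β ℓ Γ) (l : YLoop E L V)
    (hinj : ∀ t t', L t' = L t → ∃ n : ℤ, t' - t = n) :
    YLoop E (cutLoop L α β Γ) ({L α, L β} ∪ V ∩ L '' Ioo α β) :=
  l.cut hinj h.lt h.lt_add_one h.pos h.geo h.mem h.zero h.one h.notMem

theorem Chord.range_cutLoop (h : Chord E L α β ℓ Γ) :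
    range (cutLoop L α β Γ) = L '' Icc α β ∪ Γ '' Icc 0 1 := by
  rw [cutLoop, range_loop (by rw [h.zero]; ring_nf) (by rw [h.one]; ring_nf)]
  congr 1
  have : (fun s => α + (β - α) * s) '' Icc 0 1 = Icc α β := by
    have := segment_eq_image_lineMap ℝ α β
    rw [segment_eq_Icc h.lt.le] at this
    rw [this]
    exact image_congr fun s _ => by simp [AffineMap.lineMap_apply]; ring
  rw [← this, image_image]

theorem cutLoop_flip {X : Type*} {L : ℝ → X} {Γ : ℝ → X} (hp : ∀ t, L (t + 1) = L t) :
    cutLoop L (α + 1) (β + 1) (fun s => Γ (1 - (1 - s))) = cutLoop L α β Γ := by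
  have e : (fun s => L (α + 1 + (β + 1 - (α + 1)) * s)) = fun s => L (α + (β - α) * s) :=
    funext fun s => by rw [← hp (α + (β - α) * s)]; ring_nf
  simp only [cutLoop, sub_sub_cancel, e]

theorem Chord.notMem_range_cutLoop (h : Chord E L α β ℓ Γ) (hp : ∀ t, L (t + 1) = L t)
    (hinj : ∀ t t', L t' = L t → ∃ n : ℤ, t' - t = n) {u : ℝ} (hu : u ∈ Ioo α β) :
    L u ∉ range (cutLoop L β (α + 1) fun s => Γ (1 - s)) := by
  have h0 : ∀ t ∈ Icc β (α + 1), L t ≠ L u := fun t ht he => by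
    obtain ⟨n, hn⟩ := hinj u t he
    have := int_eq_zero_of_abs_lt hn
      (abs_lt.2 ⟨by linarith [hu.2, ht.1], by linarith [hu.1, ht.2]⟩)
    linarith [hu.2, ht.1]
  rw [(h.flip hp).range_cutLoop]
  rintro (⟨t, ht, he⟩ | ⟨s, hs, he⟩)
  · exact h0 t ht he
  · rcases eq_or_lt_of_le hs.1 with rfl | h1
    · exact h0 (α + 1) ⟨h.lt_add_one.le, le_rfl⟩ ((h.flip hp).zero.symm.trans he)
    rcases eq_or_lt_of_le hs.2 with rfl | h2
    · exact h0 β ⟨le_rfl, h.lt_add_one.le⟩ ((h.flip hp).one.symm.trans he)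
    · exact (h.flip hp).notMem s ⟨h1, h2⟩ ⟨u, he.symm⟩

variable [CatZero X] {D : Set X} {G : X → ℂ} {g : ℂ → X}

/-- One side of a chord winds around no point of the arc on the other side. -/
theorem Chord.wind_eq_zero (h : Chord E L α β ℓ Γ) (l : YLoop E L V)
    (hinj : ∀ t t', L t' = L t → ∃ n : ℤ, t' - t = n) (hκ : κ ≤ 0) (PC : PolyComplex2 κ X)
    (c : IsChart D G g) (hD : GConvex D) (hLD : ∀ t, L t ∈ D) (hVD : V ⊆ D)
    (hext : ∀ v ∈ V, G v ∈ extremePoints ℝ (convexHull ℝ (G '' V))) {w : ℂ}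
    (hw : wind (fun t => G (cutLoop L α β Γ t)) w ≠ 0) {u : ℝ} (hu : u ∈ Ioo α β) :
    wind (fun t => G (cutLoop L β (α + 1) (fun s => Γ (1 - s)) t)) (G (L u)) = 0 := by
  have h' := h.flip l.per
  have l1 := h.yLoop l hinj
  have l2 := h'.yLoop l hinj
  have hV1 : {L α, L β} ∪ V ∩ L '' Ioo α β ⊆ D := by
    rintro x ((rfl | rfl) | hx)
    exacts [hLD _, hLD _, hVD hx.1]
  have hV2 : {L β, L (α + 1)} ∪ V ∩ L '' Ioo β (α + 1) ⊆ D := by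
    rintro x ((rfl | rfl) | hx)
    exacts [hLD _, hLD _, hVD hx.1]
  have hm1 := l1.mem_hull hκ PC c hD ⟨L α, by simp⟩ hV1
  have hm2 := l2.mem_hull hκ PC c hD ⟨L β, by simp⟩ hV2
  have hc2 := c.continuous_comp l2.cont fun t => (hm2 t).1
  have hp2 : ∀ t, G (cutLoop L β (α + 1) (fun s => Γ (1 - s)) (t + 1)) =
    G (cutLoop L β (α + 1) (fun s => Γ (1 - s)) t) := fun t => by rw [l2.per]
  obtain ⟨v, hvV, t₀, ht₀, rfl⟩ : (V ∩ L '' Ioo α β).Nonempty := by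
    by_contra hne
    have := mem_interior_of_wind (c.continuous_comp l1.cont fun t => (hm1 t).1)
      (fun t => by rw [l1.per]) (convex_convexHull ℝ _) (fun t => (hm1 t).2) hw
    rw [not_nonempty_iff_eq_empty.1 hne, union_empty, image_pair, interior_convexHull_pair] at this
    exact this
  have hH : ∀ t, G (L t) ∈ convexHull ℝ (G '' V) := fun t =>
    (l.mem_hull hκ PC c hD ⟨_, hvV⟩ hVD t).2
  have hnot : ∀ t ∈ Ioo α β, G (L t) ∉
      range fun t => G (cutLoop L β (α + 1) (fun s => Γ (1 - s)) t) := by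
    rintro t ht ⟨t', he⟩
    exact h.notMem_range_cutLoop l.per hinj ht ⟨t', c.injOn (hm2 t').1 (hLD t) he⟩
  have hz : wind (fun t => G (cutLoop L β (α + 1) (fun s => Γ (1 - s)) t)) (G (L t₀)) = 0 := by
    refine _root_.Cat2Cx.wind_eq_zero_of_convex hc2 hp2 (convex_convexHull ℝ _)
      (fun t => (hm2 t).2) fun hmem => ?_
    have hcv := ((convex_convexHull ℝ (G '' V)).mem_extremePoints_iff_convex_sdiff.1
      (hext _ hvV)).2
    refine (convexHull_min ?_ hcv hmem).2 rfl
    have hne : ∀ t ∈ Icc β (α + 1), G (L t) ≠ G (L t₀) := fun t ht he => by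
      refine h.notMem_range_cutLoop l.per hinj ht₀ ?_
      rw [h'.range_cutLoop]
      exact Or.inl ⟨t, ht, c.injOn (hLD _) (hLD _) he⟩
    rintro _ ⟨x, (rfl | rfl) | ⟨hx, t, ht, rfl⟩, rfl⟩
    · exact ⟨hH _, hne _ ⟨le_rfl, h.lt_add_one.le⟩⟩
    · exact ⟨hH _, hne _ ⟨h.lt_add_one.le, le_rfl⟩⟩
    · exact ⟨hH _, hne _ (Ioo_subset_Icc_self ht)⟩
  have := wind_eq_of_path hc2 hp2 (σ := fun s => G (L (AffineMap.lineMap (k := ℝ) t₀ u s)))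
    ((c.continuous_comp l.cont hLD).comp (AffineMap.lineMap_continuous (R := ℝ))).continuousOn
    fun s hs => hnot _ ((convex_Ioo (𝕜 := ℝ) α β).segment_subset ht₀ hu
      (by rw [segment_eq_image_lineMap]; exact mem_image_of_mem _ hs))
  simp only [AffineMap.lineMap_apply_zero, AffineMap.lineMap_apply_one] at this
  rw [← this, hz]

theorem Chord.cutLoop_mem (h : Chord E L α β ℓ Γ) (l : YLoop E L V)
    (hinj : ∀ t t', L t' = L t → ∃ n : ℤ, t' - t = n) (hκ : κ ≤ 0) (PC : PolyComplex2 κ X)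
    (c : IsChart D G g) (hD : GConvex D) (hLD : ∀ t, L t ∈ D) (hVD : V ⊆ D) (t : ℝ) :
    cutLoop L α β Γ t ∈ D := by
  refine ((h.yLoop l hinj).mem_hull hκ PC c hD ⟨L α, by simp⟩ ?_ t).1
  rintro x ((rfl | rfl) | hx)
  exacts [hLD _, hLD _, hVD hx.1]

/-- A chord cannot run outside a filled geodesic triangle. -/
theorem Chord.exists_mem_windFill (h : Chord E L α β ℓ Γ) (l : YLoop E L V)
    (hinj : ∀ t t', L t' = L t → ∃ n : ℤ, t' - t = n) (hκ : κ ≤ 0) (PC : PolyComplex2 κ X)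
    (c : IsChart D G g) (hDc : IsCompact D) (hD : GConvex D) (hLD : ∀ t, L t ∈ D) (hVD : V ⊆ D)
    (hext : ∀ v ∈ V, G v ∈ extremePoints ℝ (convexHull ℝ (G '' V))) :
    ∃ s ∈ Ioo (0 : ℝ) 1, G (Γ s) ∈ windFill fun t => G (L t) := by
  by_contra! hΓ
  have h' := h.flip l.per
  have l1 := h.yLoop l hinj
  have hm1 := h.cutLoop_mem l hinj hκ PC c hD hLD hVD
  have hm2 := h'.cutLoop_mem l hinj hκ PC c hD hLD hVD
  have hΓr : ∀ s ∈ Icc (0 : ℝ) 1, Γ s ∈ range (cutLoop L α β Γ) := fun s hs => by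
    rw [h.range_cutLoop]; exact Or.inr ⟨s, hs, rfl⟩
  have hΓD : ∀ s ∈ Icc (0 : ℝ) 1, Γ s ∈ D := fun s hs => by
    obtain ⟨t, ht⟩ := hΓr s hs
    exact ht ▸ hm1 t
  have hΓc : ContinuousOn (fun s => G (Γ s)) (Icc 0 1) :=
    c.continuousOn.comp (continuousOn_of_dist_le (dist_le_of_pathDistIn l.rect h.mem h.geo)) hΓD
  have hc0 := c.continuous_comp l.cont hLD
  have hc1 := c.continuous_comp l1.cont hm1
  have hc2 := c.continuous_comp (h'.yLoop l hinj).cont hm2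
  have hp0 : ∀ t, G (L (t + 1)) = G (L t) := fun t => by rw [l.per]
  have hp1 : ∀ t, G (cutLoop L α β Γ (t + 1)) = G (cutLoop L α β Γ t) := fun t => by rw [l1.per]
  have hp2 : ∀ t, G (cutLoop L β (α + 1) (fun s => Γ (1 - s)) (t + 1)) =
    G (cutLoop L β (α + 1) (fun s => Γ (1 - s)) t) := fun t => by rw [(h'.yLoop l hinj).per]
  -- a point just beside the chord
  obtain ⟨w, hw1, hwr, hw0⟩ : ∃ w, wind (fun t => G (cutLoop L α β Γ t)) w ≠ 0 ∧
      w ∉ range (fun t => G (cutLoop L α β Γ t)) ∧ w ∉ windFill fun t => G (L t) := by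
    obtain ⟨t₀, ht₀⟩ := hΓr (1 / 2) (by norm_num)
    have hhalf : (1 / 2 : ℝ) ∈ Ioo 0 1 := by norm_num
    have hV : cutLoop L α β Γ t₀ ∉ {L α, L β} ∪ V ∩ L '' Ioo α β := by
      rw [ht₀]
      rintro ((he | he) | ⟨-, t, -, he⟩)
      exacts [h.notMem _ hhalf ⟨_, he.symm⟩, h.notMem _ hhalf ⟨_, he.symm⟩, h.notMem _ hhalf ⟨_, he⟩]
    obtain ⟨w₁, hU1, w₂, hU2, hr1, hr2, hj⟩ := l1.exists_jump c hm1 hV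
      ((isClosed_windFill hc0 hp0).isOpen_compl.mem_nhds (by rw [ht₀]; exact hΓ _ hhalf))
    by_cases h0 : wind (fun t => G (cutLoop L α β Γ t)) w₁ = 0
    · exact ⟨w₂, by omega, hr2, hU2⟩
    · exact ⟨w₁, h0, hr1, hU1⟩
  have hwΓ : ∀ s ∈ Icc (0 : ℝ) 1, G (Γ s) ≠ w := fun s hs he => by
    obtain ⟨t, ht⟩ := hΓr s hs
    exact hwr ⟨t, by rw [← he, ← ht]⟩
  have hw2 : wind (fun t => G (cutLoop L β (α + 1) (fun s => Γ (1 - s)) t)) w ≠ 0 := by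
    have := wind_add hc0 hp0 hΓc (congrArg G h.zero) (congrArg G h.one)
      (fun hr => hw0 (Or.inl hr)) hwΓ
    rw [← funext (loop_comp G (fun s => L (α + (β - α) * s)) Γ),
      ← funext (loop_comp G (fun s => L (β + (α + 1 - β) * s)) fun s => Γ (1 - s))] at this
    change _ = wind (fun t => G (cutLoop L α β Γ t)) w +
      wind (fun t => G (cutLoop L β (α + 1) (fun s => Γ (1 - s)) t)) w at this
    have h0 : wind (fun t => G (L t)) w = 0 := by_contra fun h0 => hw0 (Or.inr h0)
    omega
  have hz2 : ∀ u ∈ Ioo α β, wind (fun t => G (cutLoop L β (α + 1) (fun s => Γ (1 - s)) t))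
      (G (L u)) = 0 := fun u hu => h.wind_eq_zero l hinj hκ PC c hD hLD hVD hext hw1 hu
  have hz1 : ∀ u ∈ Ioo β (α + 1), wind (fun t => G (cutLoop L α β Γ t)) (G (L u)) = 0 :=
    fun u hu => by
      have := h'.wind_eq_zero l hinj hκ PC c hD hLD hVD hext hw2 hu
      rwa [cutLoop_flip l.per] at this
  -- both rays from this point hit the chord before they leave the loop
  have hR : IsClosed (range (fun t => G (L t)) ∪ (fun s => G (Γ s)) '' Icc 0 1) :=
    (isCompact_range_of_periodic hc0 hp0).isClosed.union
      (isCompact_Icc.image_of_continuousOn hΓc).isClosed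
  have hr1 : range (fun t => G (cutLoop L α β Γ t)) ⊆
      range (fun t => G (L t)) ∪ (fun s => G (Γ s)) '' Icc 0 1 := by
    rw [range_comp' G, h.range_cutLoop, image_union, image_image, image_image]
    exact union_subset_union_left _ (image_subset_range _ _)
  have hr2 : range (fun t => G (cutLoop L β (α + 1) (fun s => Γ (1 - s)) t)) ⊆
      range (fun t => G (L t)) ∪ (fun s => G (Γ s)) '' Icc 0 1 := by
    rw [range_comp' G, h'.range_cutLoop, image_union, image_image, image_image]
    refine union_subset_union (image_subset_range _ _) ?_
    rintro _ ⟨s, hs, rfl⟩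
    exact ⟨1 - s, one_sub_mem hs, rfl⟩
  have ray : ∀ e : ℝ, |e| = 1 → ∃ s ∈ Icc (0 : ℝ) 1, ∃ ρ : ℝ, 0 ≤ ρ ∧ G (Γ s) = w + (ρ * e : ℝ) ∧
      ∀ x ∈ Icc 0 ρ, w + (x * e : ℝ) ∈ windFill fun t => G (cutLoop L α β Γ t) := by
    intro e he
    have hσ : Continuous fun x : ℝ => w + ((x * e : ℝ) : ℂ) := by fun_prop
    have hseg : ∀ {c' : ℝ → ℂ} {ρ : ℝ}, 0 ≤ ρ → Continuous c' → (∀ t, c' (t + 1) = c' t) →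
        (∀ x ∈ Icc 0 ρ, w + ((x * e : ℝ) : ℂ) ∉ range c') →
        wind c' w = wind c' (w + (ρ * e : ℝ)) := fun {c' ρ} hρ hc' hp' hn => by
      have := wind_eq_of_path hc' hp' (σ := fun s => w + ((s * ρ * e : ℝ) : ℂ)) (by fun_prop)
        fun s hs => hn (s * ρ) ⟨mul_nonneg hs.1 hρ, mul_le_of_le_one_left hρ hs.2⟩
      simpa using this
    obtain ⟨M, hM⟩ := (hDc.image_of_continuousOn c.continuousOn).isBounded.exists_norm_le
    have hM0 : 0 ≤ M := (norm_nonneg _).trans (hM _ ⟨_, hLD 0, rfl⟩)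
    have hout : w + (((M + ‖w‖ + 1) * e : ℝ) : ℂ) ∉ G '' D := fun hmem => by
      have h1 := norm_sub_le (w + (((M + ‖w‖ + 1) * e : ℝ) : ℂ)) w
      rw [add_sub_cancel_left, Complex.norm_real, Real.norm_eq_abs, abs_mul, he,
        abs_of_nonneg (by positivity)] at h1
      linarith [hM _ hmem]
    have hhit : ∃ x ∈ Icc 0 (M + ‖w‖ + 1), w + ((x * e : ℝ) : ℂ) ∈
        range (fun t => G (L t)) ∪ (fun s => G (Γ s)) '' Icc 0 1 := by
      by_contra! hno
      refine hw1 ((hseg (by positivity) hc1 hp1 fun x hx hxr => hno x hx (hr1 hxr)).trans ?_)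
      exact wind_eq_zero_of_convex hc1 hp1 (c.convex_image hD le_rfl hD)
        (fun t => mem_image_of_mem G (hm1 t)) hout
    obtain ⟨x₀, hx₀, hx₀R⟩ := hhit
    obtain ⟨ρ, hρ, hρR, hfirst⟩ := exists_first_hit hx₀.1 hσ.continuousOn hR hx₀R
    have hbad : ∀ {c' : ℝ → ℂ}, Continuous c' → (∀ t, c' (t + 1) = c' t) →
        range c' ⊆ range (fun t => G (L t)) ∪ (fun s => G (Γ s)) '' Icc 0 1 → wind c' w ≠ 0 →
        w + ((ρ * e : ℝ) : ℂ) ∉ range c' → wind c' (w + ((ρ * e : ℝ) : ℂ)) ≠ 0 :=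
      fun hc' hp' hr' hw' hn => by
        rw [← hseg hρ.1 hc' hp' fun x hx hxr => ?_]
        · exact hw'
        · rcases eq_or_lt_of_le hx.2 with rfl | hlt
          · exact hn hxr
          · exact hfirst x ⟨hx.1, hlt⟩ (hr' hxr)
    have hΓhit : ∃ s ∈ Icc (0 : ℝ) 1, G (Γ s) = w + ((ρ * e : ℝ) : ℂ) := by
      rcases hρR with hρR | hρR
      · obtain ⟨u, hu, hue⟩ := exists_mem_Ioc_of_range hp0 hρR α
        rcases lt_trichotomy u β with huβ | rfl | huβ
        · refine absurd (hue ▸ hz2 u ⟨hu.1, huβ⟩) (hbad hc2 hp2 hr2 hw2 ?_)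
          rintro ⟨t, ht⟩
          exact h.notMem_range_cutLoop l.per hinj ⟨hu.1, huβ⟩
            ⟨t, c.injOn (hm2 t) (hLD u) (ht.trans hue.symm)⟩
        · exact ⟨0, by simp, by rw [h.zero, hue]⟩
        · rcases eq_or_lt_of_le hu.2 with rfl | hlt
          · exact ⟨1, by simp, by rw [h.one, ← hue, l.per]⟩
          · refine absurd (hue ▸ hz1 u ⟨huβ, hlt⟩) (hbad hc1 hp1 hr1 hw1 ?_)
            rintro ⟨t, ht⟩
            refine h'.notMem_range_cutLoop l.per hinj ⟨huβ, hlt⟩ ?_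
            rw [cutLoop_flip l.per]
            exact ⟨t, c.injOn (hm1 t) (hLD u) (ht.trans hue.symm)⟩
      · exact hρR
    obtain ⟨s, hs, hse⟩ := hΓhit
    refine ⟨s, hs, ρ, hρ.1, hse, fun x hx => ?_⟩
    rcases eq_or_lt_of_le hx.2 with rfl | hlt
    · obtain ⟨t, ht⟩ := hΓr s hs
      exact Or.inl ⟨t, by simp only [ht, hse]⟩
    · right
      have := hseg hx.1 hc1 hp1 fun y hy hyr => hfirst y ⟨hy.1, hy.2.trans_lt hlt⟩ (hr1 hyr)
      exact fun h0 => hw1 (this.trans h0)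
  -- so the chord would be a straight segment through this point
  have straight : ∀ s ∈ Icc (0 : ℝ) 1, ∀ s' ∈ Icc (0 : ℝ) 1, s ≤ s' →
      w ∈ segment ℝ (G (Γ s)) (G (Γ s')) →
      segment ℝ (G (Γ s)) (G (Γ s')) ⊆ windFill (fun t => G (cutLoop L α β Γ t)) → False := by
    intro s hs s' hs' hss hws hsub
    obtain ⟨x, hxD, rfl⟩ := (c.convex_image hD le_rfl hD).segment_subset
      (mem_image_of_mem G (hΓD s hs)) (mem_image_of_mem G (hΓD s' hs')) hws
    have hdiv : ∀ u ∈ Icc (ℓ * s) (ℓ * s'), u / ℓ ∈ Icc (0 : ℝ) 1 := fun u hu => by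
      rw [mem_Icc, le_div_iff₀ h.pos, div_le_iff₀ h.pos]
      constructor
      · nlinarith [hu.1, hs.1, h.pos]
      · nlinarith [hu.2, hs'.2, h.pos]
    have e1 : ∀ s, Γ (ℓ * s / ℓ) = Γ s := fun s => by rw [mul_div_cancel_left₀ _ h.pos.ne']
    obtain ⟨u, hu, hux⟩ := exists_eq_of_chord l.rect (f := fun u => Γ (u / ℓ))
      (mul_le_mul_of_nonneg_left hss h.pos.le)
      (fun u hu v hv => by
        rw [h.geo _ (hdiv u hu) _ (hdiv v hv), ← sub_div, abs_div, abs_of_pos h.pos,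
          mul_div_cancel₀ _ h.pos.ne'])
      (fun u hu => h.mem _ (hdiv u hu))
      (fun t ht => by
        simp only [e1]
        have hg := hD _ (hΓD s hs) _ (hΓD s' hs') t ht
        exact (l1.windFill_subset hκ PC c hDc hD hm1 ⟨hg, hsub
          ((c.btw _ (hΓD s hs) _ hg _ (hΓD s' hs')).1 (btw_geo _ _ ht))⟩).2)
      (x := x) (by
        simp only [e1]
        exact (c.btw _ (hΓD s hs) _ hxD _ (hΓD s' hs')).2 hws)
    exact hwΓ _ (hdiv u hu) (congrArg G hux)
  obtain ⟨s, hs, ρ, hρ, hsG, hsub⟩ := ray 1 (by simp)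
  obtain ⟨s', hs', ρ', hρ', hsG', hsub'⟩ := ray (-1) (by simp)
  have hws : w ∈ segment ℝ (G (Γ s)) (G (Γ s')) := by
    have hρ0 : ρ ≠ 0 := fun h0 => hwΓ s hs (by simpa [h0] using hsG)
    have hpos : 0 < ρ + ρ' := by positivity
    refine ⟨ρ' / (ρ + ρ'), ρ / (ρ + ρ'), by positivity, by positivity, by field_simp; ring, ?_⟩
    have hne : (ρ : ℂ) + ρ' ≠ 0 := by exact_mod_cast hpos.ne'
    rw [hsG, hsG']
    simp only [Complex.real_smul]
    push_cast
    field_simp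
    ring
  have hsubset : segment ℝ (G (Γ s)) (G (Γ s')) ⊆
      windFill (fun t => G (cutLoop L α β Γ t)) := by
    rintro z ⟨a, b, ha, hb, hab, rfl⟩
    have e : a • G (Γ s) + b • G (Γ s') = w + ((a * ρ - b * ρ' : ℝ) : ℂ) := by
      have : (a : ℂ) + b = 1 := by exact_mod_cast hab
      rw [hsG, hsG']
      simp only [Complex.real_smul]
      push_cast
      linear_combination w * this
    rw [e]
    rcases le_total 0 (a * ρ - b * ρ') with h0 | h0
    · have := hsub (a * ρ - b * ρ') ⟨h0, by nlinarith⟩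
      simpa using this
    · have := hsub' (b * ρ' - a * ρ) ⟨by linarith, by nlinarith⟩
      simpa using this
  rcases le_total s s' with h0 | h0
  · exact straight s hs s' hs' h0 hws hsubset
  · rw [segment_symm] at hws hsubset
    exact straight s' hs' s hs h0 hws hsubset

end Chords

end Cat2Cx
end

noncomputable section

open Topology

namespace Cat2Cx

section Convexity

variable {κ : ℝ} {X : Type*} [MetricSpace X] {E : Set X} {L : ℝ → X} {V : Set X}

theorem geoAt_of_mem_geodSeg {S : Set X} {u v x : X} (hS : geodSeg (pathDistIn E) E u v ⊆ S)
    (hx : x ∈ geodSeg (pathDistIn E) E u v) (hu : x ≠ u) (hv : x ≠ v) : GeoAt E S x := by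
  have hx' := hx
  simp only [geodSeg, mem_iUnion, mem_image] at hx'
  obtain ⟨f, hf, s, hs, rfl⟩ := hx'
  refine geoAt_of_pathDistIn one_pos (fun a ha b hb => by rw [hf.2.2.1.2 a ha b hb, one_mul])
    ⟨lt_of_le_of_ne hs.1 fun h => hu (h ▸ hf.1), lt_of_le_of_ne hs.2 fun h => hv (h ▸ hf.2.1)⟩
    fun a ha => hS ?_
  simp only [geodSeg, mem_iUnion, mem_image]
  exact ⟨f, hf, a, ha, rfl⟩

variable [CatZero X] {D : Set X} {G : X → ℂ} {g : ℂ → X}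

/-- A geodesic whose endpoints are joined inside a compact convex set stays in that set. -/
theorem geodesic_mem_of_convex (hκ : κ ≤ 0) (PC : PolyComplex2 κ X) (hEc : IsClosed E)
    (hE : RectConnected E) (hH : H1Trivial E) (hDc : IsCompact D) (hD : GConvex D) {f : ℝ → X}
    {d : ℝ} (hd : 0 < d)
    (hf : ∀ s ∈ Icc 0 d, ∀ t ∈ Icc 0 d, pathDistIn E (f s) (f t) = |s - t|)
    (hfE : ∀ s ∈ Icc 0 d, f s ∈ E) {σ : ℝ → X} (hσ : IsPathIn (D ∩ E) σ (f d) (f 0)) {s : ℝ}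
    (hs : s ∈ Icc 0 d) : f s ∈ D := by
  obtain ⟨hσc, hσ0, hσ1, hσD⟩ := hσ
  have hm : ∀ s ∈ Icc (0 : ℝ) 1, d * s ∈ Icc 0 d := fun s hs =>
    ⟨mul_nonneg hd.le hs.1, mul_le_of_le_one_right hd.le hs.2⟩
  have hP : ∀ s ∈ Icc (0 : ℝ) 1, ∀ t ∈ Icc (0 : ℝ) 1,
      pathDistIn E (f (d * s)) (f (d * t)) = d * |s - t| := fun s hs t ht => by
    rw [hf _ (hm s hs) _ (hm t ht), ← mul_sub, abs_mul, abs_of_pos hd]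
  have hPE : ∀ s ∈ Icc (0 : ℝ) 1, f (d * s) ∈ E := fun s hs => hfE _ (hm s hs)
  have j1 : f (d * 1) = σ 0 := by rw [mul_one, hσ0]
  have j2 : σ 1 = f (d * 0) := by rw [mul_zero, hσ1]
  have h0 : f (d * 0) ∈ D := j2 ▸ (hσD (right_mem_Icc.2 zero_le_one)).1
  have h1 : f (d * 1) ∈ D := j1 ▸ (hσD (left_mem_Icc.2 zero_le_one)).1
  have hr := range_loop (P := fun s => f (d * s)) (Q := σ) j1 j2
  have key := mem_of_locally_geodesic hκ PC hEc hE hH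
    (continuous_loop (continuousOn_of_dist_le (dist_le_of_pathDistIn hE hPE hP)) hσc j1 j2)
    (loop_periodic _ _) (fun t => ?_) hDc ⟨_, h0⟩ hD
    (loop_inj (P := fun s => f (d * s)) (Q := σ) j1 j2
      (fun s hs s' hs' _ he => injOn_of_pathDistIn hd hPE hP hs' hs he)
      (fun s hs _ _ hsD => absurd (hσD hs).1 hsD) fun s _ s' hs' he => he ▸ (hσD hs').1)
    (fun t ht => ?_)
  · have hs' : s / d ∈ Icc (0 : ℝ) 1 := ⟨div_nonneg hs.1 hd.le, div_le_one_of_le₀ hs.2 hd.le⟩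
    have := key (s / d / 2)
    rwa [loop_left (fun s => f (d * s)) σ hs', mul_div_cancel₀ _ hd.ne'] at this
  · have : loop (fun s => f (d * s)) σ t ∈ range (loop (fun s => f (d * s)) σ) := ⟨t, rfl⟩
    rw [hr] at this
    rcases this with ⟨s, hs, he⟩ | ⟨s, hs, he⟩
    · exact he ▸ hPE s hs
    · exact he ▸ (hσD hs).2
  · obtain ⟨n, s, hs, ⟨-, he⟩ | ⟨-, he⟩⟩ := loop_apply_cases (P := fun s => f (d * s)) j1 j2 t
    · rw [he] at ht ⊢
      exact geoAt_of_pathDistIn hd hP ⟨lt_of_le_of_ne hs.1 fun h => ht (h ▸ h0),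
        lt_of_le_of_ne hs.2 fun h => ht (h ▸ h1)⟩ fun s hs => hr ▸ Or.inl ⟨s, hs, rfl⟩
    · exact absurd (he ▸ (hσD hs).1) ht

/-- A filled geodesic triangle is convex. -/
theorem YLoop.geodesic_mem (l : YLoop E L V)
    (hinj : ∀ t t', L t' = L t → ∃ n : ℤ, t' - t = n) (hκ : κ ≤ 0) (PC : PolyComplex2 κ X)
    (c : IsChart D G g) (hDc : IsCompact D) (hD : GConvex D) (hLD : ∀ t, L t ∈ D) (hVD : V ⊆ D)
    (hext : ∀ v ∈ V, G v ∈ extremePoints ℝ (convexHull ℝ (G '' V))) {f : ℝ → X} {d : ℝ}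
    (hf : ∀ s ∈ Icc 0 d, ∀ t ∈ Icc 0 d, pathDistIn E (f s) (f t) = |s - t|)
    (hfE : ∀ s ∈ Icc 0 d, f s ∈ E) (h0 : f 0 ∈ D ∩ G ⁻¹' windFill fun t => G (L t))
    (hd : f d ∈ D ∩ G ⁻¹' windFill fun t => G (L t))
    (hj : RectJoined (D ∩ G ⁻¹' windFill fun t => G (L t)) (f d) (f 0)) {s₀ : ℝ}
    (hs₀ : s₀ ∈ Icc 0 d) : f s₀ ∈ D ∩ G ⁻¹' windFill fun t => G (L t) := by
  have hKc := c.isCompact_windFill hDc l.cont l.per hLD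
  have hKE := l.windFill_subset hκ PC c hDc hD hLD
  have hc0 := c.continuous_comp l.cont hLD
  have hp0 : ∀ t, G (L (t + 1)) = G (L t) := fun t => by rw [l.per]
  have hrK : range L ⊆ D ∩ G ⁻¹' windFill fun t => G (L t) := by
    rintro _ ⟨t, rfl⟩
    exact ⟨hLD t, Or.inl ⟨t, rfl⟩⟩
  by_contra hs₀K
  have hd0 : 0 < d := by
    refine lt_of_le_of_ne (hs₀.1.trans hs₀.2) fun h => hs₀K ?_
    rw [le_antisymm (hs₀.2.trans h.symm.le) hs₀.1]
    exact h0
  have hf1 : ∀ s ∈ Icc 0 d, ∀ t ∈ Icc 0 d, pathDistIn E (f s) (f t) = 1 * |s - t| :=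
    fun s hs t ht => by rw [hf s hs t ht, one_mul]
  have hfc := continuousOn_of_dist_le (dist_le_of_pathDistIn l.rect hfE hf1)
  have hfinj := injOn_of_pathDistIn one_pos hfE hf1
  have hfD : ∀ s ∈ Icc 0 d, f s ∈ D := fun s hs => by
    obtain ⟨σ, ⟨hσc, hσ0, hσ1, hσK⟩, -⟩ := hj
    exact geodesic_mem_of_convex hκ PC l.isClosed l.rect l.h1 hDc hD hd0 hf hfE
      ⟨hσc, hσ0, hσ1, fun t ht => ⟨(hσK ht).1, (hKE (hσK ht)).2⟩⟩ hs
  -- a maximal excursion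
  obtain ⟨s₂, hs₂, hs₂K, hn₂⟩ := exists_first_hit hs₀.2
    (hfc.mono (Icc_subset_Icc_left hs₀.1)) hKc.isClosed hd
  obtain ⟨s', hs', hs'K, hn'⟩ := exists_first_hit (σ := fun s => f (s₀ - s)) hs₀.1
    (hfc.comp (by fun_prop) fun s hs => ⟨by linarith [hs.2], by linarith [hs.1, hs₀.2]⟩)
    hKc.isClosed (by simpa using h0)
  obtain ⟨s₁, rfl⟩ : ∃ s₁, s' = s₀ - s₁ := ⟨s₀ - s', by ring⟩
  simp only [sub_sub_cancel] at hs'K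
  have h₁₀ : s₁ ≠ s₀ := fun h => hs₀K (h ▸ hs'K)
  have h₂₀ : s₂ ≠ s₀ := fun h => hs₀K (h ▸ hs₂K)
  have hlt₁ : s₁ < s₀ := lt_of_le_of_ne (by linarith [hs'.1]) h₁₀
  have hlt₂ : s₀ < s₂ := lt_of_le_of_ne hs₂.1 h₂₀.symm
  have hsub : Icc s₁ s₂ ⊆ Icc 0 d := Icc_subset_Icc (by linarith [hs'.2]) hs₂.2
  have hexc : ∀ s ∈ Ioo s₁ s₂, f s ∉ D ∩ G ⁻¹' windFill fun t => G (L t) := fun s hs => by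
    rcases le_total s₀ s with h | h
    · exact hn₂ s ⟨h, hs.2⟩
    · simpa using hn' (s₀ - s) ⟨by linarith, by linarith [hs.1]⟩
  have hlt : s₁ < s₂ := hlt₁.trans hlt₂
  have hend : ∀ s ∈ Icc s₁ s₂, f s ∈ D ∩ G ⁻¹' windFill (fun t => G (L t)) → f s ∈ range L := by
    intro s hs hsK
    by_contra hsL
    have hsr : G (f s) ∉ range fun t => G (L t) := by
      rintro ⟨t, ht⟩
      exact hsL ⟨t, c.injOn (hLD t) hsK.1 ht⟩
    have hne : (𝓝[Ioo s₁ s₂] s).NeBot := mem_closure_iff_nhdsWithin_neBot.1 <| by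
      rwa [closure_Ioo hlt.ne]
    have hcont : ContinuousWithinAt (fun s => G (f s)) (Ioo s₁ s₂) s :=
      ((c.continuousOn.comp hfc hfD) s (hsub hs)).mono (Ioo_subset_Icc_self.trans hsub)
    obtain ⟨y, hy, hyI⟩ := ((hcont.eventually (eventually_wind_eq hc0 hp0 hsr)).and
      eventually_mem_nhdsWithin).exists
    exact hexc y hyI ⟨hfD y (hsub (Ioo_subset_Icc_self hyI)),
      Or.inr fun hw => hsK.2.resolve_left hsr (hy.2.symm.trans hw)⟩
  obtain ⟨α, hα⟩ := hend s₁ ⟨le_rfl, hlt.le⟩ hs'K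
  obtain ⟨β, hβ, hβs⟩ := exists_mem_Ioc_of_range l.per (hend s₂ ⟨hlt.le, le_rfl⟩ hs₂K) α
  have hβα : β ≠ α + 1 := fun h => hlt.ne
    (hfinj (hsub ⟨le_rfl, hlt.le⟩) (hsub ⟨hlt.le, le_rfl⟩) (by rw [← hα, ← hβs, h, l.per]))
  have hm : ∀ s ∈ Icc (0 : ℝ) 1, s₂ - (s₂ - s₁) * s ∈ Icc s₁ s₂ := fun s hs =>
    ⟨by nlinarith [hs.2], by nlinarith [hs.1]⟩
  have hm' : ∀ s ∈ Ioo (0 : ℝ) 1, s₂ - (s₂ - s₁) * s ∈ Ioo s₁ s₂ := fun s hs =>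
    ⟨by nlinarith [hs.2], by nlinarith [hs.1]⟩
  have hch : Chord E L α β (s₂ - s₁) fun s => f (s₂ - (s₂ - s₁) * s) := by
    refine ⟨hβ.1, lt_of_le_of_ne hβ.2 hβα, sub_pos.2 hlt, fun s hs t ht => ?_,
      fun s hs => hfE _ (hsub (hm s hs)), ?_, ?_, fun s hs hr => hexc _ (hm' s hs) (hrK hr)⟩
    · rw [hf _ (hsub (hm s hs)) _ (hsub (hm t ht)), sub_sub_sub_cancel_left, ← mul_sub, abs_mul,
        abs_of_pos (sub_pos.2 hlt), abs_sub_comm]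
    · rw [hβs]; simp
    · rw [hα]; simp
  obtain ⟨s, hs, hsK⟩ := hch.exists_mem_windFill l hinj hκ PC c hDc hD hLD hVD hext
  exact hexc _ (hm' s hs) ⟨hfD _ (hsub (hm s (Ioo_subset_Icc_self hs))), hsK⟩

end Convexity

section Assembly

variable {X : Type*} [MetricSpace X]

/-- The periodic parametrization of a simple closed curve. -/
def SCC.periodic (γ : SCC X) (t : ℝ) : X := γ.toFun (Int.fract t)

theorem SCC.periodic_eq (γ : SCC X) {t : ℝ} (ht : t ∈ Icc (0 : ℝ) 1) :
    γ.periodic t = γ.toFun t := by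
  rcases eq_or_lt_of_le ht.2 with rfl | h
  · rw [periodic, Int.fract_one, γ.loop]
  · rw [periodic, Int.fract_eq_self.2 ⟨ht.1, h⟩]

theorem SCC.range_periodic (γ : SCC X) : range γ.periodic = γ.img := by
  ext x
  constructor
  · rintro ⟨t, rfl⟩
    exact ⟨_, ⟨Int.fract_nonneg t, (Int.fract_lt_one t).le⟩, rfl⟩
  · rintro ⟨t, ht, rfl⟩
    exact ⟨t, γ.periodic_eq ht⟩

theorem SCC.periodic_inj (γ : SCC X) (t t' : ℝ) (h : γ.periodic t' = γ.periodic t) :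
    ∃ n : ℤ, t' - t = n :=
  Int.fract_eq_fract.1 (γ.inj ⟨Int.fract_nonneg t', Int.fract_lt_one t'⟩
    ⟨Int.fract_nonneg t, Int.fract_lt_one t⟩ h)

/-- A simple geodesic triangle is a piecewise geodesic loop. -/
theorem SCC.yLoop_of_isYTriangle (γ : SCC X) {E : Set X} (hEc : IsClosed E) (hE : RectConnected E)
    (hH : H1Trivial E) {p q r : X} (hT : IsYTriangle E γ.img p q r) :
    YLoop E γ.periodic {p, q, r} := by
  have hmem : ∀ t, γ.periodic t ∈ geodSeg (pathDistIn E) E p q ∪ geodSeg (pathDistIn E) E q r ∪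
      geodSeg (pathDistIn E) E r p := fun t => by
    rw [← hT.2.2.2, ← γ.range_periodic]; exact mem_range_self t
  have hsegE : ∀ u v, geodSeg (pathDistIn E) E u v ⊆ E := fun u v x hx => by
    simp only [geodSeg, mem_iUnion, mem_image] at hx
    obtain ⟨f, hf, s, hs, rfl⟩ := hx
    exact hf.2.2.2 hs
  refine ⟨hEc, hE, hH, γ.contOn.comp_fract'' γ.loop, fun t => by
    rw [SCC.periodic, SCC.periodic, Int.fract_add_one], fun t => ?_, toFinite _,
    fun t t' _ => γ.periodic_inj t t', fun t ht => ?_⟩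
  · rcases hmem t with (h | h) | h <;> exact hsegE _ _ h
  · rw [γ.range_periodic, hT.2.2.2]
    have hp : γ.periodic t ≠ p := fun h => ht (Or.inl h)
    have hq : γ.periodic t ≠ q := fun h => ht (Or.inr (Or.inl h))
    have hr : γ.periodic t ≠ r := fun h => ht (Or.inr (Or.inr h))
    rcases hmem t with (h | h) | h
    · exact geoAt_of_mem_geodSeg (subset_union_left.trans subset_union_left) h hp hq
    · exact geoAt_of_mem_geodSeg (subset_union_right.trans subset_union_left) h hq hr
    · exact geoAt_of_mem_geodSeg subset_union_right h hr hp

variable [CatZero X] {E D : Set X} {L : ℝ → X} {G : X → ℂ} {g : ℂ → X}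

/-- The vertices of a simple geodesic triangle are the extreme points of its hull. -/
theorem YLoop.mem_extremePoints {p q r : X} (l : YLoop E L {p, q, r})
    (hinj : ∀ t t', L t' = L t → ∃ n : ℤ, t' - t = n) (c : IsChart D G g) (hLD : ∀ t, L t ∈ D)
    (hLH : ∀ t, G (L t) ∈ convexHull ℝ (G '' {p, q, r})) :
    ∀ v ∈ ({p, q, r} : Set X), G v ∈ extremePoints ℝ (convexHull ℝ (G '' {p, q, r})) := by
  obtain ⟨t, ht⟩ := l.exists_notMem hinj
  obtain ⟨w₁, -, w₂, -, -, -, hj⟩ := l.exists_jump c hLD ht univ_mem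
  obtain ⟨w, hw⟩ : ∃ w, wind (fun t => G (L t)) w ≠ 0 := by
    by_contra! h0
    rw [h0, h0] at hj
    omega
  have hw' : (interior (convexHull ℝ (G '' {p, q, r}))).Nonempty :=
    ⟨w, mem_interior_of_wind (c.continuous_comp l.cont hLD) (fun t => by rw [l.per])
      (convex_convexHull ℝ _) hLH hw⟩
  intro v hv
  have hv' := mem_image_of_mem G hv
  rw [image_insert_eq, image_pair] at hv' hw' ⊢
  exact mem_extremePoints_of_triple hw' hv'

end Assembly

end Cat2Cx
end

open Cat2Cx in
/-- **Lemma (disks_are_self_contained).**  Let `D` be a closed convex subset of `X` which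
isometrically embeds in `M_κ²`, and `T` a simple geodesic triangle in `Y` with vertices
`p, q, r ∈ D`.  Then `T ∪ Int T ⊆ D ∩ E`, and `T ∪ Int T` is compact, simply connected
and rectifiably connected as a subspace of `X`, and convex as a subspace of `Y`. -/
theorem triangle_with_interior_self_contained
    {κ : ℝ} (hκ : κ ≤ 0) {X : Type*} [MetricSpace X]
    (PC : PolyComplex2 κ X) (hX : IsCATSpace κ X)
    (E : Set X) (hEclosed : IsClosed E) (hErc : RectConnected E) (hH1 : H1Trivial ↥E)
    (D : Set X) (hDcl : IsClosed D) (hDconv : ConvexWrt (xDist X) D)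
    (hDpl : IsomEmbedsInModelPlane κ D)
    (γT : SCC X) (p q r : X) (hT : IsYTriangle E γT.img p q r)
    (hp : p ∈ D) (hq : q ∈ D) (hr : r ∈ D) :
    γT.img ∪ γT.interiorSet ⊆ D ∩ E ∧
    IsCompact (γT.img ∪ γT.interiorSet) ∧
    SimplyConnectedSpace ↥(γT.img ∪ γT.interiorSet) ∧
    RectConnected (γT.img ∪ γT.interiorSet) ∧
    ∀ x ∈ γT.img ∪ γT.interiorSet, ∀ y ∈ γT.img ∪ γT.interiorSet,
      geodSeg (pathDistIn E) E x y ⊆ γT.img ∪ γT.interiorSet := by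
  have hCat : CatZero X := catZero_of_isCATSpace hκ hX
  have hne : Nonempty X := ⟨p⟩
  have hD := gconvex_of_convexWrt hDconv
  obtain ⟨F, hF⟩ := hDpl
  obtain ⟨g, c₀⟩ := exists_isChart hκ hF
  set G : X → ℂ := fun x => klein κ (F x)
  have l := γT.yLoop_of_isYTriangle hEclosed hErc hH1 hT
  have hVD : ({p, q, r} : Set X) ⊆ D := by
    rintro x (rfl | rfl | rfl)
    exacts [hp, hq, hr]
  have hLD := l.mem_hull hκ PC c₀ hD ⟨p, by simp⟩ hVD
  have hHc : IsCompact (D ∩ G ⁻¹' convexHull ℝ (G '' {p, q, r})) := c₀.isCompact_inter_preimage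
    (convexHull_min (image_mono hVD) (c₀.convex_image hD le_rfl hD))
    ((l.finite.image G).isCompact_convexHull ℝ)
  have hHD : GConvex (D ∩ G ⁻¹' convexHull ℝ (G '' {p, q, r})) :=
    c₀.gconvex_inter_preimage hD (convex_convexHull ℝ _)
  have hVH : {p, q, r} ⊆ D ∩ G ⁻¹' convexHull ℝ (G '' {p, q, r}) := fun v hv =>
    ⟨hVD hv, subset_convexHull ℝ _ (mem_image_of_mem G hv)⟩
  have c := c₀.mono (inter_subset_left (s := D) (t := G ⁻¹' convexHull ℝ (G '' {p, q, r})))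
  have hK := l.img_union_interiorSet γT.periodic_inj hκ PC c hHc hHD hLD γT γT.range_periodic
    fun t ht => γT.periodic_eq ht
  have hrc : RectConnected (γT.img ∪ γT.interiorSet) := by
    intro x hx y hy
    have hj : ∀ x ∈ γT.img ∪ γT.interiorSet, ∃ t, RectJoined (γT.img ∪ γT.interiorSet) x
        (γT.periodic t) := fun x hx => by
      rw [hK] at hx ⊢
      exact c.rectJoined_range hHD l.cont l.per hLD hx
    obtain ⟨t, ht⟩ := hj x hx
    obtain ⟨t', ht'⟩ := hj y hy
    have himg : ∀ t, γT.periodic t ∈ γT.img := fun t => γT.range_periodic ▸ mem_range_self t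
    exact (ht.trans (rectJoined_of_isYTriangle hErc hT subset_union_left (himg t)
      (himg t'))).trans ht'.symm
  refine ⟨?_, ?_, ?_, hrc, fun x hx y hy z hz => ?_⟩
  · rw [hK]
    exact fun x hx => ⟨hx.1.1, (l.windFill_subset hκ PC c hHc hHD hLD hx).2⟩
  · rw [hK]
    exact c.isCompact_windFill hHc l.cont l.per hLD
  · rw [hK]
    have := l.contractibleSpace γT.periodic_inj c hHD hLD
    infer_instance
  · simp only [geodSeg, mem_iUnion, mem_image] at hz
    obtain ⟨f, ⟨h0, h1, h2, h3⟩, s, hs, rfl⟩ := hz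
    have hj : RectJoined (γT.img ∪ γT.interiorSet) (f (pathDistIn E x y)) (f 0) := by
      rw [h0, h1]; exact hrc y hy x hx
    rw [← h0] at hx
    rw [← h1] at hy
    rw [hK] at hx hy hj ⊢
    exact l.geodesic_mem γT.periodic_inj hκ PC c hHc hHD hLD hVH
      (l.mem_extremePoints γT.periodic_inj c hLD fun t => (hLD t).2) h2.2 h3 hx hy hj hs
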